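/- For every integer d ≥ 1 there exists ε = ε(d) > 0 such that for every finite subset F of GL_d(ℂ) containing the identity and generating a subgroup which is not virtually solvable (equivalently, by the Tits alternative, a non-amenable subgroup), one has |F^n| ≥ (1+ε)^n for all integers n ≥ 1, where F^n is the set of products of at most n elements of F. -/

import Mathlib

namespace UEG
set_option linter.unusedVariables false
open Pointwise

/-- `F` grows at least like `c ^ n`. -/
def Gr {G : Type*} [Monoid G] (c : ℝ) (F : Set G) : Prop := ∀ n : ℕ, c ^ n ≤ ((F ^ n).ncard : ℝ)

lemma fin_pow {G : Type*} [Monoid G] {F : Set G} (hF : F.Finite) (n : ℕ) : (F ^ n).Finite := by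
  induction n with
  | zero => simp
  | succ n ih => rw [pow_succ]; exact ih.mul hF

lemma ncard_mul_le' {G : Type*} [Group G] (s t : Set G) :
    (s * t).ncard ≤ s.ncard * t.ncard := by
  simpa [Set.ncard] using Set.natCard_mul_le (s := s) (t := t)

lemma ncard_pow_le {G : Type*} [Group G] (s : Set G) (n : ℕ) :
    (s ^ n).ncard ≤ s.ncard ^ n := by
  induction n with
  | zero => simp [← Set.singleton_one]
  | succ n ih =>
    rw [pow_succ, pow_succ]
    exact (ncard_mul_le' _ _).trans (Nat.mul_le_mul_right _ ih)

lemma gr_root {G : Type*} [Group G] {F F' : Set G} (hF : F.Finite) {M : ℕ} (hM : 1 ≤ M)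
    (hsub : F' ⊆ F ^ M) {c : ℝ} (hc : 1 ≤ c) (h : Gr c F') : Gr (c ^ (1 / (M : ℝ))) F := by
  intro n
  have hM0 : (M : ℝ) ≠ 0 := by positivity
  have h1 : c ^ n ≤ ((F ^ n).ncard : ℝ) ^ M := by
    refine (h n).trans ?_
    have h2 : (F' ^ n).ncard ≤ ((F ^ n) ^ M).ncard := by
      apply Set.ncard_le_ncard _ (fin_pow (fin_pow hF n) M)
      rw [← pow_mul, mul_comm, pow_mul]
      exact Set.pow_subset_pow_left hsub
    exact_mod_cast h2.trans (ncard_pow_le _ _)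
  have h3 : ((c ^ (1 / (M : ℝ))) ^ n) ^ M = c ^ n := by
    rw [← pow_mul, mul_comm, pow_mul, ← Real.rpow_natCast (c ^ _) M, ← Real.rpow_mul (by linarith)]
    simp [hM0]
  rw [← h3] at h1
  exact le_of_pow_le_pow_left₀ (by omega) (by positivity) h1

lemma gr_hom {G H : Type*} [Group G] [Group H] (f : G →* H) {F : Set G} (hF : F.Finite) {c : ℝ}
    (h : Gr c (f '' F)) : Gr c F := by
  intro n
  refine (h n).trans ?_
  rw [← Set.image_pow]
  exact_mod_cast Set.ncard_image_le (fin_pow hF n)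

lemma gr_of_mul {G H : Type*} [Group G] [Group H] {F : Set G} {F' : Set H} {c : ℝ} (hc : 0 ≤ c)
    (D : ℕ) (h : Gr c F') (hD : ∀ n, (F' ^ n).ncard ≤ D * (F ^ n).ncard) : Gr c F := by
  intro n
  by_contra! hlt
  have key : ∀ k : ℕ, (c ^ n) ^ k ≤ D * ((F ^ n).ncard : ℝ) ^ k := by
    intro k
    have h1 := h (n * k)
    have h2 := hD (n * k)
    have h3 := ncard_pow_le (F ^ n) k
    rw [← pow_mul] at h3
    rw [← pow_mul]
    calc c ^ (n * k) ≤ ((F' ^ (n * k)).ncard : ℝ) := h1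
      _ ≤ ((D * (F ^ (n * k)).ncard : ℕ) : ℝ) := by exact_mod_cast h2
      _ ≤ D * ((F ^ n).ncard : ℝ) ^ k := by
        push_cast
        gcongr
        exact_mod_cast h3
  set A : ℝ := ((F ^ n).ncard : ℝ)
  have hA0 : 0 ≤ A := by positivity
  have hcn : 0 < c ^ n := lt_of_le_of_lt hA0 hlt
  obtain ⟨k, hk⟩ := exists_pow_lt_of_lt_one (show (0 : ℝ) < 1 / (D + 1) by positivity)
    (show A / c ^ n < 1 by rw [div_lt_one hcn]; exact hlt)
  have h4 := key k
  rw [div_pow, div_lt_div_iff₀ (by positivity) (by positivity)] at hk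
  nlinarith [pow_nonneg hA0 k]

lemma gr_mono {G : Type*} [Group G] {F : Set G} {c c' : ℝ} (h0 : 0 ≤ c) (h : c ≤ c') (hF : Gr c' F) :
    Gr c F := fun n => (pow_le_pow_left₀ h0 h n).trans (hF n)

lemma pingpong {G T : Type*} [Group G] (act : G → T → T)
    (hact : ∀ a b t, act (a * b) t = act a (act b t)) (h1 : ∀ t, act 1 t = t) (U Ua Ub : Set T)
    (hU : U.Nonempty) (hUa : Ua ⊆ U) (hUb : Ub ⊆ U) (hd : Disjoint Ua Ub) (a b : G)
    (ha : ∀ t ∈ U, act a t ∈ Ua) (hb : ∀ t ∈ U, act b t ∈ Ub) : Gr 2 ({a, b} : Set G) := by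
  have hw : ∀ n : ℕ, ∀ x ∈ ({a, b} : Set G) ^ n, ∀ t ∈ U, act x t ∈ U := by
    intro n
    induction n with
    | zero => intro x hx t ht; simp at hx; subst hx; rwa [h1]
    | succ n ih =>
      intro x hx t ht
      rw [pow_succ'] at hx
      obtain ⟨y, hy, z, hz, rfl⟩ := hx
      have := ih z hz t ht
      simp only [hact]
      rcases hy with rfl | rfl
      · exact hUa (ha _ this)
      · exact hUb (hb _ this)
  intro n
  have : ∀ n : ℕ, 2 ^ n ≤ (({a, b} : Set G) ^ n).ncard := by
    intro n
    induction n with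
    | zero => simp [← Set.singleton_one]
    | succ n ih =>
      have e : ({a, b} : Set G) ^ (n + 1) =
          (fun x => a * x) '' (({a, b} : Set G) ^ n) ∪ (fun x => b * x) '' (({a, b} : Set G) ^ n) := by
        rw [pow_succ', Set.insert_eq, Set.union_mul]
        simp [Set.singleton_mul]
      have hfin : (({a, b} : Set G) ^ n).Finite := fin_pow (by simp) n
      rw [e, Set.ncard_union_eq ?_ (hfin.image _) (hfin.image _),
        Set.ncard_image_of_injective _ (mul_right_injective a),
        Set.ncard_image_of_injective _ (mul_right_injective b)]
      · rw [pow_succ]; omega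
      · rw [Set.disjoint_left]
        rintro _ ⟨x, hx, rfl⟩ ⟨y, hy, hxy⟩
        obtain ⟨t, ht⟩ := hU
        have e1 : act (a * x) t ∈ Ua := by rw [hact]; exact ha _ (hw n x hx t ht)
        have e2 : act (b * y) t ∈ Ub := by rw [hact]; exact hb _ (hw n y hy t ht)
        simp only at hxy
        rw [hxy] at e2
        exact Set.disjoint_left.1 hd e1 e2
  exact_mod_cast this n

/-- the set in the statement is the pointwise power -/
lemma stmt_set {G : Type*} [Monoid G] {F : Set G} (h1 : (1 : G) ∈ F) (n : ℕ) :
    {x : G | ∃ l : List G, l.length ≤ n ∧ (∀ g ∈ l, g ∈ F) ∧ l.prod = x} = F ^ n := by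
  ext x
  constructor
  · rintro ⟨l, hl, hF, rfl⟩
    refine Set.pow_subset_pow_right h1 hl ?_
    clear hl
    induction l with
    | nil => simp
    | cons a l ih =>
      rw [List.prod_cons, List.length_cons, pow_succ']
      exact Set.mul_mem_mul (hF a (by simp)) (ih (fun g hg => hF g (by simp [hg])))
  · intro hx
    rw [Set.mem_pow] at hx
    obtain ⟨f, rfl⟩ := hx
    refine ⟨List.ofFn fun i => (f i : G), by simp, ?_, rfl⟩
    intro g hg
    rw [List.mem_ofFn] at hg
    obtain ⟨i, rfl⟩ := hg
    exact (f i).2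

lemma one_mem_pow {G : Type*} [Monoid G] {F : Set G} (h1 : (1 : G) ∈ F) (n : ℕ) : (1 : G) ∈ F ^ n := by
  have := Set.pow_mem_pow h1 (n := n)
  rwa [one_pow] at this

lemma pow_sub_closure {G : Type*} [Group G] {F : Set G} (n : ℕ) :
    F ^ n ⊆ (Subgroup.closure F : Set G) := by
  induction n with
  | zero => simp [one_mem]
  | succ n ih =>
    rw [pow_succ]
    rintro _ ⟨x, hx, y, hy, rfl⟩
    exact mul_mem (ih hx) (Subgroup.subset_closure hy)

end UEG

namespace UEG
set_option linter.unusedVariables false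
open Pointwise

/-- virtually solvable -/
def VSG (G : Type*) [Group G] : Prop := ∃ H : Subgroup G, H.FiniteIndex ∧ Group.IsSolvable ↥H

lemma vs_of_solvable_ker {G A B : Type*} [Group G] [Group A] [Group B] (f1 : G →* A) (f2 : G →* B)
    (h1 : VSG f1.range) (h2 : VSG f2.range) (hk : Group.IsSolvable ↥(f1.ker ⊓ f2.ker)) : VSG G := by
  obtain ⟨H1, i1, s1⟩ := h1
  obtain ⟨H2, i2, s2⟩ := h2
  have j1 : (H1.comap f1.rangeRestrict).FiniteIndex := by
    constructor
    rw [Subgroup.index_comap_of_surjective _ f1.rangeRestrict_surjective]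
    exact i1.index_ne_zero
  have j2 : (H2.comap f2.rangeRestrict).FiniteIndex := by
    constructor
    rw [Subgroup.index_comap_of_surjective _ f2.rangeRestrict_surjective]
    exact i2.index_ne_zero
  refine ⟨H1.comap f1.rangeRestrict ⊓ H2.comap f2.rangeRestrict, inferInstance, ?_⟩
  set H := H1.comap f1.rangeRestrict ⊓ H2.comap f2.rangeRestrict with hH
  let g1 : H →* H1 := (f1.rangeRestrict.comp H.subtype).codRestrict H1 (fun x => x.2.1)
  let g2 : H →* H2 := (f2.rangeRestrict.comp H.subtype).codRestrict H2 (fun x => x.2.2)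
  let g : H →* H1 × H2 := g1.prod g2
  have hsub : f1.ker ⊓ f2.ker ≤ H := by
    rintro x ⟨hx1, hx2⟩
    constructor
    · change f1.rangeRestrict x ∈ H1
      have : f1.rangeRestrict x = 1 := Subtype.ext hx1
      rw [this]; exact one_mem _
    · change f2.rangeRestrict x ∈ H2
      have : f2.rangeRestrict x = 1 := Subtype.ext hx2
      rw [this]; exact one_mem _
  refine Group.isSolvable_of_ker_le_range (Subgroup.inclusion hsub) g ?_
  intro x hx
  have e : g x = 1 := hx
  have e1 : f1 x = 1 := by
    have := congrArg (fun p : H1 × H2 => ((p.1 : f1.range) : A)) e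
    exact this
  have e2 : f2 x = 1 := by
    have := congrArg (fun p : H1 × H2 => ((p.2 : f2.range) : B)) e
    exact this
  exact ⟨⟨x, e1, e2⟩, rfl⟩

lemma vs_of_finiteIndex {G : Type*} [Group G] (K : Subgroup G) [K.FiniteIndex] (h : VSG K) :
    VSG G := by
  obtain ⟨H, i, s⟩ := h
  refine ⟨H.map K.subtype, ⟨?_⟩, ?_⟩
  · rw [Subgroup.index_map_subtype]
    exact mul_ne_zero i.index_ne_zero (Subgroup.FiniteIndex.index_ne_zero)
  · exact Group.isSolvable_of_surjective (f := (K.subtype.subgroupMap H)) (K.subtype.subgroupMap_surjective H)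

lemma vs_of_surj {G H : Type*} [Group G] [Group H] (f : G →* H) (hf : Function.Surjective f)
    (h : VSG G) : VSG H := by
  obtain ⟨K, i, s⟩ := h
  refine ⟨K.map f, ⟨?_⟩, ?_⟩
  · intro h0
    have := K.index_map_dvd hf
    rw [h0, zero_dvd_iff] at this
    exact i.index_ne_zero this
  · exact Group.isSolvable_of_surjective (f := (f.subgroupMap K)) (f.subgroupMap_surjective K)

lemma vs_of_finite {G : Type*} [Group G] [Finite G] : VSG G :=
  ⟨⊥, inferInstance, inferInstance⟩

/-- the subgroup `H` meets `Γ` in index at most `N` -/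
def IdxLe {G : Type*} [Group G] (N : ℕ) (H Γ : Subgroup G) : Prop :=
  ∀ γ : Fin (N + 1) → G, (∀ i, γ i ∈ Γ) → ∃ i j, i ≠ j ∧ (γ i)⁻¹ * γ j ∈ H

lemma idxLe_of_fintype {G ι : Type*} [Group G] {H Γ : Subgroup G} (N : ℕ) (s : Finset ι)
    (hs : s.card ≤ N) (φ : G → ι) (hφ : ∀ x ∈ Γ, φ x ∈ s)
    (h : ∀ x ∈ Γ, ∀ y ∈ Γ, φ x = φ y → x⁻¹ * y ∈ H) : IdxLe N H Γ := by
  intro γ hγ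
  obtain ⟨i, -, j, -, hij, e⟩ := Finset.exists_ne_map_eq_of_card_lt_of_maps_to
    (s := (Finset.univ : Finset (Fin (N + 1)))) (t := s) (by simp; omega) (f := fun i => φ (γ i))
    (fun i _ => hφ _ (hγ i))
  exact ⟨i, j, hij, h _ (hγ i) _ (hγ j) e⟩

lemma IdxLe.mono {G : Type*} [Group G] {N N' : ℕ} {H H' Γ : Subgroup G} (hN : N ≤ N') (hH : H ≤ H')
    (h : IdxLe N H Γ) : IdxLe N' H' Γ := by
  intro γ hγ
  obtain ⟨i, j, hij, e⟩ := h (fun i => γ (Fin.castLE (by omega) i)) (fun i => hγ _)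
  exact ⟨_, _, fun h => hij (Fin.castLE_injective _ h), hH e⟩

lemma IdxLe.finiteIndex {G : Type*} [Group G] {N : ℕ} {H Γ : Subgroup G}
    (h : IdxLe N H Γ) : (H.subgroupOf Γ).FiniteIndex := by
  have : Finite (Γ ⧸ H.subgroupOf Γ) := by
    by_contra hinf
    rw [not_finite_iff_infinite] at hinf
    obtain ⟨e⟩ : Nonempty (ℕ ↪ Γ ⧸ H.subgroupOf Γ) := ⟨Infinite.natEmbedding _⟩
    obtain ⟨i, j, hij, hm⟩ := h (fun i => ((e i).out : Γ)) (fun i => SetLike.coe_mem _)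
    apply hij
    have : e i = e j := by
      rw [← (e i).out_eq, ← (e j).out_eq]
      exact QuotientGroup.eq.2 hm
    exact Fin.ext (e.injective this)
  exact Subgroup.finiteIndex_of_finite_quotient

/-- Schreier type lemma -/
lemma schreier {G : Type*} [Group G] {F : Set G} {K : Subgroup G} (W : Set G) (hW : W.Finite)
    (h1 : (1 : G) ∈ W) (h : ∀ f ∈ F, ∀ x ∈ W, ∃ y ∈ W, y⁻¹ * (f * x) ∈ K) :
    ∀ g ∈ Subgroup.closure F, ∃ x ∈ W, x⁻¹ * g ∈ K := by
  set T : Set (G ⧸ K) := (fun x : G => (x : G ⧸ K)) '' W with hT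
  have hTf : T.Finite := hW.image _
  have hle : Subgroup.closure F ≤ MulAction.stabilizer G T := by
    rw [Subgroup.closure_le]
    intro f hf
    rw [SetLike.mem_coe, MulAction.mem_stabilizer_iff]
    have hsub : f • T ⊆ T := by
      rintro _ ⟨_, ⟨x, hx, rfl⟩, rfl⟩
      obtain ⟨y, hy, hm⟩ := h f hf x hx
      exact ⟨y, hy, QuotientGroup.eq.2 hm⟩
    refine Set.eq_of_subset_of_ncard_le hsub ?_ hTf
    rw [Set.ncard_smul_set]
  intro g hg
  have h2 := hle hg
  rw [MulAction.mem_stabilizer_iff] at h2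
  have h3 : ((g : G) : G ⧸ K) ∈ T := by
    rw [← h2]
    exact ⟨((1 : G) : G ⧸ K), ⟨1, h1, rfl⟩, by simp⟩
  obtain ⟨x, hx, e⟩ := h3
  exact ⟨x, hx, QuotientGroup.eq.1 e⟩

lemma schreier_idx {G : Type*} [Group G] {F : Set G} {K : Subgroup G} (W : Set G) (hW : W.Finite)
    (h1 : (1 : G) ∈ W) (h : ∀ f ∈ F, ∀ x ∈ W, ∃ y ∈ W, y⁻¹ * (f * x) ∈ K) (N : ℕ)
    (hN : W.ncard ≤ N) : IdxLe N K (Subgroup.closure F) := by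
  classical
  have := schreier W hW h1 h
  choose! φ hφ hφ2 using this
  refine idxLe_of_fintype N hW.toFinset (by rwa [← Set.ncard_eq_toFinset_card _ hW]) φ
    (fun x hx => by simpa using hφ x hx) ?_
  intro x hx y hy e
  have := mul_mem (inv_mem (hφ2 x hx)) (hφ2 y hy)
  rw [e] at this
  simpa [mul_assoc] using this

lemma idx_pow_mem {G : Type*} [Group G] {N : ℕ} {H Γ : Subgroup G}
    (h : IdxLe N H Γ) {x : G} (hx : x ∈ Γ) : x ^ N.factorial ∈ H := by
  have key : ∃ j, 1 ≤ j ∧ j ≤ N ∧ x ^ j ∈ H := by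
    obtain ⟨i, j, hij, e⟩ := h (fun i => x ^ (i : ℕ)) (fun i => pow_mem hx _)
    rcases lt_or_gt_of_ne hij with hlt | hlt
    · have hlt' : (i : ℕ) < j := hlt
      refine ⟨j - i, by omega, by omega, ?_⟩
      have : x ^ (j : ℕ) = x ^ (i : ℕ) * x ^ ((j : ℕ) - i) := by rw [← pow_add]; congr 1; omega
      rwa [this, inv_mul_cancel_left] at e
    · have hlt' : (j : ℕ) < i := hlt
      refine ⟨i - j, by omega, by omega, ?_⟩
      have : x ^ (i : ℕ) = x ^ (j : ℕ) * x ^ ((i : ℕ) - j) := by rw [← pow_add]; congr 1; omega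
      have e' := inv_mem e
      rwa [mul_inv_rev, inv_inv, this, inv_mul_cancel_left] at e'
  obtain ⟨j, h1, h2, h3⟩ := key
  obtain ⟨k, hk⟩ := Nat.dvd_factorial (by omega) h2
  rw [hk, pow_mul]
  exact pow_mem h3 _

/-- generating a finite index subgroup by positive words -/
lemma pos_red (N : ℕ) : ∃ M : ℕ, 1 ≤ M ∧ ∀ {G : Type*} [Group G] (F : Set G), F.Finite →
    (1 : G) ∈ F → ∀ H : Subgroup G, IdxLe N H (Subgroup.closure F) →
    ∃ F' : Set G, F' ⊆ F ^ M ∧ F' ⊆ H ∧ (1 : G) ∈ F' ∧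
      ((Subgroup.closure F').subgroupOf (Subgroup.closure F)).FiniteIndex := by
  refine ⟨N * N.factorial + 1 + N, by omega, ?_⟩
  intro G _ F hF h1 H hH
  classical
  let S : ℕ → Set (G ⧸ H) := fun i => (fun x : G => (x : G ⧸ H)) '' (F ^ i)
  have hSf : ∀ i, (S i).Finite := fun i => (fin_pow hF i).image _
  have hSm : ∀ i, S i ⊆ S (i + 1) := fun i =>
    Set.image_mono (Set.pow_subset_pow_right h1 (Nat.le_succ i))
  have hScard : ∀ i, (S i).ncard ≤ N := by
    intro i
    by_contra! hlt
    obtain ⟨e⟩ : Nonempty (Fin (N + 1) ↪ S i) := by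
      have := (hSf i).fintype
      apply Function.Embedding.nonempty_of_card_le
      rw [← Nat.card_eq_fintype_card, ← Nat.card_eq_fintype_card]
      simpa [Set.ncard] using hlt
    have hex : ∀ j, ∃ x ∈ F ^ i, (x : G ⧸ H) = e j := fun j => (e j).2
    choose g hg hge using hex
    obtain ⟨a, b, hab, hm⟩ := hH g (fun j => pow_sub_closure i (hg j))
    apply hab
    apply e.injective
    apply Subtype.ext
    rw [← hge a, ← hge b]
    exact QuotientGroup.eq.2 hm
  -- stabilisation
  have hst : ∃ i ≤ N, S (i + 1) = S i := by
    by_contra! hne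
    have : ∀ i, i ≤ N + 1 → i + 1 ≤ (S i).ncard := by
      intro i
      induction i with
      | zero =>
        intro _
        have : (S 0).Nonempty := ⟨_, 1, by simp, rfl⟩
        have := (Set.ncard_pos (hSf 0)).2 this
        omega
      | succ i ih =>
        intro hi
        have h2 := Set.ncard_lt_ncard ((hSm i).ssubset_of_ne (fun h => hne i (by omega) h.symm))
          (hSf (i + 1))
        have := ih (by omega)
        omega
    have h3 := this (N + 1) le_rfl
    have := hScard (N + 1)
    omega
  obtain ⟨i, hiN, hi⟩ := hst
  have hinv : ∀ f ∈ F, ∀ q ∈ S i, f • q ∈ S i := by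
    rintro f hf _ ⟨x, hx, rfl⟩
    rw [← hi]
    refine ⟨f * x, ?_, rfl⟩
    rw [pow_succ']
    exact Set.mul_mem_mul hf hx
  have hex : ∀ q ∈ S i, ∃ x ∈ F ^ i, (x : G ⧸ H) = q ∧ (q = ((1 : G) : G ⧸ H) → x = 1) := by
    rintro q ⟨x, hx, rfl⟩
    by_cases hq : (x : G ⧸ H) = ((1 : G) : G ⧸ H)
    · exact ⟨1, one_mem_pow h1 i, hq.symm, fun _ => rfl⟩
    · exact ⟨x, hx, rfl, fun h => absurd h hq⟩
  choose! w hw hwq hw1 using hex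
  let r : G ⧸ H → G := fun q => w q ^ (N.factorial - 1)
  have hfac : 1 ≤ N.factorial := Nat.factorial_pos N
  have hrw : ∀ q, r q * w q = w q ^ N.factorial := by
    intro q
    simp only [r]
    rw [← pow_succ, Nat.sub_add_cancel hfac]
  have hrwH : ∀ q ∈ S i, r q * w q ∈ H := fun q hq => by
    rw [hrw]; exact idx_pow_mem hH (pow_sub_closure i (hw q hq))
  have hr : ∀ q ∈ S i, r q ∈ F ^ (N * N.factorial) := by
    intro q hq
    have h2 : r q ∈ F ^ (i * (N.factorial - 1)) := by
      rw [pow_mul]; exact Set.pow_mem_pow (hw q hq)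
    exact Set.pow_subset_pow_right h1 (Nat.mul_le_mul hiN (Nat.sub_le _ _)) h2
  have hwN : ∀ q ∈ S i, w q ∈ F ^ N := fun q hq => Set.pow_subset_pow_right h1 hiN (hw q hq)
  have hS1 : ((1 : G) : G ⧸ H) ∈ S i := ⟨1, one_mem_pow h1 i, rfl⟩
  let F' : Set G := {g | ∃ f ∈ F, ∃ q ∈ S i, g = r (f • q) * f * w q} ∪
    {g | ∃ q ∈ S i, g = r q * w q}
  refine ⟨F', ?_, ?_, ?_, ?_⟩
  · rintro g (⟨f, hf, q, hq, rfl⟩ | ⟨q, hq, rfl⟩)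
    · rw [pow_add, pow_add, pow_one]
      exact Set.mul_mem_mul (Set.mul_mem_mul (hr _ (hinv f hf q hq)) hf) (hwN q hq)
    · rw [pow_add]
      exact Set.mul_mem_mul (Set.pow_subset_pow_right h1 (Nat.le_succ _) (hr q hq)) (hwN q hq)
  · rintro g (⟨f, hf, q, hq, rfl⟩ | ⟨q, hq, rfl⟩)
    · have e1 := hrwH _ (hinv f hf q hq)
      have e2 : (w (f • q))⁻¹ * (f * w q) ∈ H := by
        apply QuotientGroup.eq.1
        rw [hwq _ (hinv f hf q hq)]
        nth_rewrite 1 [← hwq q hq]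
        rfl
      have := mul_mem e1 e2
      simpa [mul_assoc] using this
    · exact hrwH q hq
  · right
    refine ⟨((1 : G) : G ⧸ H), hS1, ?_⟩
    rw [hrw, hw1 _ hS1 rfl, one_pow]
  · have := schreier_idx (F := F) (K := Subgroup.closure F') (w '' S i) ((hSf i).image _)
      ⟨_, hS1, hw1 _ hS1 rfl⟩ ?_ _ le_rfl
    · exact this.finiteIndex
    · rintro f hf _ ⟨q, hq, rfl⟩
      refine ⟨w (f • q), ⟨_, hinv f hf q hq, rfl⟩, ?_⟩
      have e1 : r (f • q) * w (f • q) ∈ Subgroup.closure F' :=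
        Subgroup.subset_closure (Or.inr ⟨_, hinv f hf q hq, rfl⟩)
      have e2 : r (f • q) * f * w q ∈ Subgroup.closure F' :=
        Subgroup.subset_closure (Or.inl ⟨f, hf, q, hq, rfl⟩)
      have := mul_mem (inv_mem e1) e2
      simpa [mul_assoc] using this

end UEG

namespace UEG
set_option linter.unusedVariables false
open Pointwise Matrix

/-- no invariant subspaces -/
def Irr {d : ℕ} (H : Set (GL (Fin d) ℂ)) : Prop :=
  ∀ U : Submodule ℂ (Fin d → ℂ), (∀ g ∈ H, ∀ x ∈ U, (g : Matrix (Fin d) (Fin d) ℂ) *ᵥ x ∈ U) →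
    U = ⊥ ∨ U = ⊤

/-- subgroups of index at most `N` are irreducible -/
def NoRed {d : ℕ} (N : ℕ) (F : Set (GL (Fin d) ℂ)) : Prop :=
  ∀ H ≤ Subgroup.closure F, IdxLe N H (Subgroup.closure F) → Irr (H : Set (GL (Fin d) ℂ))

/-- uniform growth in dimension `d` -/
def UG (c : ℝ) (d : ℕ) : Prop := ∀ F : Set (GL (Fin d) ℂ), F.Finite → 1 ∈ F →
  ¬ VSG (Subgroup.closure F) → Gr c F

lemma gr_inj {G H : Type*} [Group G] [Group H] (f : G →* H) (hf : Function.Injective f) {F : Set G}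
    {c : ℝ} (h : Gr c F) : Gr c (f '' F) := by
  intro n
  rw [← Set.image_pow, Set.ncard_image_of_injective _ hf]
  exact h n

/-- An endomorphism representation of `Γ` on an `n`-dimensional space gives growth of `F`,
unless the image is virtually solvable. -/
lemma growth_of_rep {G : Type*} [Group G] {F : Set G} (hF : F.Finite) (h1 : 1 ∈ F) {c : ℝ}
    {V : Type*} [AddCommGroup V] [Module ℂ V] [FiniteDimensional ℂ V]
    (hc : UG c (Module.finrank ℂ V)) (f : Subgroup.closure F →* (Module.End ℂ V)ˣ)
    (hvs : ¬ VSG f.range) : Gr c F := by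
  let e0 : Module.End ℂ V ≃* Matrix (Fin (Module.finrank ℂ V)) (Fin (Module.finrank ℂ V)) ℂ :=
    (LinearMap.toMatrixAlgEquiv (Module.finBasis ℂ V)).toMulEquiv
  let e : (Module.End ℂ V)ˣ ≃* GL (Fin (Module.finrank ℂ V)) ℂ := Units.mapEquiv e0
  let F'' : Set (Subgroup.closure F) := Subtype.val ⁻¹' F
  have hF'' : F''.Finite := hF.preimage Subtype.val_injective.injOn
  have hcl : Subgroup.closure F'' = ⊤ := Subgroup.closure_closure_coe_preimage
  let g : Subgroup.closure F →* GL (Fin (Module.finrank ℂ V)) ℂ := e.toMonoidHom.comp f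
  have hg : Subgroup.closure (g '' F'') = g.range := by
    rw [← MonoidHom.map_closure, hcl, MonoidHom.range_eq_map]
  have hgr : Gr c (g '' F'') := by
    refine hc _ (hF''.image _) ⟨1, h1, map_one g⟩ ?_
    rw [hg]
    intro hv
    apply hvs
    have : g.range.map e.symm.toMonoidHom = f.range := by
      rw [MonoidHom.map_range]
      congr 1
      ext x : 1
      simp [g]
    rw [← this]
    exact vs_of_surj (e.symm.toMonoidHom.subgroupMap g.range)
      (e.symm.toMonoidHom.subgroupMap_surjective _) hv
  have h2 := gr_inj (Subgroup.closure F).subtype Subtype.val_injective (gr_hom g hF'' hgr)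
  have h3 : (Subgroup.closure F).subtype '' F'' = F := by
    ext x
    constructor
    · rintro ⟨y, hy, rfl⟩; exact hy
    · intro hx; exact ⟨⟨x, Subgroup.subset_closure hx⟩, hx, rfl⟩
  rwa [h3] at h2

lemma invol_hom {G M : Type*} [Group G] [Monoid M] (f : G →* M) (x : G) :
    ((f.toHomUnits x : Mˣ) : M) = f x := rfl

lemma growth_of_invariant {d : ℕ} {c : ℝ} (hc : ∀ n < d, UG c n) {F : Set (GL (Fin d) ℂ)}
    (hF : F.Finite) (h1 : 1 ∈ F) (hvs : ¬ VSG (Subgroup.closure F))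
    (U : Submodule ℂ (Fin d → ℂ)) (hU : ∀ g ∈ Subgroup.closure F, ∀ x ∈ U,
      (g : Matrix (Fin d) (Fin d) ℂ) *ᵥ x ∈ U) (hb : U ≠ ⊥) (ht : U ≠ ⊤) : Gr c F := by
  let Γ := Subgroup.closure F
  let T : GL (Fin d) ℂ → Module.End ℂ (Fin d → ℂ) := fun g => Matrix.mulVecLin (g : Matrix _ _ ℂ)
  have hT : ∀ g ∈ Γ, ∀ x ∈ U, T g x ∈ U := hU
  let a1 : Γ →* Module.End ℂ U :=
    { toFun := fun g => (T g).restrict (hT g g.2)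
      map_one' := by ext x; simp [T]
      map_mul' := by
        intro g h
        ext x
        simp [T] }
  let a2 : Γ →* Module.End ℂ ((Fin d → ℂ) ⧸ U) :=
    { toFun := fun g => U.mapQ U (T g) (hT g g.2)
      map_one' := by
        apply LinearMap.ext
        intro x
        obtain ⟨x, rfl⟩ := Submodule.mkQ_surjective U x
        simp [T]
      map_mul' := by
        intro g h
        apply LinearMap.ext
        intro x
        obtain ⟨x, rfl⟩ := Submodule.mkQ_surjective U x
        simp [T] }
  have hk : Group.IsSolvable ↥(a1.toHomUnits.ker ⊓ a2.toHomUnits.ker) := by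
    apply Group.isSolvable_of_comm
    rintro ⟨g, hg1, hg2⟩ ⟨h, hh1, hh2⟩
    have fix : ∀ g ∈ a1.toHomUnits.ker, ∀ x ∈ U, T g x = x := by
      intro g hg x hx
      have : a1 g = 1 := by rw [← invol_hom a1, MonoidHom.mem_ker.1 hg]; rfl
      have := congrArg (fun L : Module.End ℂ U => ((L ⟨x, hx⟩ : U) : Fin d → ℂ)) this
      exact this
    have dif : ∀ g ∈ a2.toHomUnits.ker, ∀ x, T g x - x ∈ U := by
      intro g hg x
      have : a2 g = 1 := by rw [← invol_hom a2, MonoidHom.mem_ker.1 hg]; rfl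
      have := congrArg (fun L : Module.End ℂ ((Fin d → ℂ) ⧸ U) => L (U.mkQ x)) this
      exact (Submodule.Quotient.eq U).1 this
    apply Subtype.ext
    apply Subtype.ext
    apply Units.ext
    apply Matrix.toLin'.injective
    apply LinearMap.ext
    intro x
    have e1 := fix g hg1 _ (dif h hh2 x)
    have e2 := fix h hh1 _ (dif g hg2 x)
    rw [map_sub] at e1 e2
    have e3 : T g (T h x) = T h (T g x) := by
      rw [sub_eq_iff_eq_add.1 e1, sub_eq_iff_eq_add.1 e2]; abel
    simpa [T, Matrix.mulVec_mulVec] using e3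
  have hor : ¬ VSG a1.toHomUnits.range ∨ ¬ VSG a2.toHomUnits.range := by
    by_contra! h
    exact hvs (vs_of_solvable_ker _ _ h.1 h.2 hk)
  have hd : Module.finrank ℂ (Fin d → ℂ) = d := by simp
  have hlt : Module.finrank ℂ U < d := by
    have := Submodule.finrank_lt ht
    rwa [hd] at this
  rcases hor with h | h
  · exact growth_of_rep hF h1 (hc _ hlt) _ h
  · refine growth_of_rep hF h1 (hc _ ?_) _ h
    have h2 := U.finrank_quotient_add_finrank
    have h3 : 0 < Module.finrank ℂ U :=
      Module.finrank_pos_iff.2 ((Submodule.nontrivial_iff_ne_bot).2 hb)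
    omega

lemma case1 {d : ℕ} (N : ℕ) {c : ℝ} (hc1 : 1 < c) (hc : ∀ n < d, UG c n) :
    ∃ c' : ℝ, 1 < c' ∧ ∀ F : Set (GL (Fin d) ℂ), F.Finite → 1 ∈ F →
      ¬ VSG (Subgroup.closure F) → ¬ NoRed N F → Gr c' F := by
  obtain ⟨M, hM, hred⟩ := pos_red N
  refine ⟨c ^ (1 / (M : ℝ)), Real.one_lt_rpow hc1 (by positivity), ?_⟩
  intro F hF h1 hvs hnr
  simp only [NoRed, Irr] at hnr
  push Not at hnr
  obtain ⟨H, hHle, hH, U, hU, hb, ht⟩ := hnr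
  obtain ⟨F', hF'M, hF'H, h1', hidx⟩ := hred F hF h1 H hH
  refine gr_root hF hM hF'M hc1.le ?_
  have hle : Subgroup.closure F' ≤ H := (Subgroup.closure_le H).2 hF'H
  refine growth_of_invariant hc ((fin_pow hF M).subset hF'M) h1' ?_ U
    (fun g hg => hU g (hle hg)) hb ht
  intro hv
  apply hvs
  refine vs_of_finiteIndex ((Subgroup.closure F').subgroupOf (Subgroup.closure F)) ?_
  exact vs_of_surj (Subgroup.subgroupOfEquivOfLe (hle.trans hHle)).symm.toMonoidHom
    (Subgroup.subgroupOfEquivOfLe (hle.trans hHle)).symm.surjective hv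

end UEG

namespace UEG
set_option linter.unusedVariables false
open Pointwise Matrix

section
variable {G K : Type*} [Group G] [Field K]

/-- right translation on functions -/
def rtr (K : Type*) [Field K] (s : G) : (G → K) →ₗ[K] (G → K) where
  toFun h := fun g => h (g * s)
  map_add' _ _ := rfl
  map_smul' _ _ := rfl

lemma rtr_inj (s : G) : Function.Injective (rtr (G := G) K s) := by
  intro a b h
  ext g
  have := congrFun h (g * s⁻¹)
  simpa [rtr] using this

/-- functions vanishing on a set -/
def vanish (K : Type*) [Field K] (S : Set G) : Submodule K (G → K) where
  carrier := {h | ∀ x ∈ S, h x = 0}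
  add_mem' ha hb x hx := by simp [ha x hx, hb x hx]
  zero_mem' x hx := rfl
  smul_mem' c h hh x hx := by simp [hh x hx]

lemma lemmaZ (𝓕 : Submodule K (G → K)) [FiniteDimensional K 𝓕]
    (hinv : ∀ s : G, ∀ h ∈ 𝓕, rtr K s h ∈ 𝓕) (D : ℕ) (hD : Module.finrank K 𝓕 ≤ D)
    {F : Set G} (h1 : (1 : G) ∈ F) {f : G → K} (hf : f ∈ 𝓕) (hv : ∀ x ∈ F ^ D, f x = 0) :
    ∀ x ∈ Subgroup.closure F, f x = 0 := by
  let I : ℕ → Submodule K (G → K) := fun i => 𝓕 ⊓ vanish K (F ^ i)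
  have hIle : ∀ i, I i ≤ 𝓕 := fun i => inf_le_left
  have hfin : ∀ i, FiniteDimensional K (I i) := fun i => Submodule.finiteDimensional_of_le (hIle i)
  have hanti : ∀ i j, i ≤ j → I j ≤ I i := by
    intro i j hij h hh
    exact ⟨hh.1, fun x hx => hh.2 x (Set.pow_subset_pow_right h1 hij hx)⟩
  have hst : ∃ i ≤ D, I i = I (i + 1) := by
    by_contra! hne
    have : ∀ i ≤ D + 1, Module.finrank K (I i) + i ≤ D := by
      intro i
      induction i with
      | zero =>
        intro _
        have := Submodule.finrank_mono (hIle 0)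
        omega
      | succ i ih =>
        intro hi
        have h2 : I (i + 1) < I i := lt_of_le_of_ne (hanti i (i + 1) (by omega))
          (fun h => hne i (by omega) h.symm)
        have h3 := Submodule.finrank_lt_finrank_of_lt h2
        have := ih (by omega)
        omega
    have := this (D + 1) le_rfl
    omega
  obtain ⟨i, hi, hii⟩ := hst
  have hfI : f ∈ I i := hanti i D hi ⟨hf, hv⟩
  have hmap : ∀ s ∈ F, (I i).map (rtr K s) ≤ I i := by
    rintro s hs _ ⟨h, hh, rfl⟩
    refine ⟨hinv s h hh.1, fun x hx => ?_⟩
    rw [SetLike.mem_coe, hii] at hh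
    refine hh.2 (x * s) ?_
    rw [pow_succ]
    exact Set.mul_mem_mul hx hs
  have hmap' : ∀ s ∈ F, (I i).map (rtr K s) = I i := by
    intro s hs
    apply Submodule.eq_of_le_of_finrank_eq (hmap s hs)
    exact LinearEquiv.finrank_eq (Submodule.equivMapOfInjective _ (rtr_inj s) _).symm
  have hall : ∀ g ∈ Subgroup.closure F, ∀ h ∈ I i, rtr K g h ∈ I i := by
    intro g hg
    induction hg using Subgroup.closure_induction'' with
    | mem x hx => intro h hh; rw [← hmap' x hx]; exact ⟨h, hh, rfl⟩
    | inv_mem x hx =>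
      intro h hh
      rw [← hmap' x hx] at hh
      obtain ⟨k, hk, rfl⟩ := hh
      have : rtr K x⁻¹ (rtr K x k) = k := by ext g; simp [rtr]
      rwa [this]
    | one => intro h hh; have : rtr K (1 : G) h = h := by ext g; simp [rtr]
             rwa [this]
    | mul x y hx hy ihx ihy =>
      intro h hh
      have : rtr K (x * y) h = rtr K x (rtr K y h) := by ext g; simp [rtr, mul_assoc]
      rw [this]
      exact ihx _ (ihy _ hh)
  intro x hx
  have := (hall x hx f hfI).2 1 (one_mem_pow h1 i)
  simpa [rtr] using this

/-- function contained in a translation invariant space of dimension at most `D` -/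
def Deg (D : ℕ) (h : G → K) : Prop := ∃ 𝓕 : Submodule K (G → K), FiniteDimensional K 𝓕 ∧
  Module.finrank K 𝓕 ≤ D ∧ (∀ s : G, ∀ h ∈ 𝓕, rtr K s h ∈ 𝓕) ∧ h ∈ 𝓕

lemma Deg.vanish {D : ℕ} {h : G → K} (hh : Deg D h) {F : Set G} (h1 : (1 : G) ∈ F)
    (hv : ∀ x ∈ F ^ D, h x = 0) : ∀ x ∈ Subgroup.closure F, h x = 0 := by
  obtain ⟨𝓕, h2, h3, h4, h5⟩ := hh
  exact lemmaZ 𝓕 h4 D h3 h1 h5 hv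

lemma Deg.mono {D D' : ℕ} (hD : D ≤ D') {h : G → K} (hh : Deg D h) : Deg D' h := by
  obtain ⟨𝓕, h2, h3, h4, h5⟩ := hh
  exact ⟨𝓕, h2, h3.trans hD, h4, h5⟩

lemma Deg.const (c : K) : Deg 1 (fun _ : G => c) := by
  refine ⟨K ∙ (fun _ : G => (1 : K)), inferInstance, ?_, ?_, ?_⟩
  · exact finrank_span_le_card _ |>.trans (by simp)
  · intro s h hh
    obtain ⟨a, rfl⟩ := Submodule.mem_span_singleton.1 hh
    exact Submodule.mem_span_singleton.2 ⟨a, rfl⟩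
  · exact Submodule.mem_span_singleton.2 ⟨c, by ext; simp⟩

lemma Deg.add {D D' : ℕ} {h h' : G → K} (hh : Deg D h) (hh' : Deg D' h') :
    Deg (D + D') (fun x => h x + h' x) := by
  obtain ⟨𝓕, h2, h3, h4, h5⟩ := hh
  obtain ⟨𝓕', h2', h3', h4', h5'⟩ := hh'
  refine ⟨𝓕 ⊔ 𝓕', inferInstance, (Submodule.finrank_add_le_finrank_add_finrank _ _).trans
    (add_le_add h3 h3'), ?_, Submodule.add_mem_sup h5 h5'⟩
  intro s h hh
  obtain ⟨a, ha, b, hb, rfl⟩ := Submodule.mem_sup.1 hh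
  rw [map_add]
  exact Submodule.add_mem_sup (h4 s a ha) (h4' s b hb)

lemma Deg.mul {D D' : ℕ} {h h' : G → K} (hh : Deg D h) (hh' : Deg D' h') :
    Deg (D * D') (fun x => h x * h' x) := by
  obtain ⟨𝓕, h2, h3, h4, h5⟩ := hh
  obtain ⟨𝓕', h2', h3', h4', h5'⟩ := hh'
  have hfd : FiniteDimensional K ↥(𝓕 * 𝓕') := by
    rw [← Submodule.mulMap_range]; infer_instance
  refine ⟨𝓕 * 𝓕', hfd, ?_, ?_, Submodule.mul_mem_mul h5 h5'⟩
  · rw [← Submodule.mulMap_range]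
    refine (LinearMap.finrank_range_le _).trans ?_
    rw [Module.finrank_tensorProduct]
    exact Nat.mul_le_mul h3 h3'
  · intro s h hh
    refine Submodule.mul_induction_on hh ?_ ?_
    · intro a ha b hb
      have : rtr K s (a * b) = rtr K s a * rtr K s b := rfl
      rw [this]
      exact Submodule.mul_mem_mul (h4 s a ha) (h4' s b hb)
    · intro a b ha hb
      rw [map_add]; exact add_mem ha hb

lemma Deg.comp {G' : Type*} [Group G'] (φ : G' →* G) {D : ℕ} {h : G → K} (hh : Deg D h) :
    Deg D (fun x => h (φ x)) := by
  obtain ⟨𝓕, h2, h3, h4, h5⟩ := hh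
  let L : (G → K) →ₗ[K] (G' → K) := LinearMap.funLeft K K φ
  refine ⟨𝓕.map L, inferInstance, (Submodule.finrank_map_le _ _).trans h3, ?_, ⟨h, h5, rfl⟩⟩
  rintro s _ ⟨h, hh, rfl⟩
  refine ⟨rtr K (φ s) h, h4 _ h hh, ?_⟩
  ext x
  simp [rtr, L, LinearMap.funLeft]

lemma Deg.sum {ι : Type*} (s : Finset ι) (D : ι → ℕ) (h : ι → G → K) (hh : ∀ i ∈ s, Deg (D i) (h i)) :
    Deg (∑ i ∈ s, D i + 1) (fun x => ∑ i ∈ s, h i x) := by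
  classical
  induction s using Finset.induction_on with
  | empty => simpa using (Deg.const (G := G) (0 : K))
  | insert a s ha ih =>
    simp only [Finset.sum_insert ha]
    rw [add_assoc]
    exact (hh a (by simp)).add (ih (fun i hi => hh i (by simp [hi])))

lemma Deg.prod {ι : Type*} (s : Finset ι) (D : ι → ℕ) (h : ι → G → K) (hh : ∀ i ∈ s, Deg (D i) (h i)) :
    Deg (∏ i ∈ s, D i) (fun x => ∏ i ∈ s, h i x) := by
  classical
  induction s using Finset.induction_on with
  | empty => simpa using (Deg.const (G := G) (1 : K))
  | insert a s ha ih =>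
    simp only [Finset.prod_insert ha]
    exact (hh a (by simp)).mul (ih (fun i hi => hh i (by simp [hi])))

lemma Deg.entry {n : Type*} [Fintype n] [DecidableEq n] (i j : n) :
    Deg (Fintype.card n) (fun c : GL n K => c.1 i j) := by
  refine ⟨Submodule.span K (Set.range (fun l : n => fun c : GL n K => c.1 i l)),
    FiniteDimensional.span_of_finite _ (Set.finite_range _), finrank_range_le_card _, ?_,
    Submodule.subset_span ⟨j, rfl⟩⟩
  intro s h hh
  have : Submodule.span K (Set.range (fun l : n => fun c : GL n K => c.1 i l)) ≤
      (Submodule.span K (Set.range (fun l : n => fun c : GL n K => c.1 i l))).comap (rtr K s) := by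
    rw [Submodule.span_le]
    rintro _ ⟨l, rfl⟩
    have : rtr K s (fun c : GL n K => c.1 i l) = ∑ k, s.1 k l • (fun c : GL n K => c.1 i k) := by
      ext c
      simp [rtr, Matrix.mul_apply, mul_comm]
    simp only [Submodule.comap_coe, Set.mem_preimage, SetLike.mem_coe]
    rw [this]
    exact Submodule.sum_mem _ (fun k _ => Submodule.smul_mem _ _ (Submodule.subset_span ⟨k, rfl⟩))
  exact this hh

lemma Deg.inv_entry {n : Type*} [Fintype n] [DecidableEq n] (i j : n) :
    Deg (Fintype.card n) (fun c : GL n K => (c⁻¹).1 i j) := by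
  refine ⟨Submodule.span K (Set.range (fun l : n => fun c : GL n K => (c⁻¹).1 l j)),
    FiniteDimensional.span_of_finite _ (Set.finite_range _), finrank_range_le_card _, ?_,
    Submodule.subset_span ⟨i, rfl⟩⟩
  intro s h hh
  have : Submodule.span K (Set.range (fun l : n => fun c : GL n K => (c⁻¹).1 l j)) ≤
      (Submodule.span K (Set.range (fun l : n => fun c : GL n K => (c⁻¹).1 l j))).comap (rtr K s) := by
    rw [Submodule.span_le]
    rintro _ ⟨l, rfl⟩
    have : rtr K s (fun c : GL n K => (c⁻¹).1 l j) =
        ∑ k, (s⁻¹).1 l k • (fun c : GL n K => (c⁻¹).1 k j) := by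
      ext c
      simp only [rtr, LinearMap.coe_mk, AddHom.coe_mk, _root_.mul_inv_rev, Units.val_mul,
        Matrix.mul_apply, Finset.sum_apply, Pi.smul_apply, smul_eq_mul]
    simp only [Submodule.comap_coe, Set.mem_preimage, SetLike.mem_coe]
    rw [this]
    exact Submodule.sum_mem _ (fun k _ => Submodule.smul_mem _ _ (Submodule.subset_span ⟨k, rfl⟩))
  exact this hh

end

/-- degree bound for all words -/
lemma Deg.word {α : Type*} {d : ℕ} (w : FreeGroup α) : ∃ D : ℕ, ∀ i j : Fin d,
    Deg D (fun x : α → GL (Fin d) ℂ => (FreeGroup.lift x w).1 i j) := by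
  induction w using FreeGroup.induction_on with
  | C1 => exact ⟨1, fun i j => by simpa using Deg.const _⟩
  | of a =>
    refine ⟨d, fun i j => ?_⟩
    have := (Deg.entry (K := ℂ) i j).comp (Pi.evalMonoidHom (fun _ : α => GL (Fin d) ℂ) a)
    simpa using this
  | inv_of a ha =>
    refine ⟨d, fun i j => ?_⟩
    have := (Deg.inv_entry (K := ℂ) i j).comp (Pi.evalMonoidHom (fun _ : α => GL (Fin d) ℂ) a)
    simpa using this
  | mul x y hx hy =>
    obtain ⟨D1, h1⟩ := hx
    obtain ⟨D2, h2⟩ := hy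
    refine ⟨∑ _k : Fin d, D1 * D2 + 1, fun i j => ?_⟩
    have := Deg.sum (Finset.univ : Finset (Fin d)) (fun _ => D1 * D2)
      (fun k => fun z : α → GL (Fin d) ℂ => (FreeGroup.lift z x).1 i k * (FreeGroup.lift z y).1 k j)
      (fun k _ => (h1 i k).mul (h2 k j))
    simpa [Matrix.mul_apply] using this

/-- laws extend from large powers to the generated subgroup -/
lemma law_extend {α : Type*} [Finite α] (d : ℕ) (w : FreeGroup α) : ∃ m : ℕ,
    ∀ F : Set (GL (Fin d) ℂ), 1 ∈ F →
    (∀ x : α → GL (Fin d) ℂ, (∀ a, x a ∈ F ^ m) → FreeGroup.lift x w = 1) →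
    ∀ x : α → GL (Fin d) ℂ, (∀ a, x a ∈ Subgroup.closure F) → FreeGroup.lift x w = 1 := by
  obtain ⟨D, hD⟩ := Deg.word (d := d) w
  refine ⟨D + 1, ?_⟩
  intro F h1 h x hx
  have hpow : ∀ n : ℕ, ∀ y ∈ (Set.univ.pi (fun _ : α => F)) ^ n, ∀ a, y a ∈ F ^ n := by
    intro n
    induction n with
    | zero => intro y hy a; simp at hy; simp [hy]
    | succ n ih =>
      intro y hy a
      rw [pow_succ] at hy
      obtain ⟨u, hu, v, hv, rfl⟩ := hy
      rw [pow_succ]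
      exact Set.mul_mem_mul (ih u hu a) (hv a trivial)
  have hmem : x ∈ Subgroup.closure (Set.univ.pi (fun _ : α => F)) := by
    rw [Subgroup.closure_pi (fun _ => h1)]
    intro a _
    exact hx a
  apply Units.ext
  ext i j
  have hdeg := ((hD i j).add (Deg.const (G := α → GL (Fin d) ℂ) (-(1 : Matrix _ _ ℂ) i j)))
  have := hdeg.vanish (F := Set.univ.pi (fun _ : α => F)) (fun _ _ => h1) (by
    intro y hy
    rw [h y (hpow _ y hy)]
    simp) x hmem
  simpa [add_neg_eq_zero] using this

end UEG

namespace UEG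
set_option linter.style.haveILetI false
set_option linter.unusedVariables false
open Polynomial Cardinal

universe u
lemma ext_iso {R K L : Type u} [CommRing R] [IsDomain R] [Field K] [Field L] [IsAlgClosed K] [IsAlgClosed L]
    (hR : #R ≤ ℵ₀) (hK : ℵ₀ < #K) (hKL : #K = #L) (i : R →+* K) (j : R →+* L)
    (hi : Function.Injective i) (hj : Function.Injective j) :
    ∃ φ : K ≃+* L, ∀ r, φ (i r) = j r := by
  letI := i.toAlgebra
  letI := j.toAlgebra
  haveI : FaithfulSMul R K := (faithfulSMul_iff_algebraMap_injective R K).2 hi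
  haveI : FaithfulSMul R L := (faithfulSMul_iff_algebraMap_injective R L).2 hj
  obtain ⟨s, hs⟩ := exists_isTranscendenceBasis R K
  obtain ⟨t, ht⟩ := exists_isTranscendenceBasis R L
  have h1 := IsAlgClosed.cardinal_eq_cardinal_transcendence_basis_of_aleph0_lt' _ hs hR hK
  have h2 := IsAlgClosed.cardinal_eq_cardinal_transcendence_basis_of_aleph0_lt' _ ht hR (hKL ▸ hK)
  obtain ⟨e⟩ := Cardinal.eq.1 (h1.symm.trans (hKL.trans h2))
  letI := IsAlgClosed.isAlgClosure_of_transcendence_basis _ hs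
  letI := IsAlgClosed.isAlgClosure_of_transcendence_basis _ ht
  let E : Algebra.adjoin R (Set.range ((↑) : s → K)) ≃ₐ[R] Algebra.adjoin R (Set.range ((↑) : t → L)) :=
    (hs.1.aevalEquiv.symm.trans (MvPolynomial.renameEquiv R e)).trans ht.1.aevalEquiv
  refine ⟨IsAlgClosure.equivOfEquiv K L E.toRingEquiv, ?_⟩
  intro r
  have h3 := IsAlgClosure.equivOfEquiv_algebraMap K L E.toRingEquiv (algebraMap R _ r)
  have h4 : E.toRingEquiv (algebraMap R _ r) = algebraMap R _ r := E.commutes r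
  rw [h4] at h3
  exact h3

lemma countable_adjoinRoot (p : ℚ[X]) : #(AdjoinRoot p) ≤ ℵ₀ := by
  have h1 : #(ℚ[X]) ≤ ℵ₀ := by
    refine (Polynomial.cardinalMk_le_max (R := ℚ)).trans ?_
    simp
  exact (Cardinal.mk_le_of_surjective (AdjoinRoot.mk_surjective (g := p))).trans h1

lemma aleph0_lt_C : ℵ₀ < #ℂ := by rw [Cardinal.mk_complex]; exact Cardinal.aleph0_lt_continuum

lemma exists_hom_alg {L : Type} [Field L] [IsAlgClosed L] [CharZero L] [Algebra ℚ L] (hL : #ℂ = #L) (z : ℂ)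
    (hz : IsIntegral ℚ z) (z' : L) (hz' : aeval z' (minpoly ℚ z) = 0) :
    ∃ φ : ℂ →+* L, φ z = z' := by
  haveI : Fact (Irreducible (minpoly ℚ z)) := ⟨minpoly.irreducible hz⟩
  let i : AdjoinRoot (minpoly ℚ z) →+* ℂ := AdjoinRoot.lift (algebraMap ℚ ℂ) z (by
    have := minpoly.aeval ℚ z
    rwa [aeval_def] at this)
  let j : AdjoinRoot (minpoly ℚ z) →+* L := AdjoinRoot.lift (algebraMap ℚ L) z' (by
    rwa [aeval_def] at hz')
  obtain ⟨φ, hφ⟩ := ext_iso (countable_adjoinRoot _) aleph0_lt_C hL i j i.injective j.injective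
  refine ⟨φ, ?_⟩
  have := hφ (AdjoinRoot.root _)
  simpa [i, j] using this

/-- places of a transcendental number -/
lemma place_trans (z : ℂ) (hz : Transcendental ℚ z) : ∃ σ : ℂ →+* ℂ, 2 ≤ ‖σ z‖ := by
  obtain ⟨n, hn⟩ := exists_nat_ge (2 + ‖z‖)
  have hz' : Transcendental ℚ (z + n) := by
    intro h
    apply hz
    have := h.sub (isAlgebraic_natCast (R := ℚ) (A := ℂ) n)
    simpa using this
  have hc : #(ℚ[X]) ≤ ℵ₀ := by
    refine (Polynomial.cardinalMk_le_max (R := ℚ)).trans ?_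
    simp
  obtain ⟨φ, hφ⟩ := ext_iso hc aleph0_lt_C rfl (aeval z : ℚ[X] →ₐ[ℚ] ℂ).toRingHom
    (aeval (z + n) : ℚ[X] →ₐ[ℚ] ℂ).toRingHom (transcendental_iff_injective.1 hz)
    (transcendental_iff_injective.1 hz')
  refine ⟨φ, ?_⟩
  have h1 := hφ X
  simp at h1
  have h2 : ‖(n : ℂ)‖ ≤ ‖z + n‖ + ‖z‖ := by
    have := norm_sub_le (z + n) z
    simpa using this
  simp only [RingHom.coe_coe]
  rw [h1]
  simp at h2
  linarith

/-- an algebraic integer has a conjugate of modulus at least one -/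
lemma place_int (z : ℂ) (hz : IsIntegral ℤ z) (h0 : z ≠ 0) : ∃ σ : ℂ →+* ℂ, 1 ≤ ‖σ z‖ := by
  have hq : IsIntegral ℚ z := hz.tower_top
  have hmp : minpoly ℚ z = (minpoly ℤ z).map (algebraMap ℤ ℚ) :=
    minpoly.isIntegrallyClosed_eq_field_fractions' ℚ hz
  set p : ℂ[X] := (minpoly ℤ z).map (algebraMap ℤ ℂ) with hp
  have hpm : p.Monic := (minpoly.monic hz).map _
  have hsp : p.Splits := IsAlgClosed.splits p
  have hc0 : (minpoly ℤ z).coeff 0 ≠ 0 := by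
    have h := minpoly.coeff_zero_ne_zero hq h0
    rw [hmp, coeff_map] at h
    intro h'
    rw [h'] at h
    simp at h
  have hprod : 1 ≤ ‖p.roots.prod‖ := by
    have h1 := hsp.coeff_zero_eq_prod_roots_of_monic hpm
    have h2 : ‖p.coeff 0‖ = ‖p.roots.prod‖ := by rw [h1]; simp
    rw [← h2, hp, coeff_map]
    simp only [algebraMap_int_eq, eq_intCast]
    rw [Complex.norm_intCast]
    exact_mod_cast Int.one_le_abs hc0
  have hex : ∃ w ∈ p.roots, 1 ≤ ‖w‖ := by
    by_contra! hall
    have hne : p.roots ≠ 0 := by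
      intro h
      have hcard := hsp.natDegree_eq_card_roots
      rw [h] at hcard
      have : p.natDegree = (minpoly ℤ z).natDegree := (minpoly.monic hz).natDegree_map _
      have h3 := minpoly.natDegree_pos hz
      simp at hcard
      omega
    have : ∀ s : Multiset ℂ, (∀ w ∈ s, ‖w‖ < 1) → s ≠ 0 → ‖s.prod‖ < 1 := by
      intro s
      induction s using Multiset.induction_on with
      | empty => intro _ h; exact absurd rfl h
      | cons a s ih =>
        intro h _
        rw [Multiset.prod_cons, norm_mul]
        have ha := h a (by simp)
        by_cases hs : s = 0
        · simpa [hs] using ha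
        · have := ih (fun w hw => h w (by simp [hw])) hs
          exact mul_lt_one_of_nonneg_of_lt_one_left (norm_nonneg _) ha this.le
    exact absurd hprod (not_le.2 (this _ hall hne))
  obtain ⟨w, hw, hw1⟩ := hex
  obtain ⟨φ, hφ⟩ := exists_hom_alg rfl z hq w (by
    rw [hmp, aeval_map_algebraMap, aeval_def, ← eval_map]
    exact isRoot_of_mem_roots hw)
  exact ⟨φ, by rwa [hφ]⟩

lemma card_padic (p : ℕ) [Fact p.Prime] : #ℂ = #(PadicAlgCl p) := by
  rw [Cardinal.mk_complex]
  apply le_antisymm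
  · refine (continuum_le_cardinal_of_nontriviallyNormedField ℚ_[p]).trans ?_
    exact Cardinal.mk_le_of_injective (algebraMap ℚ_[p] (PadicAlgCl p)).injective
  · refine (Algebra.IsAlgebraic.cardinalMk_le_max ℚ_[p] (PadicAlgCl p)).trans ?_
    refine max_le ?_ Cardinal.aleph0_le_continuum
    have h1 : #ℚ_[p] ≤ #(PadicSeq p) := Cardinal.mk_le_of_surjective (f := Quotient.mk _) Quotient.mk_surjective
    refine h1.trans ?_
    have h2 : #(PadicSeq p) ≤ #(ℕ → ℚ) := Cardinal.mk_le_of_injective Subtype.val_injective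
    refine h2.trans ?_
    simp

/-- a nonintegral algebraic number has a nonarchimedean place -/
lemma place_nonint (z : ℂ) (hz : IsAlgebraic ℚ z) (hni : ¬ IsIntegral ℤ z) :
    ∃ v : AbsoluteValue ℂ ℝ, IsNonarchimedean v ∧ 1 < v z := by
  have hq : IsIntegral ℚ z := hz.isIntegral
  have hcoef : ∃ n, ∀ k : ℤ, (minpoly ℚ z).coeff n ≠ k := by
    by_contra! hall
    apply hni
    have hl : minpoly ℚ z ∈ Polynomial.lifts (algebraMap ℤ ℚ) := by
      rw [Polynomial.lifts_iff_coeff_lifts]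
      intro n
      obtain ⟨k, hk⟩ := hall n
      exact ⟨k, by simp [hk]⟩
    obtain ⟨q, hq1, -, hq2⟩ := lifts_and_natDegree_eq_and_monic hl (minpoly.monic hq)
    refine ⟨q, hq2, ?_⟩
    rw [← aeval_def, ← aeval_map_algebraMap ℚ, hq1]
    exact minpoly.aeval ℚ z
  obtain ⟨n, hn⟩ := hcoef
  set a := (minpoly ℚ z).coeff n
  have hden : a.den ≠ 1 := fun h => hn a.num ((Rat.den_eq_one_iff a).1 h).symm
  obtain ⟨p, hp, hpd⟩ := Nat.exists_prime_and_dvd hden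
  haveI : Fact p.Prime := ⟨hp⟩
  have hbig : 1 < ‖(a : ℚ_[p])‖ := by
    by_contra! hle
    have h1 : ((a.num : ℤ) : ℚ_[p]) = (a : ℚ_[p]) * ((a.den : ℤ) : ℚ_[p]) := by
      have := Rat.mul_den_eq_num a
      exact_mod_cast congrArg (fun q : ℚ => (q : ℚ_[p])) this.symm
    have h2 : ‖((a.den : ℤ) : ℚ_[p])‖ < 1 := by
      rw [Padic.norm_intCast_lt_one_iff]
      exact_mod_cast hpd
    have h3 : ‖((a.num : ℤ) : ℚ_[p])‖ < 1 := by
      rw [h1, norm_mul]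
      exact mul_lt_one_of_nonneg_of_lt_one_right hle (norm_nonneg _) h2
    rw [Padic.norm_intCast_lt_one_iff] at h3
    have h4 : p ∣ a.num.natAbs := by exact Int.natCast_dvd.1 h3
    have h5 := Nat.dvd_gcd h4 hpd
    rw [a.reduced] at h5
    exact hp.one_lt.ne' (Nat.dvd_one.1 h5)
  set P : (PadicAlgCl p)[X] := (minpoly ℚ z).map (algebraMap ℚ (PadicAlgCl p)) with hP
  have hPm : P.Monic := (minpoly.monic hq).map _
  have hsp : P.Splits := IsAlgClosed.splits P
  have hroot : ∃ w ∈ P.roots, 1 < ‖w‖ := by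
    by_contra! hall
    have key : ∀ s : Multiset (PadicAlgCl p), (∀ w ∈ s, ‖w‖ ≤ 1) →
        ∀ m, ‖((s.map (fun w => X - C w)).prod).coeff m‖ ≤ 1 := by
      intro s
      induction s using Multiset.induction_on with
      | empty =>
        intro _ m
        simp only [Multiset.map_zero, Multiset.prod_zero, coeff_one]
        split_ifs <;> simp
      | cons b s ih =>
        intro h m
        rw [Multiset.map_cons, Multiset.prod_cons, sub_mul, coeff_sub, coeff_C_mul]
        have h1 := ih (fun w hw => h w (by simp [hw]))
        have hb := h b (by simp)
        rw [sub_eq_add_neg]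
        refine (PadicAlgCl.isNonarchimedean p _ _).trans (max_le ?_ ?_)
        · cases m with
          | zero => simp
          | succ m => rw [coeff_X_mul]; exact h1 m
        · rw [norm_neg, norm_mul]
          exact mul_le_one₀ hb (norm_nonneg _) (h1 m)
    have h2 := key P.roots hall n
    rw [← hsp.eq_prod_roots_of_monic hPm, hP, coeff_map] at h2
    have h3 : algebraMap ℚ (PadicAlgCl p) a = algebraMap ℚ_[p] (PadicAlgCl p) (a : ℚ_[p]) := by
      simp
    rw [h3] at h2
    have h4 := PadicAlgCl.norm_extends p (a : ℚ_[p])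
    rw [h4] at h2
    linarith
  obtain ⟨w, hw, hw1⟩ := hroot
  obtain ⟨φ, hφ⟩ := exists_hom_alg (card_padic p) z hq w (by
    rw [aeval_def, ← eval_map]
    exact isRoot_of_mem_roots hw)
  refine ⟨(NormedField.toAbsoluteValue (PadicAlgCl p)).comp φ.injective, ?_, ?_⟩
  · intro x y
    change ‖φ (x + y)‖ ≤ max ‖φ x‖ ‖φ y‖
    rw [map_add]
    exact PadicAlgCl.isNonarchimedean p _ _
  · change 1 < ‖φ z‖
    rwa [hφ]

/-- summary: unless `z` is an algebraic integer all of whose conjugates are at most `1+η`,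
there is a place where `z` is large -/
lemma exists_place (z : ℂ) {η : ℝ} (hη : η ≤ 1) (h : ¬ (IsIntegral ℤ z ∧ ∀ σ : ℂ →+* ℂ, ‖σ z‖ < 1 + η)) :
    (∃ σ : ℂ →+* ℂ, 1 + η ≤ ‖σ z‖) ∨ ∃ v : AbsoluteValue ℂ ℝ, IsNonarchimedean v ∧ 1 < v z := by
  by_cases h1 : IsIntegral ℤ z
  · left
    by_contra! h2
    exact h ⟨h1, h2⟩
  · by_cases h3 : IsAlgebraic ℚ z
    · exact Or.inr (place_nonint z h3 h1)
    · obtain ⟨σ, hσ⟩ := place_trans z h3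
      exact Or.inl ⟨σ, by linarith⟩

/-- absolute value induced by an embedding -/
noncomputable def archAV (σ : ℂ →+* ℂ) : AbsoluteValue ℂ ℝ := (NormedField.toAbsoluteValue ℂ).comp σ.injective

lemma archAV_apply (σ : ℂ →+* ℂ) (z : ℂ) : archAV σ z = ‖σ z‖ := rfl

/-- powers of nonarchimedean absolute values -/
lemma nonarch_pow (v : AbsoluteValue ℂ ℝ) (hv : IsNonarchimedean v) (z : ℂ) (hz : 1 < v z) (R : ℝ) :
    ∃ v' : AbsoluteValue ℂ ℝ, R ≤ v' z := by
  obtain ⟨n, hn⟩ := pow_unbounded_of_one_lt R hz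
  refine ⟨⟨⟨fun x => v x ^ (n + 1), fun x y => by rw [map_mul, mul_pow]⟩, fun x => by positivity,
    fun x => by simp, fun x y => ?_⟩, ?_⟩
  · simp only
    refine (pow_le_pow_left₀ (by positivity) (hv x y) (n + 1)).trans ?_
    rcases le_total (v x) (v y) with h | h
    · rw [max_eq_right h]
      exact le_add_of_nonneg_left (by positivity)
    · rw [max_eq_left h]
      exact le_add_of_nonneg_right (by positivity)
  · change R ≤ v z ^ (n + 1)
    exact hn.le.trans (pow_le_pow_right₀ hz.le (by omega))

end UEG

namespace UEG
set_option linter.unusedVariables false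
set_option linter.style.haveILetI false
open Polynomial Matrix

section nv
variable {m n o : Type*} [Fintype m] [Fintype n] [Fintype o]

/-- sum of absolute values of entries -/
noncomputable def nv (v : AbsoluteValue ℂ ℝ) (A : Matrix m n ℂ) : ℝ := ∑ i, ∑ j, v (A i j)

lemma nv_nonneg (v : AbsoluteValue ℂ ℝ) (A : Matrix m n ℂ) : 0 ≤ nv v A :=
  Finset.sum_nonneg fun _ _ => Finset.sum_nonneg fun _ _ => v.nonneg _

lemma le_nv (v : AbsoluteValue ℂ ℝ) (A : Matrix m n ℂ) (i : m) (j : n) : v (A i j) ≤ nv v A := by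
  refine le_trans ?_ (Finset.single_le_sum (f := fun i => ∑ j, v (A i j))
    (fun i _ => Finset.sum_nonneg fun _ _ => v.nonneg _) (Finset.mem_univ i))
  exact Finset.single_le_sum (f := fun j => v (A i j)) (fun _ _ => v.nonneg _) (Finset.mem_univ j)

lemma nv_le (v : AbsoluteValue ℂ ℝ) (A : Matrix m n ℂ) (b : ℝ) (h : ∀ i j, v (A i j) ≤ b) :
    nv v A ≤ Fintype.card m * Fintype.card n * b := by
  calc nv v A ≤ ∑ i : m, ∑ j : n, b := Finset.sum_le_sum fun i _ => Finset.sum_le_sum fun j _ => h i j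
    _ = _ := by simp [mul_assoc]

lemma nv_mul (v : AbsoluteValue ℂ ℝ) (A : Matrix m n ℂ) (B : Matrix n o ℂ) :
    nv v (A * B) ≤ nv v A * nv v B := by
  have h1 : ∀ i k, v ((A * B) i k) ≤ ∑ j, v (A i j) * v (B j k) := by
    intro i k
    rw [Matrix.mul_apply]
    refine (v.sum_le _ _).trans (Finset.sum_le_sum fun j _ => ?_)
    rw [map_mul]
  calc nv v (A * B) ≤ ∑ i, ∑ k, ∑ j, v (A i j) * v (B j k) :=
        Finset.sum_le_sum fun i _ => Finset.sum_le_sum fun k _ => h1 i k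
    _ = ∑ i, ∑ j, v (A i j) * ∑ k, v (B j k) := by
        refine Finset.sum_congr rfl fun i _ => ?_
        rw [Finset.sum_comm]
        refine Finset.sum_congr rfl fun j _ => ?_
        rw [Finset.mul_sum]
    _ ≤ ∑ i, ∑ j, v (A i j) * nv v B := by
        refine Finset.sum_le_sum fun i _ => Finset.sum_le_sum fun j _ => ?_
        refine mul_le_mul_of_nonneg_left ?_ (v.nonneg _)
        exact Finset.single_le_sum (f := fun j => ∑ k, v (B j k))
          (fun i _ => Finset.sum_nonneg fun _ _ => v.nonneg _) (Finset.mem_univ j)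
    _ = _ := by simp only [nv, Finset.sum_mul]

lemma nv_add (v : AbsoluteValue ℂ ℝ) (A B : Matrix m n ℂ) : nv v (A + B) ≤ nv v A + nv v B := by
  simp only [nv, ← Finset.sum_add_distrib]
  exact Finset.sum_le_sum fun i _ => Finset.sum_le_sum fun j _ => v.add_le _ _

lemma nv_neg (v : AbsoluteValue ℂ ℝ) (A : Matrix m n ℂ) : nv v (-A) = nv v A := by
  simp [nv]

lemma nv_smul (v : AbsoluteValue ℂ ℝ) (c : ℂ) (A : Matrix m n ℂ) : nv v (c • A) = v c * nv v A := by
  simp [nv, Finset.mul_sum]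

lemma nv_one_le [DecidableEq n] (v : AbsoluteValue ℂ ℝ) :
    nv v (1 : Matrix n n ℂ) = Fintype.card n := by
  have : ∀ i j : n, v ((1 : Matrix n n ℂ) i j) = if i = j then 1 else 0 := by
    intro i j
    rw [Matrix.one_apply]
    split_ifs <;> simp
  simp [nv, this]

lemma exists_eigvec {K : Type*} [Field K] [DecidableEq n] (A : Matrix n n K) (l : K) (hl : A.charpoly.IsRoot l) :
    ∃ x : n → K, x ≠ 0 ∧ A *ᵥ x = l • x := by
  have h1 : (Matrix.scalar n l - A).det = 0 := by
    rw [← Matrix.eval_charpoly]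
    exact hl
  obtain ⟨x, hx, h2⟩ := Matrix.exists_mulVec_eq_zero_iff.2 h1
  refine ⟨x, hx, ?_⟩
  rw [Matrix.sub_mulVec, sub_eq_zero] at h2
  rw [← h2]
  simp [Matrix.scalar_apply, ← Matrix.smul_one_eq_diagonal, Matrix.smul_mulVec]

lemma root_le_nv [DecidableEq n] (v : AbsoluteValue ℂ ℝ) (A : Matrix n n ℂ) (l : ℂ) (hl : A.charpoly.IsRoot l) :
    v l ≤ nv v A := by
  obtain ⟨x, hx, h⟩ := exists_eigvec A l hl
  have hne : Nonempty n := by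
    by_contra hne
    rw [not_nonempty_iff] at hne
    exact hx (Subsingleton.elim _ _)
  obtain ⟨i, hi⟩ := Finite.exists_max (fun i => v (x i))
  have hpos : 0 < v (x i) := by
    by_contra! h0
    apply hx
    ext j
    exact v.eq_zero.1 (le_antisymm ((hi j).trans h0) (v.nonneg _))
  have h2 := congrFun h i
  have h3 : v l * v (x i) ≤ (∑ j, v (A i j)) * v (x i) := by
    rw [← map_mul]
    have : l * x i = ∑ j, A i j * x j := by
      rw [Pi.smul_apply, smul_eq_mul] at h2
      rw [← h2]; rfl
    rw [this, Finset.sum_mul]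
    refine (v.sum_le _ _).trans (Finset.sum_le_sum fun j _ => ?_)
    rw [map_mul]
    exact mul_le_mul_of_nonneg_left (hi j) (v.nonneg _)
  have h4 := le_of_mul_le_mul_right h3 hpos
  refine h4.trans ?_
  exact Finset.single_le_sum (f := fun i => ∑ j, v (A i j))
    (fun i _ => Finset.sum_nonneg fun _ _ => v.nonneg _) (Finset.mem_univ i)

end nv

/-- data for the limit construction -/
structure Scale where
  v : ℕ → AbsoluteValue ℂ ℝ
  r : ℕ → ℝ
  hr : ∀ k, 2 ≤ r k

/-- the ultrafilter -/
noncomputable abbrev UU : Ultrafilter ℕ := Filter.hyperfilter ℕ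

namespace Scale
variable (S : Scale)

lemma r_pos (k : ℕ) : 0 < S.r k := by linarith [S.hr k]
lemma one_le_r (k : ℕ) : 1 ≤ S.r k := by linarith [S.hr k]

lemma pow_mono (k : ℕ) {a b : ℕ} (h : a ≤ b) : S.r k ^ a ≤ S.r k ^ b := pow_le_pow_right₀ (S.one_le_r k) h

/-- ring of bounded sequences -/
def B : Subring (ℕ → ℂ) where
  carrier := {x | ∃ n : ℕ, ∀ᶠ k in (UU : Filter ℕ), S.v k (x k) ≤ S.r k ^ n}
  zero_mem' := ⟨0, Filter.Eventually.of_forall fun k => by simp⟩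
  one_mem' := ⟨0, Filter.Eventually.of_forall fun k => by simp⟩
  add_mem' := by
    rintro a b ⟨n, hn⟩ ⟨m, hm⟩
    refine ⟨max n m + 1, ?_⟩
    filter_upwards [hn, hm] with k h1 h2
    have h3 := S.pow_mono k (le_max_left n m)
    have h4 := S.pow_mono k (le_max_right n m)
    calc S.v k ((a + b) k) ≤ S.v k (a k) + S.v k (b k) := (S.v k).add_le _ _
      _ ≤ S.r k ^ (max n m) * 2 := by linarith
      _ ≤ S.r k ^ (max n m + 1) := by
        rw [pow_succ]
        exact mul_le_mul_of_nonneg_left (S.hr k) (pow_nonneg (S.r_pos k).le _)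
  mul_mem' := by
    rintro a b ⟨n, hn⟩ ⟨m, hm⟩
    refine ⟨n + m, ?_⟩
    filter_upwards [hn, hm] with k h1 h2
    rw [Pi.mul_apply, map_mul, pow_add]
    exact mul_le_mul h1 h2 ((S.v k).nonneg _) (pow_nonneg (S.r_pos k).le _)
  neg_mem' := by
    rintro a ⟨n, hn⟩
    refine ⟨n, ?_⟩
    filter_upwards [hn] with k h1
    simpa using h1

/-- infinitesimals -/
def I : Ideal S.B where
  carrier := {x | ∀ n : ℕ, ∀ᶠ k in (UU : Filter ℕ), S.v k (x.1 k) * S.r k ^ n ≤ 1}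
  zero_mem' n := Filter.Eventually.of_forall fun k => by simp
  add_mem' := by
    rintro a b ha hb n
    filter_upwards [ha (n + 1), hb (n + 1)] with k h1 h2
    have h0 : 0 ≤ S.r k ^ n := pow_nonneg (S.r_pos k).le _
    have h3 : S.v k ((a + b).1 k) ≤ S.v k (a.1 k) + S.v k (b.1 k) := (S.v k).add_le _ _
    rw [pow_succ] at h1 h2
    have hr := S.hr k
    have e1 : S.v k (a.1 k) * S.r k ^ n * 2 ≤ 1 := by
      refine le_trans ?_ h1
      rw [← mul_assoc]
      exact mul_le_mul_of_nonneg_left hr (mul_nonneg ((S.v k).nonneg _) h0)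
    have e2 : S.v k (b.1 k) * S.r k ^ n * 2 ≤ 1 := by
      refine le_trans ?_ h2
      rw [← mul_assoc]
      exact mul_le_mul_of_nonneg_left hr (mul_nonneg ((S.v k).nonneg _) h0)
    have := mul_le_mul_of_nonneg_right h3 h0
    linarith
  smul_mem' := by
    rintro a b hb n
    obtain ⟨m, hm⟩ := a.2
    filter_upwards [hm, hb (n + m)] with k h1 h2
    have h0 : 0 ≤ S.r k ^ n := pow_nonneg (S.r_pos k).le _
    have : S.v k ((a • b).1 k) = S.v k (a.1 k) * S.v k (b.1 k) := by
      rw [← map_mul]; rfl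
    rw [this]
    rw [pow_add] at h2
    calc S.v k (a.1 k) * S.v k (b.1 k) * S.r k ^ n
        ≤ S.r k ^ m * S.v k (b.1 k) * S.r k ^ n := by
          have := (S.v k).nonneg (b.1 k)
          gcongr
      _ = S.v k (b.1 k) * (S.r k ^ n * S.r k ^ m) := by ring
      _ ≤ 1 := h2

lemma mem_I (x : S.B) : x ∈ S.I ↔ ∀ n : ℕ, ∀ᶠ k in (UU : Filter ℕ), S.v k (x.1 k) * S.r k ^ n ≤ 1 := Iff.rfl

lemma inv_mem_B (x : ℕ → ℂ) (n : ℕ) (h : ∀ᶠ k in (UU : Filter ℕ), 1 ≤ S.v k (x k) * S.r k ^ n) :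
    x⁻¹ ∈ S.B := by
  refine ⟨n, ?_⟩
  filter_upwards [h] with k hk
  rw [Pi.inv_apply, map_inv₀]
  have hx : 0 < S.v k (x k) := by
    rcases ((S.v k).nonneg (x k)).lt_or_eq with h | h
    · exact h
    · rw [← h] at hk; norm_num at hk
  rw [inv_le_comm₀ hx (pow_pos (S.r_pos k) n), inv_le_iff_one_le_mul₀ (pow_pos (S.r_pos k) n)]
  exact hk

lemma not_mem_I {x : S.B} (h : x ∉ S.I) :
    ∃ n : ℕ, ∀ᶠ k in (UU : Filter ℕ), 1 ≤ S.v k (x.1 k) * S.r k ^ n := by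
  rw [mem_I] at h
  push Not at h
  obtain ⟨n, hn⟩ := h
  refine ⟨n, ?_⟩
  filter_upwards [hn] with k hk
  exact hk.le

instance I_max : S.I.IsMaximal := by
  rw [Ideal.isMaximal_iff]
  constructor
  · intro h
    have := (S.mem_I 1).1 h 1
    obtain ⟨k, hk⟩ := this.exists
    have := S.hr k
    have h2 : S.v k ((1 : S.B).1 k) = 1 := map_one _
    rw [h2, pow_one, one_mul] at hk
    linarith
  · intro J x hJ hx hxJ
    obtain ⟨n, hn⟩ := S.not_mem_I hx
    let y : S.B := ⟨x.1⁻¹, S.inv_mem_B x.1 n hn⟩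
    have h1 : 1 - y * x ∈ S.I := by
      intro m
      filter_upwards [hn] with k hk
      have hx : x.1 k ≠ 0 := by
        intro h0; rw [h0, map_zero, zero_mul] at hk; norm_num at hk
      have : (1 - y * x).1 k = 0 := by
        change 1 - (x.1 k)⁻¹ * x.1 k = 0
        rw [inv_mul_cancel₀ hx, sub_self]
      rw [this, map_zero, zero_mul]
      norm_num
    have := J.add_mem (hJ h1) (J.mul_mem_left y hxJ)
    simpa using this

/-- the limit field -/
abbrev Fl := S.B ⧸ S.I

noncomputable instance : Field S.Fl := Ideal.Quotient.field S.I

/-- reduction -/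
noncomputable def pr : S.B →+* S.Fl := Ideal.Quotient.mk S.I

lemma pr_surj : Function.Surjective S.pr := Ideal.Quotient.mk_surjective

/-- evaluation -/
def ev (k : ℕ) : S.B →+* ℂ := (Pi.evalRingHom (fun _ : ℕ => ℂ) k).comp S.B.subtype

lemma pr_eq_zero (x : S.B) : S.pr x = 0 ↔ ∀ n : ℕ, ∀ᶠ k in (UU : Filter ℕ), S.v k (S.ev k x) * S.r k ^ n ≤ 1 :=
  Ideal.Quotient.eq_zero_iff_mem

lemma pr_ne_zero {x : S.B} (h : S.pr x ≠ 0) :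
    ∃ n : ℕ, ∀ᶠ k in (UU : Filter ℕ), 1 ≤ S.v k (S.ev k x) * S.r k ^ n :=
  S.not_mem_I (fun h' => h (Ideal.Quotient.eq_zero_iff_mem.2 h'))

lemma bd (x : S.B) : ∃ n : ℕ, ∀ᶠ k in (UU : Filter ℕ), S.v k (S.ev k x) ≤ S.r k ^ n := x.2

lemma pr_ne_zero' {x : S.B} {n : ℕ} (h : ∀ᶠ k in (UU : Filter ℕ), 1 ≤ S.v k (S.ev k x) * S.r k ^ n) :
    S.pr x ≠ 0 := by
  intro h0
  have := (S.pr_eq_zero x).1 h0 (n + 1)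
  obtain ⟨k, hk, hk2⟩ := (h.and this).exists
  rw [pow_succ, ← mul_assoc] at hk2
  have := S.hr k
  nlinarith

lemma ev_inj {x y : S.B} (h : ∀ k, S.ev k x = S.ev k y) : x = y := Subtype.ext (funext h)

/-- matrices from sequences -/
def mkM {m n : Type*} (A : ℕ → Matrix m n ℂ) (h : ∀ i j, (fun k => A k i j) ∈ S.B) : Matrix m n S.B :=
  Matrix.of fun i j => ⟨fun k => A k i j, h i j⟩

lemma mkM_ev {m n : Type*} (A : ℕ → Matrix m n ℂ) (h : ∀ i j, (fun k => A k i j) ∈ S.B) (k : ℕ) :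
    (S.mkM A h).map (S.ev k) = A k := rfl

lemma mat_ext {m n : Type*} {A C : Matrix m n S.B} (h : ∀ k, A.map (S.ev k) = C.map (S.ev k)) : A = C := by
  ext i j : 1
  apply S.ev_inj
  intro k
  exact congrFun (congrFun (h k) i) j

lemma bd_nv {m n : Type*} [Fintype m] [Fintype n] (A : Matrix m n S.B) : ∃ N : ℕ, ∀ᶠ k in (UU : Filter ℕ),
    nv (S.v k) (A.map (S.ev k)) ≤ S.r k ^ N := by
  have : (fun k => nv (S.v k) (A.map (S.ev k))) = fun k => ∑ i, ∑ j, S.v k (S.ev k (A i j)) := rfl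
  choose N hN using fun i j => S.bd (A i j)
  obtain ⟨c, hc⟩ := exists_nat_ge ((Fintype.card m : ℝ) * Fintype.card n)
  refine ⟨(∑ i, ∑ j, N i j) + c, ?_⟩
  have hall : ∀ᶠ k in (UU : Filter ℕ), ∀ i j, S.v k (S.ev k (A i j)) ≤ S.r k ^ (N i j) := by
    rw [Filter.eventually_all]
    intro i
    rw [Filter.eventually_all]
    exact hN i
  filter_upwards [hall] with k hk
  have h1 := nv_le (S.v k) (A.map (S.ev k)) (S.r k ^ (∑ i, ∑ j, N i j)) (by
    intro i j
    refine (hk i j).trans (S.pow_mono k ?_)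
    refine le_trans ?_ (Finset.single_le_sum (f := fun i => ∑ j, N i j) (fun _ _ => Nat.zero_le _) (Finset.mem_univ i))
    exact Finset.single_le_sum (f := fun j => N i j) (fun _ _ => Nat.zero_le _) (Finset.mem_univ j))
  refine h1.trans ?_
  rw [pow_add, mul_comm]
  refine mul_le_mul_of_nonneg_left ?_ (pow_nonneg (S.r_pos k).le _)
  refine hc.trans ?_
  calc (c : ℝ) ≤ 2 ^ c := by exact_mod_cast Nat.lt_two_pow_self.le
    _ ≤ _ := pow_le_pow_left₀ (by norm_num) (S.hr k) c

/-- lifting of eigenvalues -/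
lemma exists_eig {n : Type*} [Fintype n] [DecidableEq n] (A : Matrix n n S.B) : ∃ l : n → S.B,
    A.charpoly = ∏ i, (X - C (l i)) := by
  have h1 : ∀ k, ∃ l : n → ℂ, (A.map (S.ev k)).charpoly = ∏ i, (X - C (l i)) := by
    intro k
    have hs := IsAlgClosed.splits (A.map (S.ev k)).charpoly
    have hc := hs.natDegree_eq_card_roots
    rw [Matrix.charpoly_natDegree_eq_dim] at hc
    have he := hs.eq_prod_roots_of_monic (Matrix.charpoly_monic _)
    generalize (A.map (S.ev k)).charpoly.roots = s at hc he
    induction s using Quotient.inductionOn with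
    | h L =>
      simp only [Multiset.quot_mk_to_coe, Multiset.coe_card] at hc
      let e : n ≃ Fin L.length := (Fintype.equivFin n).trans (finCongr hc)
      refine ⟨fun i => L.get (e i), ?_⟩
      rw [he]
      simp only [Multiset.quot_mk_to_coe, Multiset.map_coe, Multiset.prod_coe]
      rw [e.prod_comp (fun i => X - C (L.get i))]
      rw [← List.prod_ofFn]
      congr 1
      apply List.ext_get <;> simp
  choose l hl using h1
  obtain ⟨N, hN⟩ := S.bd_nv A
  have hmem : ∀ i, (fun k => l k i) ∈ S.B := by
    intro i
    refine ⟨N, ?_⟩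
    filter_upwards [hN] with k hk
    refine (root_le_nv (S.v k) _ _ ?_).trans hk
    rw [hl k, IsRoot.def, eval_prod]
    exact Finset.prod_eq_zero (Finset.mem_univ i) (by simp)
  refine ⟨fun i => ⟨fun k => l k i, hmem i⟩, ?_⟩
  ext m : 1
  apply S.ev_inj
  intro k
  have e1 : S.ev k (A.charpoly.coeff m) = (A.map (S.ev k)).charpoly.coeff m := by
    rw [← coeff_map]
    congr 1
    exact (Matrix.charpoly_map A (S.ev k)).symm
  rw [e1, hl k, ← coeff_map, Polynomial.map_prod]
  congr 1
  refine Finset.prod_congr rfl fun i _ => ?_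
  rw [Polynomial.map_sub, map_X, map_C]
  rfl

end Scale
end UEG

namespace UEG
set_option linter.unusedVariables false
set_option linter.style.haveILetI false
open Matrix

lemma not_nilp_of_map_eq {K V : Type*} [Field K] [AddCommGroup V] [Module K V] (b : Module.End K V)
    (hb : IsNilpotent b) (R : Submodule K V) (hR : R ≠ ⊥) (h : R ≤ R.map b) : False := by
  obtain ⟨n, hn⟩ := hb
  have : ∀ n : ℕ, R ≤ R.map (b ^ n) := by
    intro n
    induction n with
    | zero => simp [Module.End.one_eq_id]
    | succ n ih =>
      refine h.trans ?_
      rw [pow_succ', Module.End.mul_eq_comp, Submodule.map_comp]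
      exact Submodule.map_mono ih
  have h2 := this n
  rw [hn, Submodule.map_zero] at h2
  exact hR (le_bot_iff.1 h2)

lemma levitzki_kernel (n : ℕ) : ∀ {K V : Type*} [Field K] [AddCommGroup V] [Module K V] [FiniteDimensional K V]
    (S : Set (Module.End K V)) (hmul : ∀ a ∈ S, ∀ b ∈ S, a * b ∈ S) (hnil : ∀ a ∈ S, IsNilpotent a)
    (hV : Module.finrank K V = n) (hn : 0 < n), ∃ x : V, x ≠ 0 ∧ ∀ s ∈ S, s x = 0 := by
  induction n using Nat.strong_induction_on with
  | _ n ih =>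
  intro K V _ _ _ _ S hmul hnil hV hn
  have hnt : Nontrivial V := (Module.finrank_pos_iff (R := K)).1 (by omega)
  by_cases hS : ∃ a ∈ S, a ≠ 0
  swap
  · push Not at hS
    obtain ⟨x, hx⟩ := exists_ne (0 : V)
    exact ⟨x, hx, fun s hs => by rw [hS s hs]; rfl⟩
  -- minimal rank
  obtain ⟨a, ⟨haS, ha0⟩, hmin⟩ : ∃ a, (a ∈ S ∧ a ≠ 0) ∧ ∀ b, (b ∈ S ∧ b ≠ 0) →
      Module.finrank K (LinearMap.range a) ≤ Module.finrank K (LinearMap.range b) := by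
    obtain ⟨a0, h1, h2⟩ := hS
    let T : Set (Module.End K V) := {a | a ∈ S ∧ a ≠ 0}
    have hT : T.Nonempty := ⟨a0, h1, h2⟩
    let f : Module.End K V → ℕ := fun a => Module.finrank K (LinearMap.range a)
    exact ⟨Function.argminOn f T hT, Function.argminOn_mem f T hT, fun b hb => Function.argminOn_le f T hb⟩
  have hra : LinearMap.range a ≠ ⊥ := by rwa [Ne, LinearMap.range_eq_bot]
  have key : ∀ b : Module.End K V, a * b ∈ S → a * b * a ∈ S → a * b * a = 0 := by
    intro b hab haba
    by_contra hne
    have hle : LinearMap.range (a * b * a) ≤ LinearMap.range a := by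
      rintro _ ⟨x, rfl⟩; exact ⟨b (a x), rfl⟩
    have heq := Submodule.eq_of_le_of_finrank_le hle (hmin _ ⟨haba, hne⟩)
    refine not_nilp_of_map_eq (a * b) (hnil _ hab) (LinearMap.range a) hra ?_
    rw [← LinearMap.range_comp]
    exact heq.symm.le
  have haa : a * a = 0 := by
    have := key 1 (by simpa using haS) (by simpa using hmul a haS a haS)
    simpa using this
  have hasa : ∀ s ∈ S, a * s * a = 0 := fun s hs => key s (hmul a haS s hs)
    (hmul _ (hmul a haS s hs) a haS)
  let U : Submodule K V :=
    { carrier := {x | a x = 0 ∧ ∀ s ∈ S, a (s x) = 0}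
      add_mem' := fun {x y} hx hy => ⟨by rw [map_add, hx.1, hy.1, add_zero], fun s hs => by
        rw [map_add, map_add, hx.2 s hs, hy.2 s hs, add_zero]⟩
      zero_mem' := ⟨by simp, by simp⟩
      smul_mem' := fun c x hx => ⟨by rw [map_smul, hx.1, smul_zero], fun s hs => by
        rw [map_smul, map_smul, hx.2 s hs, smul_zero]⟩ }
  have hUinv : ∀ s ∈ S, ∀ x ∈ U, s x ∈ U := fun s hs x hx =>
    ⟨hx.2 s hs, fun t ht => hx.2 (t * s) (hmul t ht s hs)⟩
  have hUra : LinearMap.range a ≤ U := by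
    rintro _ ⟨x, rfl⟩
    exact ⟨LinearMap.congr_fun haa x, fun s hs => LinearMap.congr_fun (hasa s hs) x⟩
  have hUtop : U ≠ ⊤ := by
    intro h
    apply ha0
    ext x
    have : x ∈ U := by rw [h]; trivial
    exact this.1
  have hUbot : U ≠ ⊥ := fun h => hra (le_bot_iff.1 (h ▸ hUra))
  have hlt : Module.finrank K U < n := by rw [← hV]; exact Submodule.finrank_lt hUtop
  have hpos : 0 < Module.finrank K U :=
    Module.finrank_pos_iff.2 ((Submodule.nontrivial_iff_ne_bot).2 hUbot)
  let S' : Set (Module.End K U) := {b | ∃ s ∈ S, ∀ x : U, (b x : V) = s x}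
  obtain ⟨x, hx, hxs⟩ := ih _ hlt S' (by
      rintro b ⟨s, hs, h⟩ b' ⟨s', hs', h'⟩
      exact ⟨s * s', hmul s hs s' hs', fun x => by simp [h, h']⟩) (by
      rintro b ⟨s, hs, h⟩
      obtain ⟨m, hm⟩ := hnil s hs
      refine ⟨m, ?_⟩
      have : ∀ m : ℕ, ∀ x : U, ((b ^ m) x : V) = (s ^ m) x := by
        intro m
        induction m with
        | zero => intro x; simp
        | succ m ih => intro x; rw [pow_succ', pow_succ']; simp [h, ih]
      ext x
      rw [this, hm]
      simp) rfl hpos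
  refine ⟨x, by simpa using hx, fun s hs => ?_⟩
  have := hxs (s.restrict (hUinv s hs)) ⟨s, hs, fun x => rfl⟩
  exact congrArg Subtype.val this

lemma levitzki (n : ℕ) : ∀ {K V : Type*} [Field K] [AddCommGroup V] [Module K V] [FiniteDimensional K V]
    (S : Set (Module.End K V)) (hmul : ∀ a ∈ S, ∀ b ∈ S, a * b ∈ S) (hnil : ∀ a ∈ S, IsNilpotent a)
    (hV : Module.finrank K V ≤ n) (L : List (Module.End K V)), L.length = n → (∀ a ∈ L, a ∈ S) →
    L.prod = 0 := by
  induction n with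
  | zero =>
    intro K V _ _ _ _ S hmul hnil hV L hL hLS
    have : Subsingleton V := (Module.finrank_zero_iff (R := K)).1 (by omega)
    ext x
    exact Subsingleton.elim _ _
  | succ n ih =>
    intro K V _ _ _ _ S hmul hnil hV L hL hLS
    by_cases h0 : Module.finrank K V = 0
    · have : Subsingleton V := (Module.finrank_zero_iff (R := K)).1 (by omega)
      ext x
      exact Subsingleton.elim _ _
    obtain ⟨x0, hx0, hker⟩ := levitzki_kernel _ S hmul hnil rfl (Nat.pos_of_ne_zero h0)
    let W : Submodule K V :=
      { carrier := {x | ∀ s ∈ S, s x = 0}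
        add_mem' := fun {x y} hx hy s hs => by rw [map_add, hx s hs, hy s hs, add_zero]
        zero_mem' := by simp
        smul_mem' := fun c x hx s hs => by rw [map_smul, hx s hs, smul_zero] }
    have hWinv : ∀ s ∈ S, W ≤ W.comap s := by
      intro s hs x hx
      have : s x = 0 := hx s hs
      rw [Submodule.mem_comap, this]
      exact W.zero_mem
    have hWpos : 0 < Module.finrank K W := by
      apply Module.finrank_pos_iff.2
      refine (Submodule.nontrivial_iff_ne_bot).2 fun h => hx0 ?_
      have : x0 ∈ W := hker
      rw [h] at this
      simpa using this
    have hq := W.finrank_quotient_add_finrank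
    match L, hL with
    | a :: L, hL =>
      let S' : Set (Module.End K (V ⧸ W)) := {b | ∃ s ∈ S, ∀ x : V, b (W.mkQ x) = W.mkQ (s x)}
      have hmulT : ∀ L : List (Module.End K V), (∀ a ∈ L, a ∈ S) → ∃ L' : List (Module.End K (V ⧸ W)),
          L'.length = L.length ∧ (∀ b ∈ L', b ∈ S') ∧ ∀ x, L'.prod (W.mkQ x) = W.mkQ (L.prod x) := by
        intro L
        induction L with
        | nil => intro _; exact ⟨[], rfl, by simp, by simp⟩
        | cons s L ihL =>
          intro h
          obtain ⟨L', h1, h2, h3⟩ := ihL (fun a ha => h a (by simp [ha]))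
          have hs := h s (by simp)
          refine ⟨W.mapQ W s (hWinv s hs) :: L', by simp [h1], ?_, ?_⟩
          · intro b hb
            rcases List.mem_cons.1 hb with rfl | hb
            · exact ⟨s, hs, fun x => rfl⟩
            · exact h2 b hb
          · intro x
            rw [List.prod_cons, List.prod_cons, Module.End.mul_apply, h3]
            rfl
      obtain ⟨L', h1, h2, h3⟩ := hmulT L (fun b hb => hLS b (by simp [hb]))
      have h4 := ih S' (by
          rintro b ⟨s, hs, h⟩ b' ⟨s', hs', h'⟩
          exact ⟨s * s', hmul s hs s' hs', fun x => by rw [Module.End.mul_apply, h', h]; rfl⟩) (by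
          rintro b ⟨s, hs, h⟩
          obtain ⟨m, hm⟩ := hnil s hs
          refine ⟨m, ?_⟩
          have : ∀ m : ℕ, ∀ x : V, (b ^ m) (W.mkQ x) = W.mkQ ((s ^ m) x) := by
            intro m
            induction m with
            | zero => intro x; simp
            | succ m ih => intro x; rw [pow_succ', pow_succ', Module.End.mul_apply, ih, h]; rfl
          apply LinearMap.ext
          intro y
          obtain ⟨x, rfl⟩ := W.mkQ_surjective y
          rw [this, hm]
          simp) (by omega) L' (by simpa [h1] using hL) h2
      ext x
      have h5 := h3 x
      rw [h4, LinearMap.zero_apply] at h5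
      have h6 : L.prod x ∈ W := (Submodule.Quotient.mk_eq_zero W).1 h5.symm
      rw [List.prod_cons, Module.End.mul_apply]
      exact h6 a (hLS a (by simp))

/-- matrix version -/
lemma levitzki_matrix {K : Type*} [Field K] {d : ℕ} (S : Set (Matrix (Fin d) (Fin d) K))
    (hmul : ∀ a ∈ S, ∀ b ∈ S, a * b ∈ S) (hnil : ∀ a ∈ S, IsNilpotent a)
    (L : List (Matrix (Fin d) (Fin d) K)) (hL : L.length = d) (hLS : ∀ a ∈ L, a ∈ S) : L.prod = 0 := by
  let e := Matrix.toLinAlgEquiv' (R := K) (n := Fin d)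
  have := levitzki d (K := K) (V := Fin d → K) (e '' S) (by
    rintro _ ⟨a, ha, rfl⟩ _ ⟨b, hb, rfl⟩
    exact ⟨a * b, hmul a ha b hb, map_mul e a b⟩) (by
    rintro _ ⟨a, ha, rfl⟩
    exact (hnil a ha).map e) (by simp) (L.map e) (by simpa using hL) (by
    intro b hb
    obtain ⟨a, ha, rfl⟩ := List.mem_map.1 hb
    exact ⟨a, hLS a ha, rfl⟩)
  rw [← map_list_prod] at this
  exact (map_eq_zero_iff e e.injective).1 this

end UEG

namespace UEG
set_option linter.unusedVariables false
set_option linter.style.haveILetI false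
open Polynomial Matrix
open scoped Pointwise

lemma ev_ge (j : ℕ) : ∀ᶠ k in (UU : Filter ℕ), j ≤ k :=
  Nat.hyperfilter_le_atTop (Filter.eventually_ge_atTop j)

lemma ev_pow_two (x : ℝ) : ∃ n : ℕ, x ≤ 2 ^ n := by
  obtain ⟨n, hn⟩ := pow_unbounded_of_one_lt x (by norm_num : (1:ℝ) < 2)
  exact ⟨n, hn.le⟩

namespace Scale
variable (S : Scale)

lemma eig_nilp {n : Type*} [Fintype n] [DecidableEq n] (A : Matrix n n S.B)
    (h : ∀ m : ℕ, ∀ᶠ k in (UU : Filter ℕ), ∀ l, (A.map (S.ev k)).charpoly.IsRoot l → S.v k l * S.r k ^ m ≤ 1) :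
    IsNilpotent (A.map S.pr) := by
  obtain ⟨l, hl⟩ := S.exists_eig A
  have h0 : ∀ i, S.pr (l i) = 0 := by
    intro i
    rw [S.pr_eq_zero]
    intro m
    filter_upwards [h m] with k hk
    apply hk
    have : (A.map (S.ev k)).charpoly = A.charpoly.map (S.ev k) := Matrix.charpoly_map A (S.ev k)
    rw [this, hl, Polynomial.map_prod, IsRoot.def, eval_prod]
    exact Finset.prod_eq_zero (Finset.mem_univ i) (by simp)
  have h1 : (A.map S.pr).charpoly = X ^ Fintype.card n := by
    have : (A.map S.pr).charpoly = A.charpoly.map S.pr := Matrix.charpoly_map A S.pr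
    rw [this, hl, Polynomial.map_prod]
    simp [h0]
  refine ⟨Fintype.card n, ?_⟩
  have := Matrix.aeval_self_charpoly (A.map S.pr)
  rw [h1] at this
  simpa using this

end Scale

lemma bochi_L1 (d : ℕ) (C δ : ℝ) (hδ : 0 < δ) : ∃ N : ℕ, ∃ c : ℝ, 0 < c ∧ ∀ (v : AbsoluteValue ℂ ℝ)
    (F : Set (Matrix (Fin d) (Fin d) ℂ)), (∀ f ∈ F, nv v f ≤ C) →
    (∀ j, 1 ≤ j → j ≤ N → ∀ u ∈ F ^ j, ∀ l, u.charpoly.IsRoot l → v l < c) →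
    ∀ L : Fin d → Matrix (Fin d) (Fin d) ℂ, (∀ i, L i ∈ F) → nv v (List.ofFn L).prod ≤ δ := by
  by_contra! hcon
  have hk : ∀ k : ℕ, ∃ (v : AbsoluteValue ℂ ℝ)
    (F : Set (Matrix (Fin d) (Fin d) ℂ)), (∀ f ∈ F, nv v f ≤ C) ∧
    (∀ j, 1 ≤ j → j ≤ k → ∀ u ∈ F ^ j, ∀ l, u.charpoly.IsRoot l → v l < (1/2 : ℝ) ^ k) ∧
    ∃ L : Fin d → Matrix (Fin d) (Fin d) ℂ, (∀ i, L i ∈ F) ∧ δ < nv v (List.ofFn L).prod :=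
    fun k => hcon k _ (by positivity)
  choose v F hF he L hL hLδ using hk
  let S : Scale := ⟨v, fun _ => 2, fun _ => le_rfl⟩
  obtain ⟨n, hn⟩ := ev_pow_two C
  have hmem : ∀ i a b, (fun k => L k i a b) ∈ S.B := by
    intro i a b
    refine ⟨n, Filter.Eventually.of_forall fun k => ?_⟩
    exact ((le_nv _ _ _ _).trans (hF k _ (hL k i))).trans hn
  let A : Fin d → Matrix (Fin d) (Fin d) S.B := fun i => S.mkM (fun k => L k i) (hmem i)
  let T : Set (Matrix (Fin d) (Fin d) S.B) := {X | ∃ j, 1 ≤ j ∧ ∀ k, X.map (S.ev k) ∈ F k ^ j}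
  have hmapev : ∀ k (X Y : Matrix (Fin d) (Fin d) S.B), (X * Y).map (S.ev k) = X.map (S.ev k) * Y.map (S.ev k) :=
    fun k X Y => Matrix.map_mul
  have hz := levitzki_matrix (K := S.Fl) (d := d) ((fun X => X.map S.pr) '' T) (by
      rintro _ ⟨X, ⟨j, hj, hX⟩, rfl⟩ _ ⟨Y, ⟨j', hj', hY⟩, rfl⟩
      refine ⟨X * Y, ⟨j + j', by omega, fun k => ?_⟩, Matrix.map_mul⟩
      rw [hmapev, pow_add]
      exact Set.mul_mem_mul (hX k) (hY k)) (by
      rintro _ ⟨X, ⟨j, hj, hX⟩, rfl⟩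
      apply S.eig_nilp
      intro m
      filter_upwards [ev_ge j, ev_ge m] with k hk hm l hl
      have := he k j hj hk _ (hX k) l hl
      calc S.v k l * S.r k ^ m ≤ (1/2:ℝ)^k * 2 ^ k := by
            apply mul_le_mul this.le (pow_le_pow_right₀ (by norm_num) hm) (by positivity) (by positivity)
        _ = 1 := by rw [← mul_pow]; norm_num) (List.ofFn fun i => (A i).map S.pr) (by simp) (by
      intro a ha
      rw [List.mem_ofFn] at ha
      obtain ⟨i, rfl⟩ := ha
      refine ⟨A i, ⟨1, le_rfl, fun k => ?_⟩, rfl⟩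
      rw [pow_one]
      exact hL k i)
  have hpr : (List.ofFn fun i => (A i).map S.pr).prod = ((List.ofFn A).prod).map S.pr := by
    have := map_list_prod (S.pr.mapMatrix (m := Fin d)) (List.ofFn A)
    rw [List.map_ofFn] at this
    exact this.symm
  have hev : ∀ k, ((List.ofFn A).prod).map (S.ev k) = (List.ofFn (L k)).prod := by
    intro k
    have := map_list_prod ((S.ev k).mapMatrix (m := Fin d)) (List.ofFn A)
    rw [List.map_ofFn] at this
    exact this
  rw [hpr] at hz
  obtain ⟨m, hm⟩ := ev_pow_two (d * d * (1/δ))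
  have hsmall : ∀ᶠ k in (UU : Filter ℕ), ∀ i j, v k ((List.ofFn (L k)).prod i j) * 2 ^ m ≤ 1 := by
    rw [Filter.eventually_all]; intro i
    rw [Filter.eventually_all]; intro j
    have h1 : S.pr ((List.ofFn A).prod i j) = 0 := congrFun (congrFun hz i) j
    have := (S.pr_eq_zero _).1 h1 m
    filter_upwards [this] with k hk
    rw [← hev k]; exact hk
  obtain ⟨k, hk⟩ := hsmall.exists
  have h2 := nv_le (v k) (List.ofFn (L k)).prod (1 / 2 ^ m) (fun i j => by
    rw [le_div_iff₀ (by positivity)]; exact hk i j)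
  have h3 := hLδ k
  rw [Fintype.card_fin] at h2
  have h4 : (d:ℝ) * d * (1 / 2 ^ m) ≤ δ := by
    rw [mul_one_div, div_le_iff₀ (by positivity)]
    rw [mul_one_div, div_le_iff₀ hδ] at hm
    linarith
  linarith

/-- vector norm -/
noncomputable def vn {n : Type*} [Fintype n] (v : AbsoluteValue ℂ ℝ) (x : n → ℂ) : ℝ := ∑ i, v (x i)

section vn
variable {n : Type*} [Fintype n] (v : AbsoluteValue ℂ ℝ)
lemma vn_nonneg (x : n → ℂ) : 0 ≤ vn v x := Finset.sum_nonneg fun _ _ => v.nonneg _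
lemma le_vn (x : n → ℂ) (i : n) : v (x i) ≤ vn v x :=
  Finset.single_le_sum (f := fun i => v (x i)) (fun _ _ => v.nonneg _) (Finset.mem_univ i)
lemma vn_add (x y : n → ℂ) : vn v (x + y) ≤ vn v x + vn v y := by
  simp only [vn, ← Finset.sum_add_distrib]
  exact Finset.sum_le_sum fun i _ => v.add_le _ _
lemma vn_smul (c : ℂ) (x : n → ℂ) : vn v (c • x) = v c * vn v x := by
  simp [vn, Finset.mul_sum]
lemma vn_mulVec (A : Matrix n n ℂ) (x : n → ℂ) : vn v (A *ᵥ x) ≤ nv v A * vn v x := by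
  have h := nv_mul v A (Matrix.replicateCol Unit x)
  have e1 : A * Matrix.replicateCol Unit x = Matrix.replicateCol Unit (A *ᵥ x) := (Matrix.replicateCol_mulVec A x).symm
  rw [e1] at h
  simpa [nv, vn] using h
end vn

lemma exists_unit_scalar (v : AbsoluteValue ℂ ℝ) (t : ℂ) (ht : 1 < v t) (x : ℝ) (hx : 0 < x) :
    ∃ c : ℂ, c ≠ 0 ∧ 1 ≤ v c * x ∧ v c * x ≤ 2 := by
  obtain ⟨n, hn⟩ := ev_pow_two (v t)
  have hn0 : n ≠ 0 := by rintro rfl; norm_num at hn; linarith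
  obtain ⟨s, hs⟩ := IsAlgClosed.exists_pow_nat_eq t (Nat.pos_of_ne_zero hn0)
  have hvs : v s ^ n = v t := by rw [← map_pow, hs]
  have h1 : 1 < v s := by
    by_contra! h
    have := pow_le_one₀ (n := n) (v.nonneg s) h
    linarith
  have h2 : v s ≤ 2 := by
    by_contra! h
    have := pow_lt_pow_left₀ h (by norm_num) hn0
    linarith
  obtain ⟨z, hz⟩ := exists_mem_Ioc_zpow hx h1
  have hs0 : s ≠ 0 := by rintro rfl; simp at h1; linarith
  refine ⟨s ^ (-z), zpow_ne_zero _ hs0, ?_, ?_⟩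
  · rw [map_zpow₀, _root_.zpow_neg]
    have := hz.1
    rw [inv_mul_eq_div, le_div_iff₀ (by positivity)]
    linarith
  · rw [map_zpow₀, _root_.zpow_neg]
    have := hz.2
    rw [inv_mul_eq_div, div_le_iff₀ (by positivity)]
    rw [zpow_add_one₀ (by linarith)] at this
    have h3 : 0 < v s ^ z := by positivity
    nlinarith

lemma det_le_vn {d : ℕ} (v : AbsoluteValue ℂ ℝ) (b : Matrix (Fin d) (Fin d) ℂ) :
    v b.det ≤ (d.factorial : ℝ) * ∏ i, vn v (b i) := by
  rw [Matrix.det_apply]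
  refine (v.sum_le _ _).trans ?_
  calc ∑ σ : Equiv.Perm (Fin d), v (Equiv.Perm.sign σ • ∏ i, b (σ i) i)
      ≤ ∑ σ : Equiv.Perm (Fin d), ∏ i, vn v (b i) := by
        refine Finset.sum_le_sum fun σ _ => ?_
        have : v (Equiv.Perm.sign σ • ∏ i, b (σ i) i) = ∏ i, v (b (σ i) i) := by
          rw [← map_prod]
          rcases Int.units_eq_one_or (Equiv.Perm.sign σ) with h | h <;> rw [h] <;> simp
        rw [this, ← Equiv.prod_comp σ (fun i => vn v (b i))]
        exact Finset.prod_le_prod (fun i _ => v.nonneg _) fun i _ => le_vn v (b (σ i)) i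
    _ = _ := by simp [Fintype.card_perm]

/-- near-Auerbach basis -/
lemma auerbach {d : ℕ} (v : AbsoluteValue ℂ ℝ) (t : ℂ) (ht : 1 < v t) (N : (Fin d → ℂ) → ℝ)
    (hN1 : ∀ x, vn v x ≤ N x) (hN2 : ∀ (c : ℂ) x, N (c • x) = v c * N x) :
    ∃ P : GL (Fin d) ℂ, ∀ f : Matrix (Fin d) (Fin d) ℂ, ∀ ρ : ℝ, (∀ x, N (f *ᵥ x) ≤ ρ * N x) →
      nv v (P⁻¹.1 * f * P.1) ≤ 4 * d * d * ρ := by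
  let D : Matrix (Fin d) (Fin d) ℂ → ℝ := fun b => v b.det / ∏ i, N (b i)
  have hNnn : ∀ x, 0 ≤ N x := fun x => (vn_nonneg v x).trans (hN1 x)
  have hNpos : ∀ x, x ≠ 0 → 0 < N x := by
    intro x hx
    refine lt_of_lt_of_le ?_ (hN1 x)
    obtain ⟨i, hi⟩ := Function.ne_iff.1 hx
    exact lt_of_lt_of_le (v.pos hi) (le_vn v x i)
  have hrow : ∀ b : Matrix (Fin d) (Fin d) ℂ, b.det ≠ 0 → ∀ i, b i ≠ 0 := by
    intro b hb i h0
    exact hb (Matrix.det_eq_zero_of_row_eq_zero i fun j => by rw [h0]; rfl)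
  let T : Set ℝ := {x | ∃ b : Matrix (Fin d) (Fin d) ℂ, b.det ≠ 0 ∧ x = D b}
  have hbdd : BddAbove T := by
    refine ⟨(d.factorial : ℝ), ?_⟩
    rintro _ ⟨b, hb, rfl⟩
    have hp : 0 < ∏ i, N (b i) := Finset.prod_pos fun i _ => hNpos _ (hrow b hb i)
    rw [div_le_iff₀ hp]
    refine (det_le_vn v b).trans ?_
    exact mul_le_mul_of_nonneg_left (Finset.prod_le_prod (fun i _ => vn_nonneg v _) fun i _ => hN1 _) (by positivity)
  have hDpos : ∀ b : Matrix (Fin d) (Fin d) ℂ, b.det ≠ 0 → 0 < D b := fun b hb =>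
    div_pos (v.pos hb) (Finset.prod_pos fun i _ => hNpos _ (hrow b hb i))
  have hT1 : D 1 ∈ T := ⟨1, by simp, rfl⟩
  have hsup : 0 < sSup T := lt_of_lt_of_le (hDpos 1 (by simp)) (le_csSup hbdd hT1)
  obtain ⟨_, ⟨b, hb, rfl⟩, hb2⟩ := exists_lt_of_lt_csSup ⟨_, hT1⟩ (show sSup T / 2 < sSup T by linarith)
  have hmax : ∀ b' : Matrix (Fin d) (Fin d) ℂ, b'.det ≠ 0 → D b' ≤ 2 * D b := fun b' hb' => by
    have := le_csSup hbdd ⟨b', hb', rfl⟩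
    linarith
  choose c hc0 hc1 hc2 using fun i => exists_unit_scalar v t ht (N (b i)) (hNpos _ (hrow b hb i))
  let b1 : Matrix (Fin d) (Fin d) ℂ := Matrix.of fun i => c i • b i
  have hb1det : b1.det = (∏ i, c i) * b.det := by
    have : b1 = Matrix.of fun i j => c i * b i j := rfl
    rw [this, Matrix.det_mul_column]
  have hb1 : b1.det ≠ 0 := by
    rw [hb1det]
    exact mul_ne_zero (Finset.prod_ne_zero_iff.2 fun i _ => hc0 i) hb
  have hDb1 : D b1 = D b := by
    have : ∀ i, N (b1 i) = v (c i) * N (b i) := fun i => hN2 _ _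
    simp only [D, hb1det, this, Finset.prod_mul_distrib, map_mul, map_prod]
    rw [mul_div_mul_left]
    exact Finset.prod_ne_zero_iff.2 fun i _ => v.ne_zero (hc0 i)
  have hN1b : ∀ i, 1 ≤ N (b1 i) := fun i => by rw [show N (b1 i) = v (c i) * N (b i) from hN2 _ _]; exact hc1 i
  have hN2b : ∀ i, N (b1 i) ≤ 2 := fun i => by rw [show N (b1 i) = v (c i) * N (b i) from hN2 _ _]; exact hc2 i
  -- replacement
  have hrep : ∀ i x, v (b1.updateRow i x).det ≤ 2 * v b1.det * N x := by
    intro i x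
    by_cases h0 : (b1.updateRow i x).det = 0
    · rw [h0, map_zero]
      have := hNnn x
      have := v.nonneg b1.det
      positivity
    have h1 := hmax _ h0
    rw [← hDb1] at h1
    simp only [D] at h1
    have hp : 0 < ∏ j, N (b1.updateRow i x j) := Finset.prod_pos fun i _ => hNpos _ (hrow _ h0 i)
    have hp1 : 0 < ∏ j, N (b1 j) := Finset.prod_pos fun i _ => hNpos _ (hrow _ hb1 i)
    have e1 : ∏ j, N (b1.updateRow i x j) = N x * ∏ j ∈ Finset.univ.erase i, N (b1 j) := by
      rw [← Finset.mul_prod_erase Finset.univ _ (Finset.mem_univ i)]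
      congr 1
      · rw [Matrix.updateRow_self]
      · refine Finset.prod_congr rfl fun j hj => ?_
        rw [Matrix.updateRow_ne (Finset.ne_of_mem_erase hj)]
    have e2 : ∏ j, N (b1 j) = N (b1 i) * ∏ j ∈ Finset.univ.erase i, N (b1 j) :=
      (Finset.mul_prod_erase Finset.univ _ (Finset.mem_univ i)).symm
    have hp3 : 0 < ∏ j ∈ Finset.univ.erase i, N (b1 j) := Finset.prod_pos fun i _ => hNpos _ (hrow _ hb1 i)
    rw [div_le_iff₀ hp, e1] at h1
    refine h1.trans ?_
    rw [e2, ← mul_div_assoc, div_mul_eq_mul_div, div_le_iff₀ (by rw [← e2]; exact hp1)]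
    have h5 : 0 ≤ 2 * v b1.det * N x * ∏ j ∈ Finset.univ.erase i, N (b1 j) := by
      have := hNnn x
      have := v.nonneg b1.det
      positivity
    have h6 := hN1b i
    nlinarith
  have hu : IsUnit b1ᵀ.det := by rw [Matrix.det_transpose]; exact isUnit_iff_ne_zero.2 hb1
  let P : GL (Fin d) ℂ := Matrix.GeneralLinearGroup.mk'' b1ᵀ hu
  refine ⟨P, fun f ρ hf => ?_⟩
  have hP : P.1 = b1ᵀ := rfl
  have hPi : P⁻¹.1 = b1ᵀ⁻¹ := by
    rw [Matrix.coe_units_inv, hP]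
  rw [hPi, hP]
  have hent : ∀ i j, v ((b1ᵀ⁻¹ * f * b1ᵀ) i j) ≤ 4 * ρ := by
    intro i j
    have e : (b1ᵀ⁻¹ * f * b1ᵀ) i j = b1.det⁻¹ * (b1.updateRow i (f *ᵥ b1 j)).det := by
      rw [Matrix.mul_assoc, Matrix.inv_def, Matrix.smul_mul, Matrix.smul_apply, Matrix.det_transpose,
        Ring.inverse_eq_inv', smul_eq_mul]
      congr 1
      have h7 : (b1ᵀ.adjugate * (f * b1ᵀ)) i j = (b1ᵀ.adjugate *ᵥ (f *ᵥ b1 j)) i := by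
        rw [Matrix.mulVec_mulVec, ← Matrix.mul_assoc, Matrix.mul_apply]
        rfl
      rw [h7, ← Matrix.cramer_eq_adjugate_mulVec, Matrix.cramer_apply, ← Matrix.det_transpose,
        Matrix.updateCol_transpose, Matrix.transpose_transpose]
    rw [e, map_mul, map_inv₀]
    have h8 := hrep i (f *ᵥ b1 j)
    have h9 := hf (b1 j)
    have hv := v.pos hb1
    rw [inv_mul_le_iff₀ hv]
    have h10 : 0 ≤ ρ := by
      have h11 := hNnn (f *ᵥ b1 j)
      have h12 := hN1b j
      by_contra! hneg
      nlinarith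
    have h13 : N (f *ᵥ b1 j) ≤ 2 * ρ := by
      have := hN2b j
      nlinarith
    nlinarith
  have := nv_le v _ _ hent
  rw [Fintype.card_fin] at this
  linarith

lemma bochi_L2 {d : ℕ} (hd : 1 ≤ d) (v : AbsoluteValue ℂ ℝ) (t : ℂ) (ht : 1 < v t) (C ρ : ℝ) (hρ : 0 < ρ)
    (hρ1 : ρ ≤ 1) (hC : 1 ≤ C)
    (F : Set (Matrix (Fin d) (Fin d) ℂ)) (hF : ∀ f ∈ F, nv v f ≤ C)
    (h : ∀ L : Fin d → Matrix (Fin d) (Fin d) ℂ, (∀ i, L i ∈ F) → nv v (List.ofFn L).prod ≤ ρ ^ d) :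
    ∃ P : GL (Fin d) ℂ, ∀ f ∈ F, nv v (P⁻¹.1 * f * P.1) ≤ 4 * d * d * ρ := by
  let ι := {L : List (Matrix (Fin d) (Fin d) ℂ) // L.length < d ∧ ∀ a ∈ L, a ∈ F}
  let N : (Fin d → ℂ) → ℝ := fun x => ⨆ L : ι, vn v (L.1.prod *ᵥ x) / ρ ^ L.1.length
  have i0 : ι := ⟨[], by simpa using Nat.pos_of_ne_zero (by omega), by simp⟩
  haveI : Nonempty ι := ⟨i0⟩
  have hprod : ∀ L : List (Matrix (Fin d) (Fin d) ℂ), (∀ a ∈ L, a ∈ F) → nv v L.prod ≤ d * C ^ L.length := by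
    intro L
    induction L with
    | nil => intro _; simp [nv_one_le]
    | cons a L ih =>
      intro hL
      rw [List.prod_cons, List.length_cons]
      have h1 := ih fun b hb => hL b (by simp [hb])
      have h2 := hF a (hL a (by simp))
      have := nv_mul v a L.prod
      have h3 := nv_nonneg v a
      have h4 := nv_nonneg v L.prod
      calc nv v (a * L.prod) ≤ nv v a * nv v L.prod := this
        _ ≤ C * (d * C ^ L.length) := by gcongr
        _ = _ := by ring
  have hbdd : ∀ x, BddAbove (Set.range fun L : ι => vn v (L.1.prod *ᵥ x) / ρ ^ L.1.length) := by
    intro x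
    refine ⟨d * C ^ d * vn v x / ρ ^ d, ?_⟩
    rintro _ ⟨L, rfl⟩
    have h1 := hprod L.1 L.2.2
    have h2 := vn_mulVec v L.1.prod x
    have h3 : C ^ L.1.length ≤ C ^ d := pow_le_pow_right₀ hC L.2.1.le
    have h4 : ρ ^ d ≤ ρ ^ L.1.length := pow_le_pow_of_le_one hρ.le hρ1 L.2.1.le
    have h5 := vn_nonneg v x
    have h6 : vn v (L.1.prod *ᵥ x) ≤ d * C ^ d * vn v x := by
      refine h2.trans ?_
      gcongr
      refine h1.trans ?_
      gcongr
    have h7 := vn_nonneg v (L.1.prod *ᵥ x)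
    exact div_le_div₀ (h7.trans h6) h6 (by positivity) h4
  have hle : ∀ x (L : ι), vn v (L.1.prod *ᵥ x) / ρ ^ L.1.length ≤ N x := fun x L => le_ciSup (hbdd x) L
  have hN1 : ∀ x, vn v x ≤ N x := by
    intro x
    have := hle x ⟨[], by simpa using Nat.pos_of_ne_zero (by omega), by simp⟩
    simpa using this
  obtain ⟨P, hP⟩ := auerbach v t ht N hN1 (by
    intro c x
    have : ∀ L : ι, vn v (L.1.prod *ᵥ (c • x)) / ρ ^ L.1.length = v c * (vn v (L.1.prod *ᵥ x) / ρ ^ L.1.length) := by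
      intro L
      rw [Matrix.mulVec_smul, vn_smul, mul_div_assoc]
    simp only [N, this]
    rw [← Real.mul_iSup_of_nonneg (v.nonneg c)])
  refine ⟨P, fun f hf => hP f ρ fun x => ?_⟩
  refine ciSup_le fun L => ?_
  have hLlen := L.2.1
  have e1 : L.1.prod *ᵥ (f *ᵥ x) = (L.1 ++ [f]).prod *ᵥ x := by simp [Matrix.mulVec_mulVec]
  have hmem : ∀ a ∈ L.1 ++ [f], a ∈ F := by
    intro a ha
    rw [List.mem_append] at ha
    rcases ha with ha | ha
    · exact L.2.2 a ha
    · rw [List.mem_singleton] at ha; rw [ha]; exact hf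
  rw [e1, div_le_iff₀ (by positivity)]
  by_cases hlt : L.1.length + 1 < d
  · have := hle x ⟨L.1 ++ [f], by simpa using hlt, hmem⟩
    rw [div_le_iff₀ (by positivity)] at this
    simp only [List.length_append, List.length_singleton] at this
    rw [pow_succ] at this
    linarith
  · have hlen : (L.1 ++ [f]).length = d := by simp; omega
    have h1 : nv v (L.1 ++ [f]).prod ≤ ρ ^ d := by
      obtain ⟨L', hL'⟩ : ∃ L', L' = L.1 ++ [f] := ⟨_, rfl⟩
      rw [← hL'] at hlen hmem ⊢
      have := h (fun i => L'.get (Fin.cast hlen.symm i)) (fun i => hmem _ (List.get_mem _ _))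
      have e5 : List.ofFn (fun i => L'.get (Fin.cast hlen.symm i)) = L' := by
        apply List.ext_get <;> simp [hlen]
      rwa [e5] at this
    have h2 := vn_mulVec v (L.1 ++ [f]).prod x
    have h3 := hN1 x
    have h4 := vn_nonneg v x
    have hd' : ρ ^ d = ρ * ρ ^ L.1.length := by
      rw [← pow_succ']; congr 1; omega
    calc _ ≤ _ := h2
      _ ≤ ρ ^ d * N x := by gcongr
      _ = _ := by rw [hd']; ring

lemma root_of_eigvec {n K : Type*} [Fintype n] [DecidableEq n] [Field K] (A : Matrix n n K) (l : K) (x : n → K) (hx : x ≠ 0)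
    (h : A *ᵥ x = l • x) : A.charpoly.IsRoot l := by
  rw [IsRoot.def, Matrix.eval_charpoly]
  refine Matrix.exists_mulVec_eq_zero_iff.1 ⟨x, hx, ?_⟩
  rw [Matrix.sub_mulVec, h]
  simp [Matrix.scalar_apply, ← Matrix.smul_one_eq_diagonal, Matrix.smul_mulVec]

lemma gl_inv_mul {d : ℕ} (P : GL (Fin d) ℂ) : P⁻¹.1 * P.1 = 1 := by rw [← Units.val_mul]; simp
lemma gl_mul_inv {d : ℕ} (P : GL (Fin d) ℂ) : P.1 * P⁻¹.1 = 1 := by rw [← Units.val_mul]; simp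

lemma root_conj {d : ℕ} (P : GL (Fin d) ℂ) (c : ℂ) (hc : c ≠ 0) (u : Matrix (Fin d) (Fin d) ℂ) (l : ℂ)
    (h : (c • (P⁻¹.1 * u * P.1)).charpoly.IsRoot l) : u.charpoly.IsRoot (c⁻¹ * l) := by
  obtain ⟨x, hx, h⟩ := exists_eigvec _ _ h
  have hx2 : x = P⁻¹.1 *ᵥ (P.1 *ᵥ x) := by rw [Matrix.mulVec_mulVec, gl_inv_mul, Matrix.one_mulVec]
  refine root_of_eigvec u _ (P.1 *ᵥ x) (fun h0 => hx ?_) ?_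
  · rw [hx2, h0, Matrix.mulVec_zero]
  have h2 := congrArg (fun y => c⁻¹ • P.1 *ᵥ y) h
  simp only [Matrix.smul_mulVec, Matrix.mulVec_smul, smul_smul, inv_mul_cancel₀ hc, one_smul] at h2
  rw [← h2, Matrix.mulVec_mulVec, Matrix.mulVec_mulVec, ← Matrix.mul_assoc, ← Matrix.mul_assoc, gl_mul_inv, Matrix.one_mul]

lemma mem_conj_pow {d : ℕ} (F : Set (GL (Fin d) ℂ)) (P : GL (Fin d) ℂ) (c : ℂ) (j : ℕ) :
    ∀ x ∈ ((fun f : GL (Fin d) ℂ => c • (P⁻¹.1 * f.1 * P.1)) '' F) ^ j, ∃ u ∈ F ^ j, x = c ^ j • (P⁻¹.1 * u.1 * P.1) := by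
  induction j with
  | zero =>
    intro x hx
    refine ⟨1, by simp, ?_⟩
    rw [pow_zero, Set.mem_one] at hx
    rw [hx]; simp only [Units.val_one, Matrix.mul_one, gl_inv_mul, pow_zero, one_smul]
  | succ j ih =>
    intro x hx
    rw [pow_succ] at hx
    obtain ⟨y, hy, z, ⟨f, hf, rfl⟩, rfl⟩ := hx
    obtain ⟨u, hu, rfl⟩ := ih y hy
    refine ⟨u * f, by rw [pow_succ]; exact Set.mul_mem_mul hu hf, ?_⟩
    simp only [Matrix.smul_mul, Matrix.mul_smul, smul_smul, pow_succ, Units.val_mul]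
    rw [mul_comm c]
    congr 1
    calc P⁻¹.1 * u.1 * P.1 * (P⁻¹.1 * f.1 * P.1) = P⁻¹.1 * u.1 * (P.1 * P⁻¹.1) * f.1 * P.1 := by
          simp only [Matrix.mul_assoc]
      _ = _ := by rw [gl_mul_inv]; simp only [Matrix.mul_assoc, Matrix.one_mul]

lemma bochi (d : ℕ) (hd : 1 ≤ d) : ∃ N : ℕ, ∃ c : ℝ, 0 < c ∧ ∀ (v : AbsoluteValue ℂ ℝ)
    (F : Set (GL (Fin d) ℂ)), F.Finite → 1 ∈ F → ∃ P : GL (Fin d) ℂ, ∃ E : ℝ, 1 ≤ E ∧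
    (∀ f ∈ F, nv v (P⁻¹.1 * f.1 * P.1) ≤ E) ∧ ∃ j, 1 ≤ j ∧ j ≤ N ∧ ∃ u ∈ F ^ j, ∃ l, u.1.charpoly.IsRoot l ∧
      c * E ^ j ≤ v l := by
  have hd1 : (1:ℝ) ≤ d := by exact_mod_cast hd
  have hd2 : (1:ℝ) ≤ d * d := by nlinarith
  obtain ⟨ρ, hρdef⟩ : ∃ ρ : ℝ, ρ = 1 / (16 * (d * d)) := ⟨_, rfl⟩
  have hρ : 0 < ρ := by rw [hρdef]; positivity
  have hρ1 : ρ ≤ 1 := by rw [hρdef, div_le_one (by positivity)]; linarith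
  obtain ⟨N0, c0, hc0, hL1⟩ := bochi_L1 d (d * d) (ρ ^ d) (by positivity)
  refine ⟨N0 + 1, min (c0 / (d * d) ^ N0) (1 / (d * d)), by positivity, fun v F hF h1F => ?_⟩
  haveI : Nonempty (Fin d) := ⟨⟨0, by omega⟩⟩
  have hone : (1 : Matrix (Fin d) (Fin d) ℂ).charpoly.IsRoot 1 := by
    refine root_of_eigvec _ 1 1 one_ne_zero ?_
    simp
  by_cases htriv : ∃ t, 1 < v t
  swap
  · push Not at htriv
    refine ⟨1, d * d, hd2, fun f _ => ?_, 1, le_rfl, by omega, 1, by simpa using h1F, 1, by simpa using hone, ?_⟩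
    · have := nv_le v ((1 : GL (Fin d) ℂ)⁻¹.1 * f.1 * (1 : GL (Fin d) ℂ).1) 1 (fun i j => htriv _)
      simpa using this
    · rw [map_one, pow_one]
      calc _ ≤ (1 / (d * d : ℝ)) * (d * d) := by gcongr; exact min_le_right _ _
        _ = 1 := by field_simp
  obtain ⟨t, ht⟩ := htriv
  obtain ⟨M, hM⟩ : ∃ M : GL (Fin d) ℂ → ℝ, ∀ P, (∀ f ∈ F, nv v (P⁻¹.1 * f.1 * P.1) ≤ M P) ∧
      ∃ f ∈ F, nv v (P⁻¹.1 * f.1 * P.1) = M P := by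
    have : ∀ P : GL (Fin d) ℂ, ∃ f ∈ F, ∀ g ∈ F, nv v (P⁻¹.1 * g.1 * P.1) ≤ nv v (P⁻¹.1 * f.1 * P.1) := by
      intro P
      exact Set.exists_max_image F (fun f => nv v (P⁻¹.1 * f.1 * P.1)) hF ⟨1, h1F⟩
    choose f hf hg using this
    exact ⟨fun P => nv v (P⁻¹.1 * (f P).1 * P.1), fun P => ⟨hg P, f P, hf P, rfl⟩⟩
  have hM1 : ∀ P, 1 ≤ M P := by
    intro P
    have := (hM P).1 1 h1F
    rw [Units.val_one, Matrix.mul_one, gl_inv_mul, nv_one_le, Fintype.card_fin] at this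
    linarith
  have hbdd : BddBelow (Set.range M) := ⟨1, by rintro _ ⟨P, rfl⟩; exact hM1 P⟩
  have hinf : 1 ≤ sInf (Set.range M) := le_csInf (Set.range_nonempty M) (by rintro _ ⟨P, rfl⟩; exact hM1 P)
  obtain ⟨_, ⟨P, rfl⟩, hP⟩ := exists_lt_of_csInf_lt (Set.range_nonempty M) (show sInf (Set.range M) < 2 * sInf (Set.range M) by linarith)
  have hmin : ∀ Q, M P ≤ 2 * M Q := fun Q => by
    have := csInf_le hbdd ⟨Q, rfl⟩
    linarith
  obtain ⟨f0, hf0, hf0M⟩ := (hM P).2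
  refine ⟨P, M P, hM1 P, (hM P).1, ?_⟩
  have hMP := hM1 P
  -- the scalar
  obtain ⟨θ, hθ1, hθ2⟩ : ∃ θ : ℂ, M P ≤ d * d * v θ ∧ v θ ≤ M P := by
    obtain ⟨⟨i, j⟩, hij⟩ := Finite.exists_max (fun p : Fin d × Fin d => v ((P⁻¹.1 * f0.1 * P.1) p.1 p.2))
    have h1 := nv_le v (P⁻¹.1 * f0.1 * P.1) _ (fun a b => hij (a, b))
    rw [Fintype.card_fin] at h1
    simp only at h1
    refine ⟨(P⁻¹.1 * f0.1 * P.1) i j, by linarith, ?_⟩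
    rw [← hf0M]
    exact le_nv _ _ _ _
  have hθ : 0 < v θ := by
    by_contra! h
    nlinarith
  have hθ0 : θ ≠ 0 := fun h => by rw [h, map_zero] at hθ; exact lt_irrefl _ hθ
  have hθi : v θ⁻¹ = (v θ)⁻¹ := map_inv₀ v θ
  by_contra! hcon
  let G : Set (Matrix (Fin d) (Fin d) ℂ) := (fun f : GL (Fin d) ℂ => θ⁻¹ • (P⁻¹.1 * f.1 * P.1)) '' F
  have hG : ∀ g ∈ G, nv v g ≤ d * d := by
    rintro _ ⟨f, hf, rfl⟩
    dsimp only
    rw [nv_smul, hθi, inv_mul_le_iff₀ hθ]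
    have := (hM P).1 f hf
    linarith
  have hwords := hL1 v G hG (by
    intro j hj hjN x hx l hl
    obtain ⟨u, hu, rfl⟩ := mem_conj_pow F P _ j x hx
    have hroot := root_conj P _ (pow_ne_zero _ (inv_ne_zero hθ0)) u.1 l hl
    have h2 := hcon j hj (by omega) u hu _ hroot
    rw [map_mul, map_inv₀, map_pow, hθi, inv_pow, inv_inv] at h2
    by_contra! hl2
    have h3 : M P ^ j ≤ (d * d) ^ j * v θ ^ j := by rw [← mul_pow]; gcongr
    have h4 : ((d:ℝ) * d) ^ j ≤ (d * d) ^ N0 := pow_le_pow_right₀ hd2 hjN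
    have h5 : min (c0 / (d * d) ^ N0) (1 / (d * d) : ℝ) * M P ^ j ≤ c0 * v θ ^ j := by
      calc _ ≤ c0 / ((d:ℝ) * d) ^ N0 * ((d * d) ^ N0 * v θ ^ j) := by
            gcongr
            · exact min_le_left _ _
            · exact h3.trans (by gcongr)
        _ = _ := by field_simp
    have h6 : c0 * v θ ^ j ≤ v θ ^ j * v l := by
      rw [mul_comm]; gcongr
    linarith)
  obtain ⟨Q, hQ⟩ := bochi_L2 hd v t ht (d * d) ρ hρ hρ1 hd2 G hG hwords
  obtain ⟨f, hf, hfM⟩ := (hM (P * Q)).2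
  have h1 := hQ _ ⟨f, hf, rfl⟩
  have e : (P * Q)⁻¹.1 * f.1 * (P * Q).1 = θ • (Q⁻¹.1 * (θ⁻¹ • (P⁻¹.1 * f.1 * P.1)) * Q.1) := by
    simp only [_root_.mul_inv_rev, Units.val_mul, Matrix.smul_mul, Matrix.mul_smul, smul_smul, mul_inv_cancel₀ hθ0, one_smul, Matrix.mul_assoc]
  rw [e, nv_smul] at hfM
  have h2 := hmin (P * Q)
  have h3 : M (P * Q) ≤ v θ * (1 / 4) := by
    rw [← hfM]
    gcongr
    refine h1.trans (le_of_eq ?_)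
    rw [hρdef]; field_simp; norm_num
  linarith

end UEG

namespace UEG
set_option linter.unusedVariables false
set_option linter.style.haveILetI false
open Polynomial Matrix
open scoped Pointwise

/-- triangular power bound -/
lemma tri_pow {n : ℕ} (v : AbsoluteValue ℂ ℝ) (T : Matrix (Fin n) (Fin n) ℂ) (a q : ℝ) (ha : 0 ≤ a) (hq : 1 ≤ q)
    (hT : ∀ i j, j < i → T i j = 0) (hd : ∀ i, v (T i i) ≤ a) (ho : ∀ i j, v (T i j) ≤ a * q) (M : ℕ) :
    nv v (T ^ M) ≤ n * n * (n ^ M * a ^ M * q ^ n) := by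
  have key : ∀ M : ℕ, (∀ i j, j < i → (T ^ M) i j = 0) ∧
      ∀ i j, v ((T ^ M) i j) ≤ n ^ M * a ^ M * q ^ (j.1 - i.1) := by
    intro M
    induction M with
    | zero =>
      refine ⟨fun i j h => ?_, fun i j => ?_⟩
      · rw [pow_zero, Matrix.one_apply_ne h.ne']
      · rw [pow_zero, Matrix.one_apply]
        have : 1 ≤ q ^ (j.1 - i.1) := one_le_pow₀ hq
        split_ifs
        · simpa using this
        · simp; linarith
    | succ M ih =>
      refine ⟨fun i j h => ?_, fun i j => ?_⟩
      · rw [pow_succ, Matrix.mul_apply]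
        refine Finset.sum_eq_zero fun k _ => ?_
        by_cases hk : k < i
        · rw [ih.1 i k hk, zero_mul]
        · rw [hT k j (lt_of_lt_of_le h (not_lt.1 hk)), mul_zero]
      · rw [pow_succ, Matrix.mul_apply]
        refine (v.sum_le _ _).trans ?_
        have : ∀ k, v ((T ^ M) i k * T k j) ≤ n ^ M * a ^ (M + 1) * q ^ (j.1 - i.1) := by
          intro k
          have hnn : (0:ℝ) ≤ n ^ M * a ^ (M + 1) * q ^ (j.1 - i.1) := by positivity
          by_cases hk : k < i
          · rw [ih.1 i k hk, zero_mul, map_zero]; exact hnn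
          by_cases hk2 : j < k
          · rw [hT k j hk2, mul_zero, map_zero]; exact hnn
          push Not at hk hk2
          have h1 := ih.2 i k
          have h2 : v (T k j) ≤ a * q ^ (j.1 - k.1) := by
            rcases hk2.lt_or_eq with h | h
            · refine (ho k j).trans ?_
              gcongr
              have : j.1 - k.1 ≠ 0 := by have : k.1 < j.1 := h; omega
              calc q = q ^ 1 := (pow_one q).symm
                _ ≤ _ := pow_le_pow_right₀ hq (by omega)
            · rw [h]; simpa using hd j
          have e : j.1 - i.1 = (k.1 - i.1) + (j.1 - k.1) := by
            have : i.1 ≤ k.1 := hk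
            have : k.1 ≤ j.1 := hk2
            omega
          rw [map_mul, e, pow_add, pow_succ]
          calc _ ≤ (n ^ M * a ^ M * q ^ (k.1 - i.1)) * (a * q ^ (j.1 - k.1)) :=
                mul_le_mul h1 h2 (v.nonneg _) (by positivity)
            _ = _ := by ring
        refine (Finset.sum_le_sum fun k _ => this k).trans (le_of_eq ?_)
        simp
        ring
  have := nv_le v (T ^ M) (n ^ M * a ^ M * q ^ n) (fun i j => ((key M).2 i j).trans (by
    have hji : j.1 - i.1 ≤ n := by omega
    gcongr))
  rwa [Fintype.card_fin] at this

/-- bounded inverse -/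
lemma nv_inv_le {n : ℕ} (v : AbsoluteValue ℂ ℝ) (Q : GL (Fin n) ℂ) (hQ : ∀ i j, v (Q.1 i j) ≤ 1)
    (hdet : v Q.1.det = 1) : nv v Q⁻¹.1 ≤ n * n * (n.factorial * (n + 1) ^ n) := by
  have h0 : Q⁻¹.1 = Q.1⁻¹ := Matrix.coe_units_inv Q
  rw [h0]
  have := nv_le v Q.1⁻¹ (n.factorial * (n + 1) ^ n) (fun i j => by
    rw [Matrix.inv_def, Matrix.smul_apply, Ring.inverse_eq_inv', smul_eq_mul, map_mul, map_inv₀, hdet, inv_one, one_mul,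
      Matrix.adjugate_apply]
    refine (det_le_vn v _).trans ?_
    gcongr
    calc ∏ k, vn v (Q.1.updateRow j (Pi.single i 1) k) ≤ ∏ k : Fin n, ((n:ℝ) + 1) := by
          refine Finset.prod_le_prod (fun _ _ => vn_nonneg v _) fun k _ => ?_
          have : ∀ l, v (Q.1.updateRow j (Pi.single i 1) k l) ≤ 1 := by
            intro l
            rw [Matrix.updateRow_apply]
            split_ifs
            · rw [Pi.single_apply]; split_ifs <;> simp
            · exact hQ k l
          calc vn v _ ≤ ∑ l : Fin n, (1:ℝ) := Finset.sum_le_sum fun l _ => this l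
            _ ≤ _ := by simp
      _ = _ := by simp)
  rwa [Fintype.card_fin] at this

/-- extension by 1 -/
def extM {n : ℕ} (A : Matrix (Fin n) (Fin n) ℂ) : Matrix (Fin (n+1)) (Fin (n+1)) ℂ :=
  Matrix.of (Fin.cons (Fin.cons 1 0) fun i => Fin.cons 0 (A i))

@[simp] lemma extM_00 {n : ℕ} (A : Matrix (Fin n) (Fin n) ℂ) : extM A 0 0 = 1 := rfl
@[simp] lemma extM_0s {n : ℕ} (A : Matrix (Fin n) (Fin n) ℂ) (j : Fin n) : extM A 0 j.succ = 0 := rfl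
@[simp] lemma extM_s0 {n : ℕ} (A : Matrix (Fin n) (Fin n) ℂ) (j : Fin n) : extM A j.succ 0 = 0 := rfl
@[simp] lemma extM_ss {n : ℕ} (A : Matrix (Fin n) (Fin n) ℂ) (i j : Fin n) : extM A i.succ j.succ = A i j := rfl

lemma extM_mul {n : ℕ} (A B : Matrix (Fin n) (Fin n) ℂ) : extM A * extM B = extM (A * B) := by
  ext i j
  rw [Matrix.mul_apply, Fin.sum_univ_succ]
  refine Fin.cases ?_ (fun i => ?_) i <;> refine Fin.cases ?_ (fun j => ?_) j <;> simp [Matrix.mul_apply]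

lemma extM_one {n : ℕ} : extM (1 : Matrix (Fin n) (Fin n) ℂ) = 1 := by
  ext i j
  refine Fin.cases ?_ (fun i => ?_) i <;> refine Fin.cases ?_ (fun j => ?_) j <;> simp [Matrix.one_apply, Fin.succ_ne_zero, (Fin.succ_ne_zero _).symm]

lemma nv_extM {n : ℕ} (v : AbsoluteValue ℂ ℝ) (A : Matrix (Fin n) (Fin n) ℂ) : nv v (extM A) = 1 + nv v A := by
  simp [nv, Fin.sum_univ_succ]

lemma eig_basis {n : ℕ} (v : AbsoluteValue ℂ ℝ) (u : Matrix (Fin (n+1)) (Fin (n+1)) ℂ) (l : ℂ) (hl : u.charpoly.IsRoot l) :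
    ∃ Q : GL (Fin (n+1)) ℂ, (∀ i j, v (Q.1 i j) ≤ 1) ∧ v Q.1.det = 1 ∧
      u *ᵥ (fun i => Q.1 i 0) = l • (fun i => Q.1 i 0) := by
  obtain ⟨x, hx, h⟩ := exists_eigvec u l hl
  obtain ⟨i, hi⟩ := Finite.exists_max (fun i => v (x i))
  have hxi : x i ≠ 0 := by
    intro h0
    apply hx
    ext j
    have := hi j
    rw [h0, map_zero] at this
    exact v.eq_zero.1 (le_antisymm this (v.nonneg _))
  let y : Fin (n+1) → ℂ := (x i)⁻¹ • x
  have hy1 : y i = 1 := by simp [y, inv_mul_cancel₀ hxi]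
  have hy : ∀ j, v (y j) ≤ 1 := by
    intro j
    simp only [y, Pi.smul_apply, smul_eq_mul, map_mul, map_inv₀]
    rw [inv_mul_le_iff₀ (v.pos hxi), mul_one]
    exact hi j
  have huy : u *ᵥ y = l • y := by
    simp only [y, Matrix.mulVec_smul, h, smul_comm l]
  let σ := Equiv.swap 0 i
  let R : Matrix (Fin (n+1)) (Fin (n+1)) ℂ := (1 : Matrix (Fin (n+1)) (Fin (n+1)) ℂ).updateCol 0 (y ∘ σ)
  have hRdet : R.det = 1 := by
    have := Matrix.cramer_apply (1 : Matrix (Fin (n+1)) (Fin (n+1)) ℂ) (y ∘ σ) 0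
    rw [Matrix.cramer_one] at this
    simp only [Module.End.one_apply] at this
    change y (σ 0) = R.det at this
    rw [← this]
    simpa [σ] using hy1
  let Q0 := R.submatrix σ id
  have hQdet : v Q0.det = 1 := by
    simp only [Q0]
    rw [Matrix.det_permute, hRdet, mul_one]
    rcases Int.units_eq_one_or (Equiv.Perm.sign σ) with h | h <;> rw [h] <;> simp
  have hu : IsUnit Q0.det := by
    rw [isUnit_iff_ne_zero]; rintro h0; rw [h0, map_zero] at hQdet; norm_num at hQdet
  refine ⟨Matrix.GeneralLinearGroup.mk'' Q0 hu, fun a b => ?_, hQdet, ?_⟩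
  · change v (R (σ a) b) ≤ 1
    simp only [R, Matrix.updateCol_apply]
    split_ifs
    · exact hy _
    · rw [Matrix.one_apply]; split_ifs <;> simp
  · have : (fun a => (Matrix.GeneralLinearGroup.mk'' Q0 hu).1 a 0) = y := by
      ext a
      change R (σ a) 0 = y a
      simp [R, Matrix.updateCol_apply, σ]
    rw [this, huy]

lemma exists_max_root {n : ℕ} (v : AbsoluteValue ℂ ℝ) (u : Matrix (Fin (n+1)) (Fin (n+1)) ℂ) :
    ∃ l, u.charpoly.IsRoot l ∧ ∀ l', u.charpoly.IsRoot l' → v l' ≤ v l := by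
  have hne : u.charpoly ≠ 0 := (Matrix.charpoly_monic u).ne_zero
  have hdeg : u.charpoly.degree ≠ 0 := by
    rw [Matrix.charpoly_degree_eq_dim]; simp; exact_mod_cast Nat.succ_ne_zero n
  obtain ⟨l0, hl0⟩ := IsAlgClosed.exists_root _ hdeg
  have hfin : {l | u.charpoly.IsRoot l}.Finite := Polynomial.finite_setOfPred_isRoot hne
  obtain ⟨l, hl, hmax⟩ := Set.exists_max_image _ v hfin ⟨l0, hl0⟩
  exact ⟨l, hl, hmax⟩

lemma schur (n : ℕ) : ∃ C : ℝ, 1 ≤ C ∧ ∀ (v : AbsoluteValue ℂ ℝ) (u : Matrix (Fin n) (Fin n) ℂ), ∃ P : GL (Fin n) ℂ,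
    nv v P.1 ≤ C ∧ nv v P⁻¹.1 ≤ C ∧ (∀ i j, j < i → (P⁻¹.1 * u * P.1) i j = 0) ∧
    ∀ i j, i ≤ j → v ((P⁻¹.1 * u * P.1) j j) ≤ v ((P⁻¹.1 * u * P.1) i i) := by
  induction n with
  | zero =>
    refine ⟨1, le_rfl, fun v u => ⟨1, ?_, ?_, fun i => i.elim0, fun i => i.elim0⟩⟩ <;> simp [nv]
  | succ n ih =>
    obtain ⟨C, hC1, hC⟩ := ih
    let K : ℝ := ((n+1 : ℕ):ℝ) * ((n+1 : ℕ):ℝ) * ((n+1).factorial * (((n+1:ℕ):ℝ) + 1) ^ (n+1))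
    have hK : 0 ≤ K := by positivity
    have hK2 : ((n+1 : ℕ):ℝ) * ((n+1 : ℕ):ℝ) * 1 ≤ K := by
      simp only [K]
      gcongr
      have h1 : (1:ℝ) ≤ ((n+1).factorial : ℝ) := by exact_mod_cast Nat.one_le_iff_ne_zero.2 (Nat.factorial_ne_zero _)
      have h2 : (1:ℝ) ≤ (((n+1:ℕ):ℝ) + 1) ^ (n+1) := one_le_pow₀ (by simp; positivity)
      nlinarith
    have hK1 : 1 ≤ K := by
      refine le_trans ?_ hK2
      have : (1:ℝ) ≤ ((n+1:ℕ):ℝ) := by simp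
      nlinarith
    refine ⟨K * (1 + C), by nlinarith, fun v u => ?_⟩
    obtain ⟨l, hl, hmax⟩ := exists_max_root v u
    obtain ⟨Q, hQ1, hQ2, hQ3⟩ := eig_basis v u l hl
    have hcol : ∀ i, (Q⁻¹.1 * u * Q.1) i 0 = if i = 0 then l else 0 := by
      intro i
      have h1 : (Q⁻¹.1 * u * Q.1) i 0 = (Q⁻¹.1 *ᵥ (u *ᵥ (fun i => Q.1 i 0))) i := by
        rw [Matrix.mulVec_mulVec, Matrix.mul_apply]; rfl
      have h2 : (Q⁻¹.1 *ᵥ (fun i => Q.1 i 0)) i = (Q⁻¹.1 * Q.1) i 0 := rfl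
      rw [h1, hQ3, Matrix.mulVec_smul, Pi.smul_apply, h2, gl_inv_mul, Matrix.one_apply]
      simp
    obtain ⟨P, hP1, hP2, hP3, hP4⟩ := hC v ((Q⁻¹.1 * u * Q.1).submatrix Fin.succ Fin.succ)
    let R : GL (Fin (n+1)) ℂ := ⟨extM P.1, extM P⁻¹.1, by rw [extM_mul, gl_mul_inv, extM_one],
      by rw [extM_mul, gl_inv_mul, extM_one]⟩
    have hR1 : nv v R.1 ≤ 1 + C := by
      change nv v (extM P.1) ≤ _
      rw [nv_extM]; linarith
    have hR2 : nv v R⁻¹.1 ≤ 1 + C := by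
      change nv v (extM P⁻¹.1) ≤ _
      rw [nv_extM]; linarith
    have hQn : nv v Q.1 ≤ K := by
      refine le_trans ?_ hK2
      have := nv_le v Q.1 1 hQ1
      rwa [Fintype.card_fin] at this
    have hQi : nv v Q⁻¹.1 ≤ K := nv_inv_le v Q hQ1 hQ2
    have hconj : (Q * R)⁻¹.1 * u * (Q * R).1 = extM P⁻¹.1 * (Q⁻¹.1 * u * Q.1) * extM P.1 := by
      have : (Q * R)⁻¹.1 = R⁻¹.1 * Q⁻¹.1 := by rw [_root_.mul_inv_rev]; rfl
      rw [this]
      change R⁻¹.1 * Q⁻¹.1 * u * (Q.1 * R.1) = R⁻¹.1 * (Q⁻¹.1 * u * Q.1) * R.1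
      simp only [Matrix.mul_assoc]
    obtain ⟨A, hA⟩ : ∃ A, A = Q⁻¹.1 * u * Q.1 := ⟨_, rfl⟩
    have hss : ∀ i j : Fin n, (extM P⁻¹.1 * A * extM P.1) i.succ j.succ =
        (P⁻¹.1 * (A.submatrix Fin.succ Fin.succ) * P.1) i j := by
      intro i j
      simp [Matrix.mul_apply, Fin.sum_univ_succ]
    rw [← hA] at hcol hP3 hP4
    have hA00 : A 0 0 = l := by simpa using hcol 0
    have hAs0 : ∀ i : Fin n, A i.succ 0 = 0 := fun i => by simpa [Fin.succ_ne_zero] using hcol i.succ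
    have h00 : (extM P⁻¹.1 * A * extM P.1) 0 0 = l := by
      simp [Matrix.mul_apply, Fin.sum_univ_succ, hA00]
    have hs0 : ∀ i : Fin n, (extM P⁻¹.1 * A * extM P.1) i.succ 0 = 0 := by
      intro i
      simp [Matrix.mul_apply, Fin.sum_univ_succ, hAs0]
    have htri : ∀ i j, j < i → ((Q * R)⁻¹.1 * u * (Q * R).1) i j = 0 := by
      intro i j
      rw [hconj, ← hA]
      refine Fin.cases ?_ (fun i => ?_) i
      · intro h; exact absurd h (Fin.not_lt_zero _)
      · refine Fin.cases ?_ (fun j => ?_) j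
        · intro _; exact hs0 i
        · intro h
          rw [hss]
          exact hP3 i j (Fin.succ_lt_succ_iff.1 h)
    have hdiag : ∀ i, u.charpoly.IsRoot (((Q * R)⁻¹.1 * u * (Q * R).1) i i) := by
      intro i
      have h1 : ((Q * R)⁻¹.1 * u * (Q * R).1).charpoly.IsRoot (((Q * R)⁻¹.1 * u * (Q * R).1) i i) := by
        rw [Matrix.charpoly_of_upperTriangular _ (fun i j h => htri i j h), IsRoot.def, eval_prod]
        exact Finset.prod_eq_zero (Finset.mem_univ i) (by simp)
      have h2 := root_conj (Q * R) 1 one_ne_zero u _ (by rw [one_smul]; exact h1)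
      simpa using h2
    refine ⟨Q * R, ?_, ?_, htri, ?_⟩
    · exact (nv_mul v _ _).trans (mul_le_mul hQn hR1 (nv_nonneg _ _) hK)
    · have : (Q * R)⁻¹.1 = R⁻¹.1 * Q⁻¹.1 := by rw [_root_.mul_inv_rev]; rfl
      rw [this, mul_comm K]
      exact (nv_mul v _ _).trans (mul_le_mul hR2 hQi (nv_nonneg _ _) (by linarith))
    · intro i j
      refine Fin.cases ?_ (fun i => ?_) i
      · intro _
        have := hmax _ (hdiag j)
        rw [hconj, ← hA] at this ⊢
        rwa [h00]
      · refine Fin.cases ?_ (fun j => ?_) j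
        · intro h; exact absurd h (by simp)
        · intro h
          rw [hconj, ← hA, hss, hss]
          exact hP4 i j (Fin.succ_le_succ_iff.1 h)

end UEG

namespace UEG
set_option linter.unusedVariables false
set_option linter.style.haveILetI false
set_option linter.unusedSectionVars false
open Polynomial Matrix
open scoped Pointwise

section pert
variable {m n : Type*} [Fintype m] [Fintype n] [DecidableEq m] [DecidableEq n]

lemma pert1 (v : AbsoluteValue ℂ ℝ) (p : Matrix m m ℂ) (hp : nv v p ≤ 1/2) :
    (1 + p).det ≠ 0 ∧ nv v (1 + p)⁻¹ ≤ 2 * Fintype.card m := by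
  have h0 : (1 + p).det ≠ 0 := by
    intro h
    obtain ⟨x, hx, h2⟩ := Matrix.exists_mulVec_eq_zero_iff.2 h
    rw [Matrix.add_mulVec, Matrix.one_mulVec] at h2
    have h3 : x = (-1 : ℂ) • (p *ᵥ x) := by
      rw [neg_smul, one_smul]; exact eq_neg_of_add_eq_zero_left h2
    have h4 : vn v x ≤ nv v p * vn v x := by
      conv_lhs => rw [h3]
      rw [vn_smul]
      simpa using vn_mulVec v p x
    obtain ⟨i, hi⟩ := Function.ne_iff.1 hx
    have h5 : 0 < vn v x := lt_of_lt_of_le (v.pos hi) (le_vn v x i)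
    nlinarith
  refine ⟨h0, ?_⟩
  have hB : (1 + p)⁻¹ = 1 + -(p * (1 + p)⁻¹) := by
    have := Matrix.mul_nonsing_inv (1 + p) (isUnit_iff_ne_zero.2 h0)
    rw [Matrix.add_mul, Matrix.one_mul] at this
    rw [← sub_eq_add_neg]
    exact eq_sub_of_add_eq this
  have h1 : nv v (1 + p)⁻¹ ≤ Fintype.card m + nv v p * nv v (1 + p)⁻¹ := by
    conv_lhs => rw [hB]
    refine (nv_add v _ _).trans ?_
    rw [nv_one_le, nv_neg]
    linarith [nv_mul v p (1 + p)⁻¹]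
  have := nv_nonneg v (1 + p)⁻¹
  nlinarith

lemma pert (v : AbsoluteValue ℂ ℝ) (A Y : Matrix m m ℂ) (hA : A.det ≠ 0) (h : nv v A⁻¹ * nv v Y ≤ 1/2) :
    (A + Y).det ≠ 0 ∧ nv v (A + Y)⁻¹ ≤ 2 * Fintype.card m * nv v A⁻¹ := by
  have hu : IsUnit A.det := isUnit_iff_ne_zero.2 hA
  have e : A + Y = A * (1 + A⁻¹ * Y) := by
    rw [Matrix.mul_add, Matrix.mul_one, ← Matrix.mul_assoc, Matrix.mul_nonsing_inv _ hu, Matrix.one_mul]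
  obtain ⟨h1, h2⟩ := pert1 v (A⁻¹ * Y) ((nv_mul v _ _).trans h)
  rw [e]
  refine ⟨by rw [Matrix.det_mul]; exact mul_ne_zero hA h1, ?_⟩
  rw [Matrix.mul_inv_rev]
  refine (nv_mul v _ _).trans ?_
  have := nv_nonneg v A⁻¹
  gcongr

/-- frames -/
def Fr (P : Matrix n m ℂ → Prop) : Set (Matrix (m ⊕ n) m ℂ) :=
  {x | ∃ G : Matrix m m ℂ, ∃ Z : Matrix n m ℂ, G.det ≠ 0 ∧ P Z ∧ x = Matrix.fromRows G (Z * G)}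

lemma frame_step (A : Matrix m m ℂ) (X : Matrix m n ℂ) (Y : Matrix n m ℂ) (D : Matrix n n ℂ)
    (P Q : Matrix n m ℂ → Prop) (h : ∀ Z, P Z → (A + X * Z).det ≠ 0 ∧ Q ((Y + D * Z) * (A + X * Z)⁻¹)) :
    ∀ x ∈ Fr P, Matrix.fromBlocks A X Y D * x ∈ Fr Q := by
  rintro _ ⟨G, Z, hG, hZ, rfl⟩
  obtain ⟨h1, h2⟩ := h Z hZ
  refine ⟨(A + X * Z) * G, _, by rw [Matrix.det_mul]; exact mul_ne_zero h1 hG, h2, ?_⟩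
  rw [Matrix.fromBlocks_mul_fromRows]
  congr 1
  · simp only [Matrix.add_mul, Matrix.mul_assoc]
  · rw [Matrix.mul_assoc, ← Matrix.mul_assoc (A + X * Z)⁻¹, Matrix.nonsing_inv_mul _ (isUnit_iff_ne_zero.2 h1),
      Matrix.one_mul]
    simp only [Matrix.add_mul, Matrix.mul_assoc]

lemma frame_disj (P Q : Matrix n m ℂ → Prop) (h : ∀ Z, P Z → Q Z → False) : Disjoint (Fr P) (Fr Q) := by
  rw [Set.disjoint_left]
  rintro _ ⟨G, Z, hG, hZ, rfl⟩ ⟨G', Z', hG', hZ', e⟩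
  rw [Matrix.fromRows_ext_iff] at e
  obtain ⟨rfl, e2⟩ := e
  have : Z = Z' := by
    have := congrArg (fun Y => Y * G⁻¹) e2
    simpa [Matrix.mul_assoc, Matrix.mul_nonsing_inv _ (isUnit_iff_ne_zero.2 hG)] using this
  subst this
  exact h Z hZ hZ'

lemma pp_level (v : AbsoluteValue ℂ ℝ) (r : ℝ) (hr : 2 ≤ r) (e s : ℕ) (he : (2 * Fintype.card m : ℝ) ≤ r ^ e)
    (A : Matrix m m ℂ) (X : Matrix m n ℂ) (D : Matrix n n ℂ)
    (c11 : Matrix m m ℂ) (c12 : Matrix m n ℂ) (c21 : Matrix n m ℂ) (c22 : Matrix n n ℂ)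
    (a c : GL (m ⊕ n) ℂ) (ha : a.1 = fromBlocks A X 0 D) (hc : c.1 = fromBlocks c11 c12 c21 c22)
    (hA : A.det ≠ 0) (hX : nv v A⁻¹ * nv v X * r ^ (2*s+1+e) ≤ 1/2)
    (hD : nv v D * nv v A⁻¹ * r ^ (4*s+4+2*e) ≤ 1)
    (h11 : c11.det ≠ 0) (n11 : nv v c11 ≤ r ^ s) (n12 : nv v c12 ≤ r ^ s) (n21 : nv v c21 ≤ r ^ s) (n22 : nv v c22 ≤ r ^ s)
    (ni : nv v c11⁻¹ ≤ r ^ s) (n21' : 1 ≤ nv v c21 * r ^ s) : Gr 2 ({a, c * a} : Set (GL (m ⊕ n) ℂ)) := by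
  have hr0 : 0 < r := by linarith
  have hr1 : 1 ≤ r := by linarith
  let R' : ℝ := r ^ (2*s+1+e)
  let ε : ℝ := (r ^ (2*s+3))⁻¹
  have hεpos : 0 < ε := by positivity
  have hε1 : ε ≤ 1 := inv_le_one_of_one_le₀ (one_le_pow₀ hr1)
  have hR'1 : 1 ≤ R' := one_le_pow₀ hr1
  have hεr : ε * r ^ (2*s+3) = 1 := inv_mul_cancel₀ (by positivity)
  have hstepa : ∀ x ∈ Fr (fun Z : Matrix n m ℂ => nv v Z ≤ R'), a.1 * x ∈ Fr (fun Z : Matrix n m ℂ => nv v Z ≤ ε) := by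
    rw [ha]
    apply frame_step
    intro Z hZ
    have nA := nv_nonneg v A⁻¹
    have nX := nv_nonneg v X
    have nZ := nv_nonneg v Z
    have nD := nv_nonneg v D
    obtain ⟨p1, p2⟩ := pert v A (X * Z) hA (by
      calc nv v A⁻¹ * nv v (X * Z) ≤ nv v A⁻¹ * (nv v X * nv v Z) := by gcongr; exact nv_mul _ _ _
        _ ≤ nv v A⁻¹ * (nv v X * R') := by gcongr
        _ ≤ 1/2 := by rw [← mul_assoc]; exact hX)
    refine ⟨p1, ?_⟩
    rw [zero_add]
    have h1 : nv v (D * Z * (A + X * Z)⁻¹) ≤ nv v D * R' * (r ^ e * nv v A⁻¹) := by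
      refine (nv_mul v _ _).trans ?_
      have := nv_nonneg v (A + X * Z)⁻¹
      gcongr
      · exact (nv_mul v _ _).trans (by gcongr)
      · exact p2.trans (by gcongr)
    refine h1.trans ?_
    rw [← mul_le_mul_iff_left₀ (show 0 < r ^ (2*s+3) by positivity), hεr]
    refine le_trans (le_of_eq ?_) hD
    simp only [R']
    have : r ^ (4*s+4+2*e) = r ^ (2*s+1+e) * r ^ e * r ^ (2*s+3) := by
      rw [← pow_add, ← pow_add]; congr 1; ring
    rw [this]; ring
  have hstepc : ∀ x ∈ Fr (fun Z : Matrix n m ℂ => nv v Z ≤ ε), c.1 * x ∈ Fr (fun Z : Matrix n m ℂ => ε < nv v Z ∧ nv v Z ≤ R') := by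
    rw [hc]
    apply frame_step
    intro Z hZ
    have nZ := nv_nonneg v Z
    have n1 := nv_nonneg v c11⁻¹
    have n2 := nv_nonneg v c12
    have n3 := nv_nonneg v c22
    have hrs : 0 < r ^ s := by positivity
    have hrs1 : 1 ≤ r ^ s := one_le_pow₀ hr1
    have e1 : r ^ (2*s+3) = r ^ s * r ^ s * r ^ 3 := by rw [← pow_add, ← pow_add]; congr 1; ring
    have hr3 : (8:ℝ) ≤ r ^ 3 := by
      calc (8:ℝ) = 2 ^ 3 := by norm_num
        _ ≤ r ^ 3 := pow_le_pow_left₀ (by norm_num) hr 3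
    have hsε : r ^ s * r ^ s * ε ≤ 1 / 8 := by
      rw [e1] at hεr
      have h0 : 0 ≤ r ^ s * r ^ s * ε := by positivity
      nlinarith
    have hsε' : r ^ s * ε ≤ 1 := by nlinarith
    obtain ⟨p1, p2⟩ := pert v c11 (c12 * Z) h11 (by
      calc nv v c11⁻¹ * nv v (c12 * Z) ≤ r ^ s * (r ^ s * ε) := by
            refine mul_le_mul ni ?_ (nv_nonneg v (c12 * Z)) hrs.le
            exact (nv_mul v c12 Z).trans (by gcongr)
        _ ≤ 1/2 := by linarith)
    have hcz : nv v (c22 * Z) ≤ r ^ s * ε := (nv_mul v _ _).trans (by gcongr)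
    refine ⟨p1, ?_, ?_⟩
    · by_contra! hcon
      have e2 : c21 = (c21 + c22 * Z) * (c11 + c12 * Z)⁻¹ * (c11 + c12 * Z) + -(c22 * Z) := by
        rw [Matrix.mul_assoc, Matrix.nonsing_inv_mul _ (isUnit_iff_ne_zero.2 p1), Matrix.mul_one, add_neg_cancel_right]
      have h5 : nv v c21 ≤ ε * (r ^ s + 1) + r ^ s * ε := by
        rw [e2]
        refine (nv_add v _ _).trans ?_
        rw [nv_neg]
        gcongr
        refine (nv_mul v _ _).trans ?_
        refine mul_le_mul hcon ?_ (nv_nonneg v (c11 + c12 * Z)) hεpos.le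
        refine (nv_add v _ _).trans (add_le_add n11 ?_)
        refine (nv_mul v _ _).trans ?_
        exact (by gcongr : nv v c12 * nv v Z ≤ r ^ s * ε).trans hsε'
      have h6 : nv v c21 * r ^ s ≤ (ε * (r ^ s + 1) + r ^ s * ε) * r ^ s := by gcongr
      have h7 : ε * r ^ s ≤ r ^ s * r ^ s * ε := by nlinarith
      nlinarith
    · refine (nv_mul v _ _).trans ?_
      have h5 : nv v (c21 + c22 * Z) ≤ r ^ s * r := by
        refine (nv_add v _ _).trans ?_
        nlinarith
      have h6 := nv_nonneg v (c21 + c22 * Z)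
      have h7 := nv_nonneg v (c11 + c12 * Z)⁻¹
      calc _ ≤ (r ^ s * r) * (r ^ e * r ^ s) := by
            gcongr
            exact p2.trans (by gcongr)
        _ = R' := by simp only [R']; ring
  refine pingpong (T := Matrix (m ⊕ n) m ℂ) (fun g x => g.1 * x) (fun a b t => by
      simp only [Units.val_mul, Matrix.mul_assoc]) (fun t => by simp only [Units.val_one, Matrix.one_mul])
    (Fr (fun Z : Matrix n m ℂ => nv v Z ≤ R')) (Fr (fun Z : Matrix n m ℂ => nv v Z ≤ ε))
    (Fr (fun Z : Matrix n m ℂ => ε < nv v Z ∧ nv v Z ≤ R')) ⟨_, 1, 0, by simp, ?_, rfl⟩ ?_ ?_ ?_ a (c * a) hstepa ?_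
  · simp [nv]; positivity
  · rintro _ ⟨G, Z, h1, h2, rfl⟩
    exact ⟨G, Z, h1, by linarith, rfl⟩
  · rintro _ ⟨G, Z, h1, h2, rfl⟩
    exact ⟨G, Z, h1, h2.2, rfl⟩
  · apply frame_disj
    intro Z h1 h2
    linarith [h2.1]
  · intro x hx
    rw [Units.val_mul, Matrix.mul_assoc]
    exact hstepc _ (hstepa x hx)

end pert

end UEG

namespace UEG
set_option linter.unusedVariables false
set_option linter.style.haveILetI false
set_option linter.unusedSectionVars false
open Polynomial Matrix
open scoped Pointwise

namespace Scale
variable (S : Scale) {m n : Type*} [Fintype m] [Fintype n] [DecidableEq m] [DecidableEq n]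

lemma small (A : Matrix m n S.B) (h : A.map S.pr = 0) (t : ℕ) :
    ∀ᶠ k in (UU : Filter ℕ), nv (S.v k) (A.map (S.ev k)) * S.r k ^ t ≤ 1 := by
  obtain ⟨c, hc⟩ := ev_pow_two ((Fintype.card m : ℝ) * Fintype.card n)
  have hall : ∀ᶠ k in (UU : Filter ℕ), ∀ i j, S.v k (S.ev k (A i j)) * S.r k ^ (t + c) ≤ 1 := by
    rw [Filter.eventually_all]
    intro i
    rw [Filter.eventually_all]
    intro j
    exact (S.pr_eq_zero _).1 (congrFun (congrFun h i) j) _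
  filter_upwards [hall] with k hk
  have hp : 0 < S.r k ^ (t + c) := pow_pos (S.r_pos k) _
  have h1 := nv_le (S.v k) (A.map (S.ev k)) ((S.r k ^ (t + c))⁻¹) (by
    intro i j
    rw [← one_div, le_div_iff₀ hp]
    exact hk i j)
  have h2 : (Fintype.card m : ℝ) * Fintype.card n ≤ S.r k ^ c :=
    hc.trans (pow_le_pow_left₀ (by norm_num) (S.hr k) c)
  have hp1 : 0 < S.r k ^ t := pow_pos (S.r_pos k) _
  have hp2 : 0 < S.r k ^ c := pow_pos (S.r_pos k) _
  calc nv (S.v k) (A.map (S.ev k)) * S.r k ^ t ≤ ((Fintype.card m : ℝ) * Fintype.card n * (S.r k ^ (t + c))⁻¹) * S.r k ^ t := by gcongr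
    _ ≤ (S.r k ^ c * (S.r k ^ (t + c))⁻¹) * S.r k ^ t := by gcongr
    _ = 1 := by rw [pow_add]; field_simp

lemma big (A : Matrix m n S.B) (h : A.map S.pr ≠ 0) :
    ∃ t : ℕ, ∀ᶠ k in (UU : Filter ℕ), 1 ≤ nv (S.v k) (A.map (S.ev k)) * S.r k ^ t := by
  have : ∃ i j, S.pr (A i j) ≠ 0 := by
    by_contra! h0
    exact h (by ext i j; exact h0 i j)
  obtain ⟨i, j, hij⟩ := this
  obtain ⟨t, ht⟩ := S.pr_ne_zero hij
  refine ⟨t, ?_⟩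
  filter_upwards [ht] with k hk
  refine hk.trans (mul_le_mul_of_nonneg_right ?_ (pow_pos (S.r_pos k) _).le)
  exact le_nv (S.v k) (A.map (S.ev k)) i j

lemma det_ev (A : Matrix m m S.B) (k : ℕ) : S.ev k A.det = (A.map (S.ev k)).det := by
  rw [RingHom.map_det]; rfl
lemma det_pr (A : Matrix m m S.B) : S.pr A.det = (A.map S.pr).det := by
  rw [RingHom.map_det]; rfl

lemma inv_bd (A : Matrix m m S.B) (h : (A.map S.pr).det ≠ 0) : ∃ N : ℕ, ∀ᶠ k in (UU : Filter ℕ),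
    (A.map (S.ev k)).det ≠ 0 ∧ nv (S.v k) (A.map (S.ev k))⁻¹ ≤ S.r k ^ N := by
  rw [← S.det_pr] at h
  obtain ⟨t, ht⟩ := S.pr_ne_zero h
  obtain ⟨N, hN⟩ := S.bd_nv A.adjugate
  refine ⟨t + N, ?_⟩
  filter_upwards [ht, hN] with k h1 h2
  rw [S.det_ev] at h1
  have hp : 0 < S.r k ^ t := pow_pos (S.r_pos k) _
  have h0 : (A.map (S.ev k)).det ≠ 0 := by
    intro h0; rw [h0, map_zero, zero_mul] at h1; norm_num at h1
  refine ⟨h0, ?_⟩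
  have e : A.adjugate.map (S.ev k) = (A.map (S.ev k)).adjugate := RingHom.map_adjugate (S.ev k) A
  rw [e] at h2
  rw [Matrix.inv_def, nv_smul, Ring.inverse_eq_inv', map_inv₀, pow_add]
  have hv : 0 < S.v k (A.map (S.ev k)).det := (S.v k).pos h0
  refine mul_le_mul ?_ h2 (nv_nonneg _ _) hp.le
  rw [inv_le_iff_one_le_mul₀ hv, mul_comm]
  exact h1

lemma bd_mono (f : ℕ → ℝ) {a b : ℕ} (hab : a ≤ b) (h : ∀ᶠ k in (UU : Filter ℕ), f k ≤ S.r k ^ a) :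
    ∀ᶠ k in (UU : Filter ℕ), f k ≤ S.r k ^ b := by
  filter_upwards [h] with k hk
  exact hk.trans (S.pow_mono k hab)

lemma block_pow (Wp : Matrix m m S.B) (X : Matrix m n S.B) (Wm : Matrix n n S.B) (hX : X.map S.pr = 0) (M : ℕ) :
    ∃ Y : Matrix m n S.B, Y.map S.pr = 0 ∧ (fromBlocks Wp X 0 Wm) ^ M = fromBlocks (Wp ^ M) Y 0 (Wm ^ M) := by
  induction M with
  | zero => exact ⟨0, by ext; simp, by simp⟩
  | succ M ih =>
    obtain ⟨Y, hY, e⟩ := ih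
    refine ⟨Wp ^ M * X + Y * Wm, ?_, ?_⟩
    · rw [Matrix.map_add _ (map_add S.pr), Matrix.map_mul, Matrix.map_mul, hX, hY]; simp
    · rw [pow_succ, e, Matrix.fromBlocks_multiply]; simp [pow_succ]

lemma map_pow' (A : Matrix m m S.B) (k M : ℕ) : (A ^ M).map (S.ev k) = (A.map (S.ev k)) ^ M :=
  map_pow ((S.ev k).mapMatrix) A M

theorem pps (Wp : Matrix m m S.B) (X : Matrix m n S.B) (Wm : Matrix n n S.B) (hX : X.map S.pr = 0)
    (hdet : (Wp.map S.pr).det ≠ 0)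
    (hW : ∀ t : ℕ, ∃ M : ℕ, ∀ᶠ k in (UU : Filter ℕ),
      nv (S.v k) ((Wm.map (S.ev k)) ^ M) * nv (S.v k) ((Wp.map (S.ev k)) ^ M)⁻¹ * S.r k ^ t ≤ 1)
    (c11 : Matrix m m S.B) (c12 : Matrix m n S.B) (c21 : Matrix n m S.B) (c22 : Matrix n n S.B)
    (h11 : (c11.map S.pr).det ≠ 0) (h21 : c21.map S.pr ≠ 0) :
    ∃ M : ℕ, ∀ᶠ k in (UU : Filter ℕ), ∀ a c : GL (m ⊕ n) ℂ, a.1 = (fromBlocks Wp X 0 Wm).map (S.ev k) →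
      c.1 = (fromBlocks c11 c12 c21 c22).map (S.ev k) → Gr 2 ({a ^ M, c * a ^ M} : Set (GL (m ⊕ n) ℂ)) := by
  obtain ⟨s1, hs1⟩ := S.bd_nv c11
  obtain ⟨s2, hs2⟩ := S.bd_nv c12
  obtain ⟨s3, hs3⟩ := S.bd_nv c21
  obtain ⟨s4, hs4⟩ := S.bd_nv c22
  obtain ⟨s5, hs5⟩ := S.inv_bd c11 h11
  obtain ⟨s6, hs6⟩ := S.big c21 h21
  obtain ⟨e, he⟩ := ev_pow_two (2 * Fintype.card m : ℝ)
  let s := s1 + s2 + s3 + s4 + s5 + s6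
  obtain ⟨M, hM⟩ := hW (4*s+4+2*e)
  obtain ⟨Y, hY, hWY⟩ := S.block_pow Wp X Wm hX M
  have hdM : ((Wp ^ M).map S.pr).det ≠ 0 := by
    have : (Wp ^ M).map S.pr = (Wp.map S.pr) ^ M := map_pow (S.pr.mapMatrix) Wp M
    rw [this, Matrix.det_pow]
    exact pow_ne_zero _ hdet
  obtain ⟨q, hq⟩ := S.inv_bd (Wp ^ M) hdM
  have hYs := S.small Y hY (2*s+1+e+q+1)
  refine ⟨M, ?_⟩
  filter_upwards [hs1, hs2, hs3, hs4, hs5, hs6, hM, hq, hYs] with k k1 k2 k3 k4 k5 k6 kM kq kY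
  intro a c ha hc
  have hr := S.hr k
  have hp := S.r_pos k
  refine pp_level (S.v k) (S.r k) hr e s (he.trans (pow_le_pow_left₀ (by norm_num) hr e))
    ((Wp ^ M).map (S.ev k)) (Y.map (S.ev k)) ((Wm ^ M).map (S.ev k))
    (c11.map (S.ev k)) (c12.map (S.ev k)) (c21.map (S.ev k)) (c22.map (S.ev k)) (a ^ M) c ?_ ?_ kq.1 ?_ ?_ k5.1
    (k1.trans (S.pow_mono k (by omega))) (k2.trans (S.pow_mono k (by omega)))
    (k3.trans (S.pow_mono k (by omega))) (k4.trans (S.pow_mono k (by omega)))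
    (k5.2.trans (S.pow_mono k (by omega))) (k6.trans ?_)
  · rw [Units.val_pow_eq_pow_val, ha, ← S.map_pow', hWY, Matrix.fromBlocks_map]
    congr 1
  · rw [hc, Matrix.fromBlocks_map]
  · have n0 := nv_nonneg (S.v k) (Y.map (S.ev k))
    have e1 : S.r k ^ (2*s+1+e+q+1) = S.r k ^ (2*s+1+e) * S.r k ^ q * S.r k := by rw [← pow_add, ← pow_succ]
    rw [e1] at kY
    have h2 : nv (S.v k) ((Wp ^ M).map (S.ev k))⁻¹ * nv (S.v k) (Y.map (S.ev k)) * S.r k ^ (2*s+1+e) ≤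
        S.r k ^ q * nv (S.v k) (Y.map (S.ev k)) * S.r k ^ (2*s+1+e) := by
      have := kq.2
      gcongr
    have h3 : 0 ≤ S.r k ^ q * nv (S.v k) (Y.map (S.ev k)) * S.r k ^ (2*s+1+e) := by positivity
    nlinarith
  · rw [S.map_pow', S.map_pow']; exact kM
  · have n0 := nv_nonneg (S.v k) (c21.map (S.ev k))
    exact mul_le_mul_of_nonneg_left (S.pow_mono k (by omega)) n0

end Scale

end UEG

namespace UEG
set_option linter.unusedVariables false
set_option linter.style.haveILetI false
set_option linter.unusedSectionVars false
open Polynomial Matrix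
open scoped Pointwise

lemma exists_W {G : Type*} [Group G] {F : Set G} (h1 : (1 : G) ∈ F) {H : Subgroup G} {D : ℕ}
    (h : IdxLe D H (Subgroup.closure F)) : ∃ J : ℕ, ∃ W : Finset G, (1 : G) ∈ W ∧ W.card ≤ D ∧
      (∀ w ∈ W, w ∈ F ^ J) ∧ ∀ f ∈ F, ∀ x ∈ W, ∃ y ∈ W, y⁻¹ * (f * x) ∈ H := by
  classical
  let good : Finset G → Prop := fun W => (1 : G) ∈ W ∧ (∃ J, ∀ w ∈ W, w ∈ F ^ J) ∧
    ∀ x ∈ W, ∀ y ∈ W, x ≠ y → x⁻¹ * y ∉ H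
  have hb : ∀ W, good W → W.card ≤ D := by
    rintro W ⟨g1, ⟨J, g2⟩, g3⟩
    by_contra! hc
    let γ : Fin (D + 1) → G := fun i => (W.equivFin.symm (Fin.castLE (by omega) i) : W)
    obtain ⟨i, j, hij, e⟩ := h γ (fun i => pow_sub_closure J (g2 _ (SetLike.coe_mem _)))
    refine g3 _ (SetLike.coe_mem _) _ (SetLike.coe_mem _) ?_ e
    intro h0
    exact hij (Fin.castLE_injective _ (W.equivFin.symm.injective (Subtype.ext h0)))
  have h0 : good {1} := ⟨by simp, ⟨0, by simp⟩, by simp⟩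
  obtain ⟨W, hW, hmax⟩ : ∃ W, good W ∧ ∀ W', good W' → W'.card ≤ W.card := by
    let P : ℕ → Prop := fun n => ∃ W, good W ∧ W.card = n
    have hP : P (Nat.findGreatest P D) := Nat.findGreatest_spec (hb _ h0) ⟨_, h0, rfl⟩
    obtain ⟨W, hW, hc⟩ := hP
    refine ⟨W, hW, fun W' hW' => ?_⟩
    rw [hc]
    exact Nat.le_findGreatest (hb _ hW') ⟨_, hW', rfl⟩
  obtain ⟨g1, ⟨J, g2⟩, g3⟩ := id hW
  refine ⟨J, W, g1, hb _ hW, g2, ?_⟩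
  intro f hf x hx
  by_contra! hcon
  have hnot : f * x ∉ W := fun hm => hcon _ hm (by simp [H.one_mem])
  have hgood : good (insert (f * x) W) := by
    refine ⟨by simp [g1], ⟨J + 1, ?_⟩, ?_⟩
    · intro w hw
      rw [Finset.mem_insert] at hw
      rcases hw with rfl | hw
      · rw [pow_succ']; exact Set.mul_mem_mul hf (g2 x hx)
      · exact Set.pow_subset_pow_right h1 (Nat.le_succ J) (g2 w hw)
    · intro a ha b hb hab
      rw [Finset.mem_insert] at ha hb
      rcases ha with rfl | ha <;> rcases hb with rfl | hb
      · exact absurd rfl hab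
      · intro hm
        apply hcon b hb
        have := H.inv_mem hm
        simpa [_root_.mul_inv_rev, mul_assoc] using this
      · exact hcon a ha
      · exact g3 a ha b hb hab
  have := hmax _ hgood
  rw [Finset.card_insert_of_notMem hnot] at this
  omega

section field
variable {m n : Type*} [Fintype m] [Fintype n] [DecidableEq m] [DecidableEq n]

/-- block stabilizer -/
def Hb (m n : Type*) [Fintype m] [Fintype n] [DecidableEq m] [DecidableEq n] (K : Type*) [CommRing K] :
    Subgroup (GL (m ⊕ n) K) where
  carrier := {g | g.1.toBlocks₂₁ = 0}
  one_mem' := by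
    change (1 : Matrix (m ⊕ n) (m ⊕ n) K).toBlocks₂₁ = 0
    rw [← Matrix.fromBlocks_one, Matrix.toBlocks_fromBlocks₂₁]
  mul_mem' := by
    intro a b ha hb
    simp only [Set.mem_ofPred_eq, Units.val_mul] at *
    rw [← Matrix.fromBlocks_toBlocks a.1, ← Matrix.fromBlocks_toBlocks b.1, ha, hb, Matrix.fromBlocks_multiply]
    simp
  inv_mem' := by
    intro a ha
    simp only [Set.mem_ofPred_eq] at *
    have e : a⁻¹.1 = a.1⁻¹ := by simp
    have hu : IsUnit a.1 := a.isUnit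
    rw [e]
    rw [← Matrix.fromBlocks_toBlocks a.1, ha] at hu ⊢
    rw [Matrix.isUnit_fromBlocks_zero₂₁] at hu
    rw [Matrix.inv_fromBlocks_zero₂₁_of_isUnit_iff _ _ _ (by simp [hu.1, hu.2])]
    simp

lemma mem_Hb {K : Type*} [CommRing K] (g : GL (m ⊕ n) K) : g ∈ Hb m n K ↔ g.1.toBlocks₂₁ = 0 := Iff.rfl

lemma Hb_det {K : Type*} [CommRing K] (g : GL (m ⊕ n) K) (h : g ∈ Hb m n K) : IsUnit (g.1.toBlocks₁₁).det := by
  have hu : IsUnit g.1 := g.isUnit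
  rw [mem_Hb] at h
  rw [← Matrix.fromBlocks_toBlocks g.1, h, Matrix.isUnit_fromBlocks_zero₂₁] at hu
  exact (Matrix.isUnit_iff_isUnit_det _).1 hu.1

lemma det_expand {K : Type*} [CommRing K] {l : Type*} [Fintype l] [DecidableEq l] (U : Matrix m l K) (V : Matrix l m K) :
    (U * V).det = ∑ p : m → l, (U.submatrix id p).det * ∏ i, V (p i) i := by
  simp only [Matrix.det_apply', Matrix.mul_apply, Finset.sum_mul]
  rw [Finset.sum_comm]
  refine Finset.sum_congr rfl fun σ _ => ?_
  rw [Finset.prod_univ_sum, Fintype.piFinset_univ, Finset.mul_sum]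
  refine Finset.sum_congr rfl fun p _ => ?_
  rw [Finset.prod_mul_distrib, mul_assoc]
  rfl

lemma idx_Hb {K : Type*} [Field K] (Γ : Subgroup (GL (m ⊕ n) K))
    (h : ∀ γ ∈ Γ, (γ.1.toBlocks₁₁).det ≠ 0 → γ.1.toBlocks₂₁ = 0) :
    IdxLe (Fintype.card (m → m ⊕ n)) (Hb m n K) Γ := by
  set D := Fintype.card (m → m ⊕ n) with hDdef
  intro γ hγ
  by_contra! hcon
  let A : Matrix (Fin (D + 1)) (m → m ⊕ n) K := Matrix.of fun i p =>
    (((γ i)⁻¹.1.submatrix (Sum.inl : m → m ⊕ n) (id : m ⊕ n → m ⊕ n)).submatrix id p).det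
  let C : Matrix (m → m ⊕ n) (Fin (D + 1)) K := Matrix.of fun p j =>
    ∏ i, ((γ j).1.submatrix (id : m ⊕ n → m ⊕ n) (Sum.inl : m → m ⊕ n)) (p i) i
  have hAC : A * C = 1 := by
    ext i j
    rw [Matrix.mul_apply]
    simp only [A, C, Matrix.of_apply]
    rw [← det_expand]
    have e : (γ i)⁻¹.1.submatrix (Sum.inl : m → m ⊕ n) id * (γ j).1.submatrix id Sum.inl
        = ((γ i)⁻¹ * γ j).1.toBlocks₁₁ := by
      ext a b
      simp [Matrix.mul_apply, Matrix.toBlocks₁₁]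
    rw [e]
    by_cases hij : i = j
    · subst hij
      rw [inv_mul_cancel, Matrix.one_apply_eq]
      have : ((1 : GL (m ⊕ n) K).1).toBlocks₁₁ = 1 := by
        change (1 : Matrix (m ⊕ n) (m ⊕ n) K).toBlocks₁₁ = 1
        rw [← Matrix.fromBlocks_one, Matrix.toBlocks_fromBlocks₁₁]
      rw [this, Matrix.det_one]
    · rw [Matrix.one_apply_ne hij]
      by_contra hne
      exact hcon i j hij (h _ (Γ.mul_mem (Γ.inv_mem (hγ i)) (hγ j)) hne)
  have h1 : (A * C).rank ≤ D := (Matrix.rank_mul_le_left A C).trans (Matrix.rank_le_card_width A)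
  rw [hAC, Matrix.rank_one, Fintype.card_fin] at h1
  omega

lemma vanish_Hb {K : Type*} [Field K] {F : Set (GL (m ⊕ n) K)} (h1 : 1 ∈ F)
    (h : ∀ j, ∀ γ ∈ F ^ j, (γ.1.toBlocks₁₁).det ≠ 0 → γ.1.toBlocks₂₁ = 0) :
    ∀ γ ∈ Subgroup.closure F, (γ.1.toBlocks₁₁).det ≠ 0 → γ.1.toBlocks₂₁ = 0 := by
  intro γ hγ hne
  ext i j
  have hD : ∃ D, Deg D (fun γ : GL (m ⊕ n) K => (γ.1.toBlocks₁₁).det * γ.1 (Sum.inr i) (Sum.inl j)) := by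
    simp only [Matrix.det_apply']
    exact ⟨_, (Deg.sum _ _ _ fun σ _ => (Deg.const _).mul (Deg.prod _ _ _ fun a _ =>
      Deg.entry (Sum.inl (σ a)) (Sum.inl a))).mul (Deg.entry (Sum.inr i) (Sum.inl j))⟩
  obtain ⟨D, hD⟩ := hD
  have := hD.vanish h1 (fun x hx => by
    by_cases hx0 : (x.1.toBlocks₁₁).det = 0
    · rw [hx0, zero_mul]
    · have := h D x hx hx0
      have e : x.1 (Sum.inr i) (Sum.inl j) = 0 := congrFun (congrFun this i) j
      rw [e, mul_zero]) γ hγ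
  exact (mul_eq_zero.1 this).resolve_left hne

end field

namespace Scale
variable (S : Scale) {m n : Type*} [Fintype m] [Fintype n] [DecidableEq m] [DecidableEq n]

/-- evaluation on GL -/
noncomputable def gev (l : Type*) [Fintype l] [DecidableEq l] (k : ℕ) : GL l S.B →* GL l ℂ := GeneralLinearGroup.map (S.ev k)
/-- reduction on GL -/
noncomputable def gpr (l : Type*) [Fintype l] [DecidableEq l] : GL l S.B →* GL l S.Fl := GeneralLinearGroup.map S.pr

lemma gev_val {l : Type*} [Fintype l] [DecidableEq l] (k : ℕ) (g : GL l S.B) : (S.gev l k g).1 = g.1.map (S.ev k) := rfl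
lemma gpr_val {l : Type*} [Fintype l] [DecidableEq l] (g : GL l S.B) : (S.gpr l g).1 = g.1.map S.pr := rfl

/-- sequences in F -/
def hF {l : Type*} [Fintype l] [DecidableEq l] (F : ℕ → Set (GL l ℂ)) : Set (GL l S.B) := {g | ∀ k, S.gev l k g ∈ F k}

lemma hF_pow {l : Type*} [Fintype l] [DecidableEq l] (F : ℕ → Set (GL l ℂ)) (j : ℕ) (g : GL l S.B)
    (hg : g ∈ S.hF F ^ j) (k : ℕ) : S.gev l k g ∈ F k ^ j := by
  have h1 : S.gev l k '' (S.hF F) ⊆ F k := by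
    rintro _ ⟨x, hx, rfl⟩; exact hx k
  have h2 := Set.image_pow (S.gev l k) (S.hF F) j
  exact Set.pow_subset_pow_left h1 (h2 ▸ Set.mem_image_of_mem _ hg)

lemma exists_hF {l : Type*} [Fintype l] [DecidableEq l] (F : ℕ → Set (GL l ℂ)) (N0 : ℕ)
    (hb : ∀ᶠ k in (UU : Filter ℕ), ∀ f ∈ F k, nv (S.v k) f.1 ≤ S.r k ^ N0) (hdet : ∀ k, ∀ f ∈ F k, f.1.det = 1)
    (f : ℕ → GL l ℂ) (hf : ∀ k, f k ∈ F k) : ∃ g ∈ S.hF F, ∀ k, S.gev l k g = f k := by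
  let A : Matrix l l S.B := S.mkM (fun k => (f k).1) (fun i j => ⟨N0, hb.mono fun k hk =>
    (le_nv (S.v k) (f k).1 i j).trans (hk _ (hf k))⟩)
  have hA : A.det = 1 := by
    apply S.ev_inj
    intro k
    rw [S.det_ev, map_one]
    exact hdet k _ (hf k)
  let g : GL l S.B := Matrix.GeneralLinearGroup.mk'' A (by rw [hA]; exact isUnit_one)
  have hg : ∀ k, S.gev l k g = f k := by
    intro k
    ext i j
    rfl
  exact ⟨g, fun k => by rw [hg k]; exact hf k, hg⟩

lemma eventually_const {α : Type*} (W : Finset α) (f : ℕ → α) (h : ∀ᶠ k in (UU : Filter ℕ), f k ∈ W) :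
    ∃ x ∈ W, ∀ᶠ k in (UU : Filter ℕ), f k = x := by
  have : ∀ᶠ k in (UU : Filter ℕ), ∃ x ∈ (W : Set α), f k = x := by
    filter_upwards [h] with k hk
    exact ⟨_, hk, rfl⟩
  exact (Ultrafilter.eventually_exists_mem_iff W.finite_toSet).1 this

end Scale
end UEG

namespace UEG
set_option linter.unusedVariables false
set_option linter.style.haveILetI false
set_option linter.unusedSectionVars false
open Polynomial Matrix
open scoped Pointwise

namespace Scale
variable (S : Scale) {m n : Type*} [Fintype m] [Fintype n] [DecidableEq m] [DecidableEq n]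

lemma gpr_Hb (g : GL (m ⊕ n) S.B) : S.gpr _ g ∈ Hb m n S.Fl ↔ (g.1.toBlocks₂₁).map S.pr = 0 := Iff.rfl

theorem case2 (F : ℕ → Set (GL (m ⊕ n) ℂ)) (N0 : ℕ) (h1 : ∀ k, 1 ∈ F k)
    (hb : ∀ᶠ k in (UU : Filter ℕ), ∀ f ∈ F k, nv (S.v k) f.1 ≤ S.r k ^ N0) (hdet : ∀ k, ∀ f ∈ F k, f.1.det = 1)
    (hirr : ∀ k, ∀ H ≤ Subgroup.closure (F k), IdxLe (Fintype.card (m → m ⊕ n)) H (Subgroup.closure (F k)) →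
      ∃ h ∈ H, h.1.toBlocks₂₁ ≠ 0)
    (hcase : ∀ j, ∀ γ ∈ S.hF F ^ j, ((γ.1.toBlocks₁₁).map S.pr).det ≠ 0 → (γ.1.toBlocks₂₁).map S.pr = 0) :
    ∃ J, ∃ c ∈ S.hF F ^ J, (c.1.toBlocks₂₁).map S.pr = 0 ∧
      ∀ᶠ k in (UU : Filter ℕ), (S.gev _ k c).1.toBlocks₂₁ ≠ 0 := by
  classical
  have h1' : (1 : GL (m ⊕ n) S.B) ∈ S.hF F := fun k => by rw [map_one]; exact h1 k
  set Hh : Subgroup (GL (m ⊕ n) S.B) := (Hb m n S.Fl).comap (S.gpr _) with hHh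
  have hidx : IdxLe (Fintype.card (m → m ⊕ n)) Hh (Subgroup.closure (S.hF F)) := by
    have h2 : IdxLe (Fintype.card (m → m ⊕ n)) (Hb m n S.Fl) (Subgroup.closure (S.gpr _ '' S.hF F)) := by
      apply idx_Hb
      have h1'' : (1 : GL (m ⊕ n) S.Fl) ∈ S.gpr _ '' S.hF F := ⟨1, h1', map_one _⟩
      apply vanish_Hb h1''
      intro j γ hγ
      rw [← Set.image_pow] at hγ
      obtain ⟨g, hg, rfl⟩ := hγ
      exact hcase j g hg
    intro γ hγ
    obtain ⟨i, j, hij, e⟩ := h2 (fun i => S.gpr _ (γ i)) (fun i => by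
      rw [← MonoidHom.map_closure]; exact Subgroup.mem_map_of_mem _ (hγ i))
    refine ⟨i, j, hij, ?_⟩
    rw [hHh, Subgroup.mem_comap, map_mul, map_inv]
    exact e
  obtain ⟨J, W, hW1, hWc, hWJ, hWt⟩ := exists_W h1' hidx
  set D := Fintype.card (m → m ⊕ n) with hD
  let ρ : GL (m ⊕ n) S.B → GL (m ⊕ n) S.B := fun y => y ^ (D.factorial - 1)
  have hDf : 1 ≤ D.factorial := Nat.factorial_pos D
  have hρ : ∀ y ∈ W, ρ y * y ∈ Hh := by
    intro y hy
    have := idx_pow_mem hidx (pow_sub_closure J (hWJ y hy))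
    rwa [← Nat.sub_add_cancel hDf, pow_succ] at this
  -- argmin
  have hne : W.Nonempty := ⟨1, hW1⟩
  have hmin : ∀ k (f : GL (m ⊕ n) ℂ) (x : GL (m ⊕ n) S.B), ∃ y ∈ W, ∀ z ∈ W,
      nv (S.v k) ((S.gev _ k (ρ y) * f * S.gev _ k x).1.toBlocks₂₁) ≤
      nv (S.v k) ((S.gev _ k (ρ z) * f * S.gev _ k x).1.toBlocks₂₁) := fun k f x =>
    W.exists_min_image (fun y => nv (S.v k) ((S.gev _ k (ρ y) * f * S.gev _ k x).1.toBlocks₂₁)) hne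
  choose Y hYW hYmin using hmin
  let F' : ℕ → Set (GL (m ⊕ n) ℂ) := fun k =>
    {c | (∃ f ∈ F k, ∃ x ∈ W, c = S.gev _ k (ρ (Y k f x)) * f * S.gev _ k x) ∨ ∃ y ∈ W, c = S.gev _ k (ρ y * y)}
  have hgevW : ∀ k, ∀ w ∈ W, S.gev _ k w ∈ Subgroup.closure (F k) := fun k w hw =>
    pow_sub_closure J (S.hF_pow F J w (hWJ w hw) k)
  have hgevρ : ∀ k, ∀ w ∈ W, S.gev _ k (ρ w) ∈ Subgroup.closure (F k) := fun k w hw => by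
    simp only [ρ, map_pow]; exact pow_mem (hgevW k w hw) _
  have hex : ∀ k, ∃ c ∈ F' k, c.1.toBlocks₂₁ ≠ 0 := by
    intro k
    by_contra! hcon
    have hle : Subgroup.closure (F' k) ≤ Subgroup.closure (F k) := by
      rw [Subgroup.closure_le]
      rintro c (⟨f, hf, x, hx, rfl⟩ | ⟨y, hy, rfl⟩)
      · exact mul_mem (mul_mem (hgevρ k _ (hYW k f x)) (Subgroup.subset_closure hf)) (hgevW k x hx)
      · rw [map_mul]; exact mul_mem (hgevρ k y hy) (hgevW k y hy)
    have hid : IdxLe D (Subgroup.closure (F' k)) (Subgroup.closure (F k)) := by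
      apply schreier_idx (S.gev _ k '' (W : Set _)) (W.finite_toSet.image _) ⟨1, hW1, map_one _⟩
      · rintro f hf _ ⟨x, hx, rfl⟩
        refine ⟨_, ⟨Y k f x, hYW k f x, rfl⟩, ?_⟩
        have a1 : S.gev _ k (ρ (Y k f x)) * f * S.gev _ k x ∈ Subgroup.closure (F' k) :=
          Subgroup.subset_closure (Or.inl ⟨f, hf, x, hx, rfl⟩)
        have a2 : S.gev _ k (ρ (Y k f x) * Y k f x) ∈ Subgroup.closure (F' k) :=
          Subgroup.subset_closure (Or.inr ⟨_, hYW k f x, rfl⟩)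
        have := mul_mem (inv_mem a2) a1
        rw [map_mul, _root_.mul_inv_rev] at this
        simpa [mul_assoc] using this
      · refine (Set.ncard_image_le W.finite_toSet).trans ?_
        rw [Set.ncard_coe_finset]; exact hWc
    obtain ⟨h, hh, hne⟩ := hirr k _ hle hid
    have : Subgroup.closure (F' k) ≤ Hb m n ℂ := by
      rw [Subgroup.closure_le]
      intro c hc
      exact hcon c hc
    exact hne (this hh)
  choose c hc hc2 using hex
  -- split
  have hsplit := Ultrafilter.eventually_or.1 (Filter.Eventually.of_forall (f := (UU : Filter ℕ)) hc)
  rcases hsplit with hs | hs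
  · -- first type
    have : ∀ k, ∃ f ∈ F k, ∃ x ∈ W, (∃ f ∈ F k, ∃ x ∈ W, c k = S.gev _ k (ρ (Y k f x)) * f * S.gev _ k x) →
        c k = S.gev _ k (ρ (Y k f x)) * f * S.gev _ k x := by
      intro k
      by_cases h : ∃ f ∈ F k, ∃ x ∈ W, c k = S.gev _ k (ρ (Y k f x)) * f * S.gev _ k x
      · obtain ⟨f, hf, x, hx, e⟩ := h
        exact ⟨f, hf, x, hx, fun _ => e⟩
      · exact ⟨1, h1 k, 1, hW1, fun h' => absurd h' h⟩
    choose f hf x hx he using this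
    obtain ⟨g, hg, hgf⟩ := S.exists_hF F N0 hb hdet f hf
    obtain ⟨x0, hx0, hxe⟩ := eventually_const W x (Filter.Eventually.of_forall hx)
    obtain ⟨y0, hy0, hye⟩ := eventually_const W (fun k => Y k (f k) x0) (Filter.Eventually.of_forall fun k => hYW _ _ _)
    obtain ⟨z, hz, hzH⟩ := hWt g hg x0 hx0
    refine ⟨J * (D.factorial - 1) + 1 + J, ρ y0 * g * x0, ?_, ?_, ?_⟩
    · rw [pow_add, pow_add, pow_one, pow_mul]
      exact Set.mul_mem_mul (Set.mul_mem_mul (Set.pow_mem_pow (hWJ y0 hy0)) hg) (hWJ x0 hx0)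
    · have hzs : ρ z * g * x0 ∈ Hh := by
        have := mul_mem (hρ z hz) hzH
        simpa [mul_assoc] using this
      have hsm := S.small ((ρ z * g * x0).1.toBlocks₂₁) hzs
      ext i j
      change S.pr _ = 0
      rw [S.pr_eq_zero]
      intro t
      filter_upwards [hsm t, hye] with k hk hk2
      refine le_trans (mul_le_mul_of_nonneg_right ?_ (pow_pos (S.r_pos k) _).le) hk
      have h3 := hYmin k (f k) x0 z hz
      rw [hk2] at h3
      rw [← hgf k, ← map_mul, ← map_mul, ← map_mul, ← map_mul] at h3
      exact (le_nv (S.v k) ((S.gev _ k (ρ y0 * g * x0)).1.toBlocks₂₁) i j).trans h3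
    · filter_upwards [hs, hxe, hye] with k k1 k2 k3
      have := hc2 k
      rw [he k k1, k2, k3, ← hgf k, ← map_mul, ← map_mul] at this
      exact this
  · have : ∀ k, ∃ y ∈ W, (∃ y ∈ W, c k = S.gev _ k (ρ y * y)) → c k = S.gev _ k (ρ y * y) := by
      intro k
      by_cases h : ∃ y ∈ W, c k = S.gev _ k (ρ y * y)
      · obtain ⟨y, hy, e⟩ := h
        exact ⟨y, hy, fun _ => e⟩
      · exact ⟨1, hW1, fun h' => absurd h' h⟩
    choose y hy he using this
    obtain ⟨y0, hy0, hye⟩ := eventually_const W y (Filter.Eventually.of_forall hy)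
    refine ⟨J * (D.factorial - 1) + J, ρ y0 * y0, ?_, hρ y0 hy0, ?_⟩
    · rw [pow_add, pow_mul]
      exact Set.mul_mem_mul (Set.pow_mem_pow (hWJ y0 hy0)) (hWJ y0 hy0)
    · filter_upwards [hs, hye] with k k1 k2
      have := hc2 k
      rw [he k k1, k2] at this
      exact this

/-- the ping-pong pair exists eventually -/
theorem pair [Nonempty m] [Nonempty n] (F : ℕ → Set (GL (m ⊕ n) ℂ)) (N0 : ℕ) (h1 : ∀ k, 1 ∈ F k)
    (hb : ∀ᶠ k in (UU : Filter ℕ), ∀ f ∈ F k, nv (S.v k) f.1 ≤ S.r k ^ N0) (hdet : ∀ k, ∀ f ∈ F k, f.1.det = 1)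
    (hirr : ∀ k, ∀ H ≤ Subgroup.closure (F k), IdxLe (Fintype.card (m → m ⊕ n)) H (Subgroup.closure (F k)) →
      ∃ h ∈ H, h.1.toBlocks₂₁ ≠ 0)
    (Wp : Matrix m m S.B) (X : Matrix m n S.B) (Wm : Matrix n n S.B) (hX : X.map S.pr = 0)
    (hWdet : (Wp.map S.pr).det ≠ 0)
    (hW : ∀ t : ℕ, ∃ M : ℕ, ∀ᶠ k in (UU : Filter ℕ),
      nv (S.v k) ((Wm.map (S.ev k)) ^ M) * nv (S.v k) ((Wp.map (S.ev k)) ^ M)⁻¹ * S.r k ^ t ≤ 1) :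
    ∃ M J : ℕ, ∀ᶠ k in (UU : Filter ℕ), ∀ a : GL (m ⊕ n) ℂ, a.1 = (fromBlocks Wp X 0 Wm).map (S.ev k) →
      ∃ c ∈ F k ^ J, Gr 2 ({a ^ M, c * a ^ M} : Set (GL (m ⊕ n) ℂ)) := by
  by_cases hcase : ∀ j, ∀ γ ∈ S.hF F ^ j, ((γ.1.toBlocks₁₁).map S.pr).det ≠ 0 → (γ.1.toBlocks₂₁).map S.pr = 0
  · obtain ⟨J, c, hc, hc0, hcne⟩ := S.case2 F N0 h1 hb hdet hirr hcase
    have hcu : ((c.1.toBlocks₁₁).map S.pr).det ≠ 0 := (Hb_det (S.gpr _ c) hc0).ne_zero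
    have hmax : ∀ k, ∃ p : n × m, ∀ q : n × m, S.v k ((S.gev _ k c).1 (Sum.inr q.1) (Sum.inl q.2)) ≤
        S.v k ((S.gev _ k c).1 (Sum.inr p.1) (Sum.inl p.2)) := fun k =>
      Finite.exists_max (fun q : n × m => S.v k ((S.gev _ k c).1 (Sum.inr q.1) (Sum.inl q.2)))
    choose p hp using hmax
    let t : ℕ → ℂ := fun k => (S.gev _ k c).1 (Sum.inr (p k).1) (Sum.inl (p k).2)
    have htne : ∀ᶠ k in (UU : Filter ℕ), t k ≠ 0 := by
      filter_upwards [hcne] with k hk h0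
      apply hk
      ext i j
      have := hp k (i, j)
      change _ ≤ S.v k (t k) at this
      rw [h0, map_zero] at this
      exact (S.v k).eq_zero.1 (le_antisymm this ((S.v k).nonneg _))
    obtain ⟨q, hq⟩ := S.bd_nv c.1
    let τ : S.B := ⟨t, q, by
      filter_upwards [hq] with k hk
      exact (le_nv (S.v k) (c.1.map (S.ev k)) _ _).trans hk⟩
    let d21 : Matrix n m S.B := S.mkM (fun k => (t k)⁻¹ • (S.gev _ k c).1.toBlocks₂₁) (fun i j => ⟨0, by
      filter_upwards with k
      rw [pow_zero, Matrix.smul_apply, smul_eq_mul, map_mul, map_inv₀]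
      exact inv_mul_le_one_of_le₀ (hp k (i, j)) ((S.v k).nonneg _)⟩)
    have hd21 : d21.map S.pr ≠ 0 := by
      intro h0
      obtain ⟨k, hk, hk2⟩ := ((S.small d21 h0 1).and htne).exists
      have h3 := le_nv (S.v k) (d21.map (S.ev k)) (p k).1 (p k).2
      have h4 : d21.map (S.ev k) (p k).1 (p k).2 = 1 := by
        change (t k)⁻¹ * t k = 1
        exact inv_mul_cancel₀ hk2
      rw [h4, map_one] at h3
      have := S.hr k
      rw [pow_one] at hk
      nlinarith
    obtain ⟨M, hM⟩ := S.pps Wp (τ • X) Wm (by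
        ext i j
        have : S.pr (X i j) = 0 := congrFun (congrFun hX i) j
        simp [this]) hWdet hW c.1.toBlocks₁₁ (τ • c.1.toBlocks₁₂) d21 c.1.toBlocks₂₂ hcu hd21
    refine ⟨M, J, ?_⟩
    filter_upwards [hM, htne] with k hk ht a ha
    refine ⟨S.gev _ k c, S.hF_pow F J c hc k, ?_⟩
    let T : GL (m ⊕ n) ℂ := ⟨fromBlocks 1 0 0 ((t k) • 1), fromBlocks 1 0 0 ((t k)⁻¹ • 1), by
      rw [Matrix.fromBlocks_multiply]; simp [ht], by rw [Matrix.fromBlocks_multiply]; simp [ht]⟩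
    have hconj : ∀ g : GL (m ⊕ n) ℂ, (T⁻¹ * g * T).1 = fromBlocks g.1.toBlocks₁₁ (t k • g.1.toBlocks₁₂)
        ((t k)⁻¹ • g.1.toBlocks₂₁) g.1.toBlocks₂₂ := by
      intro g
      change fromBlocks 1 0 0 ((t k)⁻¹ • 1) * g.1 * fromBlocks 1 0 0 ((t k) • 1) = _
      conv_lhs => rw [← Matrix.fromBlocks_toBlocks g.1]
      rw [Matrix.fromBlocks_multiply, Matrix.fromBlocks_multiply]
      simp [ht, smul_smul]
    have key := hk (T⁻¹ * a * T) (T⁻¹ * S.gev _ k c * T) (by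
      rw [hconj, ha, Matrix.fromBlocks_map, Matrix.fromBlocks_map]
      congr 1
      simp) (by
      rw [hconj]
      rw [Matrix.fromBlocks_map]
      congr 1)
    refine gr_hom (MulAut.conj T⁻¹).toMonoidHom (by simp) ?_
    have e : ∀ g : GL (m ⊕ n) ℂ, (MulAut.conj T⁻¹).toMonoidHom g = T⁻¹ * g * T := fun g => by simp
    rw [Set.image_pair, map_mul, map_pow, e, e]
    exact key
  · push Not at hcase
    obtain ⟨J, c, hc, h11, h21⟩ := hcase
    obtain ⟨M, hM⟩ := S.pps Wp X Wm hX hWdet hW c.1.toBlocks₁₁ c.1.toBlocks₁₂ c.1.toBlocks₂₁ c.1.toBlocks₂₂ h11 h21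
    refine ⟨M, J, ?_⟩
    filter_upwards [hM] with k hk a ha
    refine ⟨S.gev _ k c, S.hF_pow F J c hc k, hk a _ ha ?_⟩
    rw [Matrix.fromBlocks_toBlocks]; rfl

end Scale
end UEG

namespace UEG
set_option linter.unusedVariables false
set_option linter.style.haveILetI false
set_option linter.unusedSectionVars false
open Polynomial Matrix
open scoped Pointwise

/-- Sylvester map -/
def sylvL {K : Type*} [Field K] {m n : Type*} [Fintype m] [Fintype n] [DecidableEq m] [DecidableEq n]
    (A : Matrix m m K) (D : Matrix n n K) : Matrix m n K →ₗ[K] Matrix m n K :=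
  { toFun := fun N => A * N - N * D
    map_add' := fun x y => by rw [Matrix.mul_add, Matrix.add_mul]; abel
    map_smul' := fun c x => by rw [Matrix.mul_smul, Matrix.smul_mul, RingHom.id_apply, ← smul_sub] }

namespace Scale
variable (S : Scale) {m n : Type*} [Fintype m] [Fintype n] [DecidableEq m] [DecidableEq n]

lemma sylv (A : Matrix m m S.B) (X : Matrix m n S.B) (D : Matrix n n S.B)
    (hdet : (A.map S.pr).det ≠ 0)
    (hW : ∀ t : ℕ, ∃ M : ℕ, ∀ᶠ k in (UU : Filter ℕ),
      nv (S.v k) ((D.map (S.ev k)) ^ M) * nv (S.v k) ((A.map (S.ev k)) ^ M)⁻¹ * S.r k ^ t ≤ 1) :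
    ∃ N : Matrix m n S.B, (A * N + X - N * D).map S.pr = 0 := by
  let L := sylvL (A.map S.pr) (D.map S.pr)
  have hlift : ∀ Y : Matrix m n S.Fl, ∃ N : Matrix m n S.B, N.map S.pr = Y := by
    intro Y
    choose f hf using S.pr_surj
    exact ⟨Matrix.of fun i j => f (Y i j), by ext i j; exact hf _⟩
  have hinj : Function.Injective L := by
    rw [← LinearMap.ker_eq_bot, LinearMap.ker_eq_bot']
    intro Y hY
    obtain ⟨N, rfl⟩ := hlift Y
    have hY' : A.map S.pr * N.map S.pr = N.map S.pr * D.map S.pr := sub_eq_zero.1 hY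
    obtain ⟨M, hM⟩ := hW 1
    have hpow : ∀ M : ℕ, (A.map S.pr) ^ M * N.map S.pr = N.map S.pr * (D.map S.pr) ^ M := by
      intro M
      induction M with
      | zero => simp
      | succ M ih => rw [pow_succ, Matrix.mul_assoc, hY', ← Matrix.mul_assoc, ih, Matrix.mul_assoc, ← pow_succ]
    have hΔ : (A ^ M * N - N * D ^ M).map S.pr = 0 := by
      have e1 : (A ^ M).map S.pr = (A.map S.pr) ^ M := map_pow (S.pr.mapMatrix) A M
      have e2 : (D ^ M).map S.pr = (D.map S.pr) ^ M := map_pow (S.pr.mapMatrix) D M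
      rw [Matrix.map_sub _ (map_sub S.pr), Matrix.map_mul, Matrix.map_mul, e1, e2, hpow, sub_self]
    have hdM : ((A ^ M).map S.pr).det ≠ 0 := by
      have : (A ^ M).map S.pr = (A.map S.pr) ^ M := map_pow (S.pr.mapMatrix) A M
      rw [this, Matrix.det_pow]
      exact pow_ne_zero _ hdet
    obtain ⟨q, hq⟩ := S.inv_bd (A ^ M) hdM
    ext i j
    change S.pr (N i j) = 0
    rw [S.pr_eq_zero]
    intro t
    filter_upwards [hM, hq, S.small _ hΔ (q + t + 1)] with k k1 k2 k3
    have hr := S.hr k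
    set Ak := (A ^ M).map (S.ev k) with hAk
    set Δ := (A ^ M * N - N * D ^ M).map (S.ev k) with hΔk
    set Nk := N.map (S.ev k) with hNk
    have e3 : Δ = Ak * Nk - Nk * (D.map (S.ev k)) ^ M := by
      rw [hΔk, Matrix.map_sub _ (map_sub (S.ev k)), Matrix.map_mul, Matrix.map_mul, ← S.map_pow']
    have e4 : Nk = Ak⁻¹ * (Nk * (D.map (S.ev k)) ^ M) + Ak⁻¹ * Δ := by
      rw [e3, ← Matrix.mul_add, add_sub_cancel, ← Matrix.mul_assoc, Matrix.nonsing_inv_mul _ (isUnit_iff_ne_zero.2 k2.1),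
        Matrix.one_mul]
    rw [← S.map_pow' A, ← hAk, pow_one] at k1
    have n1 := nv_nonneg (S.v k) Ak⁻¹
    have n2 := nv_nonneg (S.v k) Nk
    have n3 := nv_nonneg (S.v k) Δ
    have n4 := nv_nonneg (S.v k) ((D.map (S.ev k)) ^ M)
    have h5 : nv (S.v k) Nk ≤ nv (S.v k) Ak⁻¹ * (nv (S.v k) Nk * nv (S.v k) ((D.map (S.ev k)) ^ M)) + S.r k ^ q * nv (S.v k) Δ := by
      conv_lhs => rw [e4]
      refine (nv_add _ _ _).trans (add_le_add ?_ ?_)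
      · exact (nv_mul _ _ _).trans (mul_le_mul_of_nonneg_left (nv_mul _ _ _) n1)
      · exact (nv_mul _ _ _).trans (mul_le_mul_of_nonneg_right k2.2 n3)
    have h6 : nv (S.v k) ((D.map (S.ev k)) ^ M) * nv (S.v k) Ak⁻¹ ≤ 1/2 := by
      have : 0 ≤ nv (S.v k) ((D.map (S.ev k)) ^ M) * nv (S.v k) Ak⁻¹ := by positivity
      nlinarith
    have h7 : nv (S.v k) Nk ≤ 2 * (S.r k ^ q * nv (S.v k) Δ) := by nlinarith
    have hp : 0 < S.r k ^ t := pow_pos (S.r_pos k) t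
    have hpq : 0 < S.r k ^ q := pow_pos (S.r_pos k) q
    calc S.v k (S.ev k (N i j)) * S.r k ^ t ≤ nv (S.v k) Nk * S.r k ^ t :=
          mul_le_mul_of_nonneg_right (le_nv (S.v k) Nk i j) hp.le
      _ ≤ (2 * (S.r k ^ q * nv (S.v k) Δ)) * S.r k ^ t := by gcongr
      _ ≤ (S.r k * (S.r k ^ q * nv (S.v k) Δ)) * S.r k ^ t := by gcongr
      _ = nv (S.v k) Δ * S.r k ^ (q + t + 1) := by ring
      _ ≤ 1 := k3
  obtain ⟨Y, hY⟩ := (LinearMap.injective_iff_surjective.1 hinj) (-(X.map S.pr))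
  obtain ⟨N, rfl⟩ := hlift Y
  refine ⟨N, ?_⟩
  rw [Matrix.map_sub _ (map_sub S.pr), Matrix.map_add _ (map_add S.pr), Matrix.map_mul, Matrix.map_mul]
  have : A.map S.pr * N.map S.pr - N.map S.pr * D.map S.pr = -(X.map S.pr) := hY
  rw [add_sub_right_comm, this]; simp

end Scale

lemma gapW (v : AbsoluteValue ℂ ℝ) (r : ℝ) (hr : 2 ≤ r) {κ n : ℕ} (N : ℕ) (A : Matrix (Fin κ) (Fin κ) ℂ)
    (D : Matrix (Fin n) (Fin n) ℂ) (hA : ∀ i j, j < i → A i j = 0) (hD : ∀ i j, j < i → D i j = 0)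
    (hdet : A.det ≠ 0) (nA : nv v A⁻¹ ≤ r ^ N) (nD : nv v D ≤ r ^ N) (a b : ℝ) (ha : 0 < a) (hab : a * r ^ 2 ≤ b)
    (haN : 1 ≤ a * r ^ N) (hbN : b ≤ r ^ N) (hAb : ∀ i, b ≤ v (A i i)) (hDa : ∀ i, v (D i i) ≤ a)
    (hκn : (κ : ℝ) * n ≤ r) (M : ℕ) :
    nv v (D ^ M) * nv v (A ^ M)⁻¹ * r ^ M ≤ r ^ (2 + 2 * N * (n + κ)) := by
  have hr1 : 1 ≤ r := by linarith
  have hr0 : 0 < r := by linarith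
  have hb : 0 < b := lt_of_lt_of_le (by positivity) hab
  have hu : IsUnit A.det := isUnit_iff_ne_zero.2 hdet
  have hq1 : 1 ≤ r ^ (2 * N) := one_le_pow₀ hr1
  have h1 := tri_pow v D a (r ^ (2*N)) ha.le hq1 hD hDa (fun i j => by
    refine (le_nv v D i j).trans (nD.trans ?_)
    rw [two_mul, pow_add, ← mul_assoc]
    exact le_mul_of_one_le_left (by positivity) haN) M
  have hinv := Matrix.invertibleOfIsUnitDet A hu
  have htri : ∀ i j, j < i → A⁻¹ i j = 0 := by
    have h2 : A.BlockTriangular id := fun i j h => hA i j h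
    have h3 := Matrix.blockTriangular_inv_of_blockTriangular h2
    exact fun i j h => h3 h
  have hdiag : ∀ i, v (A⁻¹ i i) ≤ b⁻¹ := by
    intro i
    have h2 := congrFun (congrFun (Matrix.mul_nonsing_inv A hu) i) i
    rw [Matrix.mul_apply, Finset.sum_eq_single i, Matrix.one_apply_eq] at h2
    · have h3 := congrArg v h2
      rw [map_mul, map_one] at h3
      rw [le_inv_comm₀ ?_ hb]
      · refine (hAb i).trans (le_of_eq ?_)
        exact eq_inv_of_mul_eq_one_left h3
      · rcases (v.nonneg (A⁻¹ i i)).lt_or_eq with h | h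
        · exact h
        · rw [← h, mul_zero] at h3; norm_num at h3
    · intro j _ hj
      rcases lt_or_gt_of_ne hj with h | h
      · rw [hA i j h, zero_mul]
      · rw [htri j i h, mul_zero]
    · simp
  have h2 := tri_pow v A⁻¹ b⁻¹ (r ^ (2*N)) (inv_nonneg.2 hb.le) hq1 htri hdiag (fun i j => by
    refine (le_nv v A⁻¹ i j).trans (nA.trans ?_)
    rw [two_mul, pow_add, ← mul_assoc]
    refine le_mul_of_one_le_left (by positivity) ?_
    rw [← div_eq_inv_mul, one_le_div hb]
    exact hbN) M
  have e : (A ^ M)⁻¹ = A⁻¹ ^ M := (Matrix.inv_pow' A M).symm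
  rw [e]
  have hx : b⁻¹ * a * r ≤ r⁻¹ := by
    rw [← div_eq_inv_mul, div_mul_eq_mul_div, div_le_iff₀ hb, ← div_eq_inv_mul, le_div_iff₀ hr0]
    nlinarith
  have hxM : (b⁻¹ * a * r) ^ M * r ^ M ≤ 1 := by
    rw [← mul_pow]
    refine pow_le_one₀ (by positivity) ?_
    calc b⁻¹ * a * r * r ≤ r⁻¹ * r := by gcongr
      _ = 1 := inv_mul_cancel₀ hr0.ne'
  have hκ0 : (0:ℝ) ≤ (κ:ℝ) * n := by positivity
  calc nv v (D ^ M) * nv v (A⁻¹ ^ M) * r ^ M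
      ≤ (n * n * (n ^ M * a ^ M * (r ^ (2*N)) ^ n)) * (κ * κ * (κ ^ M * b⁻¹ ^ M * (r ^ (2*N)) ^ κ)) * r ^ M := by
        have := nv_nonneg v (A⁻¹ ^ M)
        have := nv_nonneg v (D ^ M)
        gcongr
    _ = ((κ:ℝ) * n) ^ 2 * (((κ:ℝ) * n) ^ M * (b⁻¹ * a) ^ M * r ^ M) * r ^ (2 * N * (n + κ)) := by
        rw [mul_pow, mul_pow, mul_pow, mul_add, pow_add, pow_mul r (2*N) n, pow_mul r (2*N) κ]; ring
    _ ≤ r ^ 2 * (r ^ M * (b⁻¹ * a) ^ M * r ^ M) * r ^ (2 * N * (n + κ)) := by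
        gcongr
    _ = r ^ 2 * ((b⁻¹ * a * r) ^ M * r ^ M) * r ^ (2 * N * (n + κ)) := by
        rw [mul_pow _ r]; ring
    _ ≤ r ^ 2 * 1 * r ^ (2 * N * (n + κ)) := by gcongr
    _ = _ := by rw [pow_add]; ring

/-- compatible homomorphisms -/
def Cpt {l l' : Type*} [Fintype l] [Fintype l'] [DecidableEq l] [DecidableEq l'] (φ : GL l ℂ →* GL l' ℂ) : Prop :=
  ∃ Ψ : (l → ℂ) ≃ₗ[ℂ] (l' → ℂ), ∀ g x, Ψ (g.1 *ᵥ x) = (φ g).1 *ᵥ Ψ x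

section cpt
variable {l l' l'' : Type*} [Fintype l] [Fintype l'] [DecidableEq l] [DecidableEq l'] [Fintype l''] [DecidableEq l'']

lemma Cpt.comp {φ : GL l ℂ →* GL l' ℂ} {ψ : GL l' ℂ →* GL l'' ℂ} (hψ : Cpt ψ) (hφ : Cpt φ) : Cpt (ψ.comp φ) := by
  obtain ⟨Ψ, h⟩ := hφ
  obtain ⟨Ψ', h'⟩ := hψ
  exact ⟨Ψ.trans Ψ', fun g x => by simp [h, h']⟩

lemma Cpt.conj (P : GL l ℂ) : Cpt (MulAut.conj P⁻¹).toMonoidHom := by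
  refine ⟨{ toFun := fun x => P⁻¹.1 *ᵥ x
            invFun := fun x => P.1 *ᵥ x
            map_add' := fun x y => Matrix.mulVec_add _ _ _
            map_smul' := fun c x => Matrix.mulVec_smul _ _ _
            left_inv := fun x => by
              change P.1 *ᵥ (P⁻¹.1 *ᵥ x) = x
              rw [Matrix.mulVec_mulVec, ← Units.val_mul, mul_inv_cancel, Units.val_one, Matrix.one_mulVec]
            right_inv := fun x => by
              change P⁻¹.1 *ᵥ (P.1 *ᵥ x) = x
              rw [Matrix.mulVec_mulVec, ← Units.val_mul, inv_mul_cancel, Units.val_one, Matrix.one_mulVec] }, ?_⟩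
  intro g x
  change P⁻¹.1 *ᵥ (g.1 *ᵥ x) = ((MulAut.conj P⁻¹) g).1 *ᵥ (P⁻¹.1 *ᵥ x)
  rw [MulAut.conj_apply, inv_inv, Matrix.mulVec_mulVec, Matrix.mulVec_mulVec, ← Units.val_mul, ← Units.val_mul]
  congr 2
  group

/-- reindexing -/
def rix (e : l' ≃ l) : GL l ℂ →* GL l' ℂ := Units.map (Matrix.reindexAlgEquiv ℂ ℂ e.symm : Matrix l l ℂ →* Matrix l' l' ℂ)

lemma rix_val (e : l' ≃ l) (g : GL l ℂ) : (rix e g).1 = g.1.submatrix e e := rfl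

lemma Cpt.rix (e : l' ≃ l) : Cpt (rix e) := by
  refine ⟨LinearEquiv.funCongrLeft ℂ ℂ e, fun g x => ?_⟩
  rw [rix_val]
  ext i
  simp only [LinearEquiv.funCongrLeft_apply, LinearMap.funLeft_apply]
  have : (LinearMap.funLeft ℂ ℂ e) x = x ∘ e := rfl
  rw [this, Matrix.submatrix_mulVec_equiv]
  simp [Function.comp_assoc]

lemma hirr_of {d : ℕ} {m n : Type*} [Fintype m] [Fintype n] [DecidableEq m] [DecidableEq n] [Nonempty m] [Nonempty n]
    {φ : GL (Fin d) ℂ →* GL (m ⊕ n) ℂ} (hφ : Cpt φ) (F : Set (GL (Fin d) ℂ)) (N D : ℕ) (hDN : D ≤ N) (hN : NoRed N F)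
    (H : Subgroup (GL (m ⊕ n) ℂ)) (hH : H ≤ Subgroup.closure (φ '' F))
    (hI : IdxLe D H (Subgroup.closure (φ '' F))) : ∃ h ∈ H, h.1.toBlocks₂₁ ≠ 0 := by
  by_contra! hcon
  obtain ⟨Ψ, hΨ⟩ := hφ
  have h1 : Irr ((H.comap φ ⊓ Subgroup.closure F : Subgroup (GL (Fin d) ℂ)) : Set (GL (Fin d) ℂ)) := by
    apply hN _ inf_le_right
    apply IdxLe.mono hDN le_rfl
    intro γ hγ
    obtain ⟨i, j, hij, e⟩ := hI (fun i => φ (γ i)) (fun i => by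
      rw [← MonoidHom.map_closure]; exact Subgroup.mem_map_of_mem _ (hγ i))
    refine ⟨i, j, hij, Subgroup.mem_inf.2 ⟨?_, Subgroup.mul_mem _ (Subgroup.inv_mem _ (hγ i)) (hγ j)⟩⟩
    rw [Subgroup.mem_comap, map_mul, map_inv]
    exact e
  let U : Submodule ℂ (Fin d → ℂ) :=
    { carrier := {x | ∀ j : n, Ψ x (Sum.inr j) = 0}
      add_mem' := fun {a b} ha hb j => by simp [ha j, hb j]
      zero_mem' := fun j => by simp
      smul_mem' := fun c x hx j => by simp [hx j] }
  have hU := h1 U (by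
    rintro g ⟨hg, -⟩ x hx j
    rw [hΨ]
    have hg0 := hcon (φ g) hg
    rw [Matrix.mulVec, dotProduct, Fintype.sum_sum_type]
    have e1 : ∀ i : m, (φ g).1 (Sum.inr j) (Sum.inl i) = 0 := fun i => congrFun (congrFun hg0 j) i
    have e2 : ∀ i : n, Ψ x (Sum.inr i) = 0 := hx
    simp [e1, e2])
  rcases hU with hU | hU
  · obtain ⟨i⟩ := ‹Nonempty m›
    have hm : Ψ.symm (Pi.single (Sum.inl i) 1) ∈ U := fun j => by simp
    rw [hU, Submodule.mem_bot] at hm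
    have := congrArg Ψ hm
    rw [LinearEquiv.apply_symm_apply, map_zero] at this
    have := congrFun this (Sum.inl i)
    simp at this
  · obtain ⟨j⟩ := ‹Nonempty n›
    have hm : Ψ.symm (Pi.single (Sum.inr j) 1) ∈ U := by rw [hU]; trivial
    have := hm j
    simp at this

end cpt

end UEG

namespace UEG
set_option linter.unusedVariables false
set_option linter.style.haveILetI false
set_option linter.unusedSectionVars false
open Polynomial Matrix
open scoped Pointwise

lemma gap_real {d : ℕ} (hd : 1 ≤ d) (x : Fin d → ℝ) (r : ℝ) (hr : 2 ≤ r) (hx : ∀ i, 0 < x i) (hprod : ∏ i, x i = 1)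
    (h0 : r ^ (3 * d) ≤ x ⟨0, hd⟩) : ∃ κ : ℕ, ∃ h1 : 1 ≤ κ, ∃ h2 : κ < d, x ⟨κ, h2⟩ * r ^ 2 ≤ x ⟨κ - 1, by omega⟩ := by
  by_contra! hcon
  have hr0 : 0 < r := by linarith
  have key : ∀ i : ℕ, ∀ hi : i < d, r ^ (3 * d) ≤ x ⟨i, hi⟩ * r ^ (2 * i) := by
    intro i
    induction i with
    | zero => intro hi; simpa using h0
    | succ i ih =>
      intro hi
      have h3 := hcon (i+1) (by omega) hi
      simp only [Nat.add_sub_cancel] at h3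
      refine (ih (by omega)).trans ?_
      rw [mul_add, mul_one, pow_add, mul_comm (r ^ (2 * i)), ← mul_assoc]
      gcongr
  have h1 : ∀ i, 1 < x i := by
    intro i
    have h2 := key i.1 i.2
    have h3 : r ^ (2 * i.1) * r ≤ r ^ (3 * d) := by
      rw [← pow_succ]; exact pow_le_pow_right₀ (by linarith) (by have := i.2; omega)
    have h4 : 0 < r ^ (2 * i.1) := by positivity
    have h5 : r ≤ x i := by
      by_contra! h6
      have h7 : x i * r ^ (2 * i.1) < r * r ^ (2 * i.1) := mul_lt_mul_of_pos_right h6 h4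
      have h8 : x ⟨i.1, i.2⟩ = x i := rfl
      rw [h8] at h2
      nlinarith
    linarith
  haveI : NeZero d := ⟨by omega⟩
  have h2 : 1 < ∏ i, x i := by
    have := Finset.prod_lt_prod_of_nonempty (s := (Finset.univ : Finset (Fin d))) (f := fun _ => (1:ℝ)) (g := x)
      (fun i _ => one_pos) (fun i _ => h1 i) ⟨0, Finset.mem_univ _⟩
    simpa using this
  linarith

lemma nv_pow_mem {l : Type*} [Fintype l] [DecidableEq l] (v : AbsoluteValue ℂ ℝ) (F : Set (GL l ℂ)) (b : ℝ) (hb : 0 ≤ b)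
    (hF : ∀ f ∈ F, nv v f.1 ≤ b) (j : ℕ) : ∀ u ∈ F ^ j, nv v u.1 ≤ Fintype.card l * b ^ j := by
  induction j with
  | zero =>
    intro u hu
    rw [pow_zero, Set.mem_one] at hu
    subst hu
    simp [nv_one_le]
  | succ j ih =>
    intro u hu
    rw [pow_succ] at hu
    obtain ⟨x, hx, y, hy, rfl⟩ := hu
    have h1 := ih x hx
    have h2 := hF y hy
    have h3 := nv_nonneg v x.1
    have h4 := nv_nonneg v y.1
    calc nv v (x * y).1 ≤ nv v x.1 * nv v y.1 := nv_mul v _ _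
      _ ≤ (Fintype.card l * b ^ j) * b := by gcongr
      _ = _ := by ring

lemma diag_of_root {d : ℕ} (T : Matrix (Fin d) (Fin d) ℂ) (hT : ∀ i j, j < i → T i j = 0) (l : ℂ)
    (h : T.charpoly.IsRoot l) : ∃ i, T i i = l := by
  rw [Matrix.charpoly_of_isUpperTriangular T (fun i j hij => hT i j hij), IsRoot.def, eval_prod, Finset.prod_eq_zero_iff] at h
  obtain ⟨i, -, hi⟩ := h
  refine ⟨i, ?_⟩
  simp at hi
  exact (sub_eq_zero.1 hi).symm

lemma cp_conj {d : ℕ} (P : GL (Fin d) ℂ) (u : Matrix (Fin d) (Fin d) ℂ) : (P⁻¹.1 * u * P.1).charpoly = u.charpoly := by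
  rw [Matrix.coe_units_inv]
  exact Matrix.charpoly_units_conj' P u

lemma normal_form (d : ℕ) (hd : 1 ≤ d) : ∃ N N2 : ℕ, ∃ R : ℝ, ∀ (v : AbsoluteValue ℂ ℝ) (F : Set (GL (Fin d) ℂ)),
    F.Finite → 1 ∈ F → (∀ f ∈ F, f.1.det = 1) → (∃ u ∈ F, ∃ l, u.1.charpoly.IsRoot l ∧ R ≤ v l) →
    ∃ r : ℝ, 2 ≤ r ∧ (d : ℝ) * d ≤ r ∧ ∃ V : GL (Fin d) ℂ, (∀ f ∈ F, nv v (V⁻¹ * f * V).1 ≤ r ^ N2) ∧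
      ∃ j ≤ N, ∃ w ∈ F ^ j, (∀ i j, j < i → (V⁻¹ * w * V).1 i j = 0) ∧ nv v (V⁻¹ * w * V).1 ≤ r ^ N2 ∧
      ∃ κ : ℕ, 1 ≤ κ ∧ κ < d ∧ ∃ a b : ℝ, 0 < a ∧ a * r ^ 2 ≤ b ∧ 1 ≤ a * r ^ N2 ∧ b ≤ r ^ N2 ∧
        (∀ i : Fin d, i.1 < κ → b ≤ v ((V⁻¹ * w * V).1 i i)) ∧ ∀ i : Fin d, κ ≤ i.1 → v ((V⁻¹ * w * V).1 i i) ≤ a := by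
  obtain ⟨N, c0, hc0, hB⟩ := bochi d hd
  obtain ⟨C, hC1, hC⟩ := schur d
  obtain ⟨c', hc'⟩ := ev_pow_two C
  obtain ⟨K, hK⟩ : ∃ K : ℝ, K = max 2 (max ((d:ℝ) * d) c0⁻¹) := ⟨_, rfl⟩
  have hd1 : (1:ℝ) ≤ d := by exact_mod_cast hd
  refine ⟨N, (1 + (4 * d + 2 * c') * (N+1)) * d, K ^ (4 * d), ?_⟩
  intro v F hF h1 hdet ⟨u, hu, l0, hl0, hR⟩
  obtain ⟨P, E, hE1, hPE, j, hj1, hjN, w, hw, l, hl, hlE⟩ := hB v F hF h1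
  have hE : K ^ (4 * d) ≤ E := by
    refine hR.trans ((root_le_nv v (P⁻¹.1 * u.1 * P.1) l0 ?_).trans (hPE u hu))
    rw [cp_conj]; exact hl0
  have hK2 : 2 ≤ K := hK ▸ le_max_left _ _
  have hKd : (d:ℝ) * d ≤ K := hK ▸ (le_max_left _ _).trans (le_max_right _ _)
  have hKc : c0⁻¹ ≤ K := hK ▸ (le_max_right _ _).trans (le_max_right _ _)
  obtain ⟨r, hr0, hrE⟩ : ∃ r : ℝ, 0 ≤ r ∧ r ^ (4 * d) = E := by
    refine ⟨E ^ (1 / ((4 * d : ℕ) : ℝ)), by positivity, ?_⟩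
    rw [← Real.rpow_natCast, ← Real.rpow_mul (by linarith), one_div, inv_mul_cancel₀, Real.rpow_one]
    positivity
  have hrK : K ≤ r := by
    rw [← hrE] at hE
    exact le_of_pow_le_pow_left₀ (by omega) hr0 hE
  have hr2 : 2 ≤ r := hK2.trans hrK
  have hr1 : 1 ≤ r := by linarith
  have hrp : 0 < r := by linarith
  obtain ⟨Q, hQ1, hQ2, hQt, hQs⟩ := hC v (P⁻¹.1 * w.1 * P.1)
  have hCr : C ≤ r ^ c' := hc'.trans (pow_le_pow_left₀ (by norm_num) hr2 _)
  have hval : ∀ f : GL (Fin d) ℂ, ((P * Q)⁻¹ * f * (P * Q)).1 = Q⁻¹.1 * (P⁻¹.1 * f.1 * P.1) * Q.1 := by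
    intro f
    rw [show (P * Q)⁻¹ * f * (P * Q) = Q⁻¹ * (P⁻¹ * f * P) * Q by group]
    simp only [Units.val_mul]
  set V := P * Q with hV
  have hFn : ∀ f ∈ F, nv v (V⁻¹ * f * V).1 ≤ r ^ (4 * d + 2 * c') := by
    intro f hf
    rw [hval]
    have a1 := nv_nonneg v (P⁻¹.1 * f.1 * P.1)
    have a2 := nv_nonneg v Q.1
    have a3 := nv_nonneg v Q⁻¹.1
    have a4 := hPE f hf
    calc nv v (Q⁻¹.1 * (P⁻¹.1 * f.1 * P.1) * Q.1) ≤ nv v Q⁻¹.1 * nv v (P⁻¹.1 * f.1 * P.1) * nv v Q.1 :=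
          (nv_mul v _ _).trans (mul_le_mul_of_nonneg_right (nv_mul v _ _) a2)
      _ ≤ r ^ c' * E * r ^ c' := by
          gcongr
          · exact hQ2.trans hCr
          · exact hQ1.trans hCr
      _ = _ := by rw [← hrE]; ring
  obtain ⟨N0, hN0⟩ : ∃ N0, N0 = 4 * d + 2 * c' := ⟨_, rfl⟩
  rw [← hN0] at hFn ⊢
  have hwn : nv v (V⁻¹ * w * V).1 ≤ r ^ (1 + N0 * (N+1)) := by
    have h2 := nv_pow_mem v ((fun f => V⁻¹ * f * V) '' F) (r ^ N0) (by positivity) (by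
      rintro _ ⟨f, hf, rfl⟩; exact hFn f hf) j (V⁻¹ * w * V) (by
        have := Set.image_pow (MulAut.conj V⁻¹).toMonoidHom F j
        have e : (fun f => V⁻¹ * f * V) = ((MulAut.conj V⁻¹).toMonoidHom : GL (Fin d) ℂ → GL (Fin d) ℂ) := by
          ext1 f; simp
        rw [e, ← this]
        exact ⟨w, hw, by simp⟩)
    refine h2.trans ?_
    rw [Fintype.card_fin, pow_add, pow_one, ← pow_mul]
    have : (d:ℝ) ≤ r := by nlinarith
    gcongr
    omega
  obtain ⟨N1, hN1⟩ : ∃ N1, N1 = 1 + N0 * (N+1) := ⟨_, rfl⟩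
  rw [← hN1] at hwn ⊢
  have hN1N : N1 ≤ N1 * d := Nat.le_mul_of_pos_right _ hd
  have hN0N : N0 ≤ N1 * d := by refine le_trans ?_ hN1N; rw [hN1]; nlinarith
  have hmono : ∀ {a b : ℕ}, a ≤ b → r ^ a ≤ r ^ b := fun h => pow_le_pow_right₀ hr1 h
  rw [← hval w] at hQt hQs
  set T := (V⁻¹ * w * V).1 with hT
  have hTle : ∀ i, v (T i i) ≤ r ^ N1 := fun i => (le_nv v T i i).trans hwn
  have hdetw : w.1.det = 1 := by
    have : ∀ j, ∀ w ∈ F ^ j, w.1.det = 1 := by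
      intro j
      induction j with
      | zero => intro w hw; rw [pow_zero, Set.mem_one] at hw; subst hw; simp
      | succ j ih =>
        intro w hw
        rw [pow_succ] at hw
        obtain ⟨x, hx, y, hy, rfl⟩ := hw
        rw [Units.val_mul, det_mul, ih x hx, hdet y hy, one_mul]
    exact this j w hw
  have hdetT : T.det = 1 := by
    rw [hT, Units.val_mul, Units.val_mul, det_mul, det_mul, hdetw, mul_one, ← det_mul, gl_inv_mul, det_one]
  have hprod : ∏ i, v (T i i) = 1 := by
    rw [Matrix.det_of_isUpperTriangular (fun i j h => hQt i j h)] at hdetT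
    rw [← map_prod, hdetT, map_one]
  have hpos : ∀ i, 0 < v (T i i) := by
    intro i
    refine lt_of_le_of_ne (v.nonneg _) (fun h => ?_)
    rw [Finset.prod_eq_zero (Finset.mem_univ i) h.symm] at hprod
    norm_num at hprod
  have hlow : ∀ i, 1 ≤ v (T i i) * r ^ (N1 * d) := by
    intro i
    rw [← hprod, ← Finset.mul_prod_erase Finset.univ _ (Finset.mem_univ i)]
    refine mul_le_mul_of_nonneg_left ?_ (hpos i).le
    calc ∏ x ∈ Finset.univ.erase i, v (T x x) ≤ ∏ x ∈ Finset.univ.erase i, r ^ N1 :=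
          Finset.prod_le_prod (fun i _ => (hpos i).le) (fun i _ => hTle i)
      _ = r ^ (N1 * (d - 1)) := by rw [Finset.prod_const, Finset.card_erase_of_mem (Finset.mem_univ _)]; simp [pow_mul]
      _ ≤ _ := hmono (Nat.mul_le_mul_left _ (Nat.sub_le _ _))
  have hl2 : r ^ (3 * d) ≤ v l := by
    refine le_trans ?_ hlE
    have h3 : 1 ≤ c0 * r := by
      have := hKc.trans hrK
      rwa [inv_le_iff_one_le_mul₀ hc0, mul_comm] at this
    calc r ^ (3 * d) = 1 * r ^ (3 * d) := by rw [one_mul]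
      _ ≤ (c0 * r) * r ^ (3 * d) := by gcongr
      _ = c0 * r ^ (3 * d + 1) := by ring
      _ ≤ c0 * E ^ 1 := by rw [pow_one, ← hrE]; gcongr ?_ * ?_; exact hmono (by omega)
      _ ≤ c0 * E ^ j := by gcongr
  obtain ⟨i0, hi0⟩ : ∃ i, T i i = l := by
    apply diag_of_root T hQt
    rw [hT, Units.val_mul, Units.val_mul, cp_conj]; exact hl
  have hmu0 : r ^ (3 * d) ≤ v (T ⟨0, hd⟩ ⟨0, hd⟩) := by
    refine hl2.trans ?_
    rw [← hi0]
    exact hQs _ _ (Fin.mk_le_of_le_val (Nat.zero_le _))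
  obtain ⟨κ, hκ1, hκd, hgap⟩ := gap_real hd (fun i => v (T i i)) r hr2 hpos hprod hmu0
  refine ⟨r, hr2, hKd.trans hrK, V, fun f hf => (hFn f hf).trans (hmono hN0N), j, hjN, w, hw, hQt, hwn.trans (hmono hN1N),
    κ, hκ1, hκd, _, _, hpos _, hgap, hlow _, (hTle _).trans (hmono hN1N), ?_, ?_⟩
  · intro i hi
    exact hQs _ _ (by rw [Fin.le_def]; simp; omega)
  · intro i hi
    exact hQs _ _ (by rw [Fin.le_def]; exact hi)

end UEG

namespace UEG
set_option linter.unusedVariables false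
set_option linter.style.haveILetI false
set_option linter.unusedSectionVars false
open Polynomial Matrix
open scoped Pointwise

lemma nv_submatrix {l l' : Type*} [Fintype l] [Fintype l'] (v : AbsoluteValue ℂ ℝ) (e : l' ≃ l) (A : Matrix l l ℂ) :
    nv v (A.submatrix e e) = nv v A := by
  unfold nv
  rw [← Equiv.sum_comp e]
  refine Finset.sum_congr rfl fun i _ => ?_
  rw [← Equiv.sum_comp e]
  rfl

/-- unipotent block matrix -/
def uni {m n : Type*} [Fintype m] [Fintype n] [DecidableEq m] [DecidableEq n] (N : Matrix m n ℂ) : GL (m ⊕ n) ℂ :=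
  ⟨fromBlocks 1 N 0 1, fromBlocks 1 (-N) 0 1, by simp [fromBlocks_multiply], by simp [fromBlocks_multiply]⟩

lemma uni_val {m n : Type*} [Fintype m] [Fintype n] [DecidableEq m] [DecidableEq n] (N : Matrix m n ℂ) :
    (uni N).1 = fromBlocks 1 N 0 1 := rfl
lemma uni_inv {m n : Type*} [Fintype m] [Fintype n] [DecidableEq m] [DecidableEq n] (N : Matrix m n ℂ) :
    (uni N)⁻¹.1 = fromBlocks 1 (-N) 0 1 := rfl

lemma ev_root_two (L : ℕ) (hL : 1 ≤ L) : ∀ᶠ k : ℕ in (UU : Filter ℕ), 1 + 1 / ((k:ℝ) + 1) ≤ (2:ℝ) ^ (1 / (L:ℝ)) := by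
  have h1 : (1:ℝ) < (2:ℝ) ^ (1 / (L:ℝ)) := Real.one_lt_rpow (by norm_num) (by positivity)
  obtain ⟨q, hq⟩ := exists_nat_one_div_lt (sub_pos.2 h1)
  filter_upwards [ev_ge q] with k hk
  have : 1 / ((k:ℝ) + 1) ≤ 1 / ((q:ℝ) + 1) := by gcongr
  linarith

theorem propA (d : ℕ) (hd : 1 ≤ d) : ∃ R c : ℝ, 1 < c ∧ ∀ (v : AbsoluteValue ℂ ℝ) (F : Set (GL (Fin d) ℂ)),
    F.Finite → 1 ∈ F → (∀ f ∈ F, f.1.det = 1) → NoRed (d ^ d) F →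
    (∃ u ∈ F, ∃ l, u.1.charpoly.IsRoot l ∧ R ≤ v l) → Gr c F := by
  obtain ⟨N, N2, R, hnf⟩ := normal_form d hd
  by_contra! hcon
  have hk : ∀ k : ℕ, (1:ℝ) < 1 + 1 / ((k:ℝ) + 1) := fun k => by
    have : 0 < 1 / ((k:ℝ) + 1) := by positivity
    linarith
  choose v F hFf h1 hdet hNR hex hng using fun k : ℕ => hcon R _ (hk k)
  choose r hr2 hdr V hFn j hj w hw htri hwn κ' hκ1 hκd a b ha hab haN hbN hAb hDa using
    fun k => hnf (v k) (F k) (hFf k) (h1 k) (hdet k) (hex k)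
  let S : Scale := ⟨v, r, hr2⟩
  obtain ⟨κ, -, hκ⟩ := Scale.eventually_const (Finset.range d) κ' (Filter.Eventually.of_forall fun k => by
    simpa using hκd k)
  obtain ⟨hκ1', hκd'⟩ : 1 ≤ κ ∧ κ < d := by
    obtain ⟨k, hk⟩ := hκ.exists
    exact hk ▸ ⟨hκ1 k, hκd k⟩
  obtain ⟨n, hn⟩ : ∃ n, κ + n = d := ⟨d - κ, by omega⟩
  have hn1 : 1 ≤ n := by omega
  haveI : NeZero κ := ⟨by omega⟩
  haveI : NeZero n := ⟨by omega⟩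
  let e : Fin κ ⊕ Fin n ≃ Fin d := finSumFinEquiv.trans (finCongr hn)
  have el : ∀ i : Fin κ, (e (Sum.inl i)).1 = i.1 := fun i => by simp [e]
  have er : ∀ i : Fin n, (e (Sum.inr i)).1 = κ + i.1 := fun i => by simp [e]
  let φ0 : ∀ k, GL (Fin d) ℂ →* GL (Fin κ ⊕ Fin n) ℂ := fun k => (rix e).comp (MulAut.conj (V k)⁻¹).toMonoidHom
  have hφ0 : ∀ k f, (φ0 k f).1 = ((V k)⁻¹ * f * V k).1.submatrix e e := by
    intro k f
    change (rix e (MulAut.conj (V k)⁻¹ f)).1 = _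
    rw [rix_val, MulAut.conj_apply, inv_inv]
  have hnφ0 : ∀ k f, nv (v k) (φ0 k f).1 = nv (v k) ((V k)⁻¹ * f * V k).1 := fun k f => by rw [hφ0, nv_submatrix]
  let T : ∀ k, Matrix (Fin κ ⊕ Fin n) (Fin κ ⊕ Fin n) ℂ := fun k => (φ0 k (w k)).1
  have hTB : ∀ i j, (fun k => T k i j) ∈ S.B := fun i j => ⟨N2, Filter.Eventually.of_forall fun k =>
    (le_nv (v k) (T k) i j).trans ((hnφ0 k (w k)).le.trans (hwn k))⟩
  let A := S.mkM (fun k => (T k).toBlocks₁₁) (fun i j => hTB _ _)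
  let X := S.mkM (fun k => (T k).toBlocks₁₂) (fun i j => hTB _ _)
  let D := S.mkM (fun k => (T k).toBlocks₂₂) (fun i j => hTB _ _)
  have hA : ∀ k, A.map (S.ev k) = (T k).toBlocks₁₁ := fun k => rfl
  have hX : ∀ k, X.map (S.ev k) = (T k).toBlocks₁₂ := fun k => rfl
  have hD : ∀ k, D.map (S.ev k) = (T k).toBlocks₂₂ := fun k => rfl
  have hT21 : ∀ k, (T k).toBlocks₂₁ = 0 := by
    intro k
    ext i j
    change (φ0 k (w k)).1 (Sum.inr i) (Sum.inl j) = 0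
    rw [hφ0]
    apply htri
    rw [Fin.lt_def, el, er]
    have := j.2
    omega
  have hAt : ∀ k, ∀ i j, j < i → (T k).toBlocks₁₁ i j = 0 := by
    intro k i j hij
    change (φ0 k (w k)).1 (Sum.inl i) (Sum.inl j) = 0
    rw [hφ0]
    apply htri
    rw [Fin.lt_def, el, el]
    exact hij
  have hDt : ∀ k, ∀ i j, j < i → (T k).toBlocks₂₂ i j = 0 := by
    intro k i j hij
    change (φ0 k (w k)).1 (Sum.inr i) (Sum.inr j) = 0
    rw [hφ0]
    apply htri
    rw [Fin.lt_def, er, er]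
    have : j.1 < i.1 := hij
    omega
  have hAb' : ∀ k, κ' k = κ → ∀ i, b k ≤ v k ((T k).toBlocks₁₁ i i) := by
    intro k hk i
    change b k ≤ v k ((φ0 k (w k)).1 (Sum.inl i) (Sum.inl i))
    rw [hφ0]
    apply hAb
    rw [hk, el]
    exact i.2
  have hDa' : ∀ k, κ' k = κ → ∀ i, v k ((T k).toBlocks₂₂ i i) ≤ a k := by
    intro k hk i
    change v k ((φ0 k (w k)).1 (Sum.inr i) (Sum.inr i)) ≤ a k
    rw [hφ0]
    apply hDa
    rw [hk, er]
    omega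
  have hApr : (A.map S.pr).det ≠ 0 := by
    rw [← S.det_pr]
    apply S.pr_ne_zero' (n := N2 * κ)
    filter_upwards [hκ] with k hk
    rw [S.det_ev, hA, Matrix.det_of_isUpperTriangular (fun i j h => hAt k i j h), map_prod]
    have hc : r k ^ (N2 * κ) = ∏ i : Fin κ, r k ^ N2 := by simp [pow_mul]
    change 1 ≤ (∏ i : Fin κ, v k ((T k).toBlocks₁₁ i i)) * r k ^ (N2 * κ)
    rw [hc, ← Finset.prod_mul_distrib]
    have hr1 : 1 ≤ r k ^ 2 := one_le_pow₀ (by linarith [hr2 k])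
    have hrN : 0 < r k ^ N2 := pow_pos (by linarith [hr2 k]) _
    have h3 : ∀ i : Fin κ, 1 ≤ v k ((T k).toBlocks₁₁ i i) * r k ^ N2 := by
      intro i
      refine (haN k).trans (mul_le_mul_of_nonneg_right ?_ hrN.le)
      refine le_trans ?_ ((hab k).trans (hAb' k hk i))
      exact le_mul_of_one_le_right (ha k).le hr1
    calc (1:ℝ) = ∏ i : Fin κ, 1 := by simp
      _ ≤ _ := Finset.prod_le_prod (fun _ _ => zero_le_one) (fun i _ => h3 i)
  obtain ⟨N3, hN3⟩ := S.inv_bd A hApr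
  obtain ⟨N4, hN4⟩ := S.bd_nv D
  obtain ⟨N5, hN5⟩ : ∃ N5, N5 = N2 + N3 + N4 := ⟨_, rfl⟩
  have hW : ∀ t : ℕ, ∃ M : ℕ, ∀ᶠ k in (UU : Filter ℕ),
      nv (S.v k) ((D.map (S.ev k)) ^ M) * nv (S.v k) ((A.map (S.ev k)) ^ M)⁻¹ * S.r k ^ t ≤ 1 := by
    intro t
    refine ⟨t + (2 + 2 * N5 * (n + κ)), ?_⟩
    filter_upwards [hκ, hN3, hN4] with k hk k3 k4
    have hr1 : 1 ≤ r k := by linarith [hr2 k]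
    have hrp : ∀ q, 0 < r k ^ q := fun q => pow_pos (by linarith [hr2 k]) _
    have hκn : (κ:ℝ) * n ≤ r k := by
      refine le_trans ?_ (hdr k)
      have q1 : (κ:ℝ) ≤ d := by exact_mod_cast (by omega)
      have q2 : (n:ℝ) ≤ d := by exact_mod_cast (by omega)
      gcongr
    have g := gapW (v k) (r k) (hr2 k) N5 (A.map (S.ev k)) (D.map (S.ev k)) (hAt k) (hDt k) k3.1
      (k3.2.trans (S.pow_mono k (by omega))) (k4.trans (S.pow_mono k (by omega))) (a k) (b k) (ha k) (hab k)
      ((haN k).trans (mul_le_mul_of_nonneg_left (S.pow_mono k (by omega)) (ha k).le)) ((hbN k).trans (S.pow_mono k (by omega)))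
      (hAb' k hk) (hDa' k hk) hκn (t + (2 + 2 * N5 * (n + κ)))
    rw [pow_add (r k), ← mul_assoc] at g
    change nv (v k) _ * nv (v k) _ * r k ^ t ≤ 1
    by_contra! h7
    have := mul_lt_mul_of_pos_right h7 (hrp (2 + 2 * N5 * (n + κ)))
    linarith
  obtain ⟨Ns, hNs⟩ := S.sylv A X D hApr hW
  let U : ∀ k, GL (Fin κ ⊕ Fin n) ℂ := fun k => uni (Ns.map (S.ev k))
  let φ : ∀ k, GL (Fin d) ℂ →* GL (Fin κ ⊕ Fin n) ℂ := fun k => (MulAut.conj (U k)⁻¹).toMonoidHom.comp (φ0 k)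
  have hφc : ∀ k, Cpt (φ k) := fun k => (Cpt.conj (U k)).comp ((Cpt.rix e).comp (Cpt.conj (V k)))
  have hφ : ∀ k f, φ k f = (U k)⁻¹ * φ0 k f * U k := by
    intro k f
    change MulAut.conj (U k)⁻¹ (φ0 k f) = _
    rw [MulAut.conj_apply, inv_inv]
  have ht1 : ∀ k {m : Type} [DecidableEq m], (1 : Matrix m m S.B).map (S.ev k) = 1 := fun k m _ =>
    Matrix.map_one _ (map_zero _) (map_one _)
  obtain ⟨p, hp⟩ := S.bd_nv (fromBlocks (1 : Matrix (Fin κ) (Fin κ) S.B) Ns 0 (1 : Matrix (Fin n) (Fin n) S.B))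
  obtain ⟨q, hq⟩ := S.bd_nv (fromBlocks (1 : Matrix (Fin κ) (Fin κ) S.B) (-Ns) 0 (1 : Matrix (Fin n) (Fin n) S.B))
  have hUp : ∀ᶠ k in (UU : Filter ℕ), nv (v k) (U k).1 ≤ r k ^ p := by
    filter_upwards [hp] with k hk
    rw [Matrix.fromBlocks_map, ht1, ht1, Matrix.map_zero _ (map_zero _)] at hk
    exact hk
  have hUq : ∀ᶠ k in (UU : Filter ℕ), nv (v k) (U k)⁻¹.1 ≤ r k ^ q := by
    filter_upwards [hq] with k hk
    rw [Matrix.fromBlocks_map, ht1, ht1, Matrix.map_zero _ (map_zero _), Matrix.map_neg _ (map_neg _)] at hk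
    exact hk
  obtain ⟨M, J, hMJ⟩ := S.pair (fun k => φ k '' F k) (q + N2 + p) (fun k => ⟨1, h1 k, map_one _⟩) (by
      filter_upwards [hUp, hUq] with k k1 k2
      rintro _ ⟨f, hf, rfl⟩
      have a1 := nv_nonneg (v k) (φ0 k f).1
      have a2 := nv_nonneg (v k) (U k).1
      have a3 := nv_nonneg (v k) (U k)⁻¹.1
      have a4 := hFn k f hf
      rw [← hnφ0] at a4
      rw [hφ, Units.val_mul, Units.val_mul]
      have hrp : ∀ q, 0 < r k ^ q := fun q => pow_pos (by linarith [hr2 k]) _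
      have := hrp q
      have := hrp p
      have := hrp N2
      change nv (v k) _ ≤ r k ^ _
      calc _ ≤ nv (v k) (U k)⁻¹.1 * nv (v k) (φ0 k f).1 * nv (v k) (U k).1 :=
            (nv_mul (v k) _ _).trans (mul_le_mul_of_nonneg_right (nv_mul (v k) _ _) a2)
        _ ≤ r k ^ q * r k ^ N2 * r k ^ p := by gcongr
        _ = _ := by rw [pow_add, pow_add]) (by
      rintro k _ ⟨f, hf, rfl⟩
      have e1 : ∀ (P g : GL (Fin κ ⊕ Fin n) ℂ), (P⁻¹ * g * P).1.det = g.1.det := by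
        intro P g
        rw [Units.val_mul, Units.val_mul, det_mul, det_mul, mul_right_comm, ← det_mul, ← Units.val_mul]
        simp
      rw [hφ, e1, hφ0, det_submatrix_equiv_self, Units.val_mul, Units.val_mul, det_mul, det_mul, mul_right_comm,
        ← det_mul, gl_inv_mul, det_one, one_mul]
      exact hdet k f hf) (by
      intro k H hH hI
      refine hirr_of (hφc k) (F k) (d ^ d) _ ?_ (hNR k) H hH hI
      rw [Fintype.card_fun, Fintype.card_sum, Fintype.card_fin, Fintype.card_fin, hn]
      exact Nat.pow_le_pow_right hd hκd'.le) A (A * Ns + X - Ns * D) D hNs hApr hW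
  have hL : 1 ≤ J + N * M + 1 := by omega
  obtain ⟨k, hk, hk2⟩ := (hMJ.and (ev_root_two _ hL)).exists
  have hval : (φ k (w k)).1 = (fromBlocks A (A * Ns + X - Ns * D) 0 D).map (S.ev k) := by
    rw [hφ, Units.val_mul, Units.val_mul]
    change (uni _)⁻¹.1 * T k * (uni _).1 = _
    rw [uni_val, uni_inv, ← fromBlocks_toBlocks (T k), hT21, fromBlocks_multiply, fromBlocks_multiply, Matrix.fromBlocks_map,
      Matrix.map_sub _ (map_sub _), Matrix.map_add _ (map_add _), Matrix.map_mul, Matrix.map_mul, hA, hX, hD,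
      Matrix.map_zero _ (map_zero _)]
    congr 1 <;> simp
    abel
  obtain ⟨c, hc, hG⟩ := hk (φ k (w k)) hval
  have h1' : (1 : GL (Fin κ ⊕ Fin n) ℂ) ∈ φ k '' F k := ⟨1, h1 k, map_one _⟩
  have hwM : φ k (w k) ^ M ∈ (φ k '' F k) ^ (N * M) := by
    have : φ k (w k) ∈ (φ k '' F k) ^ (j k) := by
      rw [← Set.image_pow]; exact ⟨_, hw k, rfl⟩
    have h5 := Set.pow_mem_pow this (n := M)
    rw [← pow_mul] at h5
    exact Set.pow_subset_pow_right h1' (Nat.mul_le_mul_right _ (hj k)) h5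
  have h6 := gr_root ((hFf k).image (φ k)) hL (F' := {φ k (w k) ^ M, c * φ k (w k) ^ M}) (by
    intro x hx
    rcases hx with rfl | rfl
    · exact Set.pow_subset_pow_right h1' (by omega) hwM
    · refine Set.pow_subset_pow_right h1' (Nat.le_succ _) ?_
      rw [pow_add]
      exact Set.mul_mem_mul hc hwM) one_le_two hG
  exact hng k (gr_mono (by positivity) hk2 (gr_hom (φ k) (hFf k) h6))

end UEG

namespace UEG
set_option linter.unusedVariables false
set_option linter.style.haveILetI false
set_option linter.unusedSectionVars false
open scoped Pointwise

/-- irreducibility of a set of endomorphisms -/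
def IrrE {V : Type*} [AddCommGroup V] [Module ℂ V] (S : Set (Module.End ℂ V)) : Prop :=
  ∀ U : Submodule ℂ V, (∀ s ∈ S, ∀ x ∈ U, s x ∈ U) → U = ⊥ ∨ U = ⊤

lemma burnside_adjoin {V : Type*} [AddCommGroup V] [Module ℂ V] [FiniteDimensional ℂ V] [Nontrivial V]
    (S : Set (Module.End ℂ V)) (hS : IrrE S) : Algebra.adjoin ℂ S = ⊤ := by
  set A := Algebra.adjoin ℂ S with hA
  have hcoe : ∀ W : Submodule A V, ∃ U : Submodule ℂ V, (U : Set V) = W ∧ ∀ s ∈ S, ∀ x ∈ U, s x ∈ U := by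
    intro W
    refine ⟨{ carrier := W, add_mem' := fun ha hb => W.add_mem ha hb, zero_mem' := W.zero_mem, smul_mem' := ?_ }, rfl, ?_⟩
    · intro c x hx
      have := W.smul_mem (algebraMap ℂ A c) hx
      simpa using this
    · intro s hs x hx
      exact W.smul_mem (⟨s, Algebra.subset_adjoin hs⟩ : A) hx
  have htriv : ∀ W : Submodule A V, W = ⊥ ∨ W = ⊤ := by
    intro W
    obtain ⟨U, hU, hUS⟩ := hcoe W
    rcases hS U hUS with h | h
    · left
      apply SetLike.coe_injective; rw [← hU, h]; rfl
    · right
      apply SetLike.coe_injective; rw [← hU, h]; rfl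
  haveI : IsSimpleModule A V := by
    rw [isSimpleModule_iff]
    exact { exists_pair_ne := exists_pair_ne _, eq_bot_or_eq_top := htriv }
  have hschur : ∀ f : Module.End A V, ∃ c : ℂ, ∀ x, f x = c • x := by
    intro f
    have hlin : ∀ (c : ℂ) (x : V), f (c • x) = c • f x := by
      intro c x
      have := f.map_smul (algebraMap ℂ A c) x
      simpa using this
    let g : Module.End ℂ V := { toFun := f, map_add' := f.map_add, map_smul' := hlin }
    obtain ⟨c, hc⟩ := Module.End.exists_eigenvalue g
    refine ⟨c, ?_⟩
    obtain ⟨x0, hx0, hx0'⟩ := hc.exists_hasEigenvector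
    rw [Module.End.mem_eigenspace_iff] at hx0
    let W : Submodule A V := { carrier := {x | f x = c • x}, zero_mem' := by simp, add_mem' := by
                                  intro a b ha hb
                                  rw [Set.mem_ofPred_eq] at *
                                  rw [map_add, ha, hb, smul_add]
                               smul_mem' := by
                                  intro a x hx
                                  rw [Set.mem_ofPred_eq] at *
                                  rw [map_smul, hx]
                                  exact (a.1.map_smul c x) }
    have hW : W = ⊤ := by
      rcases htriv W with h | h
      · exfalso
        have : x0 ∈ W := hx0
        rw [h] at this
        exact hx0' this
      · exact h
    intro x
    have : x ∈ W := hW ▸ trivial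
    exact this
  rw [eq_top_iff]
  intro T _
  have hT : ∀ (f : Module.End A V) (x : V), T (f • x) = f • T x := by
    intro f x
    obtain ⟨c, hc⟩ := hschur f
    simp [hc]
  let T' : Module.End (Module.End A V) V := { toFun := T, map_add' := T.map_add, map_smul' := hT }
  classical
  obtain ⟨r, hr⟩ := jacobson_density T' (Finset.univ.image (Module.finBasis ℂ V))
  have : T = r.1 := by
    apply (Module.finBasis ℂ V).ext
    intro i
    exact hr _ (by simp)
  rw [this]; exact r.2

lemma burnside {V : Type*} [AddCommGroup V] [Module ℂ V] [FiniteDimensional ℂ V] [Nontrivial V]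
    (S : Submonoid (Module.End ℂ V)) (hS : IrrE (S : Set (Module.End ℂ V))) :
    Submodule.span ℂ (S : Set (Module.End ℂ V)) = ⊤ := by
  have := Algebra.adjoin_eq_span ℂ (S : Set (Module.End ℂ V))
  rw [burnside_adjoin _ hS, Submonoid.closure_eq] at this
  rw [← this]; rfl

open Matrix in
lemma burnside_mat {d : ℕ} (hd : 1 ≤ d) (S : Submonoid (Matrix (Fin d) (Fin d) ℂ))
    (hS : ∀ U : Submodule ℂ (Fin d → ℂ), (∀ g ∈ S, ∀ x ∈ U, g *ᵥ x ∈ U) → U = ⊥ ∨ U = ⊤) :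
    Submodule.span ℂ (S : Set (Matrix (Fin d) (Fin d) ℂ)) = ⊤ := by
  haveI : Nonempty (Fin d) := ⟨⟨0, hd⟩⟩
  let e : Matrix (Fin d) (Fin d) ℂ ≃ₐ[ℂ] Module.End ℂ (Fin d → ℂ) := Matrix.toLinAlgEquiv'
  have := burnside (S.map (e : Matrix (Fin d) (Fin d) ℂ →* Module.End ℂ (Fin d → ℂ))) (by
    intro U hU
    refine hS U fun g hg x hx => ?_
    exact hU (e g) ⟨g, hg, rfl⟩ x hx)
  have h2 : Submodule.map e.toLinearMap (Submodule.span ℂ (S : Set (Matrix (Fin d) (Fin d) ℂ))) = ⊤ := by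
    rw [Submodule.map_span, ← this]; rfl
  rw [eq_top_iff]
  intro T _
  have : e T ∈ Submodule.map e.toLinearMap (Submodule.span ℂ (S : Set (Matrix (Fin d) (Fin d) ℂ))) := by rw [h2]; trivial
  obtain ⟨T', h, h'⟩ := this
  rwa [e.injective h'] at h

lemma trace_zero_mat {d : ℕ} {S : Set (Matrix (Fin d) (Fin d) ℂ)}
    (hS : Submodule.span ℂ S = ⊤) (A : Matrix (Fin d) (Fin d) ℂ)
    (h : ∀ s ∈ S, (A * s).trace = 0) : A = 0 := by
  have h2 : ∀ T : Matrix (Fin d) (Fin d) ℂ, (A * T).trace = 0 := by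
    intro T
    have hT : T ∈ Submodule.span ℂ S := hS ▸ trivial
    induction hT using Submodule.span_induction with
    | mem x hx => exact h x hx
    | zero => simp
    | add x y _ _ hx hy => rw [mul_add, Matrix.trace_add, hx, hy, add_zero]
    | smul a x _ hx => rw [Matrix.mul_smul, Matrix.trace_smul, hx, smul_zero]
  ext i j
  have := h2 (Matrix.single j i 1)
  simpa [Matrix.trace_mul_single] using this

lemma Irr.span {d : ℕ} (hd : 1 ≤ d) (H : Subgroup (Matrix.GeneralLinearGroup (Fin d) ℂ)) (h : Irr (H : Set (Matrix.GeneralLinearGroup (Fin d) ℂ))) :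
    Submodule.span ℂ ((fun g : Matrix.GeneralLinearGroup (Fin d) ℂ => g.1) '' (H : Set (Matrix.GeneralLinearGroup (Fin d) ℂ))) = ⊤ := by
  have := burnside_mat hd (H.toSubmonoid.map (Units.coeHom _)) (by
    intro U hU
    exact h U fun g hg x hx => hU g.1 ⟨g, hg, rfl⟩ x hx)
  exact this

end UEG

namespace UEG
set_option linter.unusedVariables false
set_option linter.style.haveILetI false
set_option linter.unusedSectionVars false
open scoped Pointwise commutatorElement

/-- iterated commutators of conjugates -/
def XS {G : Type} [Group G] (T : Set G) (b : G) : ℕ → Set G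
  | 0 => {z | ∃ g ∈ T, z = g * b * g⁻¹}
  | t + 1 => {z | ∃ x ∈ XS T b t, ∃ y ∈ XS T b t, z = ⁅x, y⁆}

/-- commutators over all powers -/
def YS {G : Type} [Group G] (T : Set G) (t : ℕ) (a : G) : ℕ → Set G
  | 0 => XS T a t
  | j + 1 => {z | ∃ x ∈ XS T (a ^ (j + 2)) t, ∃ y ∈ YS T t a j, z = ⁅x, y⁆}

/-- a set operator given by a word -/
def Wordy (Φ : ∀ (G : Type) [Group G], Set G → G → Set G) : Prop :=
  ∃ (α : Type) (_ : Finite α) (w : FreeGroup (Option α)), ∀ (G : Type) [Group G] (T : Set G) (a z : G),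
    z ∈ Φ G T a ↔ ∃ g : α → G, (∀ i, g i ∈ T) ∧ z = FreeGroup.lift (fun o => Option.elim o a g) w

lemma Wordy.comm {Φ Ψ : ∀ (G : Type) [Group G], Set G → G → Set G} (h1 : Wordy Φ) (h2 : Wordy Ψ) :
    Wordy (fun G _ T a => {z | ∃ x ∈ Φ G T a, ∃ y ∈ Ψ G T a, z = ⁅x, y⁆}) := by
  obtain ⟨α, _, w, hw⟩ := h1
  obtain ⟨β, _, w', hw'⟩ := h2
  refine ⟨α ⊕ β, inferInstance, ⁅(FreeGroup.map (Option.map Sum.inl) w : FreeGroup (Option (α ⊕ β))), (FreeGroup.map (Option.map Sum.inr) w' : FreeGroup (Option (α ⊕ β)))⁆, ?_⟩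
  intro G _ T a z
  have key : ∀ (g : α ⊕ β → G), FreeGroup.lift (fun o => Option.elim o a g)
      ⁅(FreeGroup.map (Option.map Sum.inl) w : FreeGroup (Option (α ⊕ β))), (FreeGroup.map (Option.map Sum.inr) w' : FreeGroup (Option (α ⊕ β)))⁆ =
      ⁅FreeGroup.lift (fun o => Option.elim o a (g ∘ Sum.inl)) w, FreeGroup.lift (fun o => Option.elim o a (g ∘ Sum.inr)) w'⁆ := by
    intro g
    rw [map_commutatorElement]
    congr 1
    · rw [← MonoidHom.comp_apply]
      congr 1
      ext o; cases o <;> simp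
    · rw [← MonoidHom.comp_apply]
      congr 1
      ext o; cases o <;> simp
  rw [Set.mem_ofPred_eq]
  constructor
  · rintro ⟨x, hx, y, hy, rfl⟩
    obtain ⟨g, hg, rfl⟩ := (hw G T a x).1 hx
    obtain ⟨g', hg', rfl⟩ := (hw' G T a y).1 hy
    refine ⟨Sum.elim g g', ?_, ?_⟩
    · rintro (i | i)
      · exact hg i
      · exact hg' i
    · rw [key]; rfl
  · rintro ⟨g, hg, rfl⟩
    rw [key]
    exact ⟨_, (hw G T a _).2 ⟨g ∘ Sum.inl, fun i => hg _, rfl⟩, _, (hw' G T a _).2 ⟨g ∘ Sum.inr, fun i => hg _, rfl⟩, rfl⟩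

lemma wordy_X (q t : ℕ) : Wordy (fun G _ T a => XS T (a ^ q) t) := by
  induction t with
  | zero =>
    refine ⟨Unit, inferInstance, FreeGroup.of (some ()) * (FreeGroup.of none) ^ q * (FreeGroup.of (some ()))⁻¹, ?_⟩
    intro G _ T a z
    simp only [XS, Set.mem_ofPred_eq, map_mul, map_pow, map_inv, FreeGroup.lift_apply_of, Option.elim]
    constructor
    · rintro ⟨g, hg, rfl⟩
      exact ⟨fun _ => g, fun _ => hg, rfl⟩
    · rintro ⟨g, hg, rfl⟩
      exact ⟨_, hg (), rfl⟩
  | succ t ih => exact Wordy.comm ih ih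

lemma wordy_Y (t j : ℕ) : Wordy (fun G _ T a => YS T t a j) := by
  induction j with
  | zero => simpa [YS] using wordy_X 1 t
  | succ j ih => exact Wordy.comm (wordy_X (j + 2) t) ih

section normed
variable {G : Type} [Group G] {R : Type*} [NormedRing R] (π : G →* R) (hπ : ∀ g, ‖π g‖ ≤ 1)
include hπ

lemma norm_comm_le (x y : G) : ‖π ⁅x, y⁆ - 1‖ ≤ 2 * ‖π x - 1‖ * ‖π y - 1‖ := by
  have h : π ⁅x, y⁆ - 1 = ((π x - 1) * (π y - 1) - (π y - 1) * (π x - 1)) * π (y * x)⁻¹ := by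
    have e1 : π ⁅x, y⁆ = π x * π y * π (y * x)⁻¹ := by
      rw [← map_mul, ← map_mul, commutatorElement_def]; congr 1; group
    have e2 : (1 : R) = π y * π x * π (y * x)⁻¹ := by
      rw [← map_mul, ← map_mul, mul_inv_cancel, map_one]
    rw [e1]
    nth_rewrite 1 [e2]
    rw [← sub_mul]
    congr 1
    noncomm_ring
  rw [h]
  calc _ ≤ ‖(π x - 1) * (π y - 1) - (π y - 1) * (π x - 1)‖ * ‖π (y * x)⁻¹‖ := norm_mul_le _ _
    _ ≤ ‖(π x - 1) * (π y - 1) - (π y - 1) * (π x - 1)‖ * 1 := by gcongr; exact hπ _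
    _ ≤ (‖π x - 1‖ * ‖π y - 1‖ + ‖π y - 1‖ * ‖π x - 1‖) * 1 := by
        gcongr
        exact (norm_sub_le _ _).trans (add_le_add (norm_mul_le _ _) (norm_mul_le _ _))
    _ = _ := by ring

lemma norm_XS (b : G) (hb : ‖π b - 1‖ ≤ 1 / 8) (t : ℕ) : ∀ z ∈ XS Set.univ b t, ‖π z - 1‖ ≤ (1 / 2) * (1 / 4) ^ (2 ^ t) := by
  induction t with
  | zero =>
    rintro z ⟨g, -, rfl⟩
    have : π (g * b * g⁻¹) - 1 = π g * (π b - 1) * π g⁻¹ := by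
      rw [mul_sub, sub_mul, mul_one, ← map_mul, ← map_mul, ← map_mul, mul_inv_cancel, map_one]
    rw [this]
    calc _ ≤ ‖π g‖ * ‖π b - 1‖ * ‖π g⁻¹‖ := (norm_mul_le _ _).trans (by gcongr; exact norm_mul_le _ _)
      _ ≤ 1 * (1 / 8) * 1 := by gcongr <;> apply hπ
      _ ≤ _ := by norm_num
  | succ t ih =>
    rintro z ⟨x, hx, y, hy, rfl⟩
    refine (norm_comm_le π hπ x y).trans ?_
    calc _ ≤ (2:ℝ) * ((1 / 2) * (1 / 4) ^ (2 ^ t)) * ((1 / 2) * (1 / 4) ^ (2 ^ t)) := by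
          gcongr
          · exact ih x hx
          · exact ih y hy
      _ = _ := by rw [pow_succ 2 t, pow_mul]; ring

lemma norm_YS [NormOneClass R] (a : G) (i : ℕ) (hi : 1 ≤ i) (hb : ‖π (a ^ i) - 1‖ ≤ 1 / 8) (t j : ℕ) (hij : i ≤ j + 1) :
    ∀ z ∈ YS Set.univ t a j, ‖π z - 1‖ ≤ 4 ^ j * ((1 / 2) * (1 / 4) ^ (2 ^ t)) := by
  have h2 : ∀ x, ‖π x - 1‖ ≤ 2 := fun x => (norm_sub_le _ _).trans (by rw [norm_one]; linarith [hπ x])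
  induction j with
  | zero =>
    obtain rfl : i = 1 := by omega
    intro z hz
    simpa using norm_XS π hπ a (by simpa using hb) t z hz
  | succ j ih =>
    rintro z ⟨x, hx, y, hy, rfl⟩
    refine (norm_comm_le π hπ x y).trans ?_
    by_cases h : i = j + 2
    · subst h
      have := norm_XS π hπ _ hb t x hx
      calc _ ≤ (2:ℝ) * ((1 / 2) * (1 / 4) ^ (2 ^ t)) * (2:ℝ) := by
            gcongr; exact h2 y
        _ = 4 ^ 1 * ((1 / 2) * (1 / 4) ^ (2 ^ t)) := by ring
        _ ≤ _ := by gcongr <;> norm_num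
    · have := ih (by omega) y hy
      calc _ ≤ (2:ℝ) * 2 * (4 ^ j * ((1 / 2) * (1 / 4) ^ (2 ^ t))) := by
            gcongr; exact h2 x
        _ = _ := by ring
end normed

open Metric MeasureTheory Module in
open scoped Function ENNReal in
theorem card_le_sep {E : Type*} [NormedAddCommGroup E] [NormedSpace ℝ E] [FiniteDimensional ℝ E] (s : Finset E) (hs : ∀ c ∈ s, ‖c‖ ≤ 8)
    (h : ∀ c ∈ s, ∀ d ∈ s, c ≠ d → 1 ≤ ‖c - d‖) : s.card ≤ 17 ^ finrank ℝ E := by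
  borelize E
  let μ : Measure E := Measure.addHaar
  let δ : ℝ := (1 : ℝ) / 2
  let ρ : ℝ := (17 : ℝ) / 2
  have ρpos : 0 < ρ := by norm_num [ρ]
  set A := ⋃ c ∈ s, ball (c : E) δ with hA
  have D : Set.Pairwise (s : Set E) (Disjoint on fun c => ball (c : E) δ) := by
    rintro c hc d hd hcd
    apply ball_disjoint_ball
    rw [dist_eq_norm]
    convert! h c hc d hd hcd
    norm_num [δ]
  have A_subset : A ⊆ ball (0 : E) ρ := by
    refine Set.iUnion₂_subset fun x hx => ?_
    apply ball_subset_ball'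
    calc
      δ + dist x 0 ≤ δ + 8 := by rw [dist_zero_right]; exact add_le_add le_rfl (hs x hx)
      _ = 17 / 2 := by norm_num [δ]
  have I :
    (s.card : ℝ≥0∞) * ENNReal.ofReal (δ ^ finrank ℝ E) * μ (ball 0 1) ≤
      ENNReal.ofReal (ρ ^ finrank ℝ E) * μ (ball 0 1) :=
    calc
      (s.card : ℝ≥0∞) * ENNReal.ofReal (δ ^ finrank ℝ E) * μ (ball 0 1) = μ A := by
        rw [hA, measure_biUnion_finset D fun c _ => measurableSet_ball]
        have I : 0 < δ := by norm_num [δ]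
        simp only [μ.addHaar_ball_of_pos _ I]
        simp only [Finset.sum_const, nsmul_eq_mul, mul_assoc]
      _ ≤ μ (ball (0 : E) ρ) := measure_mono A_subset
      _ = ENNReal.ofReal (ρ ^ finrank ℝ E) * μ (ball 0 1) := by
        simp only [μ.addHaar_ball_of_pos _ ρpos]
  have J : (s.card : ℝ≥0∞) * ENNReal.ofReal (δ ^ finrank ℝ E) ≤ ENNReal.ofReal (ρ ^ finrank ℝ E) :=
    (ENNReal.mul_le_mul_iff_left (measure_ball_pos _ _ zero_lt_one).ne' measure_ball_lt_top.ne).1 I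
  have K : (s.card : ℝ) ≤ (17 : ℝ) ^ finrank ℝ E := by
    have := ENNReal.toReal_le_of_le_ofReal (pow_nonneg ρpos.le _) J
    simpa [ρ, δ, div_eq_mul_inv, mul_pow] using this
  exact mod_cast K

lemma iso_return {G : Type} [Group G] {R : Type*} [NormedRing R] [NormedSpace ℝ R] [FiniteDimensional ℝ R]
    (π : G →* R) (hπ : ∀ g, ‖π g‖ ≤ 1) (a : G) : ∃ i, 1 ≤ i ∧ i ≤ 17 ^ Module.finrank ℝ R ∧ ‖π (a ^ i) - 1‖ ≤ 1 / 8 := by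
  classical
  by_contra! hcon
  have hsep : ∀ i j : ℕ, i < j → j ≤ 17 ^ Module.finrank ℝ R → 1 / 8 < ‖π (a ^ j) - π (a ^ i)‖ := by
    intro i j hij hj
    have h1 := hcon (j - i) (by omega) (by omega)
    have h2 : π (a ^ (j - i)) - 1 = (π (a ^ j) - π (a ^ i)) * π (a ^ i)⁻¹ := by
      rw [sub_mul, ← map_mul, ← map_mul, mul_inv_cancel, map_one]
      congr 2
      rw [eq_mul_inv_iff_mul_eq, ← pow_add]; congr 1; omega
    rw [h2] at h1
    refine h1.trans_le ((norm_mul_le _ _).trans ?_)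
    calc _ ≤ ‖π (a ^ j) - π (a ^ i)‖ * 1 := by gcongr; exact hπ _
      _ = _ := mul_one _
  have hsep' : ∀ i j : ℕ, i ≠ j → i ≤ 17 ^ Module.finrank ℝ R → j ≤ 17 ^ Module.finrank ℝ R → 1 / 8 < ‖π (a ^ i) - π (a ^ j)‖ := by
    intro i j hij hi hj
    rcases lt_or_gt_of_ne hij with h | h
    · rw [norm_sub_rev]; exact hsep i j h hj
    · exact hsep j i h hi
  let f : ℕ → R := fun i => (8:ℝ) • π (a ^ i)
  have hf : ∀ i j, ‖f i - f j‖ = 8 * ‖π (a ^ i) - π (a ^ j)‖ := by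
    intro i j
    simp only [f]
    rw [← smul_sub, norm_smul]; norm_num
  have hinj : Set.InjOn f (Finset.range (17 ^ Module.finrank ℝ R + 1) : Set ℕ) := by
    intro i hi j hj hij
    by_contra hne
    have h1 := hsep' i j hne (by simp at hi; omega) (by simp at hj; omega)
    have h2 := hf i j
    rw [hij, sub_self, norm_zero] at h2
    linarith
  have := card_le_sep ((Finset.range (17 ^ Module.finrank ℝ R + 1)).image f) (by
      intro c hc
      obtain ⟨i, -, rfl⟩ := Finset.mem_image.1 hc
      simp only [f]
      rw [norm_smul]
      have := hπ (a ^ i)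
      rw [Real.norm_of_nonneg (by norm_num)]; linarith) (by
      intro c hc d hd hcd
      obtain ⟨i, hi, rfl⟩ := Finset.mem_image.1 hc
      obtain ⟨j, hj, rfl⟩ := Finset.mem_image.1 hd
      rw [hf]
      have := hsep' i j (fun h => hcd (h ▸ rfl)) (by simp at hi; omega) (by simp at hj; omega)
      linarith)
  rw [Finset.card_image_of_injOn hinj, Finset.card_range] at this
  omega

end UEG

namespace UEG
set_option linter.unusedVariables false
set_option linter.style.haveILetI false
set_option linter.unusedSectionVars false
open scoped Pointwise commutatorElement

lemma norm_multiset_sum_le (s : Multiset ℂ) (C : ℝ) (h : ∀ x ∈ s, ‖x‖ ≤ C) : ‖s.sum‖ ≤ s.card * C := by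
  induction s using Multiset.induction with
  | empty => simp
  | cons a s ih =>
    rw [Multiset.sum_cons, Multiset.card_cons]
    push_cast
    have h1 := h a (by simp)
    have h2 := ih fun x hx => h x (by simp [hx])
    have := norm_add_le a s.sum
    linarith

lemma norm_multiset_prod_eq (s : Multiset ℂ) (h : ∀ x ∈ s, ‖x‖ = 1) : ‖s.prod‖ = 1 := by
  induction s using Multiset.induction with
  | empty => simp
  | cons a s ih =>
    rw [Multiset.prod_cons, norm_mul, h a (by simp), ih fun x hx => h x (by simp [hx]), one_mul]

section
variable {V : Type*} [AddCommGroup V] [Module ℂ V] [FiniteDimensional ℂ V]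

lemma trace_le_of_eig (A : Module.End ℂ V) (C : ℝ) (h : ∀ μ, A.HasEigenvalue μ → ‖μ‖ ≤ C) :
    ‖LinearMap.trace ℂ V A‖ ≤ Module.finrank ℂ V * C := by
  let b := Module.finBasis ℂ V
  rw [LinearMap.trace_eq_matrix_trace ℂ b, Matrix.trace_eq_sum_roots_charpoly]
  refine (norm_multiset_sum_le _ C ?_).trans_eq ?_
  · intro x hx
    apply h
    rw [Module.End.hasEigenvalue_iff_isRoot_charpoly, ← LinearMap.charpoly_toMatrix A b]
    exact Polynomial.isRoot_of_mem_roots hx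
  · congr 2
    rw [IsAlgClosed.card_roots_eq_natDegree, Matrix.charpoly_natDegree_eq_dim, Fintype.card_fin]

lemma det_of_eig (A : Module.End ℂ V) (h : ∀ μ, A.HasEigenvalue μ → ‖μ‖ = 1) :
    ‖LinearMap.det A‖ = 1 := by
  let b := Module.finBasis ℂ V
  rw [← LinearMap.det_toMatrix b, Matrix.det_eq_prod_roots_charpoly]
  apply norm_multiset_prod_eq
  intro x hx
  apply h
  rw [Module.End.hasEigenvalue_iff_isRoot_charpoly, ← LinearMap.charpoly_toMatrix A b]
  exact Polynomial.isRoot_of_mem_roots hx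

lemma exists_norm_space {V : Type} [AddCommGroup V] [Module ℂ V] (p : V → ℝ) (h0 : ∀ x, 0 ≤ p x) (hadd : ∀ x y, p (x + y) ≤ p x + p y)
    (hsm : ∀ (c : ℂ) x, p (c • x) = ‖c‖ * p x) (hd : ∀ x, p x = 0 → x = 0) :
    ∃ (W : Type) (_ : NormedAddCommGroup W) (_ : NormedSpace ℂ W) (e : V ≃ₗ[ℂ] W), ∀ x, ‖e x‖ = p x := by
  letI : Norm V := ⟨p⟩
  have core : NormedSpace.Core ℂ V := { norm_nonneg := h0, norm_smul := hsm, norm_triangle := hadd, norm_eq_zero_iff := fun x => ⟨hd x, by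
    rintro rfl; have := hsm 0 0; rw [zero_smul, norm_zero, zero_mul] at this; exact this⟩ }
  letI i1 : NormedAddCommGroup V := NormedAddCommGroup.ofCore core
  letI i2 : NormedSpace ℂ V := NormedSpace.ofCore core
  exact ⟨V, i1, i2, LinearEquiv.refl ℂ V, fun x => rfl⟩
end

lemma trace_le_norm {W : Type*} [NormedAddCommGroup W] [NormedSpace ℂ W] [FiniteDimensional ℂ W] (A : W →L[ℂ] W) :
    ‖LinearMap.trace ℂ W A.toLinearMap‖ ≤ Module.finrank ℂ W * ‖A‖ := by
  apply trace_le_of_eig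
  intro μ hμ
  obtain ⟨x, hx⟩ := hμ.exists_hasEigenvector
  have h1 := hx.apply_eq_smul
  have h2 := A.le_opNorm x
  rw [show A x = μ • x from h1, norm_smul] at h2
  exact le_of_mul_le_mul_right h2 (norm_pos_iff.2 hx.2)

/-- power bounded with unimodular determinant implies expanding -/
lemma iso_of_contr {W : Type*} [NormedAddCommGroup W] [NormedSpace ℂ W] [FiniteDimensional ℂ W] (A : W →L[ℂ] W)
    (hA : ‖A‖ ≤ 1) (hdet : ‖LinearMap.det A.toLinearMap‖ = 1) (x : W) : ‖x‖ ≤ ‖A x‖ := by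
  haveI : ProperSpace (W →L[ℂ] W) := FiniteDimensional.proper ℂ _
  let S : Subsemigroup (W →L[ℂ] W) := Subsemigroup.closure {A}
  have hS : ∀ B ∈ S, ‖B‖ ≤ 1 ∧ ‖B.det‖ = 1 ∧ ∀ x, ‖B x‖ ≤ ‖A x‖ := by
    intro B hB
    induction hB using Subsemigroup.closure_induction with
    | mem B hB =>
      obtain rfl : B = A := hB
      exact ⟨hA, hdet, fun x => le_rfl⟩
    | mul B C _ _ hB hC =>
      refine ⟨(norm_mul_le _ _).trans (mul_le_one₀ hB.1 (norm_nonneg _) hC.1), ?_, ?_⟩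
      · have : (B * C).det = B.det * C.det := LinearMap.det_comp _ _
        rw [this, norm_mul, hB.2.1, hC.2.1, one_mul]
      · intro x
        calc ‖B (C x)‖ ≤ ‖B‖ * ‖C x‖ := B.le_opNorm _
          _ ≤ 1 * ‖C x‖ := by gcongr; exact hB.1
          _ ≤ ‖A x‖ := by rw [one_mul]; exact hC.2.2 x
  let K : Set (W →L[ℂ] W) := closure S
  have hclosed : IsClosed {B : W →L[ℂ] W | ‖B‖ ≤ 1 ∧ ‖B.det‖ = 1 ∧ ∀ x, ‖B x‖ ≤ ‖A x‖} := by
    have e : {B : W →L[ℂ] W | ‖B‖ ≤ 1 ∧ ‖B.det‖ = 1 ∧ ∀ x, ‖B x‖ ≤ ‖A x‖} =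
      {B | ‖B‖ ≤ 1} ∩ ({B | ‖B.det‖ = 1} ∩ ⋂ x, {B | ‖B x‖ ≤ ‖A x‖}) := by
      ext B; simp
    rw [e]
    refine (isClosed_le (by fun_prop) (by fun_prop)).inter (IsClosed.inter (isClosed_eq ?_ (by fun_prop)) (isClosed_iInter fun x => isClosed_le (by fun_prop) (by fun_prop)))
    exact ContinuousLinearMap.continuous_det.norm
  have hK : ∀ B ∈ K, ‖B‖ ≤ 1 ∧ ‖B.det‖ = 1 ∧ ∀ x, ‖B x‖ ≤ ‖A x‖ := fun B hB => closure_minimal (s := (S : Set (W →L[ℂ] W))) hS hclosed hB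
  have hKc : IsCompact K := by
    refine Metric.isCompact_of_isClosed_isBounded isClosed_closure ?_
    rw [isBounded_iff_forall_norm_le]
    exact ⟨1, fun B hB => (hK B hB).1⟩
  obtain ⟨m, hm, hmm⟩ := exists_idempotent_in_compact_subsemigroup (M := (W →L[ℂ] W)) (fun r => continuous_mul_const r) K
    ⟨A, subset_closure (Subsemigroup.subset_closure rfl)⟩ hKc (fun x hx y hy => S.topologicalClosure.mul_mem hx hy)
  have hdm := (hK m hm).2.1
  have hinj : Function.Injective m := by
    have : IsUnit (LinearMap.det m.toLinearMap) := by
      rw [isUnit_iff_ne_zero]; intro h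
      have : m.det = 0 := h
      rw [this] at hdm; simp at hdm
    intro x y hxy
    exact (LinearMap.equivOfDetNeZero m.toLinearMap (IsUnit.ne_zero ‹_›)).injective hxy
  have h1 : m x = x := hinj (congrArg (fun f : W →L[ℂ] W => f x) hmm)
  have := (hK m hm).2.2 x
  rwa [h1] at this


section
variable {G : Type} [Group G]

lemma U_iso {W : Type*} [NormedAddCommGroup W] [NormedSpace ℂ W] [FiniteDimensional ℂ W] [Nontrivial W]
    (π : G →* (W →L[ℂ] W)) (hπ : ∀ g, ‖π g‖ ≤ 1) (J t : ℕ) (hJ : 17 ^ (2 * Module.finrank ℂ W ^ 2) ≤ J) (a : G) :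
    ∀ z ∈ YS Set.univ t a J, ∀ y, ‖LinearMap.trace ℂ W (π (z * y)).toLinearMap - LinearMap.trace ℂ W (π y).toLinearMap‖ ≤
      Module.finrank ℂ W * (4 ^ J * ((1 / 2) * (1 / 4) ^ (2 ^ t))) := by
  intro z hz y
  have hfr : Module.finrank ℝ (W →L[ℂ] W) = 2 * Module.finrank ℂ W ^ 2 := by
    rw [finrank_real_of_complex, LinearEquiv.finrank_eq (LinearMap.toContinuousLinearMap (𝕜 := ℂ) (E := W) (F' := W)).symm, Module.finrank_linearMap]
    ring
  haveI : FiniteDimensional ℝ (W →L[ℂ] W) := FiniteDimensional.complexToReal _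
  obtain ⟨i, hi1, hi2, hi⟩ := iso_return π hπ a
  rw [hfr] at hi2
  have h1 := norm_YS π hπ a i hi1 hi t J (by omega) z hz
  rw [← map_sub]
  have h2 : (π (z * y)).toLinearMap - (π y).toLinearMap = ((π z - 1) * π y).toLinearMap := by
    rw [sub_mul, one_mul, ← map_mul]; rfl
  rw [h2]
  refine (trace_le_norm _).trans ?_
  gcongr
  calc _ ≤ ‖π z - 1‖ * ‖π y‖ := norm_mul_le _ _
    _ ≤ ‖π z - 1‖ * 1 := by gcongr; exact hπ y
    _ ≤ _ := by rw [mul_one]; exact h1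

lemma U_irr {V : Type} [AddCommGroup V] [Module ℂ V] [FiniteDimensional ℂ V] [Nontrivial V]
    (ρ : G →* Module.End ℂ V) (S : Submonoid G) (hS : Subgroup.closure (S : Set G) = ⊤)
    (heig : ∀ s ∈ S, ∀ μ, (ρ s).HasEigenvalue μ → ‖μ‖ = 1)
    (hirr : IrrE (S.map ρ : Set (Module.End ℂ V)))
    (J t : ℕ) (hJ : 17 ^ (2 * Module.finrank ℂ V ^ 2) ≤ J) (a : G) :
    ∀ z ∈ YS Set.univ t a J, ∀ y, ‖LinearMap.trace ℂ V (ρ (z * y)) - LinearMap.trace ℂ V (ρ y)‖ ≤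
      Module.finrank ℂ V * (4 ^ J * ((1 / 2) * (1 / 4) ^ (2 ^ t))) := by
  have hspan := burnside (S.map ρ) hirr
  have hb1 : ∀ E : Module.End ℂ V, ∃ C : ℝ, ∀ s ∈ S, ‖LinearMap.trace ℂ V (ρ s * E)‖ ≤ C := by
    intro E
    have hE : E ∈ Submodule.span ℂ (S.map ρ : Set (Module.End ℂ V)) := hspan ▸ trivial
    induction hE using Submodule.span_induction with
    | mem x hx =>
      obtain ⟨s', hs', rfl⟩ := hx
      refine ⟨Module.finrank ℂ V * 1, fun s hs => ?_⟩
      rw [← map_mul]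
      exact trace_le_of_eig _ _ fun μ hμ => (heig _ (S.mul_mem hs hs') μ hμ).le
    | zero => exact ⟨0, by simp⟩
    | add x y _ _ hx hy =>
      obtain ⟨C, hC⟩ := hx
      obtain ⟨C', hC'⟩ := hy
      refine ⟨C + C', fun s hs => ?_⟩
      rw [mul_add, map_add]
      exact (norm_add_le _ _).trans (add_le_add (hC s hs) (hC' s hs))
    | smul c x _ hx =>
      obtain ⟨C, hC⟩ := hx
      refine ⟨‖c‖ * C, fun s hs => ?_⟩
      rw [mul_smul_comm, map_smul, norm_smul]
      exact mul_le_mul_of_nonneg_left (hC s hs) (norm_nonneg _)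
  have hb2 : ∀ (f : V →ₗ[ℂ] ℂ) (x : V), ∃ C : ℝ, ∀ s ∈ S, ‖f (ρ s x)‖ ≤ C := by
    intro f x
    obtain ⟨C, hC⟩ := hb1 (f.smulRight x)
    refine ⟨C, fun s hs => ?_⟩
    have : ρ s * f.smulRight x = f.smulRight (ρ s x) := by
      ext y; simp
    have h2 := hC s hs
    rwa [this, LinearMap.trace_smulRight] at h2
  let e := (Module.finBasis ℂ V).equivFun
  have hbd : ∀ x, BddAbove (Set.range fun s : S => ‖e (ρ s x)‖) := by
    intro x
    choose C hC using fun i => hb2 ((Module.finBasis ℂ V).coord i) x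
    refine ⟨∑ i, C i, ?_⟩
    rintro _ ⟨s, rfl⟩
    refine (pi_norm_le_iff_of_nonneg ?_).2 fun i => ?_
    · exact Finset.sum_nonneg fun i _ => (norm_nonneg _).trans (hC i 1 S.one_mem)
    · refine (hC i s s.2).trans (Finset.single_le_sum (f := C) (fun i _ => (norm_nonneg _).trans (hC i 1 S.one_mem)) (Finset.mem_univ i))
  let p : V → ℝ := fun x => ⨆ s : S, ‖e (ρ s x)‖
  have hle : ∀ x (s : S), ‖e (ρ s x)‖ ≤ p x := fun x s => le_ciSup (hbd x) s
  haveI : Nonempty S := ⟨1⟩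
  obtain ⟨W, _, _, E, hE⟩ := exists_norm_space p (fun x => (norm_nonneg _).trans (hle x 1))
    (fun x y => ciSup_le fun s => by
      rw [map_add, map_add]
      exact (norm_add_le _ _).trans (add_le_add (hle x s) (hle y s)))
    (fun c x => by
      simp only [p]
      rw [Real.mul_iSup_of_nonneg (norm_nonneg c)]
      simp only [map_smul, norm_smul])
    (fun x hx => by
      have := hle x 1
      rw [hx] at this
      have h2 : ‖e (ρ ((1 : S) : G) x)‖ = 0 := le_antisymm this (norm_nonneg _)
      simpa using h2)
  haveI : FiniteDimensional ℂ W := E.finiteDimensional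
  haveI : Nontrivial W := E.symm.toEquiv.nontrivial
  let c : Module.End ℂ V →* (W →L[ℂ] W) :=
    { toFun := fun A => LinearMap.toContinuousLinearMap (E.conj A)
      map_one' := by ext x; simp
      map_mul' := by intro A B; ext x; simp [LinearEquiv.conj_apply] }
  have hc : ∀ A : Module.End ℂ V, (c A).toLinearMap = E.conj A := fun A => by
    ext x; rfl
  have hcE : ∀ (A : Module.End ℂ V) x, c A (E x) = E (A x) := fun A x => by
    change E.conj A (E x) = _
    simp [LinearEquiv.conj_apply]
  let π : G →* (W →L[ℂ] W) := c.comp ρ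
  have hSn : ∀ s ∈ S, ‖π s‖ ≤ 1 := by
    intro s hs
    refine ContinuousLinearMap.opNorm_le_bound _ zero_le_one fun w => ?_
    obtain ⟨x, rfl⟩ := E.surjective w
    rw [one_mul]
    change ‖c (ρ s) (E x)‖ ≤ _
    rw [hcE, hE, hE]
    refine ciSup_le fun s' => ?_
    have := hle x (s' * ⟨s, hs⟩)
    simpa using this
  have hSd : ∀ s ∈ S, ‖LinearMap.det (π s).toLinearMap‖ = 1 := by
    intro s hs
    change ‖LinearMap.det (c (ρ s)).toLinearMap‖ = 1
    rw [hc, LinearEquiv.conj_apply, LinearMap.comp_assoc]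
    have := LinearMap.det_conj (ρ s) E
    rw [this]
    exact det_of_eig _ (heig s hs)
  have hπ : ∀ g, ‖π g‖ ≤ 1 := by
    intro g
    have hg : g ∈ Subgroup.closure (S : Set G) := hS ▸ trivial
    induction hg using Subgroup.closure_induction'' with
    | mem s hs => exact hSn s hs
    | one => rw [map_one]; exact ContinuousLinearMap.norm_id_le
    | inv_mem s hs =>
      refine ContinuousLinearMap.opNorm_le_bound _ zero_le_one fun w => ?_
      rw [one_mul]
      refine (iso_of_contr (π s) (hSn s hs) (hSd s hs) _).trans_eq ?_
      rw [← mul_apply_eq_comp, ← map_mul, mul_inv_cancel, map_one]; rfl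
    | mul x y _ _ hx hy =>
      rw [map_mul]
      exact (norm_mul_le _ _).trans (mul_le_one₀ hx (norm_nonneg _) hy)
  have hfr : Module.finrank ℂ W = Module.finrank ℂ V := E.symm.finrank_eq
  intro z hz y
  have := U_iso π hπ J t (by rw [hfr]; exact hJ) a z hz y
  rw [hfr] at this
  have htr : ∀ g, LinearMap.trace ℂ W (π g).toLinearMap = LinearMap.trace ℂ V (ρ g) := by
    intro g
    change LinearMap.trace ℂ W (c (ρ g)).toLinearMap = _
    rw [hc, LinearMap.trace_conj']
  rwa [htr, htr] at this
end
end UEG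

namespace UEG
set_option linter.unusedVariables false
set_option linter.style.haveILetI false
set_option linter.unusedSectionVars false
open scoped Pointwise commutatorElement

open Module.Basis in
theorem trace_add_quot {V : Type*} [AddCommGroup V]
    [Module ℂ V] [FiniteDimensional ℂ V] (W : Submodule ℂ V) (e : V →ₗ[ℂ] V) (he : W ≤ W.comap e) :
    LinearMap.trace ℂ V e = LinearMap.trace ℂ W (e.restrict he) + LinearMap.trace ℂ (V ⧸ W) (W.mapQ W e he) := by
  let R := ℂ
  let m := Module.Free.ChooseBasisIndex R W
  let bW : Module.Basis m R W := Module.Free.chooseBasis R W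
  let n := Module.Free.ChooseBasisIndex R (V ⧸ W)
  let bQ : Module.Basis n R (V ⧸ W) := Module.Free.chooseBasis R (V ⧸ W)
  let b := sumQuot bW bQ
  let A : Matrix m m R := LinearMap.toMatrix bW bW (e.restrict he)
  let B : Matrix m n R := Matrix.of fun i l ↦
    ((sumQuot bW bQ).repr (e ((sumQuot bW bQ) (Sum.inr l)))) (Sum.inl i)
  let D : Matrix n n R := LinearMap.toMatrix bQ bQ (W.mapQ W e he)
  suffices LinearMap.toMatrix b b e = Matrix.fromBlocks A B 0 D by
    rw [LinearMap.trace_eq_matrix_trace ℂ b, this, LinearMap.trace_eq_matrix_trace ℂ bW,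
      LinearMap.trace_eq_matrix_trace ℂ bQ]
    simp [Matrix.trace, A, D]
  ext u v
  cases u with
  | inl i =>
    cases v with
    | inl k =>
      simp only [b, sumQuot_inl, Matrix.fromBlocks_apply₁₁, A, LinearMap.toMatrix_apply]
      apply sumQuot_repr_inl_of_mem
    | inr l => simp [b, LinearMap.toMatrix_apply, Matrix.fromBlocks_apply₁₂, B]
  | inr j =>
    cases v with
    | inl k =>
      suffices W.mkQ (e (bW k)) = 0 by simp [LinearMap.toMatrix_apply, b, this]
      rw [← LinearMap.mem_ker, Submodule.ker_mkQ]
      exact he (Submodule.coe_mem (bW k))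
    | inr l =>
      simp only [LinearMap.toMatrix_apply, sumQuot_repr_inr,
        Matrix.fromBlocks_apply₂₂, b, D]
      rw [← sumQuot_inr bW bQ l, W.mapQ_apply]
      simp

lemma eig_restrict {V : Type*} [AddCommGroup V] [Module ℂ V] (W : Submodule ℂ V) (e : Module.End ℂ V) (he : W ≤ W.comap e)
    (μ : ℂ) (h : Module.End.HasEigenvalue (e.restrict he : Module.End ℂ W) μ) : e.HasEigenvalue μ := by
  obtain ⟨x, hx⟩ := h.exists_hasEigenvector
  refine Module.End.hasEigenvalue_of_hasEigenvector (x := (x : V)) ⟨?_, ?_⟩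
  · rw [Module.End.mem_eigenspace_iff]
    exact congrArg Subtype.val hx.apply_eq_smul
  · intro h0; exact hx.2 (Subtype.ext h0)

lemma eig_quot {V : Type*} [AddCommGroup V] [Module ℂ V] [FiniteDimensional ℂ V] (W : Submodule ℂ V) (e : Module.End ℂ V) (he : W ≤ W.comap e)
    (μ : ℂ) (h : Module.End.HasEigenvalue (W.mapQ W e he : Module.End ℂ (V ⧸ W)) μ) : e.HasEigenvalue μ := by
  by_contra hc
  have hinj : Function.Injective (e - μ • (1 : Module.End ℂ V)) := by
    rw [← LinearMap.ker_eq_bot, ← Module.End.eigenspace_def]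
    rw [Module.End.hasEigenvalue_iff] at hc
    simpa using hc
  have hsurj := LinearMap.injective_iff_surjective.1 hinj
  let T : Module.End ℂ (V ⧸ W) := W.mapQ W e he - μ • (1 : Module.End ℂ (V ⧸ W))
  have hT : Function.Surjective T := by
    intro y
    obtain ⟨y, rfl⟩ := W.mkQ_surjective y
    obtain ⟨x, rfl⟩ := hsurj y
    exact ⟨W.mkQ x, by simp [T]⟩
  have hTi := LinearMap.injective_iff_surjective.2 hT
  obtain ⟨x, hx⟩ := h.exists_hasEigenvector
  apply hx.2
  apply hTi
  have := hx.apply_eq_smul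
  simp [T, this]

lemma lemmaU {G : Type} [Group G] (S : Submonoid G) (hS : Subgroup.closure (S : Set G) = ⊤) (d J t : ℕ)
    (hJ : 17 ^ (2 * d ^ 2) ≤ J) (a z : G) (hz : z ∈ YS Set.univ t a J) (y : G) (n : ℕ) :
    ∀ (V : Type) [AddCommGroup V] [Module ℂ V] [FiniteDimensional ℂ V] (hn : Module.finrank ℂ V = n) (hnd : n ≤ d)
    (ρ : G →* Module.End ℂ V) 
    (heig : ∀ s ∈ S, ∀ μ, (ρ s).HasEigenvalue μ → ‖μ‖ = 1),
    ‖LinearMap.trace ℂ V (ρ (z * y)) - LinearMap.trace ℂ V (ρ y)‖ ≤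
      (n : ℝ) * (4 ^ J * ((1 / 2) * (1 / 4) ^ (2 ^ t))) := by
  induction n using Nat.strong_induction_on with
  | _ n ih =>
  intro V _ _ _ hn hnd ρ heig
  have hpos : (0:ℝ) ≤ 4 ^ J * ((1 / 2) * (1 / 4) ^ (2 ^ t)) := by positivity
  rcases subsingleton_or_nontrivial V with hV | hV
  · have : ρ (z * y) = ρ y := Subsingleton.elim _ _
    rw [this, sub_self, norm_zero]
    positivity
  by_cases hirr : IrrE (S.map ρ : Set (Module.End ℂ V))
  · rw [← hn]
    refine U_irr ρ S hS heig hirr J t (le_trans ?_ hJ) a z hz y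
    rw [hn]
    gcongr; norm_num
  unfold IrrE at hirr
  push Not at hirr
  obtain ⟨U, hU, hUb, hUt⟩ := hirr
  have hinv : ∀ g, U ≤ U.comap (ρ g) := by
    intro g
    have hg : g ∈ Subgroup.closure (S : Set G) := hS ▸ trivial
    induction hg using Subgroup.closure_induction'' with
    | mem s hs => exact fun x hx => hU (ρ s) ⟨s, hs, rfl⟩ x hx
    | one => rw [map_one]; exact fun x hx => hx
    | inv_mem s hs =>
      have h1 : U ≤ U.comap (ρ s) := fun x hx => hU (ρ s) ⟨s, hs, rfl⟩ x hx
      have hl : ∀ x, ρ s⁻¹ (ρ s x) = x := fun x => by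
        rw [← Module.End.mul_apply, ← map_mul, inv_mul_cancel, map_one]; rfl
      have hinj : Function.Injective ((ρ s).restrict h1) := by
        intro x y hxy
        have := congrArg (fun x : U => ρ s⁻¹ (x : V)) hxy
        simp only [LinearMap.restrict_apply, hl] at this
        exact Subtype.ext this
      have hsurj := LinearMap.injective_iff_surjective.1 hinj
      intro x hx
      obtain ⟨y, hy⟩ := hsurj ⟨x, hx⟩
      have : ρ s y = x := congrArg Subtype.val hy
      rw [Submodule.mem_comap, ← this, hl]
      exact y.2
    | mul x y _ _ hx hy =>
      rw [map_mul]
      exact fun v hv => hx (hy hv)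
  let ρU : G →* Module.End ℂ U :=
    { toFun := fun g => (ρ g).restrict (hinv g)
      map_one' := by ext x; simp [LinearMap.restrict_apply]
      map_mul' := by intro g h; ext x; simp [LinearMap.restrict_apply] }
  let ρQ : G →* Module.End ℂ (V ⧸ U) :=
    { toFun := fun g => U.mapQ U (ρ g) (hinv g)
      map_one' := by ext x; simp
      map_mul' := by intro g h; ext x; simp }
  have hdim := Submodule.finrank_quotient_add_finrank U
  have hlt1 : Module.finrank ℂ U < n := hn ▸ Submodule.finrank_lt hUt
  have hpos1 : 0 < Module.finrank ℂ U := by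
    rw [Nat.pos_iff_ne_zero]
    intro h; exact hUb (Submodule.finrank_eq_zero.1 h)
  have h1 := ih _ hlt1 U rfl (by omega) ρU (fun s hs μ hμ => heig s hs μ (eig_restrict U _ (hinv s) μ hμ))
  have h2 := ih (Module.finrank ℂ (V ⧸ U)) (by omega) (V ⧸ U) rfl (by omega) ρQ (fun s hs μ hμ => heig s hs μ (eig_quot U _ (hinv s) μ hμ))
  have htr : ∀ g, LinearMap.trace ℂ V (ρ g) = LinearMap.trace ℂ U (ρU g) + LinearMap.trace ℂ (V ⧸ U) (ρQ g) :=
    fun g => trace_add_quot U (ρ g) (hinv g)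
  rw [htr, htr]
  have hn' : (n:ℝ) = Module.finrank ℂ (V ⧸ U) + Module.finrank ℂ U := by rw [← hn, ← hdim]; push_cast; rfl
  rw [hn', add_sub_add_comm]
  refine (norm_add_le _ _).trans ?_
  linarith

end UEG

namespace UEG
set_option linter.unusedVariables false
set_option linter.style.haveILetI false
set_option linter.unusedSectionVars false
open Matrix Polynomial
open scoped Pointwise

lemma int_coeff (s : Multiset ℂ) (h : ∀ x ∈ s, IsIntegral ℤ x) (i : ℕ) :
    IsIntegral ℤ (((s.map fun a => X - C a).prod).coeff i) := by
  induction s using Multiset.induction generalizing i with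
  | empty =>
    simp only [Multiset.map_zero, Multiset.prod_zero, coeff_one]
    split_ifs
    · exact isIntegral_one
    · exact isIntegral_zero
  | cons a s ih =>
    have ih' := ih fun x hx => h x (by simp [hx])
    have ha := h a (by simp)
    rw [Multiset.map_cons, Multiset.prod_cons, sub_mul, coeff_sub, coeff_C_mul]
    refine IsIntegral.sub ?_ (ha.mul (ih' i))
    cases i with
    | zero => simpa using isIntegral_zero
    | succ i => rw [coeff_X_mul]; exact ih' i

lemma int_charpoly {d : ℕ} (A : Matrix (Fin d) (Fin d) ℂ) (h : ∀ l, A.charpoly.IsRoot l → IsIntegral ℤ l) (i : ℕ) :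
    IsIntegral ℤ (A.charpoly.coeff i) := by
  have := (IsAlgClosed.splits A.charpoly).eq_prod_roots_of_monic A.charpoly_monic
  rw [this]
  apply int_coeff
  intro x hx
  exact h x (isRoot_of_mem_roots hx)

/-- integral span of `F^j` -/
noncomputable def MS {d : ℕ} (F : Set (GL (Fin d) ℂ)) (j : ℕ) : Submodule (integralClosure ℤ ℂ) (Matrix (Fin d) (Fin d) ℂ) :=
  Submodule.span _ ((fun g : GL (Fin d) ℂ => g.1) '' (F ^ j))

lemma MS_mul {d : ℕ} {F : Set (GL (Fin d) ℂ)} {i j : ℕ} {A B : Matrix (Fin d) (Fin d) ℂ} (hA : A ∈ MS F i) (hB : B ∈ MS F j) :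
    A * B ∈ MS F (i + j) := by
  unfold MS at *
  induction hA using Submodule.span_induction with
  | mem x hx =>
    obtain ⟨x, hx, rfl⟩ := hx
    induction hB using Submodule.span_induction with
    | mem y hy =>
      obtain ⟨y, hy, rfl⟩ := hy
      refine Submodule.subset_span ⟨x * y, ?_, rfl⟩
      rw [pow_add]; exact Set.mul_mem_mul hx hy
    | zero => rw [mul_zero]; exact Submodule.zero_mem _
    | add y z _ _ hy hz => rw [mul_add]; exact Submodule.add_mem _ hy hz
    | smul c y _ hy => rw [mul_smul_comm]; exact Submodule.smul_mem _ _ hy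
  | zero => rw [zero_mul]; exact Submodule.zero_mem _
  | add y z _ _ hy hz => rw [add_mul]; exact Submodule.add_mem _ hy hz
  | smul c y _ hy => rw [smul_mul_assoc]; exact Submodule.smul_mem _ _ hy

lemma MS_mono {d : ℕ} {F : Set (GL (Fin d) ℂ)} (h1 : 1 ∈ F) {i j : ℕ} (hij : i ≤ j) : MS F i ≤ MS F j :=
  Submodule.span_mono (Set.image_mono (Set.pow_subset_pow_right h1 hij))

lemma MS_trace {d : ℕ} {F : Set (GL (Fin d) ℂ)} {j : ℕ} (h : ∀ u ∈ F ^ j, ∀ l, u.1.charpoly.IsRoot l → IsIntegral ℤ l)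
    {A : Matrix (Fin d) (Fin d) ℂ} (hA : A ∈ MS F j) : IsIntegral ℤ A.trace := by
  unfold MS at hA
  induction hA using Submodule.span_induction with
  | mem x hx =>
    obtain ⟨x, hx, rfl⟩ := hx
    change IsIntegral ℤ x.1.trace
    rw [Matrix.trace_eq_sum_roots_charpoly]
    exact IsIntegral.multiset_sum fun l hl => h x hx l (isRoot_of_mem_roots hl)
  | zero => simpa using isIntegral_zero
  | add y z _ _ hy hz => rw [trace_add]; exact hy.add hz
  | smul c y _ hy =>
    have : (c • y).trace = (c:ℂ) * y.trace := by rw [Matrix.trace_smul]; rfl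
    rw [this]; exact c.2.mul hy

lemma MS_inv {d : ℕ} {F : Set (GL (Fin d) ℂ)} (h1 : 1 ∈ F) {m : ℕ} (u : GL (Fin d) ℂ) (hu : u ∈ F ^ m) (hdet : u.1.det = 1)
    (h : ∀ l, u.1.charpoly.IsRoot l → IsIntegral ℤ l) : (u⁻¹).1 ∈ MS F (m * d) := by
  set p := u.1.charpoly with hp
  have hCH : aeval u.1 p = 0 := Matrix.aeval_self_charpoly u.1
  have h2 : u.1 * aeval u.1 p.divX + algebraMap ℂ _ (p.coeff 0) = 0 := by
    have h5 := congrArg (aeval u.1) (X_mul_divX_add p)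
    rw [map_add, map_mul, aeval_X, aeval_C, hCH] at h5
    exact h5
  have h0 : p.coeff 0 = (-1) ^ d := by
    have := Matrix.det_eq_sign_charpoly_coeff u.1
    rw [hdet, Fintype.card_fin, ← hp] at this
    have h3 : ((-1:ℂ) ^ d) * ((-1) ^ d * p.coeff 0) = p.coeff 0 := by
      rw [← mul_assoc, ← mul_pow]; simp
    rw [← h3, ← this, mul_one]
  have h3 : (u⁻¹).1 = (-(-1:ℂ) ^ d) • aeval u.1 p.divX := by
    have e : u.1 * ((-(-1:ℂ) ^ d) • aeval u.1 p.divX) = 1 := by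
      rw [mul_smul_comm, eq_neg_of_add_eq_zero_left h2, h0, Algebra.algebraMap_eq_smul_one, smul_neg, smul_smul, ← neg_smul]
      have : -(-(-1:ℂ) ^ d * (-1) ^ d) = 1 := by rw [neg_mul, neg_neg, ← mul_pow]; simp
      rw [this, one_smul]
    calc (u⁻¹).1 = (u⁻¹).1 * (u.1 * ((-(-1:ℂ) ^ d) • aeval u.1 p.divX)) := by rw [e, mul_one]
      _ = _ := by rw [← mul_assoc, gl_inv_mul, one_mul]
  have hIntg : ∀ i, IsIntegral ℤ (p.coeff i) := int_charpoly u.1 h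
  have hsm : ∀ (c : ℂ) (hc : IsIntegral ℤ c) (A : Matrix (Fin d) (Fin d) ℂ), A ∈ MS F (m * d) → c • A ∈ MS F (m * d) :=
    fun c hc A hA => (MS F (m * d)).smul_mem (⟨c, hc⟩ : integralClosure ℤ ℂ) hA
  rw [h3]
  apply hsm
  · exact ((isIntegral_one.neg).pow d).neg
  · rw [aeval_eq_sum_range]
    refine Submodule.sum_mem _ fun i hi => hsm _ ?_ _ ?_
    · rw [coeff_divX]; exact hIntg _
    · have hi' : i ≤ d := by
        have h5 := p.natDegree_divX_eq_natDegree_tsub_one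
        rw [hp, Matrix.charpoly_natDegree_eq_dim, Fintype.card_fin] at h5
        rw [Finset.mem_range] at hi
        rw [hp] at hi
        omega
      have : u ^ i ∈ F ^ (m * d) := by
        refine Set.pow_subset_pow_right h1 (Nat.mul_le_mul_left m hi') ?_
        rw [pow_mul]; exact Set.pow_mem_pow hu
      exact Submodule.subset_span ⟨u ^ i, this, rfl⟩

lemma det_pow_mem {d : ℕ} {F : Set (GL (Fin d) ℂ)} (h : ∀ f ∈ F, f.1.det = 1) (n : ℕ) : ∀ u ∈ F ^ n, u.1.det = 1 := by
  induction n with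
  | zero => intro u hu; rw [pow_zero, Set.mem_one] at hu; simp [hu]
  | succ n ih =>
    intro u hu
    rw [pow_succ] at hu
    obtain ⟨a, ha, b, hb, rfl⟩ := hu
    change (a.1 * b.1).det = 1
    rw [Matrix.det_mul, ih a ha, h b hb, one_mul]

lemma int_word {α : Type*} (d m : ℕ) (w : FreeGroup α) : ∃ j, ∀ F : Set (GL (Fin d) ℂ), 1 ∈ F → (∀ f ∈ F, f.1.det = 1) →
    (∀ u ∈ F ^ m, ∀ l, u.1.charpoly.IsRoot l → IsIntegral ℤ l) →
    ∀ x : α → GL (Fin d) ℂ, (∀ a, x a ∈ F ^ m) → (FreeGroup.lift x w).1 ∈ MS F j := by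
  induction w using FreeGroup.induction_on with
  | C1 =>
    refine ⟨0, fun F h1 hdet hF x hx => ?_⟩
    rw [map_one]
    exact Submodule.subset_span ⟨1, by simp, rfl⟩
  | of a =>
    refine ⟨m, fun F h1 hdet hF x hx => ?_⟩
    rw [FreeGroup.lift_apply_of]
    exact Submodule.subset_span ⟨_, hx a, rfl⟩
  | inv_of a _ =>
    refine ⟨m * d, fun F h1 hdet hF x hx => ?_⟩
    rw [map_inv, FreeGroup.lift_apply_of]
    exact MS_inv h1 _ (hx a) (det_pow_mem hdet m _ (hx a)) (hF _ (hx a))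
  | mul x y hx hy =>
    obtain ⟨i, hi⟩ := hx
    obtain ⟨j, hj⟩ := hy
    refine ⟨i + j, fun F h1 hdet hF x hx => ?_⟩
    rw [map_mul]
    exact MS_mul (hi F h1 hdet hF x hx) (hj F h1 hdet hF x hx)

lemma trace_nonzero (d : ℕ) (hd : 1 ≤ d) : ∃ D, ∀ F : Set (GL (Fin d) ℂ), 1 ∈ F → Irr (Subgroup.closure F : Set (GL (Fin d) ℂ)) →
    ∀ A : Matrix (Fin d) (Fin d) ℂ, A ≠ 0 → ∃ y ∈ F ^ D, (A * y.1).trace ≠ 0 := by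
  refine ⟨∑ i : Fin d, (∑ j : Fin d, 1 * Fintype.card (Fin d) + 1) + 1, fun F h1 hirr A hA => ?_⟩
  by_contra! hcon
  apply hA
  refine trace_zero_mat (Irr.span hd _ hirr) A ?_
  rintro _ ⟨g, hg, rfl⟩
  have hdeg : Deg (∑ i : Fin d, (∑ j : Fin d, 1 * Fintype.card (Fin d) + 1) + 1) (fun y : GL (Fin d) ℂ => (A * y.1).trace) := by
    simp only [Matrix.trace, Matrix.diag_apply, Matrix.mul_apply]
    refine Deg.sum _ _ _ fun i _ => Deg.sum _ _ _ fun j _ => Deg.mul (Deg.const _) (Deg.entry j i)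
  exact hdeg.vanish h1 hcon g hg

end UEG

namespace UEG
set_option linter.unusedVariables false
set_option linter.style.haveILetI false
set_option linter.unusedSectionVars false
open Matrix Polynomial Filter Topology
open scoped Pointwise

lemma ulim {d : ℕ} (A : ℕ → Matrix (Fin d) (Fin d) ℂ) (B : ℝ) (h : ∀ᶠ k in (UU : Filter ℕ), ∀ i j, ‖A k i j‖ ≤ B) :
    ∃ L : Matrix (Fin d) (Fin d) ℂ, Tendsto A (UU : Filter ℕ) (𝓝 L) := by
  have : ∀ i j, ∃ x : ℂ, Tendsto (fun k => A k i j) (UU : Filter ℕ) (𝓝 x) := by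
    intro i j
    obtain ⟨x, -, hx⟩ := (isCompact_closedBall (0:ℂ) B).ultrafilter_le_nhds' (UU.map fun k => A k i j) (by
      change ∀ᶠ k in (UU : Filter ℕ), A k i j ∈ Metric.closedBall (0:ℂ) B
      filter_upwards [h] with k hk
      simpa using hk i j)
    exact ⟨x, hx⟩
  choose L hL using this
  exact ⟨L, tendsto_pi_nhds.2 fun i => tendsto_pi_nhds.2 fun j => hL i j⟩

lemma gl_inv_adj {d : ℕ} (u : GL (Fin d) ℂ) (h : u.1.det = 1) : (u⁻¹).1 = u.1.adjugate := by
  rw [Matrix.coe_units_inv, Matrix.inv_def, h]; simp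

lemma free_lim {β : Type*} {d : ℕ} (θ : ℕ → FreeGroup β →* GL (Fin d) ℂ) (L : β → GL (Fin d) ℂ)
    (hdet : ∀ k b, (θ k (FreeGroup.of b)).1.det = 1) 
    (hL : ∀ b, Tendsto (fun k => (θ k (FreeGroup.of b)).1) (UU : Filter ℕ) (𝓝 (L b).1)) (g : FreeGroup β) :
    (FreeGroup.lift L g).1.det = 1 ∧ Tendsto (fun k => (θ k g).1) (UU : Filter ℕ) (𝓝 (FreeGroup.lift L g).1) := by
  have hLd : ∀ b, (L b).1.det = 1 := by
    intro b
    have h1 : Tendsto (fun k => (θ k (FreeGroup.of b)).1.det) (UU : Filter ℕ) (𝓝 (L b).1.det) :=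
      ((Continuous.matrix_det continuous_id).tendsto _).comp (hL b)
    simp only [hdet] at h1
    exact tendsto_nhds_unique h1 tendsto_const_nhds
  induction g using FreeGroup.induction_on with
  | C1 => simpa using tendsto_const_nhds
  | of a => rw [FreeGroup.lift_apply_of]; exact ⟨hLd a, hL a⟩
  | inv_of a _ =>
    simp only [map_inv, FreeGroup.lift_apply_of]
    refine ⟨?_, ?_⟩
    · rw [gl_inv_adj _ (hLd a), Matrix.det_adjugate, hLd a, one_pow]
    · rw [gl_inv_adj _ (hLd a)]
      have : (fun k => ((θ k (FreeGroup.of a))⁻¹).1) = fun k => (θ k (FreeGroup.of a)).1.adjugate := by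
        funext k; exact gl_inv_adj _ (hdet k a)
      rw [this]
      exact ((Continuous.matrix_adjugate continuous_id).tendsto _).comp (hL a)
  | mul x y hx hy =>
    refine ⟨?_, ?_⟩
    · rw [map_mul]
      change ((FreeGroup.lift L x).1 * (FreeGroup.lift L y).1).det = 1
      rw [Matrix.det_mul, hx.1, hy.1, one_mul]
    · simp only [map_mul]
      exact hx.2.mul hy.2

lemma norm_multiset_prod_ge (s : Multiset ℂ) (c : ℝ) (hc : 0 ≤ c) (h : ∀ x ∈ s, c ≤ ‖x‖) : c ^ s.card ≤ ‖s.prod‖ := by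
  induction s using Multiset.induction with
  | empty => simp
  | cons a s ih =>
    rw [Multiset.prod_cons, norm_mul, Multiset.card_cons, pow_succ']
    exact mul_le_mul (h a (by simp)) (ih fun x hx => h x (by simp [hx])) (by positivity) (norm_nonneg _)

lemma norm_multiset_prod_le_one (s : Multiset ℂ) (h : ∀ x ∈ s, ‖x‖ ≤ 1) : ‖s.prod‖ ≤ 1 := by
  induction s using Multiset.induction with
  | empty => simp
  | cons a s ih =>
    rw [Multiset.prod_cons, norm_mul]
    exact mul_le_one₀ (h a (by simp)) (norm_nonneg _) (ih fun x hx => h x (by simp [hx]))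

lemma root_lim {d : ℕ} (A : ℕ → Matrix (Fin d) (Fin d) ℂ) (L : Matrix (Fin d) (Fin d) ℂ) (hL : Tendsto A (UU : Filter ℕ) (𝓝 L))
    (hdet : L.det = 1) (hr : ∀ᶠ k : ℕ in (UU : Filter ℕ), ∀ l, (A k).charpoly.IsRoot l → ‖l‖ < 1 + 1 / ((k:ℝ) + 1))
    (l : ℂ) (hl : L.charpoly.IsRoot l) : ‖l‖ = 1 := by
  have key : ∀ l, L.charpoly.IsRoot l → ‖l‖ ≤ 1 := by
    intro l hl
    by_contra! h1
    have ht : Tendsto (fun k => (A k).charpoly.eval l) (UU : Filter ℕ) (𝓝 (L.charpoly.eval l)) := by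
      simp only [Matrix.eval_charpoly]
      exact ((Continuous.matrix_det (continuous_const.sub continuous_id)).tendsto L).comp hL
    rw [show L.charpoly.eval l = 0 from hl] at ht
    have ht2 := ht.norm
    rw [norm_zero] at ht2
    obtain ⟨q, hq⟩ := exists_nat_one_div_lt (show 0 < (‖l‖ - 1) / 2 by linarith)
    have hev : ∀ᶠ k : ℕ in (UU : Filter ℕ), ((‖l‖ - 1) / 2) ^ d ≤ ‖(A k).charpoly.eval l‖ := by
      filter_upwards [hr, ev_ge q] with k hk hqk
      have h3 : 1 / ((k:ℝ) + 1) ≤ 1 / ((q:ℝ) + 1) := by gcongr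
      have h4 := (IsAlgClosed.splits (A k).charpoly).eq_prod_roots_of_monic (A k).charpoly_monic
      have h5 : (A k).charpoly.eval l = ((A k).charpoly.roots.map fun a => l - a).prod := by
        conv_lhs => rw [h4]
        rw [eval_multiset_prod, Multiset.map_map]
        congr 1
        apply Multiset.map_congr rfl
        intro a _
        simp
      rw [h5]
      have hcard : ((A k).charpoly.roots.map fun a => l - a).card = d := by
        rw [Multiset.card_map, IsAlgClosed.card_roots_eq_natDegree, Matrix.charpoly_natDegree_eq_dim, Fintype.card_fin]
      conv_lhs => rw [← hcard]
      apply norm_multiset_prod_ge _ _ (by linarith)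
      intro x hx
      obtain ⟨a, ha, rfl⟩ := Multiset.mem_map.1 hx
      have h6 := hk a (isRoot_of_mem_roots ha)
      have h7 := norm_sub_norm_le l a
      linarith
    have h8 := ge_of_tendsto ht2 hev
    have : 0 < ((‖l‖ - 1) / 2) ^ d := by
      apply pow_pos; linarith
    linarith
  refine le_antisymm (key l hl) ?_
  have h1 := Matrix.det_eq_prod_roots_charpoly L
  have hmem : l ∈ L.charpoly.roots := (mem_roots L.charpoly_monic.ne_zero).2 hl
  obtain ⟨s, hs⟩ := Multiset.exists_cons_of_mem hmem
  rw [hdet, hs, Multiset.prod_cons] at h1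
  have h2 : ‖s.prod‖ ≤ 1 := norm_multiset_prod_le_one s fun x hx => key x (isRoot_of_mem_roots (p := L.charpoly) (by rw [hs]; simp [hx]))
  have h3 : (1:ℝ) = ‖l‖ * ‖s.prod‖ := by rw [← norm_mul, ← h1]; simp
  nlinarith [norm_nonneg l]

end UEG

namespace UEG
set_option linter.unusedVariables false
set_option linter.style.haveILetI false
set_option linter.unusedSectionVars false
open Matrix Polynomial Filter Topology
open scoped Pointwise

/-- conjugate, then apply a field embedding -/
noncomputable def cmap {d : ℕ} (σ : ℂ →+* ℂ) (P : GL (Fin d) ℂ) : GL (Fin d) ℂ →* GL (Fin d) ℂ :=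
  (Matrix.GeneralLinearGroup.map σ).comp (MulAut.conj P⁻¹).toMonoidHom

lemma cmap_val {d : ℕ} (σ : ℂ →+* ℂ) (P u : GL (Fin d) ℂ) : (cmap σ P u).1 = (P⁻¹.1 * u.1 * P.1).map σ := by
  unfold cmap
  simp [MulAut.conj_apply, Matrix.GeneralLinearGroup.map]

lemma cmap_det {d : ℕ} (σ : ℂ →+* ℂ) (P u : GL (Fin d) ℂ) (h : u.1.det = 1) : (cmap σ P u).1.det = 1 := by
  rw [cmap_val]
  have := RingHom.map_det σ (P⁻¹.1 * u.1 * P.1)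
  rw [RingHom.mapMatrix_apply] at this
  rw [← this, Matrix.det_mul, Matrix.det_mul, h, mul_one, ← Matrix.det_mul, gl_inv_mul, Matrix.det_one, map_one]

lemma cmap_root {d : ℕ} (σ : ℂ →+* ℂ) (P u : GL (Fin d) ℂ) (l : ℂ) (h : (cmap σ P u).1.charpoly.IsRoot l) :
    ∃ l', u.1.charpoly.IsRoot l' ∧ l = σ l' := by
  rw [cmap_val, Matrix.charpoly_map, cp_conj] at h
  have h2 : l ∈ (u.1.charpoly.map σ).roots := (mem_roots (u.1.charpoly_monic.map σ).ne_zero).2 h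
  rw [(IsAlgClosed.splits u.1.charpoly).roots_map σ] at h2
  obtain ⟨l', h3, rfl⟩ := Multiset.mem_map.1 h2
  exact ⟨l', isRoot_of_mem_roots h3, rfl⟩

lemma cmap_trace {d : ℕ} (σ : ℂ →+* ℂ) (P u : GL (Fin d) ℂ) : (cmap σ P u).1.trace = σ u.1.trace := by
  rw [cmap_val]
  have := AddMonoidHom.map_trace σ.toAddMonoidHom (P⁻¹.1 * u.1 * P.1)
  have h2 : (P⁻¹.1 * u.1 * P.1).trace = u.1.trace := by
    rw [Matrix.trace_mul_comm, ← mul_assoc, gl_mul_inv, one_mul]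
  rw [h2] at this
  exact this.symm

theorem law_finite (d : ℕ) (hd : 1 ≤ d) (J : ℕ) (hJ : 17 ^ (2 * d ^ 2) ≤ J) (m : ℕ) : ∃ K : ℕ, ∀ F : Set (GL (Fin d) ℂ), F.Finite → 1 ∈ F →
    (∀ f ∈ F, f.1.det = 1) → Irr (Subgroup.closure F : Set (GL (Fin d) ℂ)) →
    (∀ u ∈ F ^ K, ∀ l, u.1.charpoly.IsRoot l → IsIntegral ℤ l ∧ ∀ σ : ℂ →+* ℂ, ‖σ l‖ < 1 + 1 / ((K:ℝ) + 1)) →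
    ∀ a ∈ F ^ m, ∀ z ∈ YS (F ^ m) (J + d) a J, z = 1 := by
  by_contra! hcon
  choose F hfin h1 hdet hirr hroot a ha z hz hz1 using hcon
  obtain ⟨α, hα, w, hw⟩ := wordy_Y (J + d) J
  have hx : ∀ k, ∃ x : Option α → GL (Fin d) ℂ, (∀ o, x o ∈ F k ^ m) ∧ z k = FreeGroup.lift x w := by
    intro k
    obtain ⟨g, hg, hg2⟩ := (hw _ (F k ^ m) (a k) (z k)).1 (hz k)
    refine ⟨fun o => Option.elim o (a k) g, ?_, hg2⟩
    rintro (_ | i)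
    · exact ha k
    · exact hg i
  choose x hx hzx using hx
  obtain ⟨D, hD⟩ := trace_nonzero d hd
  have hy : ∀ k, ∃ y ∈ F k ^ D, (((z k).1 - 1) * y.1).trace ≠ 0 := fun k => hD (F k) (h1 k) (hirr k) _ (by
    intro h; apply hz1 k; exact Units.ext (sub_eq_zero.1 h))
  choose y hy hyt using hy
  obtain ⟨j, hj⟩ := int_word d m w
  have hIntg : ∀ k, m ≤ k → j + D ≤ k → IsIntegral ℤ (((z k).1 - 1) * (y k).1).trace := by
    intro k hk1 hk2
    have hr : ∀ i ≤ k, ∀ u ∈ F k ^ i, ∀ l, u.1.charpoly.IsRoot l → IsIntegral ℤ l := fun i hi u hu l hl =>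
      (hroot k u (Set.pow_subset_pow_right (h1 k) hi hu) l hl).1
    have h3 := hj (F k) (h1 k) (hdet k) (hr m hk1) (x k) (hx k)
    rw [← hzx] at h3
    have hyM : (y k).1 ∈ MS (F k) D := Submodule.subset_span ⟨_, hy k, rfl⟩
    apply MS_trace (hr _ hk2)
    rw [sub_mul, one_mul]
    exact Submodule.sub_mem _ (MS_mul h3 hyM) (MS_mono (h1 k) (by omega) hyM)
  have hσ : ∀ k, ∃ σ : ℂ →+* ℂ, m ≤ k → j + D ≤ k → 1 ≤ ‖σ (((z k).1 - 1) * (y k).1).trace‖ := by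
    intro k
    by_cases h : m ≤ k ∧ j + D ≤ k
    · obtain ⟨σ, hσ⟩ := place_int _ (hIntg k h.1 h.2) (hyt k)
      exact ⟨σ, fun _ _ => hσ⟩
    · exact ⟨RingHom.id ℂ, fun h1 h2 => absurd ⟨h1, h2⟩ h⟩
  choose σ hσ using hσ
  obtain ⟨N, c, hc, hbo⟩ := bochi d hd
  have hP : ∀ k, ∃ P : GL (Fin d) ℂ, N ≤ k → ∀ f ∈ F k, nv (archAV (σ k)) (P⁻¹.1 * f.1 * P.1) ≤ 2 / c := by
    intro k
    obtain ⟨P, E, hE1, hE, i, hi1, hiN, u, hu, l, hl, hcl⟩ := hbo (archAV (σ k)) (F k) (hfin k) (h1 k)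
    refine ⟨P, fun hk f hf => (hE f hf).trans ?_⟩
    have h2 := (hroot k u (Set.pow_subset_pow_right (h1 k) (hiN.trans hk) hu) l hl).2 (σ k)
    rw [archAV_apply] at hcl
    have h3 : 1 / ((k:ℝ) + 1) ≤ 1 := by
      rw [div_le_one (by positivity)]; linarith [Nat.cast_nonneg (α := ℝ) k]
    have h4 : E ≤ E ^ i := le_self_pow₀ hE1 (by omega)
    rw [le_div_iff₀ hc]
    nlinarith
  choose P hP using hP
  -- the alphabet
  let β := (Option α × Fin m) ⊕ Fin D
  have hf : ∀ k, ∃ f : β → GL (Fin d) ℂ, (∀ b, f b ∈ F k) ∧ (∀ o, (List.ofFn fun i => f (Sum.inl (o, i))).prod = x k o) ∧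
      (List.ofFn fun i => f (Sum.inr i)).prod = y k := by
    intro k
    have e1 : ∀ o, ∃ f : Fin m → F k, (List.ofFn fun i => ((f i : GL (Fin d) ℂ))).prod = x k o := fun o => Set.mem_pow.1 (hx k o)
    choose f hf using e1
    obtain ⟨f', hf'⟩ := Set.mem_pow.1 (hy k)
    refine ⟨Sum.elim (fun p => f p.1 p.2) (fun i => f' i), ?_, hf, hf'⟩
    rintro (b | b)
    · exact (f b.1 b.2).2
    · exact (f' b).2
  choose f hfF hfx hfy using hf
  let φ : ℕ → FreeGroup β →* GL (Fin d) ℂ := fun k => FreeGroup.lift (f k)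
  let x' : Option α → FreeGroup β := fun o => (List.ofFn fun i => FreeGroup.of (Sum.inl (o, i))).prod
  let y' : FreeGroup β := (List.ofFn fun i => FreeGroup.of (Sum.inr i)).prod
  let z' : FreeGroup β := FreeGroup.lift x' w
  have hφx : ∀ k o, φ k (x' o) = x k o := by
    intro k o
    rw [← hfx]
    simp only [x', map_list_prod, List.map_ofFn, φ]
    congr 2
    funext i
    simp
  have hφy : ∀ k, φ k y' = y k := by
    intro k
    rw [← hfy]
    simp only [y', map_list_prod, List.map_ofFn, φ]
    congr 2
    funext i
    simp
  have hφz : ∀ k, φ k z' = z k := by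
    intro k
    rw [hzx]
    simp only [z']
    rw [← MonoidHom.comp_apply]
    congr 1
    ext o
    simp [hφx]
  have hz' : z' ∈ YS Set.univ (J + d) (x' none) J := by
    refine (hw _ Set.univ (x' none) z').2 ⟨fun i => x' (some i), fun _ => trivial, ?_⟩
    simp only [z']
    congr 1
    congr 1
    funext o
    cases o <;> rfl
  let θ : ℕ → FreeGroup β →* GL (Fin d) ℂ := fun k => (cmap (σ k) (P k)).comp (φ k)
  have hθ : ∀ k g, θ k g = cmap (σ k) (P k) (φ k g) := fun k g => rfl
  have hφof : ∀ k b, φ k (FreeGroup.of b) = f k b := fun k b => by simp [φ]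
  have hθdet : ∀ k b, (θ k (FreeGroup.of b)).1.det = 1 := by
    intro k b
    rw [hθ, hφof]
    exact cmap_det _ _ _ (hdet k _ (hfF k b))
  have hL : ∀ b, ∃ L : Matrix (Fin d) (Fin d) ℂ, Tendsto (fun k => (θ k (FreeGroup.of b)).1) (UU : Filter ℕ) (𝓝 L) := by
    intro b
    refine ulim _ (2 / c) ?_
    filter_upwards [ev_ge N] with k hk i i'
    rw [hθ, hφof, cmap_val]
    have := (le_nv (archAV (σ k)) ((P k)⁻¹.1 * (f k b).1 * (P k).1) i i').trans (hP k hk _ (hfF k b))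
    exact this
  choose L0 hL0 using hL
  have hL0d : ∀ b, (L0 b).det = 1 := by
    intro b
    have h1 : Tendsto (fun k => (θ k (FreeGroup.of b)).1.det) (UU : Filter ℕ) (𝓝 (L0 b).det) :=
      ((Continuous.matrix_det continuous_id).tendsto _).comp (hL0 b)
    simp only [hθdet] at h1
    exact tendsto_nhds_unique h1 tendsto_const_nhds
  let L : β → GL (Fin d) ℂ := fun b => Matrix.GeneralLinearGroup.mkOfDetNeZero (L0 b) (by rw [hL0d]; exact one_ne_zero)
  have hlim := free_lim θ L hθdet (fun b => hL0 b)
  let S : Submonoid (FreeGroup β) := Submonoid.closure (Set.range FreeGroup.of)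
  have hS : Subgroup.closure (S : Set (FreeGroup β)) = ⊤ := by
    rw [eq_top_iff, ← FreeGroup.closure_range_of]
    exact Subgroup.closure_mono Submonoid.subset_closure
  have hSF : ∀ s ∈ S, ∃ n, ∀ k, φ k s ∈ F k ^ n := by
    intro s hs
    induction hs using Submonoid.closure_induction with
    | mem s hs =>
      obtain ⟨b, rfl⟩ := hs
      exact ⟨1, fun k => by rw [hφof, pow_one]; exact hfF k b⟩
    | one => exact ⟨0, fun k => by simp⟩
    | mul s s' _ _ h h' =>
      obtain ⟨n, hn⟩ := h
      obtain ⟨n', hn'⟩ := h'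
      exact ⟨n + n', fun k => by rw [map_mul, pow_add]; exact Set.mul_mem_mul (hn k) (hn' k)⟩
  let ρ : FreeGroup β →* Module.End ℂ (Fin d → ℂ) :=
    ((Matrix.toLinAlgEquiv' : Matrix (Fin d) (Fin d) ℂ ≃ₐ[ℂ] _) : Matrix (Fin d) (Fin d) ℂ →* Module.End ℂ (Fin d → ℂ)).comp
      ((Units.coeHom _).comp (FreeGroup.lift L))
  have hρ : ∀ g, ρ g = Matrix.toLin' (FreeGroup.lift L g).1 := fun g => rfl
  have heig : ∀ s ∈ S, ∀ μ, (ρ s).HasEigenvalue μ → ‖μ‖ = 1 := by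
    intro s hs μ hμ
    rw [Module.End.hasEigenvalue_iff_isRoot_charpoly, hρ, Matrix.charpoly_toLin'] at hμ
    refine root_lim _ _ (hlim s).2 (hlim s).1 ?_ μ hμ
    obtain ⟨n, hn⟩ := hSF s hs
    filter_upwards [ev_ge n] with k hk l hl
    rw [hθ] at hl
    obtain ⟨l', hl', rfl⟩ := cmap_root _ _ _ _ hl
    exact (hroot k _ (Set.pow_subset_pow_right (h1 k) hk (hn k)) l' hl').2 (σ k)
  have hU := lemmaU S hS d J (J + d) hJ (x' none) z' hz' y' d (Fin d → ℂ) (by simp) le_rfl ρ heig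
  have hsmall : (d:ℝ) * (4 ^ J * ((1 / 2) * (1 / 4) ^ (2 ^ (J + d)))) ≤ 1 / 2 := by
    have e1 : J + d ≤ 2 ^ (J + d) := Nat.lt_two_pow_self.le
    have e2 : ((1:ℝ) / 4) ^ (2 ^ (J + d)) ≤ (1 / 4) ^ (J + d) := pow_le_pow_of_le_one (by norm_num) (by norm_num) e1
    have e3 : (4:ℝ) ^ J * (1 / 4) ^ (J + d) = (1 / 4) ^ d := by
      rw [pow_add, ← mul_assoc, ← mul_pow]; norm_num
    have e4 : (d:ℝ) ≤ 4 ^ d := by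
      have : d < 4 ^ d := Nat.lt_pow_self (by norm_num)
      exact_mod_cast this.le
    calc (d:ℝ) * (4 ^ J * ((1 / 2) * (1 / 4) ^ (2 ^ (J + d)))) ≤ (4:ℝ) ^ d * (4 ^ J * ((1 / 2) * (1 / 4) ^ (J + d))) := by gcongr
      _ = (4:ℝ) ^ d * (1 / 2) * (4 ^ J * (1 / 4) ^ (J + d)) := by ring
      _ = (1 / 2) * (4 * (1 / 4)) ^ d := by rw [e3, mul_pow]; ring
      _ = 1 / 2 := by norm_num
  have htr : Tendsto (fun k => ‖(θ k (z' * y')).1.trace - (θ k y').1.trace‖) (UU : Filter ℕ)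
      (𝓝 ‖(FreeGroup.lift L (z' * y')).1.trace - (FreeGroup.lift L y').1.trace‖) := by
    refine Tendsto.norm (Tendsto.sub ?_ ?_)
    · exact ((Continuous.matrix_trace continuous_id).tendsto _).comp (hlim (z' * y')).2
    · exact ((Continuous.matrix_trace continuous_id).tendsto _).comp (hlim y').2
  have hbig := ge_of_tendsto htr (b := 1) (by
    filter_upwards [ev_ge m, ev_ge (j + D)] with k hk1 hk2
    have := hσ k hk1 hk2
    rw [hθ, hθ, cmap_trace, cmap_trace, ← map_sub, map_mul, hφz, hφy]
    rw [sub_mul, one_mul, Matrix.trace_sub] at this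
    exact this)
  rw [hρ, hρ, Matrix.trace_toLin'_eq, Matrix.trace_toLin'_eq] at hU
  linarith

end UEG

namespace UEG
set_option linter.unusedVariables false
set_option linter.style.haveILetI false
set_option linter.unusedSectionVars false
open Matrix
open scoped Pointwise commutatorElement

/-- the group law -/
theorem law_group (d : ℕ) (hd : 1 ≤ d) (J : ℕ) (hJ : 17 ^ (2 * d ^ 2) ≤ J) : ∃ K : ℕ, ∀ F : Set (GL (Fin d) ℂ), F.Finite → 1 ∈ F →
    (∀ f ∈ F, f.1.det = 1) → Irr (Subgroup.closure F : Set (GL (Fin d) ℂ)) →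
    (∀ u ∈ F ^ K, ∀ l, u.1.charpoly.IsRoot l → IsIntegral ℤ l ∧ ∀ σ : ℂ →+* ℂ, ‖σ l‖ < 1 + 1 / ((K:ℝ) + 1)) →
    ∀ a : Subgroup.closure F, ∀ z ∈ YS Set.univ (J + d) a J, z = 1 := by
  obtain ⟨α, hα, w, hw⟩ := wordy_Y (J + d) J
  obtain ⟨m, hm⟩ := law_extend d w
  obtain ⟨K, hK⟩ := law_finite d hd J hJ m
  refine ⟨K, ?_⟩
  intro F hF h1 hdet hirr hroot a z hz
  have h2 := hm F h1 (by
    intro x hx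
    refine hK F hF h1 hdet hirr hroot (x none) (hx none) _ ?_
    refine (hw _ _ _ _).2 ⟨fun i => x (some i), fun i => hx _, ?_⟩
    congr 2
    funext o
    cases o <;> rfl)
  obtain ⟨g, -, hg⟩ := (hw _ _ _ _).1 hz
  have h3 := h2 (fun o => ((Option.elim o a g : Subgroup.closure F) : GL (Fin d) ℂ)) (fun o => (Option.elim o a g : Subgroup.closure F).2)
  apply Subtype.ext
  rw [hg]
  have h4 : (Subgroup.closure F).subtype (FreeGroup.lift (fun o => Option.elim o a g) w) = FreeGroup.lift (fun o => ((Option.elim o a g : Subgroup.closure F) : GL (Fin d) ℂ)) w := by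
    rw [← MonoidHom.comp_apply]
    congr 1
    ext o
    simp
  rw [h3] at h4
  exact h4

/-- derived series started at a subgroup -/
def DS {G : Type} [Group G] (N : Subgroup G) : ℕ → Subgroup G
  | 0 => N
  | n + 1 => ⁅DS N n, DS N n⁆

lemma DS_succ' {G : Type} [Group G] (N : Subgroup G) (n : ℕ) : DS N (n + 1) = DS ⁅N, N⁆ n := by
  induction n with
  | zero => rfl
  | succ n ih => rw [DS, ih]; rfl

lemma DS_anti {G : Type} [Group G] (N : Subgroup G) [N.Normal] (n : ℕ) : (DS N n).Normal ∧ DS N (n + 1) ≤ DS N n := by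
  induction n with
  | zero => exact ⟨by assumption, Subgroup.commutator_le_left N N⟩
  | succ n ih =>
    haveI := ih.1
    have h1 : (DS N (n+1)).Normal := by rw [DS]; infer_instance
    exact ⟨h1, by haveI := h1; exact Subgroup.commutator_le_left (DS N (n+1)) (DS N (n+1))⟩

lemma comm_closure_le {G : Type} [Group G] (s t : Set G) (hs : ∀ g, ∀ x ∈ s, g * x * g⁻¹ ∈ s) (ht : ∀ g, ∀ x ∈ t, g * x * g⁻¹ ∈ t) :
    ⁅Subgroup.closure s, Subgroup.closure t⁆ ≤ Subgroup.closure {z | ∃ x ∈ s, ∃ y ∈ t, z = ⁅x, y⁆} := by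
  set C := Subgroup.closure {z | ∃ x ∈ s, ∃ y ∈ t, z = ⁅x, y⁆} with hC
  haveI : C.Normal := by
    refine ⟨fun n hn g => ?_⟩
    have : C ≤ C.comap (MulAut.conj g).toMonoidHom := by
      rw [hC, Subgroup.closure_le]
      rintro z ⟨x, hx, y, hy, rfl⟩
      rw [SetLike.mem_coe, Subgroup.mem_comap]
      apply Subgroup.subset_closure
      refine ⟨g * x * g⁻¹, hs g x hx, g * y * g⁻¹, ht g y hy, ?_⟩
      simp only [commutatorElement_def, MulEquiv.coe_toMonoidHom, MulAut.conj_apply]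
      group
    exact this hn
  have key : Subgroup.closure s ≤ (Subgroup.centralizer ((Subgroup.closure t).map (QuotientGroup.mk' C) : Set (G ⧸ C))).comap (QuotientGroup.mk' C) := by
    rw [Subgroup.closure_le]
    intro x hx
    rw [SetLike.mem_coe, Subgroup.mem_comap, Subgroup.mem_centralizer_iff]
    rintro _ ⟨y, hy, rfl⟩
    have : Subgroup.closure t ≤ (Subgroup.centralizer {(QuotientGroup.mk' C) x}).comap (QuotientGroup.mk' C) := by
      rw [Subgroup.closure_le]
      intro y hy
      rw [SetLike.mem_coe, Subgroup.mem_comap, Subgroup.mem_centralizer_iff]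
      rintro _ rfl
      rw [← map_mul, ← map_mul, QuotientGroup.mk'_apply, QuotientGroup.mk'_apply, eq_comm, QuotientGroup.eq]
      have h1 : ⁅x⁻¹, y⁻¹⁆ ∈ C := by
        have h2 : ⁅x, y⁆ ∈ C := Subgroup.subset_closure ⟨x, hx, y, hy, rfl⟩
        have h3 := this.conj_mem _ h2 ((y * x)⁻¹)
        have e : (y * x)⁻¹ * ⁅x, y⁆ * (y * x)⁻¹⁻¹ = ⁅x⁻¹, y⁻¹⁆ := by
          simp only [commutatorElement_def]; group
        rwa [e] at h3
      have e : (y * x)⁻¹ * (x * y) = ⁅x⁻¹, y⁻¹⁆ := by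
        simp only [commutatorElement_def]; group
      rw [e]; exact h1
    have h4 := this hy
    rw [Subgroup.mem_comap, Subgroup.mem_centralizer_iff] at h4
    exact (h4 _ rfl).symm
  rw [Subgroup.commutator_le]
  intro x hx y hy
  have h1 := key hx
  rw [Subgroup.mem_comap, Subgroup.mem_centralizer_iff] at h1
  have h2 := h1 _ ⟨y, hy, rfl⟩
  rw [← QuotientGroup.eq_one_iff]
  have h3 : ((⁅x, y⁆ : G) : G ⧸ C) = ⁅QuotientGroup.mk' C x, QuotientGroup.mk' C y⁆ := rfl
  rw [h3, commutatorElement_eq_one_iff_mul_comm, h2]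

lemma XS_conj {G : Type} [Group G] (b : G) (t : ℕ) : ∀ g, ∀ x ∈ XS Set.univ b t, g * x * g⁻¹ ∈ XS Set.univ b t := by
  induction t with
  | zero =>
    rintro g x ⟨h, -, rfl⟩
    exact ⟨g * h, trivial, by group⟩
  | succ t ih =>
    rintro g z ⟨x, hx, y, hy, rfl⟩
    refine ⟨_, ih g x hx, _, ih g y hy, ?_⟩
    simp only [commutatorElement_def]; group

lemma YS_conj {G : Type} [Group G] (a : G) (t j : ℕ) : ∀ g, ∀ x ∈ YS Set.univ t a j, g * x * g⁻¹ ∈ YS Set.univ t a j := by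
  induction j with
  | zero => exact XS_conj a t
  | succ j ih =>
    rintro g z ⟨x, hx, y, hy, rfl⟩
    refine ⟨_, XS_conj _ t g x hx, _, ih g y hy, ?_⟩
    simp only [commutatorElement_def]; group

lemma DS_le_XS {G : Type} [Group G] (a : G) (k m : ℕ) (h : k ∣ m) (t : ℕ) :
    DS (Subgroup.normalClosure {a ^ m}) t ≤ Subgroup.closure (XS Set.univ (a ^ k) t) := by
  induction t with
  | zero =>
    obtain ⟨q, rfl⟩ := h
    rw [DS, Subgroup.normalClosure, Subgroup.closure_le]
    intro z hz
    rw [Group.mem_conjugatesOfSet_iff] at hz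
    obtain ⟨_, rfl, hz⟩ := hz
    obtain ⟨g, rfl⟩ := isConj_iff.1 hz
    have : g * a ^ (k * q) * g⁻¹ = (g * a ^ k * g⁻¹) ^ q := by rw [conj_pow, pow_mul]
    rw [this]
    exact pow_mem (Subgroup.subset_closure (show g * a ^ k * g⁻¹ ∈ XS Set.univ (a ^ k) 0 from ⟨g, trivial, rfl⟩)) _
  | succ t ih =>
    exact (Subgroup.commutator_mono ih ih).trans (comm_closure_le _ _ (XS_conj _ _) (XS_conj _ _))

lemma DS_le_YS {G : Type} [Group G] (a : G) (m t j : ℕ) (h : ∀ k, 1 ≤ k → k ≤ j + 1 → k ∣ m) :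
    DS (Subgroup.normalClosure {a ^ m}) (t + j) ≤ Subgroup.closure (YS Set.univ t a j) := by
  induction j with
  | zero =>
    have := DS_le_XS a 1 m (one_dvd _) t
    rwa [pow_one] at this
  | succ j ih =>
    have h1 := ih (fun k h1 h2 => h k h1 (by omega))
    have h2 := DS_le_XS a (j + 2) m (h _ (by omega) (by omega)) t
    have h3 : DS (Subgroup.normalClosure {a ^ m}) (t + j) ≤ DS (Subgroup.normalClosure {a ^ m}) t := by
      have : Antitone (DS (Subgroup.normalClosure {a ^ m})) := antitone_nat_of_succ_le (fun n => (DS_anti _ n).2)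
      exact this (by omega)
    exact (Subgroup.commutator_mono (h3.trans h2) h1).trans (comm_closure_le _ _ (XS_conj _ _) (YS_conj _ _ _))

lemma DS_bot {G : Type} [Group G] (a : G) (t j : ℕ) (h : ∀ z ∈ YS Set.univ t a j, z = 1) :
    DS (Subgroup.normalClosure {a ^ (j + 1).factorial}) (t + j) = ⊥ := by
  rw [eq_bot_iff]
  refine (DS_le_YS a _ t j (fun k h1 h2 => Nat.dvd_factorial h1 h2)).trans ?_
  rw [Subgroup.closure_le]
  intro z hz
  exact h z hz

end UEG

namespace UEG
set_option linter.unusedVariables false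
set_option linter.style.haveILetI false
set_option linter.unusedSectionVars false
open Matrix Polynomial
open scoped Pointwise commutatorElement

lemma joint_eig {d : ℕ} (A : Set (Matrix (Fin d) (Fin d) ℂ)) (hA : ∀ a ∈ A, ∀ b ∈ A, a * b = b * a) (n : ℕ) :
    ∀ W : Submodule ℂ (Fin d → ℂ), Module.finrank ℂ W ≤ n → W ≠ ⊥ → (∀ a ∈ A, ∀ x ∈ W, a *ᵥ x ∈ W) →
    ∃ x ∈ W, x ≠ 0 ∧ ∀ a ∈ A, ∃ c : ℂ, a *ᵥ x = c • x := by
  induction n with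
  | zero =>
    intro W h0 hW
    exact absurd (Submodule.finrank_eq_zero.1 (Nat.le_zero.1 h0)) hW
  | succ n ih =>
    intro W hn hW hinv
    by_cases h : ∀ a ∈ A, ∃ c : ℂ, ∀ x ∈ W, a *ᵥ x = c • x
    · obtain ⟨x, hx, hx0⟩ := Submodule.exists_mem_ne_zero_of_ne_bot hW
      refine ⟨x, hx, hx0, fun a ha => ?_⟩
      obtain ⟨c, hc⟩ := h a ha
      exact ⟨c, hc x hx⟩
    · push Not at h
      obtain ⟨a, ha, hc⟩ := h
      haveI : Nontrivial W := Submodule.nontrivial_iff_ne_bot.2 hW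
      let f : Module.End ℂ W := (Matrix.mulVecLin a).restrict (p := W) (q := W) (fun x hx => hinv a ha x hx)
      obtain ⟨c, hce⟩ := Module.End.exists_eigenvalue f
      obtain ⟨y, hy⟩ := hce.exists_hasEigenvector
      have hy1 : a *ᵥ (y : Fin d → ℂ) = c • (y : Fin d → ℂ) := by
        have := congrArg Subtype.val (Module.End.HasEigenvector.apply_eq_smul hy)
        exact this
      let W' : Submodule ℂ (Fin d → ℂ) := W ⊓ LinearMap.ker (Matrix.mulVecLin a - c • LinearMap.id)
      have hW' : ∀ x, x ∈ W' ↔ x ∈ W ∧ a *ᵥ x = c • x := by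
        intro x
        simp [W', Submodule.mem_inf, sub_eq_zero]
      have hlt : W' < W := by
        refine lt_of_le_of_ne inf_le_left ?_
        intro e
        obtain ⟨x, hx, hx2⟩ := hc c
        rw [← e] at hx
        exact hx2 ((hW' x).1 hx).2
      have h1 := Submodule.finrank_lt_finrank_of_lt hlt
      obtain ⟨x, hx, hx0, hx2⟩ := ih W' (by omega) (by
        intro e
        have : (y : Fin d → ℂ) ∈ W' := (hW' _).2 ⟨y.2, hy1⟩
        rw [e, Submodule.mem_bot] at this
        exact hy.2 (Subtype.ext this)) (by
        intro b hb x hx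
        obtain ⟨h2, h3⟩ := (hW' _).1 hx
        refine (hW' _).2 ⟨hinv b hb x h2, ?_⟩
        rw [Matrix.mulVec_mulVec, hA a ha b hb, ← Matrix.mulVec_mulVec, h3, Matrix.mulVec_smul])
      exact ⟨x, ((hW' _).1 hx).1, hx0, hx2⟩

/-- independence of joint eigenvectors with distinct weights -/
lemma weight_pigeon {d : ℕ} {ι : Type} (A : ι → Matrix (Fin d) (Fin d) ℂ) (hA : ∀ i j, A i * A j = A j * A i)
    (x : Fin (d + 1) → Fin d → ℂ) (hx : ∀ k, x k ≠ 0) (χ : Fin (d + 1) → ι → ℂ)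
    (h : ∀ k i, A i *ᵥ x k = χ k i • x k) : ∃ k l, k ≠ l ∧ χ k = χ l := by
  by_contra! hne
  have hinj : Function.Injective χ := by
    intro k l e
    by_contra hkl
    exact hne k l hkl e
  let f : ι → Module.End ℂ (Fin d → ℂ) := fun i => Matrix.mulVecLin (A i)
  have hcomm : ∀ i j, Commute (f i) (f j) := by
    intro i j
    change f i * f j = f j * f i
    simp only [f, Module.End.mul_eq_comp, ← Matrix.mulVecLin_mul, hA i j]
  have hind := (Module.End.independent_iInf_maxGenEigenspace_of_forall_mapsTo f
    (fun i j φ => Module.End.mapsTo_maxGenEigenspace_of_comm (hcomm j i) φ)).comp hinj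
  have hli : LinearIndependent ℂ x := by
    refine hind.linearIndependent _ (fun k => ?_) hx
    simp only [Function.comp_apply, Submodule.mem_iInf]
    intro i
    refine (Module.End.mem_maxGenEigenspace _ _ _).2 ⟨1, ?_⟩
    simp [f, h k i]
  have := hli.fintype_card_le_finrank
  simp at this

def IsScal {d : ℕ} (g : GL (Fin d) ℂ) : Prop := ∃ c : ℂ, ∀ x : Fin d → ℂ, g.1 *ᵥ x = c • x

lemma gl_inv_vec {d : ℕ} (g : GL (Fin d) ℂ) (x : Fin d → ℂ) : g⁻¹.1 *ᵥ (g.1 *ᵥ x) = x := by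
  rw [Matrix.mulVec_mulVec, gl_inv_mul, Matrix.one_mulVec]

lemma gl_vec_inv {d : ℕ} (g : GL (Fin d) ℂ) (x : Fin d → ℂ) : g.1 *ᵥ (g⁻¹.1 *ᵥ x) = x := by
  rw [Matrix.mulVec_mulVec, gl_mul_inv, Matrix.one_mulVec]

lemma gl_mul_vec {d : ℕ} (g h : GL (Fin d) ℂ) (x : Fin d → ℂ) : (g * h).1 *ᵥ x = g.1 *ᵥ (h.1 *ᵥ x) := by
  rw [Matrix.mulVec_mulVec]; rfl

/-- abelian normal subgroups are scalar -/
lemma abel_scalar {d : ℕ} (hd : 1 ≤ d) (Γ A : Subgroup (GL (Fin d) ℂ))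
    (hN : ∀ H ≤ Γ, IdxLe d H Γ → Irr (H : Set (GL (Fin d) ℂ)))
    (hn : ∀ g ∈ Γ, ∀ a ∈ A, g * a * g⁻¹ ∈ A) (hab : ∀ a ∈ A, ∀ b ∈ A, a * b = b * a) :
    ∀ a ∈ A, IsScal a := by
  haveI : Nonempty (Fin d) := ⟨⟨0, hd⟩⟩
  obtain ⟨x, -, hx0, hx⟩ := joint_eig ((fun g : GL (Fin d) ℂ => g.1) '' (A : Set (GL (Fin d) ℂ))) (by
    rintro _ ⟨a, ha, rfl⟩ _ ⟨b, hb, rfl⟩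
    exact congrArg Units.val (hab a ha b hb)) _ ⊤ le_rfl (by simp) (by simp)
  have hx' : ∀ a : A, ∃ c : ℂ, a.1.1 *ᵥ x = c • x := fun a => hx _ ⟨a.1, a.2, rfl⟩
  choose χ hχ using hx'
  let V : Submodule ℂ (Fin d → ℂ) := ⨅ a : A, LinearMap.ker (Matrix.mulVecLin a.1.1 - χ a • LinearMap.id)
  have hV : ∀ y, y ∈ V ↔ ∀ a : A, a.1.1 *ᵥ y = χ a • y := by
    intro y
    simp only [V, Submodule.mem_iInf, LinearMap.mem_ker, LinearMap.sub_apply, Matrix.mulVecLin_apply, LinearMap.smul_apply, LinearMap.id_apply, sub_eq_zero]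
  have hxV : x ∈ V := (hV x).2 hχ
  let H : Subgroup (GL (Fin d) ℂ) := Γ ⊓
    { carrier := {g | ∀ y, g.1 *ᵥ y ∈ V ↔ y ∈ V}
      one_mem' := by intro y; simp
      mul_mem' := by
        intro g h hg hh y
        rw [gl_mul_vec, hg, hh]
      inv_mem' := by
        intro g hg y
        rw [← hg, gl_vec_inv] }
  have hH : IdxLe d H Γ := by
    intro γ hγ
    have hconj : ∀ g ∈ Γ, ∀ a : A, g⁻¹ * a.1 * g ∈ A := by
      intro g hg a
      have := hn g⁻¹ (inv_mem hg) a.1 a.2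
      rwa [inv_inv] at this
    have hmv : ∀ g ∈ Γ, ∀ hg : g ∈ Γ, ∀ (a : A) y, a.1.1 *ᵥ (g.1 *ᵥ y) = g.1 *ᵥ ((g⁻¹ * a.1 * g).1 *ᵥ y) := by
      intro g _ hg a y
      rw [← gl_mul_vec, ← gl_mul_vec]
      congr 2
      group
    obtain ⟨i, j, hij, e⟩ := weight_pigeon (ι := A) (fun a => a.1.1) (fun a b => congrArg Units.val (hab _ a.2 _ b.2))
      (fun i => (γ i).1 *ᵥ x) (by
        intro i h0
        apply hx0
        rw [← gl_inv_vec (γ i) x, h0, Matrix.mulVec_zero]) (fun i a => χ ⟨_, hconj _ (hγ i) a⟩) (by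
        intro i a
        rw [hmv _ (hγ i) (hγ i), ← Matrix.mulVec_smul, ← hχ ⟨_, hconj _ (hγ i) a⟩])
    refine ⟨i, j, hij, Subgroup.mem_inf.2 ⟨mul_mem (inv_mem (hγ i)) (hγ j), ?_⟩⟩
    have key : ∀ i y, (γ i).1 *ᵥ y ∈ ((⨅ a : A, LinearMap.ker (Matrix.mulVecLin a.1.1 - χ ⟨_, hconj _ (hγ i) a⟩ • LinearMap.id) : Submodule ℂ (Fin d → ℂ))) ↔ y ∈ V := by
      intro i y
      rw [hV]
      simp only [Submodule.mem_iInf, LinearMap.mem_ker, LinearMap.sub_apply, Matrix.mulVecLin_apply, LinearMap.smul_apply, LinearMap.id_apply, sub_eq_zero]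
      constructor
      · intro h a
        have h1 := h ⟨γ i * a.1 * (γ i)⁻¹, hn _ (hγ i) _ a.2⟩
        rw [hmv _ (hγ i) (hγ i), ← Matrix.mulVec_smul] at h1
        have h2 := congrArg (fun z => (γ i)⁻¹.1 *ᵥ z) h1
        simp only [gl_inv_vec] at h2
        have e : (γ i)⁻¹ * (γ i * a.1 * (γ i)⁻¹) * γ i = a.1 := by group
        have e2 : (⟨(γ i)⁻¹ * (γ i * a.1 * (γ i)⁻¹) * γ i, hconj _ (hγ i) ⟨γ i * a.1 * (γ i)⁻¹, hn _ (hγ i) _ a.2⟩⟩ : A) = a := Subtype.ext e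
        rw [e2] at h2
        rw [e] at h2
        exact h2
      · intro h a
        rw [hmv _ (hγ i) (hγ i), ← Matrix.mulVec_smul, ← h ⟨_, hconj _ (hγ i) a⟩]
    intro y
    have h1 := key i (((γ i)⁻¹ * γ j).1 *ᵥ y)
    rw [← h1, gl_mul_vec, gl_vec_inv, ← key j]
    have e' := fun a => (congrFun e a).symm
    simp only [Submodule.mem_iInf]
    refine forall_congr' fun a => ?_
    rw [e' a]
  rcases hN H inf_le_left hH V (fun g hg y hy => ((Subgroup.mem_inf.1 hg).2 y).2 hy) with h | h
  · rw [h, Submodule.mem_bot] at hxV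
    exact absurd hxV hx0
  · intro a ha
    refine ⟨χ ⟨a, ha⟩, fun y => ?_⟩
    have : y ∈ V := by rw [h]; trivial
    exact (hV y).1 this ⟨a, ha⟩

end UEG

namespace UEG
set_option linter.unusedVariables false
set_option linter.style.haveILetI false
set_option linter.unusedSectionVars false
open Matrix Polynomial
open scoped Pointwise commutatorElement

lemma IdxLe.trans {G : Type*} [Group G] {M N : ℕ} {H K Γ : Subgroup G} (h1 : IdxLe M K Γ) (h2 : IdxLe N H K) :
    IdxLe (M * N) H Γ := by
  classical
  intro γ hγ
  set s : Finset (G ⧸ K) := Finset.univ.image (fun i => (γ i : G ⧸ K)) with hs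
  have hcard : s.card ≤ M := by
    by_contra hlt
    push Not at hlt
    obtain ⟨t, ht, htc⟩ := Finset.exists_subset_card_eq (show M + 1 ≤ s.card from hlt)
    let e := t.equivFinOfCardEq htc
    have hp : ∀ k : Fin (M + 1), ∃ i, ((γ i : G) : G ⧸ K) = ((e.symm k : t) : G ⧸ K) := by
      intro k
      have := ht (e.symm k).2
      rw [hs, Finset.mem_image] at this
      obtain ⟨i, -, hi⟩ := this
      exact ⟨i, hi⟩
    choose p hp using hp
    obtain ⟨k, l, hkl, hK⟩ := h1 (fun k => γ (p k)) (fun k => hγ _)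
    rw [← QuotientGroup.eq, hp, hp] at hK
    exact hkl (e.symm.injective (Subtype.ext hK))
  obtain ⟨y, -, hy⟩ := Finset.exists_lt_card_fiber_of_mul_lt_card_of_maps_to
    (s := (Finset.univ : Finset (Fin (M * N + 1)))) (t := s) (f := fun i => (γ i : G ⧸ K)) (n := N)
    (fun i _ => Finset.mem_image_of_mem _ (Finset.mem_univ i)) (by
      simp only [Finset.card_univ, Fintype.card_fin]
      exact Nat.lt_succ_of_le (Nat.mul_le_mul_right _ hcard))
  obtain ⟨t, ht, htc⟩ := Finset.exists_subset_card_eq (show N + 1 ≤ _ from hy)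
  let e := t.equivFinOfCardEq htc
  have hq : ∀ k : Fin (N + 1), ((γ (e.symm k).1 : G) : G ⧸ K) = y := by
    intro k
    have := ht (e.symm k).2
    exact (Finset.mem_filter.1 this).2
  obtain ⟨k, l, hkl, hK⟩ := h2 (fun k => (γ (e.symm 0).1)⁻¹ * γ (e.symm k).1) (fun k => by
    rw [← QuotientGroup.eq, hq, hq])
  refine ⟨(e.symm k).1, (e.symm l).1, fun h => hkl (e.symm.injective (Subtype.ext h)), ?_⟩
  convert hK using 1
  group

lemma IsScal.val {d : ℕ} {g : GL (Fin d) ℂ} (h : IsScal g) : ∃ c : ℂ, g.1 = c • (1 : Matrix (Fin d) (Fin d) ℂ) := by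
  obtain ⟨c, hc⟩ := h
  refine ⟨c, ?_⟩
  apply Matrix.ext_of_mulVec_single
  intro i
  rw [hc, Matrix.smul_mulVec, Matrix.one_mulVec]

lemma IsScal.of_val {d : ℕ} {g : GL (Fin d) ℂ} {c : ℂ} (h : g.1 = c • (1 : Matrix (Fin d) (Fin d) ℂ)) : IsScal g :=
  ⟨c, fun x => by rw [h, Matrix.smul_mulVec, Matrix.one_mulVec]⟩

lemma gl_val_ne {d : ℕ} (hd : 1 ≤ d) (g : GL (Fin d) ℂ) : g.1 ≠ 0 := by
  haveI : Nonempty (Fin d) := ⟨⟨0, hd⟩⟩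
  exact g.ne_zero

lemma nil_scalar {d : ℕ} (hd : 1 ≤ d) (Γ A : Subgroup (GL (Fin d) ℂ))
    (hN : ∀ H ≤ Γ, IdxLe (d ^ 2 * d) H Γ → Irr (H : Set (GL (Fin d) ℂ)))
    (hn : ∀ g ∈ Γ, ∀ a ∈ A, g * a * g⁻¹ ∈ A) (hab : ∀ a ∈ A, ∀ b ∈ A, IsScal ⁅a, b⁆) :
    ∀ a ∈ A, IsScal a := by
  haveI : Nonempty (Fin d) := ⟨⟨0, hd⟩⟩
  have hZ := abel_scalar hd Γ (A ⊓ Subgroup.centralizer (A : Set (GL (Fin d) ℂ)))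
    (fun H h1 h2 => hN H h1 (h2.mono (by nlinarith [Nat.one_le_pow 2 d hd]) le_rfl)) (by
      intro g hg a ha
      obtain ⟨h1, h2⟩ := Subgroup.mem_inf.1 ha
      refine Subgroup.mem_inf.2 ⟨hn g hg a h1, ?_⟩
      rw [Subgroup.mem_centralizer_iff] at h2 ⊢
      intro b hb
      have h3 := hn g⁻¹ (inv_mem hg) b hb
      have h4 := h2 _ h3
      have h5 := congrArg (fun z => g * z * g⁻¹) h4
      calc b * (g * a * g⁻¹) = g * (g⁻¹ * b * g⁻¹⁻¹ * a) * g⁻¹ := by group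
        _ = g * (a * (g⁻¹ * b * g⁻¹⁻¹)) * g⁻¹ := h5
        _ = _ := by group) (by
      intro a ha b hb
      have h1 := (Subgroup.mem_inf.1 ha).2
      rw [Subgroup.mem_centralizer_iff] at h1
      exact (h1 b (Subgroup.mem_inf.1 hb).1).symm)
  have htr : ∀ g ∈ A, ¬ IsScal g → g.1.trace = 0 := by
    intro g hg hns
    have h1 : ¬ (g ∈ Subgroup.centralizer (A : Set (GL (Fin d) ℂ))) := fun h => hns (hZ g (Subgroup.mem_inf.2 ⟨hg, h⟩))
    rw [Subgroup.mem_centralizer_iff] at h1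
    push Not at h1
    obtain ⟨h, hh, hne⟩ := h1
    obtain ⟨c, hc⟩ := (hab h hh g hg).val
    have e1 : h * g * h⁻¹ = ⁅h, g⁆ * g := by simp [commutatorElement_def]
    have e2 : h.1 * g.1 * h⁻¹.1 = c • g.1 := by
      have := congrArg Units.val e1
      rw [Units.val_mul, Units.val_mul, Units.val_mul, hc] at this
      rw [this]; simp
    have e3 : g.1.trace = c * g.1.trace := by
      have := congrArg Matrix.trace e2
      rw [Matrix.trace_mul_comm, ← mul_assoc, gl_inv_mul, one_mul, Matrix.trace_smul, smul_eq_mul] at this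
      exact this
    by_contra h0
    have hc1 : c = 1 := by
      have : (c - 1) * g.1.trace = 0 := by linear_combination -e3
      rcases mul_eq_zero.1 this with h | h
      · linear_combination h
      · exact absurd h h0
    rw [hc1, one_smul] at e2
    apply hne
    have : h * g * h⁻¹ = g := Units.ext e2
    exact mul_inv_eq_iff_eq_mul.1 this
  intro h hh
  let C : Subgroup (GL (Fin d) ℂ) := Γ ⊓
    { carrier := {γ | ∃ c : ℂ, γ.1 * h.1 = c • (h.1 * γ.1)}
      one_mem' := ⟨1, by simp⟩
      mul_mem' := by
        rintro γ γ' ⟨c, hc⟩ ⟨c', hc'⟩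
        refine ⟨c * c', ?_⟩
        rw [Units.val_mul, mul_assoc, hc', Matrix.mul_smul, ← mul_assoc, hc, Matrix.smul_mul, smul_smul, mul_assoc, mul_comm c' c]
      inv_mem' := by
        rintro γ ⟨c, hc⟩
        have hc0 : c ≠ 0 := by
          rintro rfl
          rw [zero_smul] at hc
          exact gl_val_ne hd (γ * h) hc
        refine ⟨c⁻¹, ?_⟩
        have e : h.1 * γ⁻¹.1 = c • (γ⁻¹.1 * h.1) := by
          calc h.1 * γ⁻¹.1 = γ⁻¹.1 * (γ.1 * h.1) * γ⁻¹.1 := by rw [← mul_assoc, gl_inv_mul, one_mul]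
            _ = c • (γ⁻¹.1 * h.1 * (γ.1 * γ⁻¹.1)) := by rw [hc]; simp [mul_assoc]
            _ = _ := by rw [gl_mul_inv, mul_one]
        rw [e, smul_smul, inv_mul_cancel₀ hc0, one_smul] }
  have hC : IdxLe (d ^ 2) C Γ := by
    intro γ hγ
    by_contra! hcon
    have hmem : ∀ i, γ i * h * (γ i)⁻¹ ∈ A := fun i => hn _ (hγ i) _ hh
    have h0 : ∀ i j, i ≠ j → ((γ i * h * (γ i)⁻¹)⁻¹ * (γ j * h * (γ j)⁻¹)).1.trace = 0 := by
      intro i j hij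
      apply htr _ (mul_mem (inv_mem (hmem i)) (hmem j))
      intro hs
      obtain ⟨c, hc⟩ := hs.val
      apply hcon i j hij
      refine Subgroup.mem_inf.2 ⟨mul_mem (inv_mem (hγ i)) (hγ j), c, ?_⟩
      have e1 : (γ i)⁻¹ * γ j * h = h * (γ i)⁻¹ * ((γ i * h * (γ i)⁻¹)⁻¹ * (γ j * h * (γ j)⁻¹)) * γ j := by group
      have e2 := congrArg Units.val e1
      rw [Units.val_mul, Units.val_mul (_ * _) (γ j), Units.val_mul _ (_ * _), hc] at e2
      rw [e2]
      simp [mul_assoc]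
    have hli : LinearIndependent ℂ (fun i => (γ i * h * (γ i)⁻¹).1) := by
      rw [Fintype.linearIndependent_iff]
      intro b hb i
      have h1 := congrArg (fun M => ((γ i * h * (γ i)⁻¹)⁻¹.1 * M).trace) hb
      simp only [Finset.mul_sum, Matrix.trace_sum, Matrix.mul_smul, Matrix.trace_smul, Matrix.mul_zero, Matrix.trace_zero] at h1
      rw [Finset.sum_eq_single i] at h1
      · rw [gl_inv_mul, Matrix.trace_one, smul_eq_mul] at h1
        rcases mul_eq_zero.1 h1 with h | h
        · exact h
        · simp at h; omega
      · intro j _ hj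
        have := h0 i j hj.symm
        rw [Units.val_mul] at this
        rw [this, smul_zero]
      · simp
    have := hli.fintype_card_le_finrank
    rw [Module.finrank_matrix] at this
    simp at this
    nlinarith
  obtain ⟨l, hl⟩ := Module.End.exists_eigenvalue (Matrix.mulVecLin h.1)
  obtain ⟨x, hxm, hx0⟩ := hl.exists_hasEigenvector
  have hx : h.1 *ᵥ x = l • x := Module.End.mem_eigenspace_iff.1 hxm
  have hl0 : l ≠ 0 := by
    rintro rfl
    rw [zero_smul] at hx
    apply hx0
    rw [← gl_inv_vec h x, hx, Matrix.mulVec_zero]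
  have hC' : IdxLe d (Γ ⊓ Subgroup.centralizer {h}) C := by
    have h1 : ∀ γ ∈ C, ∃ c : ℂ, γ.1 * h.1 = c • (h.1 * γ.1) := fun γ hγ => (Subgroup.mem_inf.1 hγ).2
    choose! c hc using h1
    have hc0 : ∀ γ ∈ C, c γ ≠ 0 := by
      intro γ hγ h0
      have := hc γ hγ
      rw [h0, zero_smul] at this
      exact gl_val_ne hd (γ * h) this
    refine idxLe_of_fintype d h.1.charpoly.roots.toFinset ?_ (fun γ => (c γ)⁻¹ * l) ?_ ?_
    · refine (Multiset.toFinset_card_le _).trans ((card_roots' _).trans ?_)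
      rw [Matrix.charpoly_natDegree_eq_dim, Fintype.card_fin]
    · intro γ hγ
      rw [Multiset.mem_toFinset, mem_roots h.1.charpoly_monic.ne_zero]
      refine root_of_eigvec _ _ (γ.1 *ᵥ x) ?_ ?_
      · intro h0
        apply hx0
        rw [← gl_inv_vec γ x, h0, Matrix.mulVec_zero]
      · have e : h.1 * γ.1 = (c γ)⁻¹ • (γ.1 * h.1) := by
          rw [hc γ hγ, smul_smul, inv_mul_cancel₀ (hc0 γ hγ), one_smul]
        rw [Matrix.mulVec_mulVec, e, Matrix.smul_mulVec, ← Matrix.mulVec_mulVec, hx, Matrix.mulVec_smul, smul_smul]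
    · intro γ hγ γ' hγ' e
      have e1 : c γ = c γ' := inv_injective (mul_right_cancel₀ hl0 e)
      refine Subgroup.mem_inf.2 ⟨mul_mem (inv_mem (Subgroup.mem_inf.1 hγ).1) (Subgroup.mem_inf.1 hγ').1, ?_⟩
      rw [Subgroup.mem_centralizer_iff]
      intro h' hh'
      rw [Set.mem_singleton_iff.1 hh']
      apply Units.ext
      have e2 : h.1 * γ⁻¹.1 = c γ • (γ⁻¹.1 * h.1) := by
        calc h.1 * γ⁻¹.1 = γ⁻¹.1 * (γ.1 * h.1) * γ⁻¹.1 := by rw [← mul_assoc, gl_inv_mul, one_mul]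
          _ = c γ • (γ⁻¹.1 * h.1 * (γ.1 * γ⁻¹.1)) := by rw [hc γ hγ]; simp [mul_assoc]
          _ = _ := by rw [gl_mul_inv, mul_one]
      rw [Units.val_mul, Units.val_mul, ← mul_assoc, e2, Units.val_mul, Units.val_mul, mul_assoc γ⁻¹.1, hc γ' hγ', e1]
      simp [mul_assoc]
  have hirr := hN _ inf_le_left (hC.trans hC')
  let V : Submodule ℂ (Fin d → ℂ) := LinearMap.ker (Matrix.mulVecLin h.1 - l • LinearMap.id)
  have hV : ∀ y, y ∈ V ↔ h.1 *ᵥ y = l • y := by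
    intro y
    simp only [V, LinearMap.mem_ker, LinearMap.sub_apply, Matrix.mulVecLin_apply, LinearMap.smul_apply, LinearMap.id_apply, sub_eq_zero]
  rcases hirr V (by
    intro g hg y hy
    rw [hV] at hy ⊢
    have h2 := (Subgroup.mem_inf.1 hg).2
    rw [Subgroup.mem_centralizer_iff] at h2
    rw [← gl_mul_vec, h2 h rfl, gl_mul_vec, hy, Matrix.mulVec_smul]) with h1 | h1
  · have : x ∈ V := (hV x).2 hx
    rw [h1, Submodule.mem_bot] at this
    exact absurd this hx0
  · exact ⟨l, fun y => (hV y).1 (by rw [h1]; trivial)⟩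

end UEG

namespace UEG
set_option linter.unusedVariables false
set_option linter.style.haveILetI false
set_option linter.unusedSectionVars false
open Matrix Polynomial
open scoped Pointwise commutatorElement

lemma DS_map {G H : Type} [Group G] [Group H] (f : G →* H) (N : Subgroup G) (n : ℕ) : DS (N.map f) n = (DS N n).map f := by
  induction n with
  | zero => rfl
  | succ n ih => rw [DS, ih, ← Subgroup.map_commutator]; rfl

lemma sol_scalar {d : ℕ} (hd : 1 ≤ d) (Γ : Subgroup (GL (Fin d) ℂ))
    (hN : ∀ H ≤ Γ, IdxLe (d ^ 2 * d) H Γ → Irr (H : Set (GL (Fin d) ℂ))) (n : ℕ) : ∀ A : Subgroup (GL (Fin d) ℂ),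
    (∀ g ∈ Γ, ∀ a ∈ A, g * a * g⁻¹ ∈ A) → DS A n = ⊥ → ∀ a ∈ A, IsScal a := by
  induction n with
  | zero =>
    intro A hA h0 a ha
    have : a ∈ DS A 0 := ha
    rw [h0, Subgroup.mem_bot] at this
    exact ⟨1, fun x => by rw [this]; simp⟩
  | succ n ih =>
    intro A hA h0
    rw [DS_succ'] at h0
    have h1 := ih ⁅A, A⁆ (by
      intro g hg
      have : ⁅A, A⁆ ≤ (⁅A, A⁆).comap (MulAut.conj g).toMonoidHom := by
        rw [Subgroup.commutator_le]
        intro x hx y hy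
        rw [Subgroup.mem_comap]
        have := Subgroup.commutator_mem_commutator (hA g hg x hx) (hA g hg y hy)
        convert this using 1
        simp only [commutatorElement_def, MulEquiv.coe_toMonoidHom, MulAut.conj_apply]
        group
      intro a ha
      exact this ha) h0
    exact nil_scalar hd Γ A hN hA (fun a ha b hb => h1 _ (Subgroup.commutator_mem_commutator ha hb))

lemma finite_of_exponent {d : ℕ} (hd : 1 ≤ d) (Γ : Subgroup (GL (Fin d) ℂ)) (hirr : Irr (Γ : Set (GL (Fin d) ℂ))) (M : ℕ) (hM : 1 ≤ M)
    (h : ∀ a ∈ Γ, a ^ M = 1) : (Γ : Set (GL (Fin d) ℂ)).Finite := by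
  classical
  have htr : {z : ℂ | ∃ a ∈ Γ, z = a.1.trace}.Finite := by
    let R : Finset ℂ := (nthRoots M (1 : ℂ)).toFinset
    refine ((Set.finite_Iic (d • R.val)).image Multiset.sum).subset ?_
    rintro z ⟨a, ha, rfl⟩
    refine ⟨a.1.charpoly.roots, ?_, (Matrix.trace_eq_sum_roots_charpoly _).symm⟩
    rw [Set.mem_Iic, Multiset.le_iff_count]
    intro l
    by_cases hl : l ∈ a.1.charpoly.roots
    · have h1 : l ^ M = 1 := by
        obtain ⟨x, hx0, hx⟩ := exists_eigvec a.1 l (isRoot_of_mem_roots hl)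
        have h2 : ∀ k : ℕ, (a ^ k).1 *ᵥ x = l ^ k • x := by
          intro k
          induction k with
          | zero => simp
          | succ k ih => rw [pow_succ, gl_mul_vec, hx, Matrix.mulVec_smul, ih, smul_smul, pow_succ, mul_comm]
        have h3 := h2 M
        rw [h a ha, Units.val_one, Matrix.one_mulVec] at h3
        have h4 : (l ^ M - 1) • x = 0 := by rw [sub_smul, ← h3, one_smul, sub_self]
        rcases smul_eq_zero.1 h4 with h5 | h5
        · linear_combination h5
        · exact absurd h5 hx0
      have h2 : l ∈ R := by
        rw [Multiset.mem_toFinset, mem_nthRoots hM]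
        exact h1
      rw [Multiset.count_nsmul, Multiset.count_eq_one_of_mem R.nodup h2, mul_one]
      refine (Multiset.count_le_card _ _).trans ((card_roots' _).trans ?_)
      rw [Matrix.charpoly_natDegree_eq_dim, Fintype.card_fin]
    · rw [Multiset.count_eq_zero_of_notMem hl]
      exact Nat.zero_le _
  have hspan := Irr.span hd Γ hirr
  obtain ⟨b, hb, hbs, hli⟩ := exists_linearIndependent ℂ ((fun g : GL (Fin d) ℂ => g.1) '' (Γ : Set (GL (Fin d) ℂ)))
  rw [hspan] at hbs
  haveI : Finite b := hli.setFinite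
  let φ : GL (Fin d) ℂ → (b → ℂ) := fun g s => (g.1 * s.1).trace
  refine Set.Finite.of_finite_image (f := φ) ?_ ?_
  · refine (Set.Finite.pi' (fun _ : b => htr)).subset ?_
    rintro _ ⟨g, hg, rfl⟩ s
    obtain ⟨g', hg', e⟩ := hb s.2
    refine ⟨g * g', mul_mem hg hg', ?_⟩
    simp only [φ, ← e, Units.val_mul]
  · intro g hg g' hg' e
    apply Units.ext
    rw [← sub_eq_zero]
    refine trace_zero_mat hbs _ ?_
    intro s hs
    have := congrFun e ⟨s, hs⟩
    simp only [φ] at this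
    rw [sub_mul, Matrix.trace_sub, this, sub_self]

lemma NoRed.irr {d N : ℕ} (hN : 1 ≤ N) {F : Set (GL (Fin d) ℂ)} (h : NoRed N F) :
    Irr (Subgroup.closure F : Set (GL (Fin d) ℂ)) := by
  refine h _ le_rfl ?_
  intro γ hγ
  refine ⟨⟨0, by omega⟩, ⟨1, by omega⟩, ?_, mul_mem (inv_mem (hγ _)) (hγ _)⟩
  intro h0
  exact absurd (congrArg Fin.val h0) (by norm_num)

lemma det_closure {d : ℕ} {F : Set (GL (Fin d) ℂ)} (hdet : ∀ f ∈ F, f.1.det = 1) : ∀ g ∈ Subgroup.closure F, g.1.det = 1 := by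
  have : Subgroup.closure F ≤ (Matrix.GeneralLinearGroup.det (n := Fin d) (R := ℂ)).ker := by
    rw [Subgroup.closure_le]
    intro f hf
    rw [SetLike.mem_coe, MonoidHom.mem_ker]
    exact Units.ext (hdet f hf)
  intro g hg
  have := MonoidHom.mem_ker.1 (this hg)
  exact congrArg Units.val this

lemma scal_pow {d : ℕ} (hd : 1 ≤ d) (F : Set (GL (Fin d) ℂ)) (hNR : NoRed (d ^ 2 * d) F) (hdet : ∀ f ∈ F, f.1.det = 1)
    (M t : ℕ) (hMb : ∀ a : Subgroup.closure F, DS (Subgroup.normalClosure {a ^ M}) t = ⊥) (a : GL (Fin d) ℂ) (ha : a ∈ Subgroup.closure F) :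
    a ^ (M * d) = 1 := by
  have hsc := sol_scalar hd (Subgroup.closure F) hNR t
    ((Subgroup.normalClosure {(⟨a, ha⟩ : Subgroup.closure F) ^ M}).map (Subgroup.closure F).subtype) (by
      rintro g hg _ ⟨x, hx, rfl⟩
      refine ⟨⟨g, hg⟩ * x * ⟨g, hg⟩⁻¹, ?_, ?_⟩
      · exact (Subgroup.normalClosure_normal (s := {(⟨a, ha⟩ : Subgroup.closure F) ^ M})).conj_mem x hx ⟨g, hg⟩
      · simp) (by
      rw [DS_map, hMb, Subgroup.map_bot])
    (a ^ M) (Subgroup.mem_map.2 ⟨(⟨a, ha⟩ : Subgroup.closure F) ^ M, Subgroup.subset_normalClosure (Set.mem_singleton _), by simp⟩)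
  obtain ⟨c, hc⟩ := hsc.val
  have h2 := det_closure hdet _ (pow_mem ha M)
  rw [hc, Matrix.det_smul, Matrix.det_one, mul_one, Fintype.card_fin] at h2
  rw [pow_mul]
  apply Units.ext
  rw [Units.val_pow_eq_pow_val, hc, _root_.smul_pow, one_pow, h2, one_smul, Units.val_one]

theorem propB (d : ℕ) (hd : 1 ≤ d) : ∃ K : ℕ, ∀ F : Set (GL (Fin d) ℂ), F.Finite → 1 ∈ F → (∀ f ∈ F, f.1.det = 1) →
    NoRed (d ^ 2 * d) F → (Subgroup.closure F : Set (GL (Fin d) ℂ)).Infinite →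
    ∃ u ∈ F ^ K, ∃ l, u.1.charpoly.IsRoot l ∧ ((∃ σ : ℂ →+* ℂ, 1 + 1 / ((K:ℝ) + 1) ≤ ‖σ l‖) ∨
      ∃ v : AbsoluteValue ℂ ℝ, IsNonarchimedean v ∧ 1 < v l) := by
  obtain ⟨J, hJ⟩ : ∃ J : ℕ, 17 ^ (2 * d ^ 2) ≤ J := ⟨_, le_rfl⟩
  obtain ⟨K, hK⟩ := law_group d hd J hJ
  refine ⟨K, ?_⟩
  intro F hF h1 hdet hNR hinf
  by_contra hcon
  push Not at hcon
  have hirr := NoRed.irr (Nat.mul_pos (Nat.pow_pos hd) hd) hNR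
  have hlaw := hK F hF h1 hdet hirr (by
    intro u hu l hl
    by_contra hc
    rcases exists_place l (η := 1 / ((K:ℝ) + 1)) (by
      rw [div_le_one (by positivity)]
      have : (0:ℝ) ≤ K := Nat.cast_nonneg _
      linarith) hc with ⟨σ, hσ⟩ | ⟨v, hv, hv1⟩
    · exact absurd hσ (not_le.2 ((hcon u hu l hl).1 σ))
    · exact absurd hv1 (not_lt.2 ((hcon u hu l hl).2 v hv)))
  obtain ⟨M, hM1, hMb⟩ : ∃ M : ℕ, 1 ≤ M ∧ ∀ a : Subgroup.closure F, DS (Subgroup.normalClosure {a ^ M}) (J + d + J) = ⊥ :=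
    ⟨(J + 1).factorial, Nat.factorial_pos _, fun a => DS_bot a (J + d) J (hlaw a)⟩
  generalize J + d + J = t at hMb
  refine hinf (finite_of_exponent hd _ hirr (M * d) (Nat.mul_pos hM1 hd) (scal_pow hd F hNR hdet M t hMb))

end UEG

namespace UEG
set_option linter.unusedVariables false
set_option linter.style.haveILetI false
set_option linter.unusedSectionVars false
open Matrix Polynomial
open scoped Pointwise

/-- scalar matrices -/
noncomputable def tau (d : ℕ) : ℂˣ →* GL (Fin d) ℂ :=
  Units.map (algebraMap ℂ (Matrix (Fin d) (Fin d) ℂ)).toMonoidHom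

lemma tau_val (d : ℕ) (z : ℂˣ) : (tau d z).1 = (z : ℂ) • (1 : Matrix (Fin d) (Fin d) ℂ) := by
  change algebraMap ℂ (Matrix (Fin d) (Fin d) ℂ) z = _
  rw [Algebra.algebraMap_eq_smul_one]

lemma tau_comm (d : ℕ) (z : ℂˣ) (g : GL (Fin d) ℂ) : tau d z * g = g * tau d z := by
  apply Units.ext
  rw [Units.val_mul, Units.val_mul, tau_val]
  simp

lemma tau_det (d : ℕ) (z : ℂˣ) : (tau d z).1.det = (z : ℂ) ^ d := by
  rw [tau_val, Matrix.det_smul, Matrix.det_one, mul_one, Fintype.card_fin]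

lemma exists_theta (d : ℕ) (hd : 1 ≤ d) : ∃ θ : GL (Fin d) ℂ → ℂˣ, θ 1 = 1 ∧ ∀ g, (tau d (θ g) * g).1.det = 1 := by
  classical
  have h : ∀ g : GL (Fin d) ℂ, ∃ z : ℂˣ, (tau d z * g).1.det = 1 := by
    intro g
    have hg : g.1.det ≠ 0 := by
      have := congrArg Matrix.det (gl_mul_inv g)
      rw [Matrix.det_mul, Matrix.det_one] at this
      exact left_ne_zero_of_mul_eq_one this
    obtain ⟨z, hz⟩ := IsAlgClosed.exists_pow_nat_eq (g.1.det)⁻¹ hd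
    have hz0 : z ≠ 0 := by
      rintro rfl
      rw [zero_pow (by omega)] at hz
      exact inv_ne_zero hg hz.symm
    refine ⟨Units.mk0 z hz0, ?_⟩
    rw [Units.val_mul, Matrix.det_mul, tau_det, Units.val_mk0, hz, inv_mul_cancel₀ hg]
  choose θ hθ using h
  refine ⟨fun g => if g = 1 then 1 else θ g, by simp, fun g => ?_⟩
  by_cases hg : g = 1
  · simp [hg]
  · simp only [hg, if_false]
    exact hθ g

section sl
variable {d : ℕ} (hd : 1 ≤ d) (θ : GL (Fin d) ℂ → ℂˣ) (h1θ : θ 1 = 1) (hθ : ∀ g, (tau d (θ g) * g).1.det = 1) (F : Set (GL (Fin d) ℂ))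
include hd h1θ hθ

lemma tilde_pow (n : ℕ) : ∀ x ∈ ((fun g => tau d (θ g) * g) '' F) ^ n, ∃ z : ℂˣ, ∃ g ∈ F ^ n, x = tau d z * g := by
  induction n with
  | zero =>
    intro x hx
    rw [pow_zero, Set.mem_one] at hx
    exact ⟨1, 1, by simp, by simp [hx]⟩
  | succ n ih =>
    intro x hx
    rw [pow_succ] at hx
    obtain ⟨y, hy, _, ⟨g, hg, rfl⟩, rfl⟩ := hx
    obtain ⟨z, g', hg', rfl⟩ := ih y hy
    refine ⟨z * θ g, g' * g, ?_, ?_⟩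
    · rw [pow_succ]; exact Set.mul_mem_mul hg' hg
    · simp only [map_mul, mul_assoc]
      rw [← mul_assoc g', ← tau_comm d (θ g) g', mul_assoc]

lemma tilde_card (hF : F.Finite) (n : ℕ) : (((fun g => tau d (θ g) * g) '' F) ^ n).ncard ≤ d * (F ^ n).ncard := by
  haveI : NeZero d := ⟨by omega⟩
  set T : Set (GL (Fin d) ℂ) := (fun p : ℂˣ × GL (Fin d) ℂ => tau d p.1 * (tau d (θ p.2) * p.2)) '' ((rootsOfUnity d ℂ : Set ℂˣ) ×ˢ (F ^ n)) with hT
  have hfin : (((rootsOfUnity d ℂ : Set ℂˣ) ×ˢ (F ^ n))).Finite := Set.Finite.prod (Set.finite_coe_iff.1 (inferInstanceAs (Finite (rootsOfUnity d ℂ)))) (fin_pow hF n)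
  have hsub : ((fun g => tau d (θ g) * g) '' F) ^ n ⊆ T := by
    intro x hx
    have hdx : x.1.det = 1 := by
      refine det_pow_mem ?_ n x hx
      rintro _ ⟨g, -, rfl⟩
      exact hθ g
    obtain ⟨z, g, hg, rfl⟩ := tilde_pow hd θ h1θ hθ F n x hx
    refine ⟨(z * (θ g)⁻¹, g), ⟨?_, hg⟩, ?_⟩
    · change z * (θ g)⁻¹ ∈ rootsOfUnity d ℂ
      rw [mem_rootsOfUnity]
      have h2 := hθ g
      rw [Units.val_mul, Matrix.det_mul, tau_det] at hdx h2
      have h3 : g.1.det ≠ 0 := right_ne_zero_of_mul_eq_one h2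
      have h4 : (z : ℂ) ^ d = (θ g : ℂ) ^ d := mul_right_cancel₀ h3 (hdx.trans h2.symm)
      have h5 : z ^ d = θ g ^ d := Units.ext (by push_cast; exact h4)
      rw [mul_pow, h5, ← mul_pow, mul_inv_cancel, one_pow]
    · simp only [map_mul, map_inv]
      group
  calc _ ≤ T.ncard := Set.ncard_le_ncard hsub (hfin.image _)
    _ ≤ _ := Set.ncard_image_le hfin
    _ = (rootsOfUnity d ℂ : Set ℂˣ).ncard * (F ^ n).ncard := Set.ncard_prod
    _ ≤ d * (F ^ n).ncard := Nat.mul_le_mul_right _ (le_of_eq (Complex.card_rootsOfUnity d))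

lemma tilde_closure : ∀ g ∈ Subgroup.closure F, ∃ z : ℂˣ, tau d z * g ∈ Subgroup.closure ((fun g => tau d (θ g) * g) '' F) := by
  intro g hg
  induction hg using Subgroup.closure_induction with
  | mem x hx => exact ⟨θ x, Subgroup.subset_closure ⟨x, hx, rfl⟩⟩
  | one => exact ⟨1, by simp [one_mem]⟩
  | mul x y _ _ h1 h2 =>
    obtain ⟨z, hz⟩ := h1
    obtain ⟨w, hw⟩ := h2
    refine ⟨z * w, ?_⟩
    have := mul_mem hz hw
    convert this using 1
    rw [map_mul, mul_assoc, mul_assoc, ← mul_assoc x, ← tau_comm d w x, mul_assoc]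
  | inv x _ h1 =>
    obtain ⟨z, hz⟩ := h1
    refine ⟨z⁻¹, ?_⟩
    have := inv_mem hz
    rw [_root_.mul_inv_rev, ← map_inv, ← tau_comm] at this
    exact this

lemma tilde_nored (N : ℕ) (h : NoRed N F) : NoRed N ((fun g => tau d (θ g) * g) '' F) := by
  intro H hH hidx U hU
  let H' : Subgroup (GL (Fin d) ℂ) := Subgroup.closure F ⊓
    { carrier := {g | ∃ z : ℂˣ, tau d z * g ∈ H}
      one_mem' := ⟨1, by simp [one_mem]⟩
      mul_mem' := by
        rintro x y ⟨z, hz⟩ ⟨w, hw⟩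
        refine ⟨z * w, ?_⟩
        have := mul_mem hz hw
        convert this using 1
        rw [map_mul, mul_assoc, mul_assoc, ← mul_assoc x, ← tau_comm d w x, mul_assoc]
      inv_mem' := by
        rintro x ⟨z, hz⟩
        refine ⟨z⁻¹, ?_⟩
        have := inv_mem hz
        rw [_root_.mul_inv_rev, ← map_inv, ← tau_comm] at this
        exact this }
  refine h H' inf_le_left ?_ U ?_
  · intro γ hγ
    have hz := fun i => tilde_closure hd θ h1θ hθ F (γ i) (hγ i)
    choose z hz using hz
    obtain ⟨i, j, hij, e⟩ := hidx (fun i => tau d (z i) * γ i) hz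
    refine ⟨i, j, hij, Subgroup.mem_inf.2 ⟨mul_mem (inv_mem (hγ i)) (hγ j), (z i)⁻¹ * z j, ?_⟩⟩
    convert e using 1
    rw [_root_.mul_inv_rev, map_mul, map_inv, mul_assoc, mul_assoc, ← map_inv, ← mul_assoc (γ i)⁻¹ (tau d (z i)⁻¹), ← tau_comm d (z i)⁻¹ (γ i)⁻¹,
      mul_assoc, ← mul_assoc (tau d (z j)), tau_comm d (z j) (γ i)⁻¹, mul_assoc]
  · intro g hg x hx
    obtain ⟨z, hz⟩ := (Subgroup.mem_inf.1 hg).2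
    have h1 := hU _ hz x hx
    rw [gl_mul_vec, tau_val, Matrix.smul_mulVec, Matrix.one_mulVec] at h1
    have h2 := U.smul_mem ((z⁻¹ : ℂˣ) : ℂ) h1
    rwa [smul_smul, ← Units.val_mul, inv_mul_cancel, Units.val_one, one_smul] at h2

lemma tilde_vs (hfin : (Subgroup.closure ((fun g => tau d (θ g) * g) '' F) : Set (GL (Fin d) ℂ)).Finite) :
    VSG (Subgroup.closure F) := by
  have h1 := tilde_closure hd θ h1θ hθ F
  choose! z hz using h1
  have h2 : IdxLe hfin.toFinset.card (tau d).range (Subgroup.closure F) := by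
    refine idxLe_of_fintype _ hfin.toFinset le_rfl (fun g => tau d (z g) * g) ?_ ?_
    · intro x hx
      rw [Set.Finite.mem_toFinset]
      exact hz x hx
    · intro x hx y hy e
      refine ⟨z x * (z y)⁻¹, ?_⟩
      have e2 : y = tau d (z y)⁻¹ * (tau d (z x) * x) := by rw [e, map_inv]; group
      have e3 : x⁻¹ * y = x⁻¹ * (tau d (z y)⁻¹ * (tau d (z x) * x)) := congrArg (fun w => x⁻¹ * w) e2
      rw [e3, ← mul_assoc (tau d (z y)⁻¹), ← map_mul, tau_comm d _ x, ← mul_assoc, inv_mul_cancel, one_mul, mul_comm]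
  refine ⟨_, h2.finiteIndex, Group.isSolvable_of_comm ?_⟩
  rintro ⟨⟨a, ha⟩, ⟨u, hu⟩⟩ ⟨⟨b, hb⟩, hb2⟩
  apply Subtype.ext
  apply Subtype.ext
  change a * b = b * a
  have hu' : tau d u = a := hu
  rw [← hu', tau_comm]

end sl

lemma closure_pow' {G : Type*} [Group G] {F : Set G} (h1 : 1 ∈ F) {M : ℕ} (hM : 1 ≤ M) :
    Subgroup.closure (F ^ M) = Subgroup.closure F := by
  apply le_antisymm
  · rw [Subgroup.closure_le]; exact pow_sub_closure M
  · apply Subgroup.closure_mono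
    have := Set.pow_subset_pow_right h1 hM
    rwa [pow_one] at this

theorem step (d : ℕ) (hd : 1 ≤ d) (c0 : ℝ) (hc0 : 1 < c0) (hU : ∀ n < d, UG c0 n) : ∃ c, 1 < c ∧ UG c d := by
  obtain ⟨c1, hc1, hcase1⟩ := case1 (d ^ d + d ^ 2 * d) hc0 hU
  obtain ⟨R, cA, hcA, hA⟩ := propA d hd
  obtain ⟨K, hB⟩ := propB d hd
  obtain ⟨θ, h1θ, hθ⟩ := exists_theta d hd
  obtain ⟨q, hq⟩ := pow_unbounded_of_one_lt R (show (1:ℝ) < 1 + 1 / ((K:ℝ) + 1) by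
    have : 0 < 1 / ((K:ℝ) + 1) := by positivity
    linarith)
  set M := K * (q + 1) + 1 with hM
  have hM1 : 1 ≤ M := by omega
  have hc2 : 1 < cA ^ (1 / (M : ℝ)) := Real.one_lt_rpow hcA (by positivity)
  refine ⟨min c1 (cA ^ (1 / (M : ℝ))), lt_min hc1 hc2, ?_⟩
  intro F hF h1 hvs
  by_cases hN : NoRed (d ^ d + d ^ 2 * d) F
  swap
  · exact gr_mono (lt_min hc1 hc2 |>.le.trans' zero_le_one) (min_le_left _ _) (hcase1 F hF h1 hvs hN)
  refine gr_mono (lt_min hc1 hc2 |>.le.trans' zero_le_one) (min_le_right _ _) ?_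
  set F' : Set (GL (Fin d) ℂ) := (fun g => tau d (θ g) * g) '' F with hF'
  have hF'fin : F'.Finite := hF.image _
  have h1' : 1 ∈ F' := ⟨1, h1, by simp [h1θ]⟩
  have hdet' : ∀ f ∈ F', f.1.det = 1 := by
    rintro _ ⟨g, -, rfl⟩
    exact hθ g
  have hN' : NoRed (d ^ d + d ^ 2 * d) F' := tilde_nored hd θ h1θ hθ F _ hN
  have hinf : (Subgroup.closure F' : Set (GL (Fin d) ℂ)).Infinite := fun h => hvs (tilde_vs hd θ h1θ hθ F h)
  refine gr_of_mul (by positivity) d ?_ (tilde_card hd θ h1θ hθ F hF)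
  refine gr_root hF'fin hM1 (subset_refl _) hcA.le ?_
  have hNA : NoRed (d ^ d) (F' ^ M) := by
    intro H hH hidx
    rw [closure_pow' h1' hM1] at hH hidx
    exact hN' H hH (hidx.mono (by omega) le_rfl)
  have hNB : NoRed (d ^ 2 * d) F' := fun H hH hidx => hN' H hH (hidx.mono (by omega) le_rfl)
  obtain ⟨u, hu, l, hl, hcase⟩ := hB F' hF'fin h1' hdet' hNB hinf
  rcases hcase with ⟨σ, hσ⟩ | ⟨v, hv, hvl⟩
  · refine hA (archAV σ) (F' ^ M) (fin_pow hF'fin M) (one_mem_pow h1' M) (det_pow_mem hdet' M) hNA ⟨u ^ q, ?_, l ^ q, ?_, ?_⟩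
    · have := Set.pow_mem_pow hu (n := q)
      rw [← pow_mul] at this
      refine Set.pow_subset_pow_right h1' ?_ this
      rw [hM, Nat.mul_succ]; omega
    · obtain ⟨x, hx0, hx⟩ := exists_eigvec u.1 l hl
      refine root_of_eigvec _ _ x hx0 ?_
      have h2 : ∀ k : ℕ, (u ^ k).1 *ᵥ x = l ^ k • x := by
        intro k
        induction k with
        | zero => simp
        | succ k ih => rw [pow_succ, gl_mul_vec, hx, Matrix.mulVec_smul, ih, smul_smul, pow_succ, mul_comm]
      exact h2 q
    · rw [map_pow, archAV_apply]
      refine hq.le.trans (pow_le_pow_left₀ (by positivity) hσ q)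
  · obtain ⟨v', hv'⟩ := nonarch_pow v hv l hvl R
    refine hA v' (F' ^ M) (fin_pow hF'fin M) (one_mem_pow h1' M) (det_pow_mem hdet' M) hNA ⟨u, ?_, l, hl, hv'⟩
    refine Set.pow_subset_pow_right h1' ?_ hu
    rw [hM, Nat.mul_succ]; omega

theorem UG_all (d : ℕ) : ∃ c, 1 < c ∧ ∀ n < d, UG c n := by
  induction d with
  | zero => exact ⟨2, by norm_num, by simp⟩
  | succ d ih =>
    obtain ⟨c, hc, h⟩ := ih
    rcases Nat.eq_zero_or_pos d with rfl | hd
    · refine ⟨2, by norm_num, ?_⟩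
      intro n hn F hF h1 hvs
      obtain rfl : n = 0 := by omega
      exact absurd (vs_of_finite) hvs
    · obtain ⟨c', hc', h'⟩ := step d hd c hc h
      refine ⟨min c c', lt_min hc hc', ?_⟩
      intro n hn F hF h1 hvs
      have h0 : 0 ≤ min c c' := (lt_min hc hc').le.trans' zero_le_one
      rcases Nat.lt_succ_iff_lt_or_eq.1 hn with h2 | rfl
      · exact gr_mono h0 (min_le_left _ _) (h n h2 F hF h1 hvs)
      · exact gr_mono h0 (min_le_right _ _) (h' F hF h1 hvs)

end UEG

open scoped MatrixGroups

/-- **Uniform exponential growth.** For every `d ≥ 1` there exists `ε = ε(d) > 0` such that for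
every finite subset `F` of `GL_d(ℂ)` containing the identity and generating a subgroup which is
not virtually solvable, one has `|F^n| ≥ (1+ε)^n` for all `n ≥ 1`, where `F^n` is the set of
products of at most `n` elements of `F`. -/
theorem uniform_exponential_growth :
    ∀ d : ℕ, 1 ≤ d → ∃ ε : ℝ, 0 < ε ∧
      ∀ F : Set (GL (Fin d) ℂ), F.Finite → (1 : GL (Fin d) ℂ) ∈ F →
        ¬(∃ H : Subgroup ↥(Subgroup.closure F), H.FiniteIndex ∧ IsSolvable ↥H) →
        ∀ n : ℕ, 1 ≤ n →
          (1 + ε) ^ n ≤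
            (({x : GL (Fin d) ℂ | ∃ l : List (GL (Fin d) ℂ),
                l.length ≤ n ∧ (∀ g ∈ l, g ∈ F) ∧ l.prod = x}).ncard : ℝ) := by
  intro d hd
  obtain ⟨c, hc, h⟩ := UEG.UG_all (d + 1)
  refine ⟨c - 1, by linarith, ?_⟩
  intro F hF h1 hvs n hn
  rw [UEG.stmt_set h1 n]
  have h2 := h d (Nat.lt_succ_self d) F hF h1 hvs n
  have h3 : 1 + (c - 1) = c := by ring
  rw [h3]
  exact h2
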